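/- Under Assumptions A3 and A4, for any α_1 > 0 and α_2 > 0, as n → ∞, E[ e^{S_n} / ∏_{i=1}^2 (α_i + e^{S_n} b_n) ; τ(n) = n ] / E[e^{S_n}; τ(n) = n] converges to ∭ Ψ(u, v, −z) P_z⁺(B⁺ ∈ du) P⁻(B⁻ ∈ dv) μ_1(dz), where Ψ(u,v,x) = ∏_{i=1}^2 1/(α_i + e^{x} κ(u) + κ(v)) with κ(y) = y·1{y > 0}, and μ_1(dz) = c_{11} e^{−z} u(z) 1{z ≥ 0} dz with c_{11}^{−1} = ∫_0^∞ e^{−z} u(z) dz. -/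

import Mathlib

open MeasureTheory ProbabilityTheory Filter Set Topology

noncomputable section

namespace BPREpaper

variable {Ω : Type*} [MeasurableSpace Ω]

/-- The random walk `S n = X 1 + ... + X n` (increments indexed from `1`, `S 0 = 0`). -/
def walk (X : ℕ → Ω → ℝ) (n : ℕ) (ω : Ω) : ℝ := ∑ i ∈ Finset.Icc 1 n, X i ω

/-- `Mwalk X n = max (S 1, ..., S n)` for `n ≥ 1` (junk value `0` for `n = 0`). -/
def Mwalk (X : ℕ → Ω → ℝ) : ℕ → Ω → ℝ
  | 0, _ => 0
  | n + 1, ω =>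
      (Finset.Icc 1 (n + 1)).sup' (Finset.nonempty_Icc.mpr (by omega)) fun i => walk X i ω

/-- `Lwalk X n = min (S 1, ..., S n)` for `n ≥ 1` (junk value `0` for `n = 0`). -/
def Lwalk (X : ℕ → Ω → ℝ) : ℕ → Ω → ℝ
  | 0, _ => 0
  | n + 1, ω =>
      (Finset.Icc 1 (n + 1)).inf' (Finset.nonempty_Icc.mpr (by omega)) fun i => walk X i ω

/-- minimum of `S 0, S 1, ..., S n`. -/
def minWalk (X : ℕ → Ω → ℝ) (n : ℕ) (ω : Ω) : ℝ :=
  (Finset.range (n + 1)).inf' (by simp) fun i => walk X i ω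

/-- `τ(n)`: the first moment at which the minimum of `S 0, ..., S n` is attained. -/
def tauWalk (X : ℕ → Ω → ℝ) (n : ℕ) (ω : Ω) : ℕ :=
  sInf {i : ℕ | walk X i ω = minWalk X n ω}

/-- The renewal function `u(x) = 1 + ∑_{k ≥ 1} P(-S_k ≤ x, M_k < 0)` for `x ≥ 0`,
`u(x) = 0` for `x < 0`. -/
def uFun (μ : Measure Ω) (X : ℕ → Ω → ℝ) (x : ℝ) : ℝ :=
  if 0 ≤ x then
    1 + ∑' k : ℕ, (μ {ω | -walk X (k + 1) ω ≤ x ∧ Mwalk X (k + 1) ω < 0}).toReal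
  else 0

/-- The renewal function `v(x) = 1 + ∑_{k ≥ 1} P(-S_k > x, L_k ≥ 0)` for `x ≤ 0`,
`v(x) = 0` for `x > 0`. -/
def vFun (μ : Measure Ω) (X : ℕ → Ω → ℝ) (x : ℝ) : ℝ :=
  if x ≤ 0 then
    1 + ∑' k : ℕ, (μ {ω | x < -walk X (k + 1) ω ∧ 0 ≤ Lwalk X (k + 1) ω}).toReal
  else 0

/-- The event `{∀ 1 ≤ i ≤ n, x + S_i ≥ 0} = {L_n ≥ 0}` for the walk started at `x`. -/
def posSet (X : ℕ → Ω → ℝ) (x : ℝ) (n : ℕ) : Set Ω :=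
  {ω | ∀ i ∈ Finset.Icc 1 n, 0 ≤ x + walk X i ω}

/-- The event `{∀ 1 ≤ i ≤ n, x + S_i < 0} = {M_n < 0}` for the walk started at `x`. -/
def negSet (X : ℕ → Ω → ℝ) (x : ℝ) (n : ℕ) : Set Ω :=
  {ω | ∀ i ∈ Finset.Icc 1 n, x + walk X i ω < 0}

/-- A distribution on `ℝ` is non-lattice: it is not concentrated on any arithmetic
progression `a + hℤ`. -/
def NonLattice (ν : Measure ℝ) : Prop :=
  ¬ ∃ a h : ℝ, ν {x | ∃ k : ℤ, x = a + k * h} = 1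

/-- `ν` is an `α`-stable law on `ℝ`. -/
def IsStableLaw (α : ℝ) (ν : Measure ℝ) : Prop :=
  ∀ a b : ℝ, 0 < a → 0 < b → ∃ c d : ℝ, 0 < c ∧ a ^ α + b ^ α = c ^ α ∧
    ((ν.map (fun x => a * x)).prod (ν.map (fun x => b * x))).map (fun p : ℝ × ℝ => p.1 + p.2)
      = ν.map (fun x => c * x + d)

/-- Weak convergence of a sequence of laws on `ℝ`, tested against bounded continuous
functions. -/
def WeakTendsto (μs : ℕ → Measure ℝ) (ν : Measure ℝ) : Prop :=
  ∀ g : BoundedContinuousFunction ℝ ℝ,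
    Tendsto (fun n => ∫ x, g x ∂(μs n)) atTop (𝓝 (∫ x, g x ∂ν))

/-- Assumption A4: there are norming constants `c n → ∞` such that `S n / c n` converges in
distribution to an `α`-stable law concentrated neither on `[0,∞)` nor on `(-∞,0]`; the
increment distribution is non-lattice. -/
def AssumptionA4 (μ : Measure Ω) (X : ℕ → Ω → ℝ) (c : ℕ → ℝ) : Prop :=
  Tendsto c atTop atTop ∧ NonLattice (μ.map (X 1)) ∧
    ∃ (α : ℝ) (ν : Measure ℝ), IsProbabilityMeasure ν ∧ IsStableLaw α ν ∧
      0 < ν (Set.Iio 0) ∧ 0 < ν (Set.Ioi 0) ∧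
      WeakTendsto (fun n => μ.map fun ω => walk X n ω / c n) ν

/-- A family of random elements indexed by `ι` which is i.i.d. (the common distribution
being that of the element with index `i0`). -/
def IIDfam {ι : Type*} {E : Type*} [MeasurableSpace E] (μ : Measure Ω) (Q : ι → Ω → E)
    (i0 : ι) : Prop :=
  (∀ i, Measurable (Q i)) ∧ iIndepFun Q μ ∧
    ∀ i, IdentDistrib (Q i) (Q i0) μ μ

/-- An i.i.d. sequence indexed by `ℕ` (indices from `1` are the relevant ones). -/
def IIDseq {E : Type*} [MeasurableSpace E] (μ : Measure Ω) (Q : ℕ → Ω → E) : Prop :=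
  IIDfam μ Q 1

/-- `P` is the h-transform measure `P_x⁺`: for every `n` and every bounded
`F n`-measurable `g`, `E_P[g] = u(x)⁻¹ E_x[g · u(S_n); L_n ≥ 0]`. -/
def IsPplus (μ : Measure Ω) (X : ℕ → Ω → ℝ) (F : ℕ → MeasurableSpace Ω) (x : ℝ)
    (P : Measure Ω) : Prop :=
  IsProbabilityMeasure P ∧
    ∀ (n : ℕ) (g : Ω → ℝ), Measurable[F n] g → (∃ C, ∀ ω, |g ω| ≤ C) →
      ∫ ω, g ω ∂P =
        (uFun μ X x)⁻¹ * ∫ ω in posSet X x n, g ω * uFun μ X (x + walk X n ω) ∂μ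

/-- `P` is the h-transform measure `P_x⁻`: for every `n` and every bounded
`F n`-measurable `g`, `E_P[g] = v(x)⁻¹ E_x[g · v(S_n); M_n < 0]`. -/
def IsPminus (μ : Measure Ω) (X : ℕ → Ω → ℝ) (F : ℕ → MeasurableSpace Ω) (x : ℝ)
    (P : Measure Ω) : Prop :=
  IsProbabilityMeasure P ∧
    ∀ (n : ℕ) (g : Ω → ℝ), Measurable[F n] g → (∃ C, ∀ ω, |g ω| ≤ C) →
      ∫ ω, g ω ∂P =
        (vFun μ X x)⁻¹ * ∫ ω in negSet X x n, g ω * vFun μ X (x + walk X n ω) ∂μ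

/-- The filtration generated by the environment `Q 1, ..., Q n`. -/
def envFiltration {E : Type*} [MeasurableSpace E] (Q : ℕ → Ω → E) (n : ℕ) :
    MeasurableSpace Ω :=
  ⨆ i ∈ Finset.Icc 1 n, MeasurableSpace.comap (Q i) inferInstance

/-- The σ-algebra generated by the whole environment `Q 1, Q 2, ...`. -/
def envSigma {E : Type*} [MeasurableSpace E] (Q : ℕ → Ω → E) : MeasurableSpace Ω :=
  ⨆ i, MeasurableSpace.comap (Q (i + 1)) inferInstance




/-- Probability generating function of the (random) offspring law `Q n`. -/
def pgf (Q : ℕ → Ω → Measure ℕ) (n : ℕ) (ω : Ω) (s : ℝ) : ℝ :=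
  ∑' i : ℕ, (Q n ω {i}).toReal * s ^ i

/-- Mean `m(Q_n)` of the offspring law `Q n`. -/
def meanQ (Q : ℕ → Ω → Measure ℕ) (n : ℕ) (ω : Ω) : ℝ :=
  ∑' i : ℕ, (i : ℝ) * (Q n ω {i}).toReal

/-- `X_n = log f_n'(1)`, the increments of the associated random walk. -/
def Xenv (Q : ℕ → Ω → Measure ℕ) (n : ℕ) (ω : Ω) : ℝ := Real.log (meanQ Q n ω)

/-- `η_n = f_n''(1) / (2 f_n'(1)^2)`. -/
def etaEnv (Q : ℕ → Ω → Measure ℕ) (n : ℕ) (ω : Ω) : ℝ :=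
  (∑' i : ℕ, ((i : ℝ) * ((i : ℝ) - 1)) * (Q n ω {i}).toReal) / (2 * meanQ Q n ω ^ 2)

/-- The associated random walk `S_n = X_1 + ... + X_n`. -/
def Senv (Q : ℕ → Ω → Measure ℕ) : ℕ → Ω → ℝ := walk (Xenv Q)

/-- The composition `f_{j,n}(s) = f_{j+1}(f_{j+2}(⋯ f_n(s) ⋯))`, with `f_{j,n} = id` for
`n ≤ j`. -/
def pgfComp (Q : ℕ → Ω → Measure ℕ) (j : ℕ) : ℕ → Ω → ℝ → ℝ
  | 0, _, s => s
  | n + 1, ω, s => if n + 1 ≤ j then s else pgfComp Q j n ω (pgf Q (n + 1) ω s)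

/-- `b_n = ∑_{i=0}^{n-1} η_{i+1} e^{-S_i}`. -/
def bEnv (Q : ℕ → Ω → Measure ℕ) (n : ℕ) (ω : Ω) : ℝ :=
  ∑ i ∈ Finset.range n, etaEnv Q (i + 1) ω * Real.exp (-(Senv Q i ω))

/-- `B⁺ = ∑_{i=0}^∞ η_{i+1} e^{-S_i}`. -/
def Bplus (Q : ℕ → Ω → Measure ℕ) (ω : Ω) : ℝ :=
  ∑' i : ℕ, etaEnv Q (i + 1) ω * Real.exp (-(Senv Q i ω))

/-- `B⁻ = ∑_{i=1}^∞ η_i e^{S_i}`. -/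
def Bminus (Q : ℕ → Ω → Measure ℕ) (ω : Ω) : ℝ :=
  ∑' i : ℕ, etaEnv Q (i + 1) ω * Real.exp (Senv Q (i + 1) ω)

/-- `V_∞(r) = 1 / (B⁻ + (1 - r)⁻¹)`. -/
def Vinf (Q : ℕ → Ω → Measure ℕ) (r : ℝ) (ω : Ω) : ℝ := (Bminus Q ω + (1 - r)⁻¹)⁻¹

/-- All the offspring generating functions are fractional linear:
`1/(1 - f_n(s)) = e^{-X_n}/(1-s) + η_n`. -/
def FracLinear (Q : ℕ → Ω → Measure ℕ) : Prop :=
  ∀ n, 1 ≤ n → ∀ ω : Ω, ∀ s : ℝ, 0 ≤ s → s < 1 →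
    (1 - pgf Q n ω s)⁻¹ = Real.exp (-(Xenv Q n ω)) / (1 - s) + etaEnv Q n ω

/-- Assumption A1 with explicit constant `χ`. -/
def AssumptionA1With (μ : Measure Ω) (Q : ℕ → Ω → Measure ℕ) (χ : ℝ) : Prop :=
  0 < χ ∧ χ < 1 / 2 ∧ ∀ n, 1 ≤ n →
    ∀ᵐ ω ∂μ, χ ≤ pgf Q n ω 0 ∧ pgf Q n ω 0 ≤ 1 - χ ∧ χ ≤ etaEnv Q n ω

/-- Assumption A1: for some `χ ∈ (0,1/2)`, `χ ≤ f(0) ≤ 1 - χ` and `η ≥ χ` a.s. -/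
def AssumptionA1 (μ : Measure Ω) (Q : ℕ → Ω → Measure ℕ) : Prop :=
  ∃ χ : ℝ, AssumptionA1With μ Q χ

/-- Assumption A2: `X` has zero mean, finite positive variance and is non-lattice. -/
def AssumptionA2 (μ : Measure Ω) (Q : ℕ → Ω → Measure ℕ) : Prop :=
  Integrable (Xenv Q 1) μ ∧ (∫ ω, Xenv Q 1 ω ∂μ) = 0 ∧
    Integrable (fun ω => Xenv Q 1 ω ^ 2) μ ∧ 0 < ∫ ω, Xenv Q 1 ω ^ 2 ∂μ ∧
    NonLattice (μ.map (Xenv Q 1))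

/-- `ζ(a) = ∑_{y ≥ a} y² Q({y}) / m(Q)²`. -/
def zetaEnv (Q : ℕ → Ω → Measure ℕ) (a : ℕ) (ω : Ω) : ℝ :=
  (∑' y : ℕ, if a ≤ y then (y : ℝ) ^ 2 * (Q 1 ω {y}).toReal else 0) / meanQ Q 1 ω ^ 2

/-- Assumption A3: `E[(log⁺ ζ(a))^{2+ε}] < ∞` for some `ε > 0`, `a ∈ ℕ`. -/
def AssumptionA3 (μ : Measure Ω) (Q : ℕ → Ω → Measure ℕ) : Prop :=
  ∃ ε : ℝ, 0 < ε ∧ ∃ a : ℕ, 1 ≤ a ∧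
    Integrable (fun ω => Real.log (max (zetaEnv Q a ω) 1) ^ (2 + ε)) μ

/-- The extinction moment `T = min {k ≥ 0 : Z_k = 0}`. -/
def extinctTime (Z : ℕ → Ω → ℕ) (ω : Ω) : ℕ := sInf {k | Z k ω = 0}

/-- The branching property of `Z` in the environment `Q` (started from one particle):
given the environment and `Z_k`, the conditional generating function of `Z_n` is
`f_{k,n}(s)^{Z_k}`; the state `0` is absorbing. -/
def BranchingProperty (μ : Measure Ω) (Q : ℕ → Ω → Measure ℕ) (Z : ℕ → Ω → ℕ) : Prop :=
  (∀ ω, Z 0 ω = 1) ∧ (∀ n, Measurable (Z n)) ∧ (∀ n ω, Z n ω = 0 → Z (n + 1) ω = 0) ∧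
    ∀ k n : ℕ, k ≤ n → ∀ s : ℝ, 0 ≤ s → s ≤ 1 →
      (μ[fun ω => s ^ Z n ω | envSigma Q ⊔ MeasurableSpace.comap (Z k) inferInstance])
        =ᵐ[μ] fun ω => pgfComp Q k n ω s ^ Z k ω



/-- `κ(y) = y 1{y > 0}`. -/
def kappa (y : ℝ) : ℝ := if 0 < y then y else 0

/-- Trajectories of the environment: step `i` is `(X (i + 1), η (i + 1))`. -/
abbrev Traj := ℕ → ℝ × ℝ

open scoped ENNReal Real
open ENNReal (add_lt_top continuous_ofReal inv_le_inv le_tsum mul_lt_top mul_ne_top ofReal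
  ofReal_add ofReal_le_ofReal ofReal_lt_top ofReal_mul ofReal_mul' ofReal_ne_top ofReal_one
  ofReal_pos ofReal_toReal one_lt_top one_ne_top sum_le_tsum summable tendsto_toReal toReal_mono
  toReal_mul toReal_nonneg toReal_ofReal toReal_pos tsum_le_tsum tsum_toReal_eq)
open Finset (mem_range mul_sum range sum_congr sum_le_sum sum_le_sum_of_subset
  sum_le_sum_of_subset_of_nonneg sum_mul sum_nonneg)
open Complex (I norm_exp_ofReal_mul_I)
open MeasureTheory.Measure (isProbabilityMeasure_map map_apply)
open Real (cos dist_eq exp exp_add exp_le_exp exp_neg exp_nonneg exp_pos norm_of_nonneg pi_pos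
  rpow_le_rpow sin sqrt)

section

set_option linter.unusedSectionVars false

variable {μ : Measure Ω} [IsProbabilityMeasure μ]
  {Q : ℕ → Ω → Measure ℕ} {ρ : Measure (ℝ × ℝ)} [IsProbabilityMeasure ρ] {ℓ c : ℕ → ℝ} {C θ a : ℝ}
  {F ν : Measure ℝ} [IsProbabilityMeasure F] [IsProbabilityMeasure ν] {A B : Set ℝ}
  {f : ℝ → ℝ≥0∞} {G : ℝ≥0∞ → ℝ≥0∞} {P : Measure Traj} {Pu : ℝ → Measure Traj} {Z : ℝ × ℝ → ℝ}
  {α₁ α₂ : ℝ}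

/-- The law of an i.i.d. sequence with one-step law `ρ`. -/
def pathLaw (ρ : Measure (ℝ × ℝ)) : Measure Traj := Measure.infinitePi fun _ => ρ

instance (ρ : Measure (ℝ × ℝ)) [IsProbabilityMeasure ρ] : IsProbabilityMeasure (pathLaw ρ) := by
  unfold pathLaw; infer_instance

/-- The random walk driven by the first coordinates of a path. -/
def pS (n : ℕ) (ω : Traj) : ℝ := ∑ i ∈ range n, (ω i).1

@[fun_prop]
lemma measurable_pS (n : ℕ) : Measurable (pS n) := by
  unfold pS; fun_prop

@[simp] lemma pS_zero (ω : Traj) : pS 0 ω = 0 := by simp [pS]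

lemma pS_succ (n : ℕ) (ω : Traj) : pS (n + 1) ω = pS n ω + (ω n).1 := by
  simp [pS, Finset.sum_range_succ]

/-- Concatenation of the first `k` steps of a path with another path. -/
def pcat (k : ℕ) (ω ω' : Traj) : Traj := fun i => if i < k then ω i else ω' (i - k)

/-- Reversal of the first `n` steps of a path. -/
def prev (n : ℕ) (ω : Traj) : Traj := fun i => if i < n then ω (n - 1 - i) else ω i

lemma measurable_pcat (k : ℕ) :
    Measurable fun p : Traj × Traj => pcat k p.1 p.2 := by
  refine measurable_pi_lambda _ fun i => ?_
  unfold pcat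
  split_ifs <;> fun_prop

@[fun_prop]
lemma Measurable.pcat {α : Type*} [MeasurableSpace α] {f g : α → Traj} (k : ℕ)
    (hf : Measurable f) (hg : Measurable g) : Measurable fun a => BPREpaper.pcat k (f a) (g a) :=
  (measurable_pcat k).comp (hf.prodMk hg)

@[fun_prop]
lemma measurable_prev (n : ℕ) : Measurable (prev n) := by
  refine measurable_pi_lambda _ fun i => ?_
  unfold prev
  split_ifs <;> fun_prop

variable (ρ) in
lemma map_pcat (k : ℕ) :
    ((pathLaw ρ).prod (pathLaw ρ)).map (fun p => pcat k p.1 p.2) = pathLaw ρ := by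
  refine Measure.eq_infinitePi _ fun s t ht => ?_
  rw [map_apply (measurable_pcat k)
    (MeasurableSet.pi (Finset.countable_toSet s) fun i _ => ht i)]
  have : (fun p : Traj × Traj => pcat k p.1 p.2) ⁻¹' (Set.pi s t)
      = (Set.pi (s.filter (· < k) : Finset ℕ) t) ×ˢ
        (Set.pi ((s.filter (¬ · < k)).image (· - k) : Finset ℕ) fun j => t (j + k)) := by
    ext p
    simp only [mem_preimage, Set.mem_pi, mem_prod, Finset.mem_coe, Finset.mem_filter,
      Finset.mem_image, pcat]
    grind
  rw [this, Measure.prod_prod, pathLaw, Measure.infinitePi_pi _ fun i _ => ht i,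
    Measure.infinitePi_pi _ fun i _ => ht _, Finset.prod_image,
    ← Finset.prod_filter_mul_prod_filter_not s (· < k)]
  · congr 1
    refine Finset.prod_congr rfl fun i hi => ?_
    grind
  · intro i hi j hj h
    grind

variable (ρ) in
lemma map_prev (n : ℕ) :
    (pathLaw ρ).map (prev n) = pathLaw ρ := by
  have hf : Function.Injective (fun i => if i < n then n - 1 - i else i) := by
    intro i j h
    grind
  have := Measure.map_infinitePi_infinitePi_of_inj (P := fun _ : ℕ => ρ) hf
  rw [pathLaw]
  convert this using 2
  funext ω i
  simp only [prev]
  split_ifs <;> rfl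

variable (ρ) in
lemma lintegral_pcat (k : ℕ)
    {f : Traj → ℝ≥0∞} (hf : Measurable f) :
    ∫⁻ ω, f ω ∂pathLaw ρ = ∫⁻ ω, ∫⁻ ω', f (pcat k ω ω') ∂pathLaw ρ ∂pathLaw ρ := by
  conv_lhs => rw [← map_pcat ρ k]
  rw [lintegral_map hf (measurable_pcat k)]
  exact lintegral_prod _ (hf.comp (measurable_pcat k)).aemeasurable

variable (ρ) in
lemma lintegral_prev (n : ℕ)
    {f : Traj → ℝ≥0∞} (hf : Measurable f) :
    ∫⁻ ω, f ω ∂pathLaw ρ = ∫⁻ ω, f (prev n ω) ∂pathLaw ρ := by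
  conv_lhs => rw [← map_prev ρ n]
  rw [lintegral_map hf (measurable_prev n)]

lemma pS_pcat_of_le {k i : ℕ} (h : i ≤ k) (ω ω' : Traj) :
    pS i (pcat k ω ω') = pS i ω := by
  unfold pS
  refine sum_congr rfl fun j hj => ?_
  rw [pcat, if_pos ((mem_range.1 hj).trans_le h)]

lemma pS_pcat_add (k i : ℕ) (ω ω' : Traj) :
    pS (k + i) (pcat k ω ω') = pS k ω + pS i ω' := by
  induction i with
  | zero => simp [pS_pcat_of_le le_rfl]
  | succ i ih =>
    rw [← add_assoc, pS_succ, pS_succ, ih, pcat, if_neg (by omega), add_assoc]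
    congr 3; congr 1; omega

lemma pS_prev {n i : ℕ} (h : i ≤ n) (ω : Traj) :
    pS i (prev n ω) = pS n ω - pS (n - i) ω := by
  induction i with
  | zero => simp
  | succ i ih =>
    rw [pS_succ, ih (by omega), prev, if_pos (by omega)]
    have : n - i = (n - (i + 1)) + 1 := by omega
    rw [this, pS_succ, show n - 1 - i = n - (i + 1) by omega]
    ring

lemma pS_prev_self (n : ℕ) (ω : Traj) : pS n (prev n ω) = pS n ω := by
  rw [pS_prev le_rfl]; simp

/-- The event that the walk stays in `A` during the times `1, …, n`. -/
def stay (A : Set ℝ) (n : ℕ) : Set Traj := {ω | ∀ i, 1 ≤ i → i ≤ n → pS i ω ∈ A}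

lemma measurableSet_stay {A : Set ℝ} (hA : MeasurableSet A) (n : ℕ) :
    MeasurableSet (stay A n) := by
  unfold stay
  simp only [ofPred_forall]
  exact MeasurableSet.iInter fun i => MeasurableSet.iInter fun _ => MeasurableSet.iInter fun _ =>
    measurable_pS i hA

/-- The law of the walk at time `n` on the event that it stays in `A`. -/
def stayLaw (ρ : Measure (ℝ × ℝ)) (A : Set ℝ) (n : ℕ) : Measure ℝ :=
  ((pathLaw ρ).restrict (stay A n)).map (pS n)

instance (ρ : Measure (ℝ × ℝ)) [IsProbabilityMeasure ρ] (A : Set ℝ) (n : ℕ) :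
    IsFiniteMeasure (stayLaw ρ A n) := by
  unfold stayLaw; infer_instance

lemma lintegral_stayLaw (ρ : Measure (ℝ × ℝ)) {A : Set ℝ} (hA : MeasurableSet A) (n : ℕ)
    {f : ℝ → ℝ≥0∞} (hf : Measurable f) :
    ∫⁻ x, f x ∂stayLaw ρ A n = ∫⁻ ω, (stay A n).indicator (fun ω => f (pS n ω)) ω ∂pathLaw ρ := by
  rw [stayLaw, lintegral_map hf (measurable_pS n), lintegral_indicator (measurableSet_stay hA n)]

/-- The time `k` splits the path of length `n` into a part which after reversal stays in the
complement of `A` and a part which stays in `A`. -/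
def splitSet (A : Set ℝ) (n k : ℕ) : Set Traj :=
  {ω | (∀ i < k, pS k ω - pS i ω ∉ A) ∧ ∀ i, k < i → i ≤ n → pS i ω - pS k ω ∈ A}

lemma measurableSet_splitSet {A : Set ℝ} (hA : MeasurableSet A) (n k : ℕ) :
    MeasurableSet (splitSet A n k) := by
  unfold splitSet
  simp only [ofPred_and, ofPred_forall]
  refine MeasurableSet.inter (MeasurableSet.iInter fun i => MeasurableSet.iInter fun _ => ?_)
    (MeasurableSet.iInter fun i => MeasurableSet.iInter fun _ => MeasurableSet.iInter fun _ => ?_)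
  · exact ((measurable_pS k).sub (measurable_pS i)) hA.compl
  · exact ((measurable_pS i).sub (measurable_pS k)) hA

/-- A half line containing or not containing `0`: a measurable set which is closed under addition
and whose complement is closed under addition. -/
structure IsHalf (A : Set ℝ) : Prop where
  meas : MeasurableSet A
  add : ∀ x ∈ A, ∀ y ∈ A, x + y ∈ A
  add' : ∀ x ∉ A, ∀ y ∉ A, x + y ∉ A

lemma isHalf_Iio : IsHalf (Iio 0) where
  meas := measurableSet_Iio
  add := by grind
  add' := by grind

lemma isHalf_Ici : IsHalf (Ici 0) where
  meas := measurableSet_Ici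
  add := by grind
  add' := by grind

lemma IsHalf.compl (h : IsHalf A) : IsHalf Aᶜ :=
  ⟨h.meas.compl, h.add', by simpa using h.add⟩

lemma exists_mem_splitSet (hA : IsHalf A) (n : ℕ) (ω : Traj) :
    ∃ k ≤ n, ω ∈ splitSet A n k := by
  induction n with
  | zero => exact ⟨0, le_rfl, by simp [splitSet]; omega⟩
  | succ n ih =>
    obtain ⟨k, hk, h1, h2⟩ := ih
    have := hA.add
    have := hA.add'
    by_cases h : pS (n + 1) ω - pS k ω ∈ A
    · refine ⟨k, by omega, h1, fun i hi hin => ?_⟩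
      grind
    · refine ⟨n + 1, le_rfl, fun i hi => ?_, fun i hi hin => by omega⟩
      grind

lemma splitSet_unique {A : Set ℝ} {n k l : ℕ} (hk : k ≤ n) (hl : l ≤ n) {ω : Traj}
    (h1 : ω ∈ splitSet A n k) (h2 : ω ∈ splitSet A n l) : k = l := by
  rcases lt_trichotomy k l with h | h | h
  · exact absurd (h1.2 l h hl) (h2.1 k h)
  · exact h
  · exact absurd (h2.2 k h hk) (h1.1 l h)

lemma sum_indicator_splitSet (hA : IsHalf A) (n : ℕ) (f : Traj → ℝ≥0∞) (ω : Traj) :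
    ∑ k ∈ range (n + 1), (splitSet A n k).indicator f ω = f ω := by
  obtain ⟨k, hk, hω⟩ := exists_mem_splitSet hA n ω
  rw [Finset.sum_eq_single k]
  · exact indicator_of_mem hω f
  · intro l hl hne
    exact indicator_of_notMem
      (fun h => hne (splitSet_unique (by simpa [Nat.lt_succ_iff] using hl) hk h hω)) f
  grind

variable (ρ) in
lemma lintegral_splitSet {A : Set ℝ}
    (hA : MeasurableSet A) {n k : ℕ} (hk : k ≤ n) {h : ℝ → ℝ → ℝ≥0∞}
    (hh : Measurable (Function.uncurry h)) :
    ∫⁻ ω, (splitSet A n k).indicator (fun ω => h (pS k ω) (pS n ω)) ω ∂pathLaw ρ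
      = ∫⁻ x, ∫⁻ y, h x (x + y) ∂stayLaw ρ A (n - k) ∂stayLaw ρ Aᶜ k := by
  have hm : Measurable fun ω => (splitSet A n k).indicator (fun ω => h (pS k ω) (pS n ω)) ω := by
    refine Measurable.indicator ?_ (measurableSet_splitSet hA n k)
    fun_prop
  rw [lintegral_pcat ρ k hm, lintegral_prev ρ k (by
    exact Measurable.lintegral_prod_right (hm.comp (measurable_pcat k)))]
  rw [lintegral_stayLaw ρ hA.compl k (Measurable.lintegral_prod_right (f := fun x y => h x (x + y))
    (hh.comp (measurable_fst.prodMk (measurable_fst.add measurable_snd))))]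
  refine lintegral_congr fun ω => ?_
  have key : ∀ ω', pcat k (prev k ω) ω' ∈ splitSet A n k ↔ ω ∈ stay Aᶜ k ∧ ω' ∈ stay A (n - k) := by
    intro ω'
    have e : ∀ i, k < i → i ≤ n → pS i (pcat k (prev k ω) ω') = pS k ω + pS (i - k) ω' := by
      intro i hi _
      conv_lhs => rw [show i = k + (i - k) by omega, pS_pcat_add, pS_prev_self]
    simp only [splitSet, stay, mem_ofPred_eq, pS_pcat_of_le le_rfl, pS_prev_self, mem_compl_iff]
    constructor
    · rintro ⟨h1, h2⟩
      refine ⟨fun i hi hik => ?_, fun i hi hik => ?_⟩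
      · have := h1 (k - i) (by omega)
        rw [pS_pcat_of_le (by omega), pS_prev (by omega), Nat.sub_sub_self hik] at this
        simpa using this
      · have := h2 (k + i) (by omega) (by omega)
        grind
    · rintro ⟨h1, h2⟩
      refine ⟨fun i hi => ?_, fun i hi hik => ?_⟩
      · rw [pS_pcat_of_le hi.le, pS_prev hi.le]
        grind
      grind
  have e2 : ∀ ω', pS n (pcat k (prev k ω) ω') = pS k ω + pS (n - k) ω' := by
    intro ω'
    conv_lhs => rw [show n = k + (n - k) by omega, pS_pcat_add, pS_prev_self]
  by_cases hω : ω ∈ stay Aᶜ k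
  · rw [indicator_of_mem hω, lintegral_stayLaw ρ hA _ (f := fun y => h (pS k ω) (pS k ω + y))
      (hh.comp (measurable_const.prodMk (measurable_const.add measurable_id)))]
    refine lintegral_congr fun ω' => ?_
    by_cases hω' : ω' ∈ stay A (n - k)
    · rw [indicator_of_mem hω', indicator_of_mem ((key ω').2 ⟨hω, hω'⟩), e2,
        pS_pcat_of_le le_rfl, pS_prev_self]
    simp_all
  simp_all

/-- The law of the walk at time `n`. -/
def walkLaw (ρ : Measure (ℝ × ℝ)) (n : ℕ) : Measure ℝ := (pathLaw ρ).map (pS n)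

instance (ρ : Measure (ℝ × ℝ)) [IsProbabilityMeasure ρ] (n : ℕ) :
    IsProbabilityMeasure (walkLaw ρ n) :=
  isProbabilityMeasure_map (measurable_pS n).aemeasurable

lemma lintegral_walkLaw (ρ : Measure (ℝ × ℝ)) (n : ℕ) {f : ℝ → ℝ≥0∞} (hf : Measurable f) :
    ∫⁻ x, f x ∂walkLaw ρ n = ∫⁻ ω, f (pS n ω) ∂pathLaw ρ :=
  lintegral_map hf (measurable_pS n)

variable (ρ) in
lemma walkLaw_zero :
    walkLaw ρ 0 = Measure.dirac 0 := by
  have : pS 0 = fun _ => (0 : ℝ) := by funext ω; simp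
  rw [walkLaw, this, Measure.map_const]
  simp

variable (ρ) in
lemma walkLaw_add (m n : ℕ) :
    walkLaw ρ (m + n) = (walkLaw ρ m).conv (walkLaw ρ n) := by
  refine Measure.ext_of_lintegral _ fun f hf => ?_
  rw [Measure.lintegral_conv hf, lintegral_walkLaw ρ _ hf,
    lintegral_pcat ρ m (f := fun ω => f (pS (m + n) ω)) (hf.comp (measurable_pS _)),
    lintegral_walkLaw ρ m (f := fun x => ∫⁻ y, f (x + y) ∂walkLaw ρ n)
      (Measurable.lintegral_prod_right' (f := fun p : ℝ × ℝ => f (p.1 + p.2))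
        (hf.comp measurable_add))]
  refine lintegral_congr fun ω => ?_
  rw [lintegral_walkLaw ρ n (f := fun y => f (pS m ω + y))
    (hf.comp (measurable_const_add _))]
  simp [pS_pcat_add]

variable (ρ) in
lemma walkLaw_one :
    walkLaw ρ 1 = ρ.map Prod.fst := by
  have h : pS 1 = Prod.fst ∘ (fun ω : Traj => ω 0) := by funext ω; simp [pS]
  rw [walkLaw, h, ← Measure.map_map measurable_fst (measurable_pi_apply 0), pathLaw]
  exact congrArg _ (measurePreserving_eval_infinitePi (fun _ : ℕ => ρ) 0).map_eq

variable (ρ) in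
lemma charFun_walkLaw (n : ℕ) (t : ℝ) :
    charFun (walkLaw ρ n) t = charFun (ρ.map Prod.fst) t ^ n := by
  induction n with
  | zero => simp [walkLaw_zero, charFun_dirac]
  | succ n ih => rw [walkLaw_add, charFun_conv, ih, walkLaw_one, pow_succ]

variable (ρ) in
lemma sum_stayLaw_conv (hA : IsHalf A) (n : ℕ) :
    ∑ k ∈ range (n + 1), (stayLaw ρ Aᶜ k).conv (stayLaw ρ A (n - k)) = walkLaw ρ n := by
  refine Measure.ext_of_lintegral _ fun f hf => ?_
  rw [lintegral_finsetSum_measure, lintegral_walkLaw ρ n hf]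
  have : ∀ ω, f (pS n ω) = ∑ k ∈ range (n + 1),
      (splitSet A n k).indicator (fun ω => f (pS n ω)) ω := fun ω =>
    (sum_indicator_splitSet hA n (fun ω => f (pS n ω)) ω).symm
  rw [lintegral_congr this, lintegral_finsetSum]
  · refine sum_congr rfl fun k hk => ?_
    rw [Measure.lintegral_conv hf]
    exact (lintegral_splitSet ρ hA.meas (Nat.lt_succ_iff.1 (mem_range.1 hk))
      (h := fun _ y => f y) (hf.comp measurable_snd)).symm
  · exact fun k _ => (hf.comp (measurable_pS n)).indicator (measurableSet_splitSet hA.meas n k)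

lemma integrable_charFun_aux (μ : Measure ℝ) [IsFiniteMeasure μ] (t : ℝ) :
    Integrable (fun x : ℝ => Complex.exp (t * x * I)) μ := by
  refine Integrable.of_bound (C := 1) (by fun_prop) (.of_forall fun x => ?_)
  rw [← Complex.ofReal_mul, norm_exp_ofReal_mul_I]

lemma charFun_finsetSum {ι : Type*} (s : Finset ι) (μ : ι → Measure ℝ)
    [∀ i, IsFiniteMeasure (μ i)] (t : ℝ) :
    charFun (∑ i ∈ s, μ i) t = ∑ i ∈ s, charFun (μ i) t := by
  simp only [charFun_apply_real]
  exact integral_finsetSum_measure fun i _ => integrable_charFun_aux _ t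

lemma charFun_add_measure (μ ν : Measure ℝ) [IsFiniteMeasure μ] [IsFiniteMeasure ν] (t : ℝ) :
    charFun (μ + ν) t = charFun μ t + charFun ν t := by
  simp only [charFun_apply_real]
  exact integral_add_measure (integrable_charFun_aux _ t) (integrable_charFun_aux _ t)

lemma charFun_nsmul_measure (n : ℕ) (μ : Measure ℝ) (t : ℝ) :
    charFun ((n : ℝ≥0∞) • μ) t = n * charFun μ t := by
  simp only [charFun_apply_real, integral_smul_measure]
  simp

lemma stayLaw_compl_of_pos (ρ : Measure (ℝ × ℝ)) {A : Set ℝ} (hA : MeasurableSet A) {n : ℕ}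
    (hn : 1 ≤ n) : stayLaw ρ A n Aᶜ = 0 := by
  rw [stayLaw, map_apply (measurable_pS n) hA.compl,
    Measure.restrict_apply (measurable_pS n hA.compl)]
  convert measure_empty (μ := pathLaw ρ)
  ext ω
  simp only [mem_inter_iff, mem_preimage, stay, mem_ofPred_eq, mem_empty_iff_false, iff_false]
  exact fun h => h.1 (h.2 n hn le_rfl)

variable (ρ) in
lemma stayLaw_zero (A : Set ℝ) :
    stayLaw ρ A 0 = Measure.dirac 0 := by
  have : stay A 0 = univ := by ext ω; simp [stay]; omega
  rw [stayLaw, this, Measure.restrict_univ]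
  exact walkLaw_zero ρ

/-- The right hand side of Spitzer's identity. -/
def spitzerSum (ρ : Measure (ℝ × ℝ)) (A : Set ℝ) (n : ℕ) : Measure ℝ :=
  ∑ k ∈ range (n + 1), ((walkLaw ρ (k + 1)).restrict A).conv (stayLaw ρ A (n - k))

instance (ρ : Measure (ℝ × ℝ)) [IsProbabilityMeasure ρ] (A : Set ℝ) (n : ℕ) :
    IsFiniteMeasure (spitzerSum ρ A n) := by
  unfold spitzerSum; infer_instance

variable (ρ) in
lemma spitzerSum_compl (hA : IsHalf A) (n : ℕ) : spitzerSum ρ A n Aᶜ = 0 := by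
  rw [spitzerSum, Measure.finsetSum_apply]
  refine Finset.sum_eq_zero fun k _ => ?_
  rw [← lintegral_indicator_one hA.meas.compl, Measure.lintegral_conv (by
    exact measurable_one.indicator hA.meas.compl)]
  refine (setLIntegral_congr_fun hA.meas fun x hx => ?_).trans lintegral_zero
  rcases Nat.eq_zero_or_pos (n - k) with h | h
  · rw [h, stayLaw_zero, lintegral_dirac]
    simp [hx]
  · refine (lintegral_congr_ae ?_).trans lintegral_zero
    have h0 := stayLaw_compl_of_pos ρ hA.meas h
    filter_upwards [measure_eq_zero_iff_ae_notMem.1 h0] with y hy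
    rw [indicator_of_notMem]
    simpa using hA.add x hx y (by simpa using hy)

variable (ρ) in
lemma spitzer_charFun (hA : IsHalf A) (n : ℕ) :
    ((n + 1 : ℕ) : ℝ≥0∞) • stayLaw ρ A (n + 1) = spitzerSum ρ A n ∧
    ((n + 1 : ℕ) : ℝ≥0∞) • stayLaw ρ Aᶜ (n + 1) = spitzerSum ρ Aᶜ n := by
  let a : PowerSeries (ℝ → ℂ) := PowerSeries.mk fun n => charFun (stayLaw ρ A n)
  let d : PowerSeries (ℝ → ℂ) := PowerSeries.mk fun n => charFun (stayLaw ρ Aᶜ n)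
  let βa : PowerSeries (ℝ → ℂ) :=
    PowerSeries.mk fun n => charFun ((walkLaw ρ (n + 1)).restrict A)
  let βd : PowerSeries (ℝ → ℂ) :=
    PowerSeries.mk fun n => charFun ((walkLaw ρ (n + 1)).restrict Aᶜ)
  let φ : ℝ → ℂ := charFun (ρ.map Prod.fst)
  let G : PowerSeries (ℝ → ℂ) := PowerSeries.mk fun n => φ ^ n
  let Φ : PowerSeries (ℝ → ℂ) := PowerSeries.mk fun n => φ ^ (n + 1)
  have hG : d * a = G := by
    ext n : 1
    rw [PowerSeries.coeff_mul, Finset.Nat.sum_antidiagonal_eq_sum_range_succ_mk]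
    funext t
    simp only [a, d, G, PowerSeries.coeff_mk, Pi.pow_apply, φ, Finset.sum_apply, Pi.mul_apply]
    rw [← charFun_walkLaw, ← sum_stayLaw_conv ρ hA, charFun_finsetSum]
    exact sum_congr rfl fun k _ => (charFun_conv t).symm
  have hΦ : βa + βd = Φ := by
    ext n : 1
    funext t
    simp only [βa, βd, Φ, map_add, PowerSeries.coeff_mk, Pi.pow_apply, φ, Pi.add_apply]
    rw [← charFun_add_measure, Measure.restrict_add_restrict_compl hA.meas, charFun_walkLaw]
  have hdG : PowerSeries.derivative (ℝ → ℂ) G = Φ * G := by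
    ext n : 1
    rw [PowerSeries.coeff_derivative, PowerSeries.coeff_mul,
      Finset.Nat.sum_antidiagonal_eq_sum_range_succ_mk]
    simp only [G, Φ, PowerSeries.coeff_mk]
    rw [sum_congr rfl fun k hk => by
      rw [← pow_add, show k + 1 + (n - k) = n + 1 by have := mem_range.1 hk; omega]]
    simp [mul_comm]
  let εa := PowerSeries.derivative (ℝ → ℂ) a - βa * a
  let εd := PowerSeries.derivative (ℝ → ℂ) d - βd * d
  have hε : εa * d + εd * a = 0 := by
    have h1 := (PowerSeries.derivative (ℝ → ℂ)).leibniz d a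
    rw [hG, hdG, smul_eq_mul, smul_eq_mul, ← hΦ, ← hG] at h1
    linear_combination -h1
  have ca : ∀ n, PowerSeries.coeff n εa = fun t =>
      charFun (((n + 1 : ℕ) : ℝ≥0∞) • stayLaw ρ A (n + 1)) t - charFun (spitzerSum ρ A n) t := by
    intro n
    funext t
    simp only [εa, map_sub, PowerSeries.coeff_derivative, PowerSeries.coeff_mul,
      Finset.Nat.sum_antidiagonal_eq_sum_range_succ_mk, a, βa, PowerSeries.coeff_mk, spitzerSum]
    rw [charFun_nsmul_measure, charFun_finsetSum]
    simp [charFun_conv, mul_comm]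
  have cd : ∀ n, PowerSeries.coeff n εd = fun t =>
      charFun (((n + 1 : ℕ) : ℝ≥0∞) • stayLaw ρ Aᶜ (n + 1)) t
        - charFun (spitzerSum ρ Aᶜ n) t := by
    intro n
    funext t
    simp only [εd, map_sub, PowerSeries.coeff_derivative, PowerSeries.coeff_mul,
      Finset.Nat.sum_antidiagonal_eq_sum_range_succ_mk, d, βd, PowerSeries.coeff_mk, spitzerSum]
    rw [charFun_nsmul_measure, charFun_finsetSum]
    simp [charFun_conv, mul_comm]
  have ha0 : PowerSeries.coeff 0 a = 1 := by
    funext t; simp [a, stayLaw_zero, charFun_dirac]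
  have hd0 : PowerSeries.coeff 0 d = 1 := by
    funext t; simp [d, stayLaw_zero, charFun_dirac]
  induction n using Nat.strong_induction_on with
  | _ n ih =>
    have z : ∀ k < n, PowerSeries.coeff k εa = 0 ∧ PowerSeries.coeff k εd = 0 := by
      intro k hk
      rw [ca, cd, (ih k hk).1, (ih k hk).2]
      exact ⟨by funext t; simp, by funext t; simp⟩
    have hn := congrArg (PowerSeries.coeff n) hε
    rw [map_add, PowerSeries.coeff_mul, PowerSeries.coeff_mul,
      Finset.Nat.sum_antidiagonal_eq_sum_range_succ_mk,
      Finset.Nat.sum_antidiagonal_eq_sum_range_succ_mk, Finset.sum_range_succ,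
      Finset.sum_range_succ, Finset.sum_eq_zero, Finset.sum_eq_zero] at hn
    rotate_left
    · intro k hk; simp [(z k (mem_range.1 hk)).2]
    · intro k hk; simp [(z k (mem_range.1 hk)).1]
    simp only [Nat.sub_self, ha0, hd0, mul_one, zero_add, map_zero] at hn
    have fin1 : ∀ B, IsFiniteMeasure (((n + 1 : ℕ) : ℝ≥0∞) • stayLaw ρ B (n + 1)) := fun B =>
      Measure.smul_finite _ (by simp)
    have heq : ((n + 1 : ℕ) : ℝ≥0∞) • stayLaw ρ A (n + 1)
        + ((n + 1 : ℕ) : ℝ≥0∞) • stayLaw ρ Aᶜ (n + 1)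
        = spitzerSum ρ A n + spitzerSum ρ Aᶜ n := by
      have := fin1 A
      have := fin1 Aᶜ
      refine Measure.ext_of_charFun ?_
      funext t
      have ht := congrFun hn t
      rw [ca, cd] at ht
      simp only [Pi.add_apply, Pi.zero_apply] at ht
      rw [charFun_add_measure, charFun_add_measure]
      linear_combination ht
    have r0 : ∀ (μ : Measure ℝ) (B : Set ℝ), μ B = 0 → μ.restrict B = 0 := fun μ B h =>
      Measure.restrict_eq_zero.2 h
    have rs : ∀ (μ : Measure ℝ) (B : Set ℝ), MeasurableSet B → μ Bᶜ = 0 → μ.restrict B = μ := by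
      intro μ B hB h
      conv_rhs => rw [← Measure.restrict_add_restrict_compl (μ := μ) hB, r0 μ _ h, add_zero]
    have c1 : stayLaw ρ A (n + 1) Aᶜ = 0 := stayLaw_compl_of_pos ρ hA.meas (by omega)
    have c2 : stayLaw ρ Aᶜ (n + 1) A = 0 := by
      simpa using stayLaw_compl_of_pos ρ hA.meas.compl (n := n + 1) (by omega)
    have c3 := spitzerSum_compl ρ hA n
    have c4 : spitzerSum ρ Aᶜ n A = 0 := by
      simpa using spitzerSum_compl ρ hA.compl n
    constructor
    · have := congrArg (fun μ => Measure.restrict μ A) heq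
      simp only [Measure.restrict_add, Measure.restrict_smul] at this
      rwa [rs _ _ hA.meas c1, r0 _ _ c2, rs _ _ hA.meas c3, r0 _ _ c4, smul_zero, add_zero,
        add_zero] at this
    · have := congrArg (fun μ => Measure.restrict μ Aᶜ) heq
      simp only [Measure.restrict_add, Measure.restrict_smul] at this
      rwa [r0 _ _ c1, rs _ _ hA.meas.compl (by rwa [compl_compl]), r0 _ _ c3,
        rs _ _ hA.meas.compl (by rwa [compl_compl]), smul_zero, zero_add, zero_add] at this

variable (ρ) in
lemma spitzer (hA : IsHalf A) (n : ℕ) {f : ℝ → ℝ≥0∞} (hf : Measurable f) :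
    ((n + 1 : ℕ) : ℝ≥0∞) * ∫⁻ x, f x ∂stayLaw ρ A (n + 1) = ∑ k ∈ range (n + 1),
      ∫⁻ x in A, ∫⁻ y, f (x + y) ∂stayLaw ρ A (n - k) ∂walkLaw ρ (k + 1) := by
  rw [← smul_eq_mul, ← lintegral_smul_measure, (spitzer_charFun ρ hA n).1, spitzerSum,
    lintegral_finsetSum_measure]
  exact sum_congr rfl fun k _ => Measure.lintegral_conv hf

/-- The regularity of the local-limit normalisation `ℓ n = 1 / c n` which is used for comparing
sequences with `ℓ n / n`. -/
structure RegSeq (ℓ : ℕ → ℝ) : Prop where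
  pos : ∀ n, 0 < ℓ n
  comp : ∃ K, 0 < K ∧ ∀ m n, n ≤ 2 * m → ℓ m ≤ K * ℓ n
  ratio : Tendsto (fun n => ℓ (n + 1) / ℓ n) atTop (𝓝 1)
  lim : Tendsto ℓ atTop (𝓝 0)
  summ : Summable fun n : ℕ => ℓ n / n

lemma RegSeq.comp_pow {ℓ : ℕ → ℝ} (h : RegSeq ℓ) (j : ℕ) :
    ∃ K, 0 < K ∧ ∀ m n, n ≤ 2 ^ j * m → ℓ m ≤ K * ℓ n := by
  obtain ⟨K, hK, hc⟩ := h.comp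
  refine ⟨K ^ (j + 1), by positivity, ?_⟩
  induction j with
  | zero => intro m n hmn; simpa using hc m n (by omega)
  | succ j ih =>
    intro m n hmn
    have h1 := ih (2 * m) n (by rw [pow_succ] at hmn; rwa [← mul_assoc])
    calc ℓ m ≤ K * ℓ (2 * m) := hc _ _ le_rfl
      _ ≤ K * (K ^ (j + 1) * ℓ n) := by gcongr
      _ = K ^ (j + 1 + 1) * ℓ n := by ring

lemma RegSeq.div_pos {ℓ : ℕ → ℝ} (h : RegSeq ℓ) {n : ℕ} (hn : 1 ≤ n) : 0 < ℓ n / n :=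
  _root_.div_pos (h.pos n) (by exact_mod_cast hn)

lemma RegSeq.div_comp {ℓ : ℕ → ℝ} (h : RegSeq ℓ) (j : ℕ) :
    ∃ K, 0 < K ∧ ∀ m n, 1 ≤ n → n ≤ 2 ^ j * m → ℓ m / m ≤ K * (ℓ n / n) := by
  obtain ⟨K, hK, hc⟩ := h.comp_pow j
  refine ⟨2 ^ j * K, by positivity, fun m n hn hmn => ?_⟩
  have hm : 0 < m := Nat.pos_of_ne_zero (by rintro rfl; omega)
  have hm' : (0 : ℝ) < m := by exact_mod_cast hm
  have hn' : (0 : ℝ) < n := by exact_mod_cast hn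
  have hmn' : (n : ℝ) ≤ 2 ^ j * m := by exact_mod_cast hmn
  rw [div_le_iff₀ hm']
  have h1 := hc m n hmn
  calc ℓ m ≤ K * ℓ n := h1
    _ = K * (ℓ n / n) * n := by field_simp
    _ ≤ K * (ℓ n / n) * (2 ^ j * m) := by
        have := (h.div_pos hn).le
        gcongr
    _ = _ := by ring

lemma RegSeq.tendsto_ratio {ℓ : ℕ → ℝ} (h : RegSeq ℓ) (j : ℕ) :
    Tendsto (fun n => ℓ (n + j) / ℓ n) atTop (𝓝 1) := by
  induction j with
  | zero => simp [div_self (h.pos _).ne']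
  | succ j ih =>
    have h1 := (h.ratio.comp (tendsto_add_atTop_nat j)).mul ih
    rw [one_mul] at h1
    refine h1.congr fun n => ?_
    have := (h.pos (n + j)).ne'
    have := (h.pos n).ne'
    simp only [Function.comp]
    rw [← add_assoc]
    field_simp

lemma RegSeq.tendsto_ratio_sub {ℓ : ℕ → ℝ} (h : RegSeq ℓ) (j : ℕ) :
    Tendsto (fun n => ℓ (n - j) / ℓ n) atTop (𝓝 1) := by
  have h1 := (h.tendsto_ratio j).inv₀ one_ne_zero
  rw [inv_one] at h1
  rw [← tendsto_add_atTop_iff_nat j]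
  grind

lemma RegSeq.tendsto_div_ratio {ℓ : ℕ → ℝ} (h : RegSeq ℓ) (j : ℕ) :
    Tendsto (fun n : ℕ => (ℓ (n - j) / (n - j : ℕ)) / (ℓ n / n)) atTop (𝓝 1) := by
  have h1 : Tendsto (fun n : ℕ => (n : ℝ) / (n + j : ℝ)) atTop (𝓝 1) := by
    simpa using tendsto_natCast_div_add_atTop (j : ℝ)
  have h2 := (h.tendsto_ratio_sub j).mul
    (((h1.inv₀ one_ne_zero).comp (tendsto_sub_atTop_nat j)))
  rw [inv_one, one_mul] at h2
  refine h2.congr' ?_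
  filter_upwards [eventually_ge_atTop (j + 1)] with n hn
  have : ((n - j : ℕ) : ℝ) + j = n := by
    rw [Nat.cast_sub (by omega)]; ring
  grind

/-- The recursion satisfied by the coefficients of `exp (∑ β k s ^ k / k)`. -/
structure SpitzerSeq (a β : ℕ → ℝ) : Prop where
  zero : a 0 = 1
  nonneg : ∀ n, 0 ≤ a n
  nonneg' : ∀ n, 0 ≤ β n
  recurrence : ∀ n : ℕ, ((n : ℝ) + 1) * a (n + 1) = ∑ k ∈ range (n + 1), β (k + 1) * a (n - k)

lemma SpitzerSeq.sum_le_exp {a β : ℕ → ℝ} (h : SpitzerSeq a β) (N : ℕ) :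
    ∑ n ∈ range (N + 1), a n ≤ exp (∑ k ∈ range N, β (k + 1) / (k + 1)) := by
  let A : ℝ → ℝ := fun s => ∑ n ∈ range (N + 1), a n * s ^ n
  let B : ℝ → ℝ := fun s => ∑ k ∈ range N, β (k + 1) / (k + 1) * s ^ (k + 1)
  let A' : ℝ → ℝ := fun s => ∑ n ∈ range N, ((n : ℝ) + 1) * a (n + 1) * s ^ n
  let B' : ℝ → ℝ := fun s => ∑ k ∈ range N, β (k + 1) * s ^ k
  have hA : ∀ s, HasDerivAt A (A' s) s := fun s => by
    have : A = fun s => ∑ n ∈ range N, a (n + 1) * s ^ (n + 1) + a 0 := by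
      funext s; simp [A, Finset.sum_range_succ']
    rw [this]
    refine (HasDerivAt.fun_sum fun n _ => ?_).add_const _
    refine ((hasDerivAt_pow (n + 1) s).const_mul (a (n + 1))).congr_deriv ?_
    simp; ring
  have hB : ∀ s, HasDerivAt B (B' s) s := fun s => by
    refine HasDerivAt.fun_sum fun k _ => ?_
    refine ((hasDerivAt_pow (k + 1) s).const_mul (β (k + 1) / (k + 1))).congr_deriv ?_
    grind
  have key : ∀ s, 0 ≤ s → A' s ≤ B' s * A s := fun s hs => by
    have e1 : A' s = ∑ p ∈ (range N).sigma fun n => range (n + 1),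
        (β (p.2 + 1) * s ^ p.2) * (a (p.1 - p.2) * s ^ (p.1 - p.2)) := by
      rw [Finset.sum_sigma]
      refine sum_congr rfl fun n _ => ?_
      rw [h.recurrence, sum_mul]
      refine sum_congr rfl fun k hk => ?_
      have : s ^ n = s ^ k * s ^ (n - k) := by
        rw [← pow_add]; congr 1; have := mem_range.1 hk; omega
      rw [this]; ring
    have e2 : B' s * A s = ∑ q ∈ range N ×ˢ range (N + 1),
        (β (q.1 + 1) * s ^ q.1) * (a q.2 * s ^ q.2) := by
      rw [Finset.sum_mul_sum, Finset.sum_product]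
    rw [e1, e2]
    have e3 : ∀ p : (_ : ℕ) × ℕ, (β (p.2 + 1) * s ^ p.2) * (a (p.1 - p.2) * s ^ (p.1 - p.2)) =
        (fun q : ℕ × ℕ => (β (q.1 + 1) * s ^ q.1) * (a q.2 * s ^ q.2)) (p.2, p.1 - p.2) :=
      fun _ => rfl
    rw [sum_congr rfl fun p _ => e3 p, ← Finset.sum_image (f := fun q : ℕ × ℕ =>
      (β (q.1 + 1) * s ^ q.1) * (a q.2 * s ^ q.2)) (g := fun p : (_ : ℕ) × ℕ => (p.2, p.1 - p.2))]
    · refine sum_le_sum_of_subset_of_nonneg ?_ fun q _ _ => ?_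
      · grind
      · have := h.nonneg' (q.1 + 1)
        have := h.nonneg q.2
        positivity
    · rintro ⟨n, k⟩ h1 ⟨n', k'⟩ h2 h3
      grind
  have anti : AntitoneOn (fun s => A s * exp (-B s)) (Set.Ici 0) := by
    have hd : ∀ s, HasDerivAt (fun s => A s * exp (-B s))
        (A' s * exp (-B s) + A s * (exp (-B s) * -B' s)) s := fun s =>
      (hA s).mul ((hB s).neg.exp)
    refine antitoneOn_of_deriv_nonpos (convex_Ici 0)
      (fun s _ => (hd s).continuousAt.continuousWithinAt)
      (fun s _ => (hd s).differentiableAt.differentiableWithinAt) fun s hs => ?_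
    rw [(hd s).deriv]
    have h1 := key s (by simpa using interior_subset hs)
    have h2 := exp_pos (-B s)
    nlinarith
  have h1 := anti (show (0 : ℝ) ∈ Set.Ici 0 by simp) (show (1 : ℝ) ∈ Set.Ici 0 by simp) zero_le_one
  have hA0 : A 0 = 1 := by simp [A, Finset.sum_range_succ', h.zero]
  have hB0 : B 0 = 0 := by simp [B]
  simp only [hA0, hB0, neg_zero, Real.exp_zero, mul_one] at h1
  rw [exp_neg, ← div_eq_mul_inv, div_le_one (exp_pos _)] at h1
  simpa [A, B] using h1

lemma SpitzerSeq.summable {a β ℓ : ℕ → ℝ} (h : SpitzerSeq a β) (hℓ : RegSeq ℓ)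
    (hb : ∃ K, ∀ k, β k ≤ K * ℓ k) : Summable a := by
  obtain ⟨K, hK⟩ := hb
  have hs : Summable fun k : ℕ => β (k + 1) / ((k : ℝ) + 1) := by
    have := ((summable_nat_add_iff 1).2 hℓ.summ).mul_left K
    refine this.of_nonneg_of_le (fun k => div_nonneg (h.nonneg' _) (by positivity)) fun k => ?_
    rw [← mul_div_assoc]
    push_cast
    have := hK (k + 1)
    gcongr
  refine summable_of_sum_range_le h.nonneg (c := exp (∑' k : ℕ, β (k + 1) / ((k : ℝ) + 1)))
    fun N => ?_
  calc ∑ n ∈ range N, a n ≤ ∑ n ∈ range (N + 1), a n :=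
        sum_le_sum_of_subset_of_nonneg (Finset.range_mono (Nat.le_succ N))
          fun _ _ _ => h.nonneg _
    _ ≤ _ := h.sum_le_exp N
    _ ≤ _ := exp_le_exp.2 (hs.sum_le_tsum _ fun k _ =>
        div_nonneg (h.nonneg' _) (by positivity))

/-- A sum over `k ≤ n` splits into `k` of order `n` and `k` at most `n / 2`. -/
lemma sum_range_split (g : ℕ → ℕ → ℝ) (n : ℕ) :
    ∑ k ∈ range (n + 1), g k (n - k) =
      ∑ k ∈ range (n / 2), g k (n - k)
      + ∑ j ∈ range (n + 1 - n / 2), g (n - j) j := by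
  have e : n + 1 = n / 2 + (n + 1 - n / 2) := by omega
  conv_lhs => rw [e, Finset.sum_range_add]
  congr 1
  rw [← Finset.sum_range_reflect]
  refine sum_congr rfl fun j hj => ?_
  grind

lemma RegSeq.cesaro {ℓ : ℕ → ℝ} (hℓ : RegSeq ℓ) :
    Tendsto (fun n : ℕ => (∑ k ∈ range n, ℓ (k + 1)) / ((n : ℝ) + 1)) atTop (𝓝 0) := by
  have h1 := (hℓ.lim.comp (tendsto_add_atTop_nat 1)).cesaro
  have h2 := h1.mul (tendsto_natCast_div_add_atTop (1 : ℝ))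
  rw [zero_mul] at h2
  refine h2.congr fun n => ?_
  rcases Nat.eq_zero_or_pos n with rfl | hn
  · simp
  have : (n : ℝ) ≠ 0 := by positivity
  grind

lemma SpitzerSeq.le {a β ℓ : ℕ → ℝ} (h : SpitzerSeq a β) (hℓ : RegSeq ℓ)
    (hb : ∃ K, ∀ k, β k ≤ K * ℓ k) : ∃ K, 0 < K ∧ ∀ n, 1 ≤ n → a n ≤ K * (ℓ n / n) := by
  have hsum := h.summable hℓ hb
  obtain ⟨K₀, hK₀⟩ := hb
  obtain ⟨K₁, hK₁, hb⟩ : ∃ K, 0 < K ∧ ∀ k, β k ≤ K * ℓ k :=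
    ⟨max K₀ 1, by positivity, fun k => (hK₀ k).trans
      (mul_le_mul_of_nonneg_right (le_max_left _ _) (hℓ.pos k).le)⟩
  obtain ⟨K₂, hK₂, hc⟩ := hℓ.comp_pow 2
  obtain ⟨K₃, hK₃, hd⟩ := hℓ.div_comp 2
  set S := ∑' n, a n
  have hS : 0 ≤ S := tsum_nonneg h.nonneg
  have hev : ∀ᶠ n : ℕ in atTop,
      (∑ k ∈ range n, ℓ (k + 1)) / ((n : ℝ) + 1) < 1 / (2 * K₁ * K₃) :=
    hℓ.cesaro.eventually_lt_const (by positivity)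
  obtain ⟨N, hN⟩ := eventually_atTop.1 hev
  set T := 2 * K₁ * K₂ * S + ∑ j ∈ range (N + 2), a j / (ℓ j / j) + 1
  have hT0 : ∀ j, 0 ≤ a j / (ℓ j / j) := fun j =>
    div_nonneg (h.nonneg j) (div_nonneg (hℓ.pos j).le (by positivity))
  have hT : 0 < T := by
    have : 0 ≤ ∑ j ∈ range (N + 2), a j / (ℓ j / j) := sum_nonneg fun j _ => hT0 j
    positivity
  refine ⟨T, hT, fun n => ?_⟩
  induction n using Nat.strong_induction_on with
  | _ n ih =>
    intro hn
    by_cases hnN : n < N + 2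
    · rw [← div_le_iff₀ (hℓ.div_pos hn)]
      have := Finset.single_le_sum (f := fun j => a j / (ℓ j / j)) (fun j _ => hT0 j)
        (mem_range.2 hnN)
      have : 0 ≤ 2 * K₁ * K₂ * S := by positivity
      simp only [T]
      linarith
    obtain ⟨n, rfl⟩ : ∃ m, n = m + 1 := ⟨n - 1, by omega⟩
    have hrec := h.recurrence n
    rw [sum_range_split (fun k j => β (k + 1) * a j) n] at hrec
    have hn1 : (0 : ℝ) < n + 1 := by positivity
    have hl := hℓ.pos (n + 1)
    have h1 : ∑ k ∈ range (n / 2), β (k + 1) * a (n - k)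
        ≤ (1 / 2) * T * ℓ (n + 1) := by
      calc ∑ k ∈ range (n / 2), β (k + 1) * a (n - k)
          ≤ ∑ k ∈ range (n / 2), (K₁ * ℓ (k + 1)) * (T * (K₃ * (ℓ (n + 1) / (n + 1)))) := by
            refine sum_le_sum fun k hk => ?_
            have hk := mem_range.1 hk
            have h2 := ih (n - k) (by omega) (by omega)
            have h3 := hd (n - k) (n + 1) (by omega) (by omega)
            have := hℓ.pos (k + 1)
            push_cast at h3
            refine mul_le_mul (hb _) (h2.trans (by gcongr)) (h.nonneg _) (by positivity)
        _ = (∑ k ∈ range (n / 2), ℓ (k + 1)) *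
              (K₁ * (T * (K₃ * (ℓ (n + 1) / (n + 1))))) := by
            rw [sum_mul]; exact sum_congr rfl fun k _ => by ring
        _ ≤ (∑ k ∈ range n, ℓ (k + 1)) *
              (K₁ * (T * (K₃ * (ℓ (n + 1) / (n + 1))))) := by
            refine mul_le_mul_of_nonneg_right ?_ (by positivity)
            exact sum_le_sum_of_subset_of_nonneg (Finset.range_mono (by omega))
              fun _ _ _ => (hℓ.pos _).le
        _ = (∑ k ∈ range n, ℓ (k + 1)) / ((n : ℝ) + 1) *
              (K₁ * K₃ * T * ℓ (n + 1)) := by field_simp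
        _ ≤ 1 / (2 * K₁ * K₃) * (K₁ * K₃ * T * ℓ (n + 1)) := by
            exact mul_le_mul_of_nonneg_right (hN n (by omega)).le (by positivity)
        _ = _ := by field_simp
    have h2 : ∑ j ∈ range (n + 1 - n / 2), β (n - j + 1) * a j
        ≤ K₁ * K₂ * S * ℓ (n + 1) := by
      calc ∑ j ∈ range (n + 1 - n / 2), β (n - j + 1) * a j
          ≤ ∑ j ∈ range (n + 1 - n / 2), (K₁ * (K₂ * ℓ (n + 1))) * a j := by
            refine sum_le_sum fun j hj => ?_
            have hj := mem_range.1 hj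
            refine mul_le_mul_of_nonneg_right ((hb _).trans ?_) (h.nonneg _)
            gcongr
            exact hc _ _ (by omega)
        _ = (K₁ * (K₂ * ℓ (n + 1))) * ∑ j ∈ range (n + 1 - n / 2), a j := by
            rw [mul_sum]
        _ ≤ (K₁ * (K₂ * ℓ (n + 1))) * S := by
            gcongr; exact hsum.sum_le_tsum _ fun _ _ => h.nonneg _
        _ = _ := by ring
    have h3 : K₁ * K₂ * S ≤ T / 2 := by
      have : 0 ≤ ∑ j ∈ range (N + 2), a j / (ℓ j / j) := sum_nonneg fun j _ => hT0 j
      simp only [T]; linarith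
    have h4 : ((n : ℝ) + 1) * a (n + 1) ≤ T * ℓ (n + 1) := by
      rw [hrec]
      nlinarith
    push_cast
    rw [← mul_div_assoc, le_div_iff₀ hn1]
    linarith

lemma SpitzerSeq.tendsto {a β ℓ : ℕ → ℝ} (h : SpitzerSeq a β) (hℓ : RegSeq ℓ)
    (hb : ∃ K, ∀ k, β k ≤ K * ℓ k) {C : ℝ}
    (hC : Tendsto (fun k => β k / ℓ k) atTop (𝓝 C)) :
    Tendsto (fun n : ℕ => a n / (ℓ n / n)) atTop (𝓝 (C * ∑' n, a n)) := by
  have hsum := h.summable hℓ hb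
  obtain ⟨T, hT, hle⟩ := h.le hℓ hb
  obtain ⟨K₀, hK₀⟩ := hb
  obtain ⟨K₁, hK₁, hb⟩ : ∃ K, 0 < K ∧ ∀ k, β k ≤ K * ℓ k :=
    ⟨max K₀ 1, by positivity, fun k => (hK₀ k).trans
      (mul_le_mul_of_nonneg_right (le_max_left _ _) (hℓ.pos k).le)⟩
  obtain ⟨K₂, hK₂, hc⟩ := hℓ.comp_pow 2
  obtain ⟨K₃, hK₃, hd⟩ := hℓ.div_comp 2
  rw [← tendsto_add_atTop_iff_nat 1]
  have e : ∀ n : ℕ, a (n + 1) / (ℓ (n + 1) / (n + 1 : ℕ)) =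
      (∑ k ∈ range (n / 2), β (k + 1) * a (n - k)) / ℓ (n + 1)
      + ∑' j, if j < n + 1 - n / 2 then β (n - j + 1) / ℓ (n + 1) * a j else 0 := by
    intro n
    have hrec := h.recurrence n
    rw [sum_range_split (fun k j => β (k + 1) * a j) n] at hrec
    rw [tsum_eq_sum (s := range (n + 1 - n / 2)) (by
      intro j hj; rw [if_neg (by simpa using hj)])]
    rw [sum_congr rfl fun j hj => if_pos (mem_range.1 hj)]
    have hl := hℓ.pos (n + 1)
    rw [div_div_eq_mul_div, mul_comm]
    push_cast
    rw [hrec, add_div, Finset.sum_div]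
    congr 2
    simp_rw [Finset.sum_div]
    grind
  simp_rw [e]
  rw [← zero_add (C * _)]
  refine Tendsto.add ?_ ?_
  · have h0 := (hℓ.cesaro.mul_const (K₁ * T * K₃))
    rw [zero_mul] at h0
    refine squeeze_zero' (.of_forall fun n => div_nonneg (sum_nonneg fun k _ =>
      mul_nonneg (h.nonneg' _) (h.nonneg _)) (hℓ.pos _).le) ?_ h0
    filter_upwards with n
    have hl := hℓ.pos (n + 1)
    have hn1 : (0 : ℝ) < n + 1 := by positivity
    rw [div_le_iff₀ hl]
    calc ∑ k ∈ range (n / 2), β (k + 1) * a (n - k)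
        ≤ ∑ k ∈ range (n / 2), (K₁ * ℓ (k + 1)) * (T * (K₃ * (ℓ (n + 1) / (n + 1)))) := by
          refine sum_le_sum fun k hk => ?_
          have hk := mem_range.1 hk
          have h2 := hle (n - k) (by omega)
          have h3 := hd (n - k) (n + 1) (by omega) (by omega)
          have := hℓ.pos (k + 1)
          push_cast at h3
          refine mul_le_mul (hb _) (h2.trans (by gcongr)) (h.nonneg _) (by positivity)
      _ = (∑ k ∈ range (n / 2), ℓ (k + 1)) *
            (K₁ * (T * (K₃ * (ℓ (n + 1) / (n + 1))))) := by
          rw [sum_mul]; exact sum_congr rfl fun k _ => by ring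
      _ ≤ (∑ k ∈ range n, ℓ (k + 1)) *
            (K₁ * (T * (K₃ * (ℓ (n + 1) / (n + 1))))) := by
          refine mul_le_mul_of_nonneg_right ?_ (by positivity)
          exact sum_le_sum_of_subset_of_nonneg (Finset.range_mono (by omega))
            fun _ _ _ => (hℓ.pos _).le
      _ = _ := by field_simp
  · rw [← tsum_mul_left]
    refine tendsto_tsum_of_dominated_convergence (bound := fun j => K₁ * K₂ * a j)
      (hsum.mul_left _) ?_ ?_
    · intro j
      have h1 : Tendsto (fun n => β (n - j + 1) / ℓ (n - j + 1)) atTop (𝓝 C) :=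
        hC.comp ((tendsto_add_atTop_nat 1).comp (tendsto_sub_atTop_nat j))
      have h2 := ((hℓ.tendsto_ratio_sub j).comp (tendsto_add_atTop_nat 1))
      have h3 := (h1.mul h2).mul_const (a j)
      rw [mul_one] at h3
      refine h3.congr' ?_
      filter_upwards [eventually_ge_atTop (2 * j + 2)] with n hn
      rw [if_pos (by omega)]
      simp only [Function.comp]
      rw [show n + 1 - j = n - j + 1 by omega]
      have := (hℓ.pos (n - j + 1)).ne'
      field_simp
    · filter_upwards with n j
      split_ifs with hj
      · have hl := hℓ.pos (n + 1)
        rw [norm_of_nonneg (mul_nonneg (div_nonneg (h.nonneg' _) hl.le) (h.nonneg _))]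
        refine mul_le_mul_of_nonneg_right ?_ (h.nonneg _)
        rw [div_le_iff₀ hl, mul_assoc]
        refine (hb _).trans ?_
        gcongr
        exact hc _ _ (by omega)
      · rw [norm_zero]
        have := h.nonneg j
        positivity

/-- The law of the difference of two independent variables with law `F`. -/
def symLaw (F : Measure ℝ) : Measure ℝ := F.conv (F.map fun x => -x)

instance (F : Measure ℝ) [IsProbabilityMeasure F] : IsProbabilityMeasure (symLaw F) := by
  have : IsProbabilityMeasure (F.map fun x => -x) :=
    isProbabilityMeasure_map measurable_neg.aemeasurable
  unfold symLaw; infer_instance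

lemma charFun_symLaw (F : Measure ℝ) [IsProbabilityMeasure F] (t : ℝ) :
    charFun (symLaw F) t = ((‖charFun F t‖ ^ 2 : ℝ) : ℂ) := by
  have : IsProbabilityMeasure (F.map fun x => -x) :=
    isProbabilityMeasure_map measurable_neg.aemeasurable
  have h : charFun (F.map fun x => -x) t = charFun F (-t) := by
    have := charFun_map_mul (μ := F) (-1) t
    simpa using this
  rw [symLaw, charFun_conv, h, charFun_neg, Complex.mul_conj, Complex.normSq_eq_norm_sq]

lemma charFun_re (F : Measure ℝ) [IsProbabilityMeasure F] (t : ℝ) :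
    (charFun F t).re = ∫ x, cos (t * x) ∂F := by
  rw [charFun_apply_real, ← RCLike.re_eq_complex_re, ← integral_re (integrable_charFun_aux F t)]
  refine integral_congr_ae (.of_forall fun x => ?_)
  simp only [RCLike.re_eq_complex_re]
  rw [← Complex.ofReal_mul, Complex.exp_ofReal_mul_I_re]

lemma integrable_cos (F : Measure ℝ) [IsProbabilityMeasure F] (t : ℝ) :
    Integrable (fun x => cos (t * x)) F :=
  Integrable.of_bound (C := 1) (by fun_prop)
    (.of_forall fun x => by simpa using Real.abs_cos_le_one _)

lemma one_sub_norm_charFun_sq (F : Measure ℝ) [IsProbabilityMeasure F] (t : ℝ) :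
    1 - ‖charFun F t‖ ^ 2 = ∫ x, (1 - cos (t * x)) ∂symLaw F := by
  rw [integral_sub (integrable_const _) (integrable_cos _ t), ← charFun_re, charFun_symLaw,
    Complex.ofReal_re]
  simp

lemma abs_sin_nat_mul_le (k : ℕ) (x : ℝ) : |sin (k * x)| ≤ k * |sin x| := by
  induction k with
  | zero => simp
  | succ k ih =>
    push_cast
    rw [add_mul, one_mul, Real.sin_add]
    calc |sin (k * x) * cos x + cos (k * x) * sin x|
        ≤ |sin (k * x)| * |cos x| + |cos (k * x)| * |sin x| := by
          rw [← abs_mul, ← abs_mul]; exact abs_add_le _ _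
      _ ≤ |sin (k * x)| * 1 + 1 * |sin x| := by
          gcongr <;> exact Real.abs_cos_le_one _
      _ ≤ _ := by linarith

lemma one_sub_cos_nat_mul_le (k : ℕ) (x : ℝ) :
    1 - cos (k * x) ≤ k ^ 2 * (1 - cos x) := by
  have e : ∀ y : ℝ, 1 - cos y = 2 * |sin (y / 2)| ^ 2 := fun y => by
    rw [sq_abs, Real.sin_sq_eq_half_sub]
    grind
  rw [e, e, mul_div_assoc]
  have := abs_sin_nat_mul_le k (x / 2)
  have h0 := abs_nonneg (sin (k * (x / 2)))
  nlinarith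

lemma one_sub_norm_charFun_nat_mul (F : Measure ℝ) [IsProbabilityMeasure F] (k : ℕ) (t : ℝ) :
    1 - ‖charFun F (k * t)‖ ^ 2 ≤ k ^ 2 * (1 - ‖charFun F t‖ ^ 2) := by
  rw [one_sub_norm_charFun_sq, one_sub_norm_charFun_sq, ← integral_const_mul]
  refine integral_mono ((integrable_const _).sub (integrable_cos _ _))
    (((integrable_const _).sub (integrable_cos _ _)).const_mul _) fun x => ?_
  simp only [mul_assoc]
  exact one_sub_cos_nat_mul_le k (t * x)

lemma exists_of_norm_charFun_eq_one (F : Measure ℝ) [IsProbabilityMeasure F] {t : ℝ}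
    (h : ‖charFun F t‖ = 1) : ∃ y, ∀ᵐ x ∂F, ∃ k : ℤ, t * (x - y) = k * (2 * π) := by
  have h1 := one_sub_norm_charFun_sq F t
  rw [h, one_pow, sub_self] at h1
  have h2 := (integral_eq_zero_iff_of_nonneg (μ := symLaw F)
    (fun x => by simpa using Real.cos_le_one _)
    ((integrable_const _).sub (integrable_cos _ _))).1 h1.symm
  have h3 : ∀ᵐ x ∂symLaw F, cos (t * x) = 1 := by
    filter_upwards [h2] with x hx
    simp only [Pi.zero_apply, Pi.sub_apply] at hx
    linarith
  have : IsProbabilityMeasure (F.map fun x => -x) :=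
    isProbabilityMeasure_map measurable_neg.aemeasurable
  have hm : MeasurableSet {x : ℝ | cos (t * x) = 1} :=
    measurableSet_eq_fun (by fun_prop) measurable_const
  rw [symLaw, Measure.conv, ae_map_iff measurable_add.aemeasurable hm] at h3
  have h4 := Measure.ae_ae_of_ae_prod h3
  have h5 : ∀ᵐ x ∂F, ∀ᵐ y ∂F, cos (t * (x - y)) = 1 := by
    filter_upwards [h4] with x hx
    have := (ae_of_ae_map measurable_neg.aemeasurable hx)
    omega
  obtain ⟨y, hy⟩ := h5.exists
  refine ⟨y, ?_⟩
  filter_upwards [hy] with x hx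
  have : cos (t * (x - y)) = 1 := by
    rw [← hx, ← Real.cos_neg]; congr 1; ring
  obtain ⟨k, hk⟩ := (Real.cos_eq_one_iff _).1 this
  exact ⟨k, hk.symm⟩

lemma NonLattice.norm_charFun_lt {F : Measure ℝ} [IsProbabilityMeasure F] (hF : NonLattice F)
    {t : ℝ} (ht : t ≠ 0) : ‖charFun F t‖ < 1 := by
  refine lt_of_le_of_ne (norm_charFun_le_one t) fun h => hF ?_
  obtain ⟨y, hy⟩ := exists_of_norm_charFun_eq_one F h
  refine ⟨y, 2 * π / t, ?_⟩
  have e : {x | ∃ k : ℤ, x = y + k * (2 * π / t)} =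
      {x | ∃ k : ℤ, t * (x - y) = k * (2 * π)} := by grind
  rw [e]
  have := prob_compl_eq_zero_iff₀ (μ := F) (s := {x | ∃ k : ℤ, t * (x - y) = k * (2 * π)})
  refine (this ?_).1 ?_
  · have : {x : ℝ | ∃ k : ℤ, t * (x - y) = k * (2 * π)} =
        ⋃ k : ℤ, {x : ℝ | t * (x - y) = k * (2 * π)} := by ext; simp
    rw [this]
    exact (MeasurableSet.iUnion fun k =>
      measurableSet_eq_fun (by fun_prop) measurable_const).nullMeasurableSet
  · exact hy

lemma exists_norm_charFun_lt_one (F : Measure ℝ) [IsProbabilityMeasure F]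
    (h0 : 0 < F (Iio 0)) (h1 : 0 < F (Ioi 0)) :
    ∃ s₀ > 0, ∀ s, s ≠ 0 → |s| ≤ s₀ → ‖charFun F s‖ < 1 := by
  by_contra! hcon
  have hp : ∀ j : ℕ, (0 : ℝ) < 1 / (j + 1) := fun j => by positivity
  choose s hs0 hs hs1 using fun j : ℕ => hcon (1 / (j + 1)) (hp j)
  choose y hy using fun j => exists_of_norm_charFun_eq_one F
    (le_antisymm (norm_charFun_le_one _) (hs1 j))
  have hall := ae_all_iff.2 hy
  obtain ⟨a, ha, ha'⟩ : ∃ a ∈ Iio (0 : ℝ), ∀ j, ∃ k : ℤ, s j * (a - y j) = k * (2 * π) := by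
    by_contra! h
    exact h0.ne' (measure_eq_zero_iff_ae_notMem.2 (hall.mono fun x hx hx' => by
      obtain ⟨j, hj⟩ := h x hx'
      obtain ⟨k, hk⟩ := hx j
      exact hj k hk))
  obtain ⟨b, hb, hb'⟩ : ∃ a ∈ Ioi (0 : ℝ), ∀ j, ∃ k : ℤ, s j * (a - y j) = k * (2 * π) := by
    by_contra! h
    exact h1.ne' (measure_eq_zero_iff_ae_notMem.2 (hall.mono fun x hx hx' => by
      obtain ⟨j, hj⟩ := h x hx'
      obtain ⟨k, hk⟩ := hx j
      exact hj k hk))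
  have hab : 0 < b - a := sub_pos.2 (lt_trans ha hb)
  obtain ⟨j, hj⟩ := exists_nat_gt (b - a)
  obtain ⟨k, hk⟩ := ha' j
  obtain ⟨l, hl⟩ := hb' j
  have e : s j * (b - a) = ((l - k : ℤ) : ℝ) * (2 * π) := by grind
  have hlt : |s j * (b - a)| < 1 := by
    rw [abs_mul, abs_of_pos hab]
    calc |s j| * (b - a) ≤ 1 / (j + 1) * (b - a) := by gcongr; exact hs j
      _ < 1 := by rw [one_div, inv_mul_lt_iff₀ (by positivity)]; linarith
  have hne : l - k ≠ 0 := by grind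
  have h2 : (1 : ℝ) ≤ |((l - k : ℤ) : ℝ)| := by
    rw [← Int.cast_abs]; exact_mod_cast Int.one_le_abs hne
  rw [e, abs_mul, abs_of_pos Real.two_pi_pos] at hlt
  have := Real.pi_gt_three
  nlinarith

/-- Truncation inequality for the symmetrised law, transferred back to the law itself. -/
lemma exists_tail_le (F : Measure ℝ) [IsProbabilityMeasure F] :
    ∃ M : ℝ, 0 < M ∧ ∀ r q : ℝ, 0 < r → (∀ t, |t| ≤ 2 / r → 1 - ‖charFun F t‖ ^ 2 ≤ q) →
      F.real {x | r + M < |x|} ≤ 4 * q := by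
  obtain ⟨M, hM0, hM⟩ : ∃ M : ℝ, 0 < M ∧ 1 / 2 ≤ F.real {x | |x| ≤ M} := by
    have h1 : Tendsto (fun n : ℕ => F.real {x : ℝ | |x| ≤ n}) atTop (𝓝 1) := by
      have := tendsto_measure_iUnion_atTop (μ := F) (s := fun n : ℕ => {x : ℝ | |x| ≤ n})
        (fun m n hmn x (hx : |x| ≤ m) => hx.trans (by exact_mod_cast hmn))
      have h2 : ⋃ n : ℕ, {x : ℝ | |x| ≤ n} = univ :=
        eq_univ_of_forall fun x => mem_iUnion.2 (exists_nat_ge |x|)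
      rw [h2, measure_univ] at this
      exact (tendsto_toReal one_ne_top).comp this
    obtain ⟨n, hn1, hn⟩ := ((h1.eventually_const_le (show (1 / 2 : ℝ) < 1 by norm_num)).and
      (eventually_ge_atTop 1)).exists
    exact ⟨n, by exact_mod_cast hn, hn1⟩
  refine ⟨M, hM0, fun r q hr hq => ?_⟩
  have h1 := measureReal_abs_gt_le_integral_charFun (μ := symLaw F) hr
  have h2 : ‖∫ t in (-2 * r⁻¹)..(2 * r⁻¹), 1 - charFun (symLaw F) t‖ ≤
      q * |2 * r⁻¹ - (-2 * r⁻¹)| := by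
    refine intervalIntegral.norm_integral_le_of_norm_le_const fun t ht => ?_
    rw [uIoc_of_le (by nlinarith [inv_pos.2 hr])] at ht
    rw [charFun_symLaw, ← Complex.ofReal_one, ← Complex.ofReal_sub, Complex.norm_real,
      norm_of_nonneg]
    · grind
    · have := norm_charFun_le_one (μ := F) t
      simp_all
  have h3 : (symLaw F).real {x | r < |x|} ≤ 2 * q := by
    refine h1.trans ?_
    rw [show 2 * r⁻¹ - (-2 * r⁻¹) = 4 * r⁻¹ by ring, abs_of_pos (by positivity)] at h2
    calc 2⁻¹ * r * _ ≤ 2⁻¹ * r * (q * (4 * r⁻¹)) := by gcongr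
      _ = 2 * q := by field_simp; ring
  have h4 : F.real {x | r + M < |x|} * F.real {x | |x| ≤ M} ≤ (symLaw F).real {x | r < |x|} := by
    have hs : IsProbabilityMeasure (F.map fun x => -x) :=
      isProbabilityMeasure_map measurable_neg.aemeasurable
    have e : symLaw F = (F.prod F).map (fun p : ℝ × ℝ => p.1 - p.2) := by
      refine Measure.ext_of_lintegral _ fun f hf => ?_
      rw [symLaw, Measure.lintegral_conv hf, lintegral_map hf (by fun_prop),
        lintegral_prod _ (by fun_prop)]
      refine lintegral_congr fun x => ?_
      rw [lintegral_map (by fun_prop) measurable_neg]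
      simp [sub_eq_add_neg]
    rw [e, map_measureReal_apply (by fun_prop) (measurableSet_lt measurable_const (by fun_prop)),
      ← measureReal_prod_prod]
    refine measureReal_mono ?_
    rintro ⟨x, y⟩ ⟨hx, hy⟩
    simp only [mem_ofPred_eq, mem_preimage] at hx hy ⊢
    have := abs_sub_abs_le_abs_sub x y
    linarith
  have h5 : 0 ≤ F.real {x | r + M < |x|} := measureReal_nonneg
  nlinarith

lemma norm_exp_sub_exp_le (x s t : ℝ) :
    ‖Complex.exp (t * x * I) - Complex.exp (s * x * I)‖ ≤ |t - s| * |x| := by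
  have e : Complex.exp (t * x * I) - Complex.exp (s * x * I) =
      Complex.exp (s * x * I) * (Complex.exp (I * ((t - s) * x : ℝ)) - 1) := by
    rw [mul_sub, mul_one, ← Complex.exp_add]
    congr 2
    push_cast; ring
  rw [e, norm_mul, ← Complex.ofReal_mul, norm_exp_ofReal_mul_I, one_mul, ← abs_mul]
  simpa using Real.norm_exp_I_mul_ofReal_sub_one_le (x := (t - s) * x)

lemma norm_charFun_sub_le (μ : Measure ℝ) [IsProbabilityMeasure μ] {s t δ : ℝ}
    (h : |t - s| ≤ δ) : ‖charFun μ t - charFun μ s‖ ≤ ∫ x, min 2 (δ * |x|) ∂μ := by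
  have hδ : 0 ≤ δ := (abs_nonneg _).trans h
  rw [charFun_apply_real, charFun_apply_real, ← integral_sub (integrable_charFun_aux μ t)
    (integrable_charFun_aux μ s)]
  refine norm_integral_le_of_norm_le (Integrable.of_bound (C := 2) (by fun_prop)
    (.of_forall fun x => ?_)) (.of_forall fun x => le_min ?_ ?_)
  · rw [norm_of_nonneg (le_min (by norm_num) (by positivity))]
    exact min_le_left _ _
  · refine (norm_sub_le _ _).trans ?_
    rw [← Complex.ofReal_mul, ← Complex.ofReal_mul, norm_exp_ofReal_mul_I,
      norm_exp_ofReal_mul_I]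
    norm_num
  · exact (norm_exp_sub_exp_le x s t).trans (by gcongr)

/-- Weak convergence implies locally uniform convergence of characteristic functions. -/
lemma tendsto_charFun_prod {μ : ℕ → ProbabilityMeasure ℝ} {ν : ProbabilityMeasure ℝ}
    (h : Tendsto μ atTop (𝓝 ν)) (s : ℝ) :
    Tendsto (fun p : ℕ × ℝ => charFun (μ p.1 : Measure ℝ) p.2) (atTop ×ˢ 𝓝 s)
      (𝓝 (charFun (ν : Measure ℝ) s)) := by
  have hb : ∀ δ : ℝ, 0 ≤ δ → ∀ x : ℝ, ‖min 2 (δ * |x|)‖ ≤ 2 := fun δ hδ x => by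
    rw [norm_of_nonneg (le_min (by norm_num) (by positivity))]
    exact min_le_left _ _
  have h0 : Tendsto (fun n : ℕ => ∫ x, min 2 (1 / ((n : ℝ) + 1) * |x|) ∂(ν : Measure ℝ)) atTop
      (𝓝 0) := by
    rw [← integral_zero ℝ ℝ (μ := (ν : Measure ℝ))]
    refine tendsto_integral_of_dominated_convergence (fun _ => 2)
      (fun n => by fun_prop) (integrable_const _)
      (fun n => Eventually.of_forall (hb _ (by positivity)))
      (.of_forall fun x => ?_)
    have : Tendsto (fun n : ℕ => min 2 (1 / ((n : ℝ) + 1) * |x|)) atTop (𝓝 (min 2 (0 * |x|))) :=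
      tendsto_const_nhds.min (tendsto_one_div_add_atTop_nhds_zero_nat.mul_const _)
    simpa using this
  rw [Metric.tendsto_nhds]
  intro ε hε
  obtain ⟨k, hk⟩ := (h0.eventually_lt_const (show (0 : ℝ) < ε / 2 by positivity)).exists
  set δ : ℝ := 1 / ((k : ℝ) + 1) with hδ
  have hδ0 : 0 < δ := by positivity
  let g : BoundedContinuousFunction ℝ ℝ :=
    BoundedContinuousFunction.ofNormedAddCommGroup (fun x => min 2 (δ * |x|)) (by fun_prop) 2
      (hb δ hδ0.le)
  have hg := (ProbabilityMeasure.tendsto_iff_forall_integral_tendsto.1 h g).eventually_lt_const hk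
  have hs := (Metric.tendsto_nhds.1 (ProbabilityMeasure.tendsto_iff_tendsto_charFun.1 h s))
    (ε / 2) (by positivity)
  filter_upwards [(hg.and hs).prod_mk (Metric.closedBall_mem_nhds s hδ0)] with p ⟨⟨h1, h2⟩, h3⟩
  have h4 := norm_charFun_sub_le (μ p.1 : Measure ℝ) (s := s) (t := p.2) (δ := δ)
    (by simpa [dist_eq] using h3)
  calc dist (charFun (μ p.1 : Measure ℝ) p.2) (charFun (ν : Measure ℝ) s)
      ≤ dist (charFun (μ p.1 : Measure ℝ) p.2) (charFun (μ p.1 : Measure ℝ) s) + _ :=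
        dist_triangle _ (charFun (μ p.1 : Measure ℝ) s) _
    _ < ε / 2 + ε / 2 := by
        refine add_lt_add ?_ h2
        rw [dist_eq_norm]
        exact h4.trans_lt h1
    _ = ε := by ring

/-- The walk with non-lattice step distribution `F`, normalised by `c`, is attracted to `ν`. -/
structure Attracted (F ν : Measure ℝ) (c : ℕ → ℝ) : Prop where
  pos : ∀ n, 0 < c n
  lim : Tendsto c atTop atTop
  charFun_lim : ∀ s, Tendsto (fun p : ℕ × ℝ => charFun F (p.2 / c p.1) ^ p.1) (atTop ×ˢ 𝓝 s)
    (𝓝 (charFun ν s))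
  comp : ∃ K, 1 ≤ K ∧ ∀ m n, m ≤ 2 * n → c m ≤ K * c n
  nonlattice : NonLattice F
  neg_mass : 0 < ν (Iio 0)
  pos_mass : 0 < ν (Ioi 0)

lemma tendsto_charFun_norm {f : ℕ × ℝ → ℂ} {s : ℝ} {z : ℂ}
    (h : Tendsto f (atTop ×ˢ 𝓝 s) (𝓝 z)) {x y : ℝ} (hx : x < ‖z‖) (hy : ‖z‖ < y) :
    ∃ N : ℕ, ∃ δ > 0, ∀ n t, N ≤ n → |t - s| ≤ δ → x < ‖f (n, t)‖ ∧ ‖f (n, t)‖ < y := by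
  have h1 := (h.norm.eventually_const_lt hx).and (h.norm.eventually_lt_const hy)
  obtain ⟨p, hp, q, hq, hpq⟩ := eventually_prod_iff.1 h1
  obtain ⟨N, hN⟩ := eventually_atTop.1 hp
  obtain ⟨δ, hδ, hball⟩ := Metric.eventually_nhds_iff.1 hq
  exact ⟨N, δ / 2, by positivity, fun n t hn ht =>
    hpq (hN n hn) (hball (by rw [dist_eq]; linarith))⟩

lemma exists_comp {F ν : Measure ℝ} [IsProbabilityMeasure F] [IsProbabilityMeasure ν] {c : ℕ → ℝ}
    (hc : Tendsto c atTop atTop)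
    (hL : ∀ s, Tendsto (fun p : ℕ × ℝ => charFun F (p.2 / c p.1) ^ p.1) (atTop ×ˢ 𝓝 s)
      (𝓝 (charFun ν s)))
    (h0 : 0 < ν (Iio 0)) (h1 : 0 < ν (Ioi 0)) :
    ∃ (N : ℕ) (K : ℝ), 1 ≤ K ∧ (∀ n, N ≤ n → 0 < c n) ∧
      ∀ m n, N ≤ m → N ≤ n → m ≤ 2 * n → c m ≤ K * c n := by
  obtain ⟨s, hs, hs1⟩ := exists_norm_charFun_lt_one ν h0 h1
  have hs1 := hs1 s hs.ne' (abs_of_pos hs).le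
  obtain ⟨x, hx0, hx, hxp⟩ : ∃ x : ℝ, x < 1 ∧ ‖charFun ν s‖ < x ^ 2 ∧ 0 ≤ x := by
    have := norm_nonneg (charFun ν s)
    exact ⟨(1 + ‖charFun ν s‖) / 2, by linarith,
      by nlinarith [sq_pos_of_pos (sub_pos.2 hs1)], by positivity⟩
  obtain ⟨N₁, δ₁, hδ₁, hN₁⟩ := tendsto_charFun_norm (hL 0) (x := x) (y := 2)
    (by simpa using hx0) (by simp)
  obtain ⟨N₂, δ₂, hδ₂, hN₂⟩ := tendsto_charFun_norm (hL s) (x := -1) (y := x ^ 2)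
    (by linarith [norm_nonneg (charFun ν s)]) hx
  obtain ⟨N₃, hN₃⟩ := eventually_atTop.1 (hc.eventually_gt_atTop 0)
  refine ⟨max N₁ (max N₂ N₃), max 1 (s / δ₁), le_max_left _ _,
    fun n hn => hN₃ n (by simp at hn; omega), fun m n hm hn hmn => ?_⟩
  have cm := hN₃ m (by simp at hm; omega)
  have cn := hN₃ n (by simp at hn; omega)
  by_contra! hlt
  have h2 : s / δ₁ * c n < c m := lt_of_le_of_lt (by gcongr; exact le_max_right _ _) hlt
  have h3 : c n * s / c m < δ₁ := by
    rw [div_mul_eq_mul_div, div_lt_iff₀ hδ₁] at h2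
    rw [div_lt_iff₀ cm]; linarith
  have h4 := (hN₁ n (c n * s / c m) (by simp at hn; omega)
    (by rw [sub_zero, abs_of_pos (by positivity)]; exact h3.le)).1
  have h5 := (hN₂ m s (by simp at hm; omega) (by simpa using hδ₂.le)).2
  have e : c n * s / c m / c n = s / c m := by field_simp
  simp only [e] at h4
  rw [norm_pow] at h4 h5
  have h6 : x ^ 2 < ‖charFun F (s / c m)‖ ^ (2 * n) := by
    rw [mul_comm 2 n, pow_mul]
    exact pow_lt_pow_left₀ h4 hxp two_ne_zero
  have h7 := pow_le_pow_of_le_one (norm_nonneg (charFun F (s / c m))) (norm_charFun_le_one _) hmn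
  linarith

variable (ρ) in
lemma exists_attracted (hnl : NonLattice (ρ.map Prod.fst)) {ν : Measure ℝ}
    [IsProbabilityMeasure ν] {c : ℕ → ℝ} (hc : Tendsto c atTop atTop)
    (hw : WeakTendsto (fun n => (walkLaw ρ n).map fun x => x / c n) ν)
    (h0 : 0 < ν (Iio 0)) (h1 : 0 < ν (Ioi 0)) :
    ∃ c' : ℕ → ℝ, Attracted (ρ.map Prod.fst) ν c' := by
  have hF : IsProbabilityMeasure (ρ.map Prod.fst) :=
    isProbabilityMeasure_map measurable_fst.aemeasurable
  have hp : ∀ n, IsProbabilityMeasure ((walkLaw ρ n).map fun x => x / c n) := fun n =>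
    isProbabilityMeasure_map (by fun_prop)
  let μ : ℕ → ProbabilityMeasure ℝ := fun n => ⟨_, hp n⟩
  let ν' : ProbabilityMeasure ℝ := ⟨ν, inferInstance⟩
  have hlim : Tendsto μ atTop (𝓝 ν') :=
    ProbabilityMeasure.tendsto_iff_forall_integral_tendsto.2 hw
  have hL : ∀ s, Tendsto (fun p : ℕ × ℝ => charFun (ρ.map Prod.fst) (p.2 / c p.1) ^ p.1)
      (atTop ×ˢ 𝓝 s) (𝓝 (charFun ν s)) := fun s => by
    refine (tendsto_charFun_prod hlim s).congr fun p => ?_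
    rw [← charFun_walkLaw, div_eq_inv_mul, ← charFun_map_mul]
    simp only [μ, ProbabilityMeasure.coe_mk, div_eq_inv_mul]
  obtain ⟨N, K, hK, hpos, hcomp⟩ := exists_comp hc hL h0 h1
  have hev : ∀ᶠ n in atTop, c (max n N) = c n := by
    filter_upwards [eventually_ge_atTop N] with n hn
    rw [max_eq_left hn]
  refine ⟨fun n => c (max n N), ⟨fun n => hpos _ (le_max_right _ _), hc.congr' ?_, fun s => ?_,
    ⟨K, hK, fun m n hmn => hcomp _ _ (le_max_right _ _) (le_max_right _ _) (by omega)⟩,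
    hnl, h0, h1⟩⟩
  · exact hev.mono fun n h => h.symm
  · refine (hL s).congr' ?_
    filter_upwards [hev.prod_inl _] with p hp
    rw [hp]

lemma Attracted.comp_pow (h : Attracted F ν c) :
    ∃ K, 1 ≤ K ∧ ∀ j m n : ℕ, m ≤ 2 ^ j * n → c m ≤ K ^ (j + 1) * c n := by
  obtain ⟨K, hK, hc⟩ := h.comp
  refine ⟨K, hK, fun j => ?_⟩
  induction j with
  | zero => intro m n hmn; simpa using hc m n (by omega)
  | succ j ih =>
    intro m n hmn
    calc c m ≤ K ^ (j + 1) * c (2 * n) := ih m (2 * n) (by rw [pow_succ] at hmn; rwa [← mul_assoc])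
      _ ≤ K ^ (j + 1) * (K * c n) := by gcongr; exact hc _ _ le_rfl
      _ = K ^ (j + 1 + 1) * c n := by ring

/-- The norming constants grow at most polynomially. -/
lemma Attracted.potter_upper (h : Attracted F ν c) :
    ∃ (K : ℝ) (p : ℕ), 1 ≤ K ∧ ∀ m n q : ℕ, 1 ≤ q → n < (q + 1) * m →
      c n ≤ K * (q : ℝ) ^ p * c m := by
  obtain ⟨K, hK, hc⟩ := h.comp_pow
  obtain ⟨p, hp⟩ := pow_unbounded_of_one_lt K one_lt_two
  refine ⟨K * 2 ^ p, p, one_le_mul_of_one_le_of_one_le hK (one_le_pow₀ one_le_two),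
    fun m n q hq hn => ?_⟩
  have h1 : 2 ^ Nat.log 2 q ≤ q := Nat.pow_log_le_self 2 (by omega)
  have h2 : q < 2 ^ (Nat.log 2 q + 1) := Nat.lt_pow_succ_log_self (by norm_num) q
  have h3 := hc (Nat.log 2 q + 1) n m (hn.le.trans (Nat.mul_le_mul_right m (by omega)))
  have cm := h.pos m
  have h4 : (2 : ℝ) ^ Nat.log 2 q ≤ q := by exact_mod_cast h1
  calc c n ≤ K ^ (Nat.log 2 q + 1 + 1) * c m := h3
    _ = K * K ^ (Nat.log 2 q + 1) * c m := by ring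
    _ ≤ K * ((2 : ℝ) ^ p) ^ (Nat.log 2 q + 1) * c m := by gcongr
    _ = K * 2 ^ p * ((2 : ℝ) ^ Nat.log 2 q) ^ p * c m := by
        rw [pow_succ, ← pow_mul, ← pow_mul, mul_comm p]; ring
    _ ≤ _ := by gcongr

lemma Attracted.eventually_near_zero (h : Attracted F ν c) :
    ∃ Λ > 0, ∃ δ > 0, ∃ N : ℕ, ∀ n s, N ≤ n → |s| ≤ δ →
      1 - ‖charFun F (s / c n)‖ ^ 2 ≤ Λ / n := by
  obtain ⟨N, δ, hδ, hN⟩ := tendsto_charFun_norm (h.charFun_lim 0) (x := 1 / 2) (y := 2)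
    (by norm_num) (by norm_num)
  refine ⟨Real.log 4, Real.log_pos (by norm_num), δ, hδ, N + 1, fun n s hn hs => ?_⟩
  have h1 := (hN n s (by omega) (by simpa using hs)).1
  have hn0 : (0 : ℝ) < n := by exact_mod_cast (show 0 < n by omega)
  rw [norm_pow] at h1
  set q := 1 - ‖charFun F (s / c n)‖ ^ 2 with hq
  have h2 : (1 / 2 : ℝ) ^ 2 ≤ (1 - q) ^ n := by
    rw [hq, sub_sub_cancel, ← pow_mul, mul_comm, pow_mul]
    gcongr
  have h3 : (1 - q) ^ n ≤ exp (-(q * n)) := by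
    calc (1 - q) ^ n ≤ exp (-q) ^ n := by
          refine pow_le_pow_left₀ ?_ ?_ n
          · rw [hq, sub_sub_cancel]; positivity
          · have := Real.add_one_le_exp (-q); linarith
      _ = _ := by rw [← Real.exp_nat_mul]; congr 1; ring
  rw [le_div_iff₀ hn0, Real.le_log_iff_exp_le (by norm_num)]
  have h4 := h2.trans h3
  rw [exp_neg] at h4
  have h5 := exp_pos (q * n)
  rw [le_inv_comm₀ (by norm_num) h5] at h4
  linarith

/-- Lower Potter bound: the norming constants grow at least like a square root. -/
lemma Attracted.potter_lower (h : Attracted F ν c) :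
    ∃ K > 0, ∃ N : ℕ, ∀ m n, N ≤ m → m ≤ n → (n : ℝ) * c m ^ 2 ≤ K * (m * c n ^ 2) := by
  obtain ⟨Λ, hΛ, δ, hδ, N₁, hN₁⟩ := h.eventually_near_zero
  obtain ⟨K, hK, hc⟩ := h.comp
  obtain ⟨s₀, hs₀, hs₀'⟩ := exists_norm_charFun_lt_one ν h.neg_mass h.pos_mass
  set s := min s₀ δ with hs
  have hs0 : 0 < s := lt_min hs₀ hδ
  have hs1 := hs₀' s hs0.ne' (by rw [abs_of_pos hs0]; exact min_le_left _ _)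
  obtain ⟨y, hy0, hy1⟩ := exists_between hs1
  obtain ⟨N₂, δ₂, hδ₂, hN₂⟩ := tendsto_charFun_norm (h.charFun_lim s) (x := -1) (y := y)
    (by linarith [norm_nonneg (charFun ν s)]) hy0
  have hy : 0 ≤ y := (norm_nonneg _).trans hy0.le
  have hy2 : 0 < 1 - y ^ 2 := by nlinarith
  refine ⟨(1 + K) ^ 2 * Λ / (1 - y ^ 2), by positivity, max N₁ N₂ + 1, fun m n hm hmn => ?_⟩
  have hm0 : (0 : ℝ) < m := by exact_mod_cast (show 0 < m by omega)
  have hn0 : (0 : ℝ) < n := by exact_mod_cast (show 0 < n by omega)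
  have cm := h.pos m
  have cn := h.pos n
  set r := c n / c m with hr
  have hr0 : 0 < r := div_pos cn cm
  have hrK : 1 ≤ K * r := by
    rw [hr, ← mul_div_assoc, le_div_iff₀ cm, one_mul]; exact hc m n (by omega)
  set k := ⌈r⌉₊ with hk
  have hk0 : (0 : ℝ) < k := by exact_mod_cast Nat.ceil_pos.2 hr0
  have hrk : r ≤ k := Nat.le_ceil r
  have hk1 : (k : ℝ) ≤ (1 + K) * r := by
    have := (Nat.ceil_lt_add_one hr0.le).le
    linarith
  have h1 := (hN₂ m s (by omega) (by simpa using hδ₂.le)).2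
  rw [norm_pow] at h1
  have h2 : 1 - y ^ 2 ≤ m * (1 - ‖charFun F (s / c m)‖ ^ 2) := by
    have hb := one_add_mul_le_pow (a := -(1 - ‖charFun F (s / c m)‖ ^ 2)) (by
      have := sq_nonneg ‖charFun F (s / c m)‖; linarith) m
    rw [show 1 + -(1 - ‖charFun F (s / c m)‖ ^ 2) = ‖charFun F (s / c m)‖ ^ 2 by ring, ← pow_mul,
      mul_comm 2 m, pow_mul] at hb
    have : (‖charFun F (s / c m)‖ ^ m) ^ 2 ≤ y ^ 2 := by gcongr
    linarith
  have h3 := one_sub_norm_charFun_nat_mul F k (s * (r / k) / c n)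
  have e : (k : ℝ) * (s * (r / k) / c n) = s / c m := by rw [hr]; field_simp
  rw [e] at h3
  have h4 := hN₁ n (s * (r / k)) (by omega) (by
    rw [abs_of_pos (by positivity)]
    calc s * (r / k) ≤ s * 1 := by gcongr; exact (div_le_one hk0).2 hrk
      _ ≤ δ := by rw [mul_one]; exact min_le_right _ _)
  have h5 : 1 - y ^ 2 ≤ m * (((1 + K) * r) ^ 2 * (Λ / n)) := by
    refine h2.trans (mul_le_mul_of_nonneg_left (h3.trans ?_) hm0.le)
    exact mul_le_mul (pow_le_pow_left₀ hk0.le hk1 2) h4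
      (sub_nonneg.2 (pow_le_one₀ (norm_nonneg _) (norm_charFun_le_one _))) (by positivity)
  have e2 : m * (((1 + K) * r) ^ 2 * (Λ / n)) * (n * c m ^ 2) = (1 + K) ^ 2 * Λ * (m * c n ^ 2) := by
    rw [hr]; field_simp
  rw [div_mul_eq_mul_div, le_div_iff₀ hy2, ← e2, mul_comm]
  gcongr

lemma Attracted.uniform_lt_one (h : Attracted F ν c) {S : Set ℝ} (hS : IsCompact S)
    (hlt : ∀ s ∈ S, ‖charFun ν s‖ < 1) :
    ∃ r : ℝ, 0 ≤ r ∧ r < 1 ∧ ∃ N : ℕ, ∀ n s, N ≤ n → s ∈ S → ‖charFun F (s / c n)‖ ^ n ≤ r := by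
  refine hS.induction_on (p := fun S => ∃ r : ℝ, 0 ≤ r ∧ r < 1 ∧ ∃ N : ℕ, ∀ n s, N ≤ n → s ∈ S →
    ‖charFun F (s / c n)‖ ^ n ≤ r) ⟨0, le_rfl, one_pos, 0, by simp⟩ ?_ ?_ ?_
  · rintro S T hST ⟨r, h0, h1, N, hN⟩
    exact ⟨r, h0, h1, N, fun n s hn hs => hN n s hn (hST hs)⟩
  · rintro S T ⟨r, h0, h1, N, hN⟩ ⟨r', h0', h1', N', hN'⟩
    refine ⟨max r r', le_max_of_le_left h0, max_lt h1 h1', max N N', fun n s hn hs => ?_⟩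
    grind
  · intro s hs
    obtain ⟨y, hy0, hy1⟩ := exists_between (hlt s hs)
    obtain ⟨N, δ, hδ, hN⟩ := tendsto_charFun_norm (h.charFun_lim s) (x := -1) (y := y)
      (by linarith [norm_nonneg (charFun ν s)]) hy0
    refine ⟨Metric.closedBall s δ, mem_nhdsWithin_of_mem_nhds (Metric.closedBall_mem_nhds s hδ),
      y, (norm_nonneg _).trans hy0.le, hy1, N, fun n t hn ht => ?_⟩
    have := (hN n t hn (by simpa [dist_eq] using ht)).2
    rw [norm_pow] at this
    exact this.le

lemma norm_charFun_neg (t : ℝ) : ‖charFun F (-t)‖ = ‖charFun F t‖ := by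
  rw [charFun_neg, RCLike.norm_conj]

/-- Uniform quadratic decay of the normalised characteristic functions. -/
lemma Attracted.domination (h : Attracted F ν c) :
    ∃ D > 0, ∃ δ > 0, ∃ N : ℕ, ∀ n t, N ≤ n → |t| ≤ δ * c n →
      ‖charFun F (t / c n)‖ ^ n ≤ D * (1 + t ^ 2)⁻¹ := by
  obtain ⟨s₀, hs₀, hs₀'⟩ := exists_norm_charFun_lt_one ν h.neg_mass h.pos_mass
  obtain ⟨K, hK, hc⟩ := h.comp
  obtain ⟨K', p, hK', hpot⟩ := h.potter_upper
  have hK0 : 0 < K := by linarith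
  set s₁ := s₀ / K with hs₁
  have hs₁0 : 0 < s₁ := by positivity
  obtain ⟨r, hr0, hr1, N, hN⟩ := h.uniform_lt_one (S := Icc s₁ (K * s₁)) isCompact_Icc
    fun s hs => hs₀' s (hs₁0.trans_le hs.1).ne' (by
      rw [abs_of_pos (hs₁0.trans_le hs.1)]
      refine hs.2.trans ?_
      rw [hs₁]; field_simp; exact le_rfl)
  obtain ⟨B, hB⟩ : ∃ B : ℝ, ∀ q : ℕ, (q : ℝ) ^ (2 * p) * r ^ q ≤ B := by
    obtain ⟨B, hB⟩ := (tendsto_pow_const_mul_const_pow_of_abs_lt_one (2 * p)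
      (by rwa [abs_of_nonneg hr0])).bddAbove_range
    exact ⟨B, fun q => hB ⟨q, rfl⟩⟩
  have hB0 : 0 ≤ B := le_trans (by positivity) (hB 0)
  set N' := N + 1 with hN'
  set C := (K * s₁ * K') ^ 2 * B with hC
  have hC0 : 0 ≤ C := by positivity
  have cN := h.pos N'
  have main : ∀ n t, N' ≤ n → s₁ ≤ t → t ≤ s₁ / (2 * c N') * c n →
      ‖charFun F (t / c n)‖ ^ n * t ^ 2 ≤ C := by
    intro n t hn ht1 ht2
    have cn := h.pos n
    have ht0 : 0 < t := hs₁0.trans_le ht1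
    have hex : ∃ m, N' ≤ m ∧ s₁ ≤ c m * t / c n := ⟨n, hn, by rwa [mul_div_cancel_left₀ _ cn.ne']⟩
    classical
    set m := Nat.find hex with hm
    obtain ⟨hm1, hm2⟩ := Nat.find_spec hex
    rw [← hm] at hm1 hm2
    have hmn : m ≤ n := Nat.find_min' hex ⟨hn, by rwa [mul_div_cancel_left₀ _ cn.ne']⟩
    have hmN : N' < m := by
      refine lt_of_le_of_ne hm1 fun hEq => ?_
      rw [← hEq, le_div_iff₀ cn] at hm2
      have : c N' * t ≤ s₁ / 2 * c n := by
        calc c N' * t ≤ c N' * (s₁ / (2 * c N') * c n) := by gcongr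
          _ = s₁ / 2 * c n := by field_simp
      nlinarith
    have hlt : c (m - 1) * t / c n < s₁ := by
      have := Nat.find_min hex (m := m - 1) (by omega)
      grind
    have cm := h.pos m
    have hup : c m * t / c n ≤ K * s₁ := by
      calc c m * t / c n ≤ (K * c (m - 1)) * t / c n := by gcongr; exact hc _ _ (by omega)
        _ = K * (c (m - 1) * t / c n) := by ring
        _ ≤ _ := by gcongr
    have h1 := hN m _ (by omega) ⟨hm2, hup⟩
    rw [show c m * t / c n / c m = t / c n by field_simp] at h1
    set q := n / m with hq
    have hm0 : 0 < m := by omega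
    have hq1 : 1 ≤ q := (Nat.one_le_div_iff hm0).2 hmn
    have hnq : n < (q + 1) * m := by
      rw [hq, add_mul, one_mul]; exact Nat.lt_div_mul_add hm0
    have h2 := hpot m n q hq1 hnq
    have h3 : ‖charFun F (t / c n)‖ ^ n ≤ r ^ q := by
      calc ‖charFun F (t / c n)‖ ^ n ≤ ‖charFun F (t / c n)‖ ^ (m * q) :=
            pow_le_pow_of_le_one (norm_nonneg _) (norm_charFun_le_one _) (Nat.mul_div_le n m)
        _ = (‖charFun F (t / c n)‖ ^ m) ^ q := pow_mul _ _ _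
        _ ≤ _ := pow_le_pow_left₀ (by positivity) h1 q
    have h4 : t ≤ K * s₁ * K' * (q : ℝ) ^ p := by
      calc t = c m * t / c n * (c n / c m) := by field_simp
        _ ≤ K * s₁ * (K' * (q : ℝ) ^ p) := by
            gcongr
            rwa [div_le_iff₀ cm]
        _ = _ := by ring
    calc ‖charFun F (t / c n)‖ ^ n * t ^ 2 ≤ r ^ q * (K * s₁ * K' * (q : ℝ) ^ p) ^ 2 := by gcongr
      _ = (K * s₁ * K') ^ 2 * ((q : ℝ) ^ (2 * p) * r ^ q) := by rw [mul_pow, ← pow_mul]; ring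
      _ ≤ _ := mul_le_mul_of_nonneg_left (hB q) (by positivity)
  refine ⟨1 + s₁ ^ 2 + (1 + C / s₁ ^ 2) + C, by positivity, s₁ / (2 * c N'), by positivity, N',
    fun n t hn ht => ?_⟩
  rw [← div_eq_mul_inv, le_div_iff₀ (by positivity)]
  have hle1 : ‖charFun F (t / c n)‖ ^ n ≤ 1 := pow_le_one₀ (norm_nonneg _) (norm_charFun_le_one _)
  have habs : ‖charFun F (t / c n)‖ = ‖charFun F (|t| / c n)‖ := by
    rcases abs_choice t with h | h <;> rw [h]
    rw [neg_div, norm_charFun_neg]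
  have hC1 : 0 ≤ C / s₁ ^ 2 := by positivity
  have hp0 : 0 ≤ ‖charFun F (t / c n)‖ ^ n := by positivity
  rcases le_total s₁ |t| with h1 | h1
  · have h2 := main n |t| hn h1 ht
    rw [← habs, sq_abs] at h2
    nlinarith [sq_nonneg s₁]
  · have h2 : t ^ 2 ≤ s₁ ^ 2 := by rw [← sq_abs]; gcongr
    nlinarith [sq_nonneg t]

lemma eq_one_of_charFun_scale {r : ℝ} (hr : 0 < r) (hneg : 0 < ν (Iio 0)) (hpos : 0 < ν (Ioi 0))
    (h : ∀ s, charFun ν s = charFun ν (s / r)) : r = 1 := by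
  obtain ⟨s₀, hs₀, hs₀'⟩ := exists_norm_charFun_lt_one ν hneg hpos
  have key : ∀ q : ℝ, 0 < q → q < 1 → (∀ s, charFun ν s = charFun ν (s * q)) → False := by
    intro q hq0 hq1 hq
    have h1 : ∀ k : ℕ, charFun ν s₀ = charFun ν (s₀ * q ^ k) := by
      intro k
      induction k with
      | zero => simp
      | succ k ih => rw [ih, hq, pow_succ, mul_assoc]
    have h2 : Tendsto (fun k : ℕ => charFun ν (s₀ * q ^ k)) atTop (𝓝 (charFun ν (s₀ * 0))) :=
      (continuous_charFun.tendsto _).comp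
        ((tendsto_pow_atTop_nhds_zero_of_lt_one hq0.le hq1).const_mul s₀)
    have h3 := tendsto_nhds_unique h2 (tendsto_const_nhds.congr h1)
    have h4 := hs₀' s₀ hs₀.ne' (abs_of_pos hs₀).le
    rw [← h3] at h4
    simp at h4
  rcases lt_trichotomy r 1 with h1 | h1 | h1
  · grind
  · exact h1
  · refine (key r⁻¹ (by positivity) (inv_lt_one_of_one_lt₀ h1) fun s => ?_).elim
    rw [h s, div_eq_mul_inv]

lemma Attracted.charFun_lim_comp (h : Attracted F ν c) {ι : Type*} {l : Filter ι} {m : ι → ℕ}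
    {t : ι → ℝ} {s : ℝ} (hm : Tendsto m l atTop) (ht : Tendsto t l (𝓝 s)) :
    Tendsto (fun k => charFun F (t k / c (m k)) ^ m k) l (𝓝 (charFun ν s)) := by
  have h1 := (h.charFun_lim s).comp (hm.prodMk ht)
  simp only [Function.comp_def] at h1
  exact h1

lemma Attracted.tendsto_ratio (h : Attracted F ν c) :
    Tendsto (fun n => c (n + 1) / c n) atTop (𝓝 1) := by
  obtain ⟨K, hK, hc⟩ := h.comp
  have hK0 : 0 < K := by linarith
  have hmem : ∀ n, c (n + 1 + 1) / c (n + 1) ∈ Icc K⁻¹ K := fun n => by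
    have h1 := h.pos (n + 1)
    refine ⟨?_, (div_le_iff₀ h1).2 (hc _ _ (by omega))⟩
    rw [le_div_iff₀ h1, inv_mul_le_iff₀ hK0]
    exact hc _ _ (by omega)
  rw [← tendsto_add_atTop_iff_nat 1]
  refine tendsto_of_subseq_tendsto fun ns hns => ?_
  obtain ⟨r, hr, φ, hφ, hlim⟩ := isCompact_Icc.tendsto_subseq (fun n => hmem (ns n))
  refine ⟨φ, ?_⟩
  have hr0 : 0 < r := lt_of_lt_of_le (by positivity) hr.1
  have hms : Tendsto (fun k => ns (φ k) + 1) atTop atTop :=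
    (tendsto_add_atTop_nat 1).comp (hns.comp hφ.tendsto_atTop)
  change Tendsto (fun k => c (ns (φ k) + 1 + 1) / c (ns (φ k) + 1)) atTop (𝓝 r) at hlim
  change Tendsto (fun k => c (ns (φ k) + 1 + 1) / c (ns (φ k) + 1)) atTop (𝓝 1)
  generalize hM : (fun k => ns (φ k) + 1) = M at hms
  replace hM : ∀ k, ns (φ k) + 1 = M k := fun k => congrFun hM k
  simp only [hM] at hlim ⊢
  clear hM hφ hns
  suffices hr1 : r = 1 by rwa [hr1] at hlim
  refine eq_one_of_charFun_scale hr0 h.neg_mass h.pos_mass fun s => ?_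
  have hM1 : Tendsto (fun k => M k + 1) atTop atTop := (tendsto_add_atTop_nat 1).comp hms
  have e1 := h.charFun_lim_comp hM1 (tendsto_const_nhds (x := s))
  have e2 := h.charFun_lim_comp hms ((tendsto_const_nhds (x := s)).div hlim hr0.ne')
  have e3 : Tendsto (fun k => charFun F (s / c (M k + 1))) atTop (𝓝 1) := by
    have h0 := (continuous_charFun (μ := F)).tendsto 0
    rw [charFun_zero, probReal_univ, Complex.ofReal_one] at h0
    exact h0.comp ((tendsto_const_nhds (x := s)).div_atTop (h.lim.comp hM1))
  refine tendsto_nhds_unique e1 ?_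
  have e4 := e2.mul e3
  rw [mul_one] at e4
  refine e4.congr fun k => ?_
  simp only [Pi.div_apply]
  have h1 := h.pos (M k)
  grind

lemma Attracted.regSeq (h : Attracted F ν c) : RegSeq fun n => (c n)⁻¹ := by
  obtain ⟨K, hK, hc⟩ := h.comp
  obtain ⟨K', hK', N, hN⟩ := h.potter_lower
  refine ⟨fun n => inv_pos.2 (h.pos n), ⟨K, by linarith, fun m n hmn => ?_⟩, ?_,
    tendsto_inv_atTop_zero.comp h.lim, ?_⟩
  · have h1 := h.pos m
    have h2 := h.pos n
    rw [inv_le_iff_one_le_mul₀ h1, mul_assoc, inv_mul_eq_div, ← mul_div_assoc, le_div_iff₀ h2,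
      one_mul]
    exact hc _ _ hmn
  · have := h.tendsto_ratio.inv₀ one_ne_zero
    grind
  · set M := N + 1 with hM
    have hM0 : (0 : ℝ) < M := by positivity
    have cM := h.pos M
    have hs : Summable fun n : ℕ => sqrt (K' * M / c M ^ 2) * (1 / (n : ℝ) ^ (3 / 2 : ℝ)) :=
      (Real.summable_one_div_nat_rpow.2 (by norm_num)).mul_left _
    refine hs.of_norm_bounded_eventually_nat ?_
    filter_upwards [eventually_ge_atTop M] with n hn
    have hn0 : (0 : ℝ) < n := by exact_mod_cast (show 0 < n by omega)
    have cn := h.pos n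
    have h1 := hN M n (by omega) hn
    rw [norm_of_nonneg (by positivity)]
    have h2 : (c n)⁻¹ ≤ sqrt (K' * M / c M ^ 2) / sqrt n := by
      rw [← Real.sqrt_div (by positivity)]
      refine Real.le_sqrt_of_sq_le ?_
      rw [inv_pow, div_div, inv_eq_one_div, div_le_div_iff₀ (by positivity) (by positivity)]
      linarith
    have h3 : (n : ℝ) ^ (3 / 2 : ℝ) = sqrt n * n := by
      rw [Real.sqrt_eq_rpow, ← Real.rpow_add_one hn0.ne']; norm_num
    calc (c n)⁻¹ / n ≤ sqrt (K' * M / c M ^ 2) / sqrt n / n := by gcongr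
      _ = _ := by rw [h3]; field_simp

lemma Attracted.tendsto_charFun (h : Attracted F ν c) (s : ℝ) :
    Tendsto (fun n => charFun F (s / c n) ^ n) atTop (𝓝 (charFun ν s)) :=
  h.charFun_lim_comp tendsto_id tendsto_const_nhds

lemma Attracted.tendsto_sq_mul_pow (h : Attracted F ν c) {r : ℝ} (h0 : 0 ≤ r) (h1 : r < 1) :
    Tendsto (fun n => c n ^ 2 * r ^ n) atTop (𝓝 0) := by
  obtain ⟨K, p, hK, hp⟩ := h.potter_upper
  have c1 := h.pos 1
  have := (tendsto_pow_const_mul_const_pow_of_abs_lt_one (p * 2)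
    (by rwa [abs_of_nonneg h0])).const_mul ((K * c 1) ^ 2)
  rw [mul_zero] at this
  refine squeeze_zero' (.of_forall fun n => by positivity) ?_ this
  filter_upwards [eventually_ge_atTop 1] with n hn
  have := (h.pos n).le
  calc c n ^ 2 * r ^ n ≤ (K * n ^ p * c 1) ^ 2 * r ^ n := by gcongr; exact hp 1 n n hn (by omega)
    _ = _ := by ring

/-- Convergence of the Fourier inversion integrals in the local limit theorem. -/
lemma Attracted.tendsto_integral (h : Attracted F ν c) {g : ℝ → ℂ}
    (hg : Measurable g) {G T : ℝ} (hG : ∀ t, ‖g t‖ ≤ G) (hT : ∀ t, T < |t| → g t = 0)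
    (hg0 : ContinuousAt g 0) :
    Integrable (charFun ν) ∧
    Tendsto (fun n => ∫ s, ‖g (s / c n) * charFun F (s / c n) ^ n - g 0 * charFun ν s‖) atTop
      (𝓝 0) := by
  obtain ⟨D, hD, δ, hδ, N, hN⟩ := h.domination
  have hG0 : 0 ≤ G := (norm_nonneg _).trans (hG 0)
  have hψ : ∀ s, ‖charFun ν s‖ ≤ D * (1 + s ^ 2)⁻¹ := by
    intro s
    refine le_of_tendsto (h.tendsto_charFun s).norm ?_
    filter_upwards [eventually_ge_atTop N, h.lim.eventually_ge_atTop (|s| / δ)] with n hn hn'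
    rw [norm_pow]
    exact hN n s hn ((div_le_iff₀' hδ).1 hn')
  have hint : Integrable (charFun ν) := by
    refine (integrable_inv_one_add_sq.const_mul D).mono'
      continuous_charFun.aestronglyMeasurable (.of_forall hψ)
  refine ⟨hint, ?_⟩
  obtain ⟨r, hr0, hr1, hr⟩ : ∃ r : ℝ, 0 ≤ r ∧ r < 1 ∧
      ∀ t, δ ≤ |t| → |t| ≤ T → ‖charFun F t‖ ≤ r := by
    have hK : IsCompact {t : ℝ | δ ≤ |t| ∧ |t| ≤ T} := by
      refine (isCompact_Icc (a := -T) (b := T)).of_isClosed_subset ?_ fun t ht => abs_le.1 ht.2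
      exact (isClosed_le continuous_const continuous_abs).inter
        (isClosed_le continuous_abs continuous_const)
    rcases {t : ℝ | δ ≤ |t| ∧ |t| ≤ T}.eq_empty_or_nonempty with he | he
    · refine ⟨0, le_rfl, one_pos, fun t h1 h2 => ?_⟩
      have : t ∈ {t : ℝ | δ ≤ |t| ∧ |t| ≤ T} := ⟨h1, h2⟩
      rw [he] at this
      exact this.elim
    · obtain ⟨t₀, ht₀, hmax⟩ := hK.exists_isMaxOn he
        (continuous_charFun (μ := F)).norm.continuousOn
      refine ⟨_, norm_nonneg _, h.nonlattice.norm_charFun_lt ?_, fun t h1 h2 => hmax ⟨h1, h2⟩⟩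
      grind
  have hb : ∀ᶠ n in atTop, ∀ s, ‖g (s / c n) * charFun F (s / c n) ^ n‖ ≤
      G * ((D + (1 + T ^ 2)) * (1 + s ^ 2)⁻¹) := by
    filter_upwards [eventually_ge_atTop N,
      (h.tendsto_sq_mul_pow hr0 hr1).eventually_le_const one_pos] with n hn hn' s
    have cn := h.pos n
    rcases lt_or_ge T |s / c n| with hs2 | hs2
    · rw [hT _ hs2, zero_mul, norm_zero]; positivity
    rw [norm_mul, norm_pow, add_mul]
    refine mul_le_mul (hG _) ?_ (by positivity) hG0
    rcases le_or_gt |s| (δ * c n) with hs | hs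
    · exact (hN n s hn hs).trans (le_add_of_nonneg_right (by positivity))
    refine le_add_of_nonneg_of_le (by positivity) ?_
    have h1 : ‖charFun F (s / c n)‖ ^ n ≤ r ^ n := pow_le_pow_left₀ (norm_nonneg _)
      (hr _ (by rw [abs_div, abs_of_pos cn, le_div_iff₀ cn]; exact hs.le) hs2) n
    have h2 : |s| ≤ T * c n := by rwa [abs_div, abs_of_pos cn, div_le_iff₀ cn] at hs2
    rw [← div_eq_mul_inv, le_div_iff₀ (by positivity), ← sq_abs s]
    calc _ ≤ r ^ n * (1 + (T * c n) ^ 2) := by gcongr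
      _ = r ^ n + T ^ 2 * (c n ^ 2 * r ^ n) := by ring
      _ ≤ 1 + T ^ 2 * 1 := by gcongr; exact pow_le_one₀ hr0 hr1.le
      _ = _ := by ring
  have hmeas : ∀ n, Measurable fun s => g (s / c n) * charFun F (s / c n) ^ n := fun n =>
    (hg.comp (measurable_id.div_const _)).mul
      ((measurable_charFun.comp (measurable_id.div_const _)).pow_const n)
  rw [show (0 : ℝ) = ∫ s : ℝ, (0 : ℝ) by simp]
  refine tendsto_integral_filter_of_dominated_convergence (fun s =>
    G * ((D + (1 + T ^ 2)) * (1 + s ^ 2)⁻¹) + G * (D * (1 + s ^ 2)⁻¹)) (.of_forall fun n =>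
      ((hmeas n).sub (measurable_const.mul measurable_charFun)).norm.aestronglyMeasurable) ?_
    (((integrable_inv_one_add_sq.const_mul _).const_mul _).add
      ((integrable_inv_one_add_sq.const_mul D).const_mul _)) (.of_forall fun s => ?_)
  · filter_upwards [hb] with n hn
    refine .of_forall fun s => ?_
    rw [norm_norm]
    refine (norm_sub_le _ _).trans (add_le_add (hn s) ?_)
    rw [norm_mul]
    exact mul_le_mul (hG _) (hψ s) (by positivity) hG0
  · simpa using (((hg0.tendsto.comp ((tendsto_const_nhds (x := s)).div_atTop h.lim)).mul
      (h.tendsto_charFun s)).sub_const (g 0 * charFun ν s)).norm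

/-- The triangular function. -/
def tri (t : ℝ) : ℝ := max 0 (1 - |t|)

/-- The Fourier transform of the triangular function. -/
def fejer (x : ℝ) : ℝ := if x = 0 then 1 else 2 * (1 - cos x) / x ^ 2

/-- The integrand defining the transform of a strictly positive kernel. -/
def kerHat (t : ℝ) : ℂ := tri t * (1 + Complex.exp (-(t * π * I)))

/-- A strictly positive kernel with compactly supported Fourier transform. -/
def kern (x : ℝ) : ℝ := fejer x + fejer (x - π)

lemma continuous_tri : Continuous tri := by unfold tri; fun_prop

lemma tri_nonneg (t : ℝ) : 0 ≤ tri t := le_max_left _ _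

lemma tri_le_one (t : ℝ) : tri t ≤ 1 := max_le zero_le_one (by linarith [abs_nonneg t])

lemma tri_zero : tri 0 = 1 := by simp [tri]

lemma tri_of_one_lt {t : ℝ} (h : 1 < |t|) : tri t = 0 := max_eq_left (by linarith)

lemma support_tri : Function.support tri ⊆ Ioc (-1) 1 := by
  intro t ht
  have : |t| < 1 := by
    by_contra! h
    exact ht (max_eq_left (by linarith))
  grind

lemma integrable_tri : Integrable tri :=
  continuous_tri.integrable_of_hasCompactSupport
    (HasCompactSupport.of_support_subset_isCompact isCompact_Icc
      (support_tri.trans Ioc_subset_Icc_self))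

lemma norm_exp_mul_mul_I (t x : ℝ) : ‖Complex.exp (t * x * I)‖ = 1 := by
  rw [← Complex.ofReal_mul, norm_exp_ofReal_mul_I]

lemma integrable_tri_mul_exp (x : ℝ) :
    Integrable fun t : ℝ => (tri t : ℂ) * Complex.exp (t * x * I) := by
  refine (integrable_tri.ofReal (𝕜 := ℂ)).mul_bdd (c := 1) (by fun_prop) ?_
  exact Eventually.of_forall fun t => (norm_exp_mul_mul_I t x).le

lemma integral_tri_mul_exp (x : ℝ) :
    ∫ t : ℝ, (tri t : ℂ) * Complex.exp (t * x * I) = fejer x := by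
  have hs : Function.support (fun t : ℝ => (tri t : ℂ) * Complex.exp (t * x * I)) ⊆
      Ioc (-1) 1 := by
    intro t ht
    refine support_tri fun h => ht ?_
    simp [h]
  rw [← intervalIntegral.integral_eq_integral_of_support_subset hs,
    ← intervalIntegral.integral_add_adjacent_intervals (b := 0)
      (integrable_tri_mul_exp x).intervalIntegrable (integrable_tri_mul_exp x).intervalIntegrable]
  have e1 : ∫ t in (-1 : ℝ)..0, (tri t : ℂ) * Complex.exp (t * x * I) =
      ∫ t in (-1 : ℝ)..0, (1 + (t : ℂ)) * Complex.exp (t * x * I) := by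
    refine intervalIntegral.integral_congr fun t ht => ?_
    rw [uIcc_of_le (by norm_num)] at ht
    have : tri t = 1 + t := by
      rw [tri, abs_of_nonpos ht.2, max_eq_right (by linarith [ht.1])]; ring
    simp [this]
  have e2 : ∫ t in (0 : ℝ)..1, (tri t : ℂ) * Complex.exp (t * x * I) =
      ∫ t in (0 : ℝ)..1, (1 - (t : ℂ)) * Complex.exp (t * x * I) := by
    refine intervalIntegral.integral_congr fun t ht => ?_
    rw [uIcc_of_le (by norm_num)] at ht
    have : tri t = 1 - t := by
      rw [tri, abs_of_nonneg ht.1, max_eq_right (by linarith [ht.2])]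
    simp [this]
  rw [e1, e2]
  by_cases hx : x = 0
  · subst hx
    have h1 : ∫ t in (-1 : ℝ)..0, (1 + (t : ℂ)) * Complex.exp (t * (0 : ℝ) * I) =
      ((∫ t in (-1 : ℝ)..0, (1 + t) : ℝ) : ℂ) := by
      rw [← intervalIntegral.integral_ofReal]; simp
    have h2 : ∫ t in (0 : ℝ)..1, (1 - (t : ℂ)) * Complex.exp (t * (0 : ℝ) * I) =
      ((∫ t in (0 : ℝ)..1, (1 - t) : ℝ) : ℂ) := by
      rw [← intervalIntegral.integral_ofReal]; simp
    rw [h1, h2, intervalIntegral.integral_add (by simp) (by simp),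
      intervalIntegral.integral_sub (by simp) (by simp)]
    simp [fejer]
    norm_num
  · set a : ℂ := x * I with ha
    have ha0 : a ≠ 0 := mul_ne_zero (by exact_mod_cast hx) Complex.I_ne_zero
    have hexp : ∀ t : ℝ, HasDerivAt (fun t : ℝ => Complex.exp (t * a)) (Complex.exp (t * a) * a) t :=
      fun t => by
        have h0 : HasDerivAt (fun t : ℝ => (t : ℂ) * a) a t := by
          simpa using (Complex.ofRealCLM.hasDerivAt (x := t)).mul_const a
        exact h0.cexp
    have hid : ∀ t : ℝ, HasDerivAt (fun t : ℝ => (t : ℂ)) 1 t := fun t =>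
      Complex.ofRealCLM.hasDerivAt
    have d1 : ∀ t : ℝ, HasDerivAt (fun t : ℝ => (1 + (t : ℂ)) * Complex.exp (t * a) / a -
        Complex.exp (t * a) / a ^ 2) ((1 + (t : ℂ)) * Complex.exp (t * a)) t := fun t => by
      have := ((((hid t).const_add 1).mul (hexp t)).div_const a).sub ((hexp t).div_const (a ^ 2))
      refine this.congr_deriv ?_
      field_simp
      ring
    have d2 : ∀ t : ℝ, HasDerivAt (fun t : ℝ => (1 - (t : ℂ)) * Complex.exp (t * a) / a +
        Complex.exp (t * a) / a ^ 2) ((1 - (t : ℂ)) * Complex.exp (t * a)) t := fun t => by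
      have := ((((hid t).const_sub 1).mul (hexp t)).div_const a).add ((hexp t).div_const (a ^ 2))
      refine this.congr_deriv ?_
      field_simp
      ring
    simp only [mul_assoc, ← ha]
    rw [intervalIntegral.integral_eq_sub_of_hasDerivAt (fun t _ => d1 t)
        (Continuous.intervalIntegrable (by fun_prop) _ _),
      intervalIntegral.integral_eq_sub_of_hasDerivAt (fun t _ => d2 t)
        (Continuous.intervalIntegrable (by fun_prop) _ _), fejer, if_neg hx]
    have hx' : (x : ℂ) ≠ 0 := by exact_mod_cast hx
    have ha2 : a ^ 2 = -(x : ℂ) ^ 2 := by rw [ha, mul_pow, Complex.I_sq]; ring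
    have hc : Complex.exp a + Complex.exp (-a) = 2 * Complex.cos x := by
      rw [Complex.cos, ha]; ring_nf
    have hfin : ((2 * (1 - cos x) / x ^ 2 : ℝ) : ℂ) =
        (Complex.exp a + Complex.exp (-a) - 2) / a ^ 2 := by
      rw [hc, ha2]
      push_cast
      field_simp
      ring
    rw [hfin]
    clear_value a
    simp only [Complex.ofReal_zero, Complex.ofReal_one, Complex.ofReal_neg, zero_mul,
      Complex.exp_zero, one_mul, neg_mul, add_neg_cancel, sub_self, zero_div, add_zero, sub_zero]
    field_simp
    ring

lemma fejer_nonneg (x : ℝ) : 0 ≤ fejer x := by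
  unfold fejer
  split_ifs
  · exact zero_le_one
  · have := Real.cos_le_one x
    exact div_nonneg (by linarith) (sq_nonneg x)

lemma fejer_mul_sq (x : ℝ) : fejer x * x ^ 2 = 2 * (1 - cos x) := by
  unfold fejer
  split_ifs with h
  · simp [h]
  · field_simp

lemma fejer_le_one (x : ℝ) : fejer x ≤ 1 := by
  unfold fejer
  split_ifs with h
  · exact le_rfl
  · rw [div_le_one (by positivity)]
    have := Real.one_sub_sq_div_two_le_cos (x := x)
    linarith

lemma fejer_le (x : ℝ) : fejer x ≤ 5 * (1 + x ^ 2)⁻¹ := by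
  rw [← div_eq_mul_inv, le_div_iff₀ (by positivity), mul_add, mul_one, fejer_mul_sq]
  linarith [fejer_le_one x, Real.neg_one_le_cos x]

lemma fejer_ge {x : ℝ} (h : |x| ≤ π) : 2 / 5 ≤ fejer x := by
  unfold fejer
  split_ifs with h0
  · norm_num
  · have h1 := Real.cos_le_one_sub_mul_cos_sq h
    rw [le_div_iff₀ (by positivity)]
    have h2 : π ^ 2 ≤ 10 := by nlinarith [Real.pi_lt_d2, pi_pos]
    have h3 : 1 / 5 ≤ 2 / π ^ 2 := by
      rw [div_le_div_iff₀ (by norm_num) (by positivity)]; linarith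
    nlinarith [sq_nonneg x]

lemma continuous_fejer : Continuous fejer := by
  have h : Continuous fun x : ℝ => ∫ t : ℝ, (tri t : ℂ) * Complex.exp (t * x * I) := by
    refine continuous_of_dominated (bound := tri)
      (fun x => (integrable_tri_mul_exp x).aestronglyMeasurable) (fun x => ?_) integrable_tri ?_
    · refine Eventually.of_forall fun t => ?_
      rw [norm_mul, norm_exp_mul_mul_I, mul_one, Complex.norm_real,
        norm_of_nonneg (tri_nonneg t)]
    · exact Eventually.of_forall fun t => by fun_prop
  simp only [integral_tri_mul_exp] at h
  exact (Complex.continuous_re.comp h).congr fun x => Complex.ofReal_re _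

lemma integrable_fejer : Integrable fejer :=
  (integrable_inv_one_add_sq.const_mul 5).mono' continuous_fejer.aestronglyMeasurable
    (.of_forall fun x => by rw [norm_of_nonneg (fejer_nonneg x)]; exact fejer_le x)

lemma continuous_kern : Continuous kern :=
  continuous_fejer.add (continuous_fejer.comp (by fun_prop))

lemma integrable_kern : Integrable kern := integrable_fejer.add (integrable_fejer.comp_sub_right _)

lemma kern_ge (x : ℝ) : 4 / (|x| + π) ^ 2 ≤ kern x := by
  have hπ := pi_pos
  rw [div_le_iff₀ (by positivity)]
  have h1 := fejer_mul_sq x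
  have h2 := fejer_mul_sq (x - π)
  rw [Real.cos_sub_pi] at h2
  have h3 : x ^ 2 ≤ (|x| + π) ^ 2 := by
    rw [← sq_abs]; gcongr; linarith
  have h4 : (x - π) ^ 2 ≤ (|x| + π) ^ 2 := by
    rw [← sq_abs (x - π)]; gcongr
    grind
  have h5 := mul_le_mul_of_nonneg_left h3 (fejer_nonneg x)
  have h6 := mul_le_mul_of_nonneg_left h4 (fejer_nonneg (x - π))
  rw [kern, add_mul]
  linarith

lemma kern_pos (x : ℝ) : 0 < kern x := lt_of_lt_of_le (by positivity) (kern_ge x)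

lemma continuous_kerHat : Continuous kerHat := by
  unfold kerHat
  have := continuous_tri
  fun_prop

lemma kerHat_of_one_lt {t : ℝ} (h : 1 < |t|) : kerHat t = 0 := by simp [kerHat, tri_of_one_lt h]

lemma norm_kerHat_le (t : ℝ) : ‖kerHat t‖ ≤ 2 * tri t := by
  rw [kerHat, norm_mul, Complex.norm_real, norm_of_nonneg (tri_nonneg t), mul_comm]
  refine mul_le_mul_of_nonneg_right ((norm_add_le _ _).trans ?_) (tri_nonneg t)
  rw [norm_one, ← neg_mul, ← neg_mul, ← Complex.ofReal_neg, norm_exp_mul_mul_I]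
  norm_num

lemma integrable_kerHat : Integrable kerHat :=
  (integrable_tri.const_mul 2).mono' continuous_kerHat.aestronglyMeasurable
    (.of_forall norm_kerHat_le)

lemma kerHat_zero : kerHat 0 = 2 := by simp [kerHat, tri_zero]; norm_num

lemma integral_kerHat_mul_exp (x : ℝ) :
    ∫ t : ℝ, kerHat t * Complex.exp (t * x * I) = kern x := by
  have e : ∀ t : ℝ, kerHat t * Complex.exp (t * x * I) =
      (tri t : ℂ) * Complex.exp (t * x * I) +
        (tri t : ℂ) * Complex.exp (t * (x - π : ℝ) * I) := by
    intro t
    rw [kerHat, mul_assoc, add_mul, one_mul, ← Complex.exp_add, mul_add]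
    congr 4
    push_cast
    ring
  simp only [e]
  rw [integral_add (integrable_tri_mul_exp _) (integrable_tri_mul_exp _), integral_tri_mul_exp,
    integral_tri_mul_exp, kern]
  push_cast
  ring

/-- Fourier inversion for the kernel. -/
lemma integral_kern_mul_exp (θ : ℝ) :
    ∫ x : ℝ, (kern x : ℂ) * Complex.exp (θ * x * I) = 2 * π * kerHat (-θ) := by
  have hπ := pi_pos
  have hF : ∀ w : ℝ, FourierTransform.fourier kerHat w = kern (-2 * π * w) := by
    intro w
    rw [Real.fourier_real_eq_integral_exp_smul, ← integral_kerHat_mul_exp]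
    refine integral_congr_ae (.of_forall fun t => ?_)
    simp only [smul_eq_mul]
    rw [mul_comm]
    congr 2
    push_cast
    ring
  have hint : Integrable (FourierTransform.fourier kerHat) := by
    have : Integrable fun w : ℝ => (kern (-2 * π * w) : ℂ) :=
      (integrable_kern.comp_mul_left' (by simp [hπ.ne'])).ofReal
    exact this.congr (.of_forall fun w => (hF w).symm)
  have h := congrFun (continuous_kerHat.fourierInv_fourier_eq integrable_kerHat hint) (-θ)
  rw [Real.fourierInv_eq'] at h
  rw [← h]
  have e : ∀ v : ℝ, Complex.exp (↑(2 * π * inner ℝ v (-θ)) * I) •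
      FourierTransform.fourier kerHat v =
      (fun x : ℝ => (kern x : ℂ) * Complex.exp (θ * x * I)) (-2 * π * v) := by
    intro v
    rw [hF, smul_eq_mul, mul_comm]
    simp only
    congr 2
    simp
    ring
  simp only [e]
  rw [Measure.integral_comp_mul_left (fun x : ℝ => (kern x : ℂ) * Complex.exp (θ * x * I))]
  rw [show |(-2 * π)⁻¹| = (2 * π)⁻¹ by
    rw [abs_inv, abs_mul, abs_neg, abs_two, abs_of_pos hπ]]
  rw [Complex.real_smul]
  push_cast
  have : (π : ℂ) ≠ 0 := by exact_mod_cast hπ.ne'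
  grind

instance isProbabilityMeasure_walkLaw (n : ℕ) : IsProbabilityMeasure (walkLaw ρ n) := by
  rw [walkLaw]
  exact isProbabilityMeasure_map (measurable_pS n).aemeasurable

instance isProbabilityMeasure_map_fst : IsProbabilityMeasure (ρ.map Prod.fst) :=
  isProbabilityMeasure_map measurable_fst.aemeasurable

lemma Attracted.le_liminf_open (h : Attracted (ρ.map Prod.fst) ν c) {G : Set ℝ} (hG : IsOpen G) :
    ν G ≤ liminf (fun n => walkLaw ρ n {x | x / c n ∈ G}) atTop := by
  have hm : ∀ n, Measurable fun x : ℝ => (c n)⁻¹ * x := fun n => measurable_const_mul _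
  have hp : ∀ n, IsProbabilityMeasure ((walkLaw ρ n).map fun x => (c n)⁻¹ * x) := fun n =>
    isProbabilityMeasure_map (hm n).aemeasurable
  let P : ℕ → ProbabilityMeasure ℝ := fun n => ⟨(walkLaw ρ n).map fun x => (c n)⁻¹ * x, hp n⟩
  have hP : Tendsto P atTop (𝓝 (⟨ν, inferInstance⟩ : ProbabilityMeasure ℝ)) := by
    refine ProbabilityMeasure.tendsto_iff_tendsto_charFun.2 fun t => ?_
    refine (h.tendsto_charFun t).congr fun n => ?_
    change _ = charFun ((walkLaw ρ n).map fun x => (c n)⁻¹ * x) t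
    rw [charFun_map_mul, charFun_walkLaw, inv_mul_eq_div]
  have h1 := ProbabilityMeasure.le_liminf_measure_open_of_tendsto hP hG
  refine h1.trans_eq (congrArg (fun f => liminf f atTop) (funext fun n => ?_))
  change ((walkLaw ρ n).map fun x => (c n)⁻¹ * x) G = _
  rw [map_apply (hm n) hG.measurableSet]
  simp only [preimage, inv_mul_eq_div]

lemma integral_transform (P : Measure ℝ) [IsProbabilityMeasure P] {g : ℝ → ℂ} (hg : Integrable g)
    (y : ℝ) :
    ∫ x, (∫ t : ℝ, g t * Complex.exp (t * (x - y : ℝ) * I)) ∂P =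
      ∫ t : ℝ, g t * Complex.exp (-(t * y * I)) * charFun P t := by
  rw [integral_integral_swap]
  · refine integral_congr_ae (.of_forall fun t => ?_)
    simp only
    rw [charFun_apply_real, mul_assoc, ← integral_const_mul, ← integral_const_mul]
    refine integral_congr_ae (.of_forall fun x => ?_)
    simp only
    rw [← Complex.exp_add]
    congr 2
    push_cast
    ring
  · have h1 : Integrable (fun p : ℝ × ℝ => g p.2) (P.prod volume) := hg.comp_snd P
    refine h1.mul_bdd (c := 1) (by fun_prop) (.of_forall fun p => ?_)
    exact (norm_exp_mul_mul_I _ _).le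

/-- The (unnormalised) density obtained by Fourier inversion. -/
def dens (ν : Measure ℝ) (y : ℝ) : ℂ := ∫ s : ℝ, charFun ν s * Complex.exp (-(s * y * I))

lemma norm_exp_neg_mul_mul_I (t x : ℝ) : ‖Complex.exp (-(t * x * I))‖ = 1 := by
  rw [← neg_mul, ← neg_mul, ← Complex.ofReal_neg, norm_exp_mul_mul_I]

lemma integrable_of_bounded_support {g : ℝ → ℂ} (hg : Measurable g) {G T : ℝ}
    (hG : ∀ t, ‖g t‖ ≤ G) (hT : ∀ t, T < |t| → g t = 0) : Integrable g := by
  have h1 : IntegrableOn g (Icc (-T) T) :=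
    Measure.integrableOn_of_bounded (M := G) (by simp) hg.aestronglyMeasurable
      (.of_forall hG)
  refine (integrableOn_iff_integrable_of_support_subset fun t ht => ?_).1 h1
  by_contra hcon
  exact ht (hT t (by by_contra! h; exact hcon (abs_le.1 h)))

lemma Attracted.local_limit (h : Attracted (ρ.map Prod.fst) ν c) {g : ℝ → ℂ}
    (hg : Measurable g) {G T : ℝ} (hG : ∀ t, ‖g t‖ ≤ G) (hT : ∀ t, T < |t| → g t = 0)
    (hg0 : ContinuousAt g 0) {ε : ℝ} (hε : 0 < ε) :
    ∀ᶠ n in atTop, ∀ y : ℝ,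
      ‖c n * (∫ x, (∫ t : ℝ, g t * Complex.exp (t * (x - c n * y : ℝ) * I)) ∂walkLaw ρ n)
        - g 0 * dens ν y‖ ≤ ε := by
  obtain ⟨hint, hlim⟩ := h.tendsto_integral hg hG hT hg0
  have hgi := integrable_of_bounded_support hg hG hT
  filter_upwards [hlim.eventually_lt_const hε] with n hn y
  have cn := h.pos n
  rw [integral_transform _ hgi]
  simp only [charFun_walkLaw]
  set φ := charFun (ρ.map Prod.fst) with hφ
  have e1 : (c n : ℂ) * ∫ t : ℝ, g t * Complex.exp (-(t * (c n * y : ℝ) * I)) * φ t ^ n =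
      ∫ s : ℝ, g (s / c n) * φ (s / c n) ^ n * Complex.exp (-(s * y * I)) := by
    have := Measure.integral_comp_div
      (fun t : ℝ => g t * Complex.exp (-(t * (c n * y : ℝ) * I)) * φ t ^ n) (c n)
    rw [abs_of_pos cn, Complex.real_smul] at this
    rw [← this]
    refine integral_congr_ae (.of_forall fun s => ?_)
    have cn' : (c n : ℂ) ≠ 0 := by exact_mod_cast cn.ne'
    have : ((s / c n : ℝ) : ℂ) * (c n * y : ℝ) = s * y := by
      push_cast; field_simp
    simp only [this]
    ring
  have hI : Integrable fun s : ℝ => g (s / c n) * φ (s / c n) ^ n := by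
    refine (hgi.comp_div cn.ne').mul_bdd (c := 1)
      ((measurable_charFun.comp (measurable_id.div_const _)).pow_const n).aestronglyMeasurable ?_
    exact Eventually.of_forall fun s => by
      rw [norm_pow]; exact pow_le_one₀ (norm_nonneg _) (norm_charFun_le_one _)
  have hexp : AEStronglyMeasurable (fun s : ℝ => Complex.exp (-(s * y * I))) volume := by
    fun_prop
  have hb : ∀ᵐ s : ℝ, ‖Complex.exp (-(s * y * I))‖ ≤ 1 :=
    Eventually.of_forall fun s => (norm_exp_neg_mul_mul_I s y).le
  rw [e1, dens, ← integral_const_mul, ← integral_sub (hI.mul_bdd hexp hb)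
    ((hint.mul_bdd hexp hb).const_mul _)]
  refine (norm_integral_le_integral_norm _).trans (le_trans (le_of_eq ?_) hn.le)
  refine integral_congr_ae (.of_forall fun s => ?_)
  simp only
  rw [← mul_assoc, ← sub_mul, norm_mul, norm_exp_neg_mul_mul_I, mul_one]

lemma Attracted.fejer_limit (h : Attracted (ρ.map Prod.fst) ν c) :
    (∀ y, dens ν y = ((dens ν y).re : ℂ)) ∧ (∀ y, 0 ≤ (dens ν y).re) ∧
    (∀ ε > 0, ∀ᶠ n in atTop, ∀ y : ℝ,
      |c n * (∫ x, fejer (x - c n * y) ∂walkLaw ρ n) - (dens ν y).re| ≤ ε) := by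
  have key : ∀ ε > 0, ∀ᶠ n in atTop, ∀ y : ℝ,
      ‖((c n * (∫ x, fejer (x - c n * y) ∂walkLaw ρ n) : ℝ) : ℂ) - dens ν y‖ ≤ ε := by
    intro ε hε
    have := h.local_limit (g := fun t => (tri t : ℂ)) (G := 1) (T := 1)
      (by have := continuous_tri; fun_prop)
      (fun t => by rw [Complex.norm_real, norm_of_nonneg (tri_nonneg t)]; exact tri_le_one t)
      (fun t ht => by simp [tri_of_one_lt ht])
      (by have := continuous_tri; fun_prop) hε
    filter_upwards [this] with n hn y
    have h2 := hn y
    simp only [integral_tri_mul_exp, tri_zero, Complex.ofReal_one, one_mul, integral_complex_ofReal]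
      at h2
    exact_mod_cast h2
  have hT : ∀ y, Tendsto (fun n => ((c n * (∫ x, fejer (x - c n * y) ∂walkLaw ρ n) : ℝ) : ℂ)) atTop
      (𝓝 (dens ν y)) := by
    intro y
    rw [Metric.tendsto_nhds]
    intro ε hε
    filter_upwards [key (ε / 2) (by positivity)] with n hn
    rw [dist_eq_norm]
    linarith [hn y]
  refine ⟨fun y => ?_, fun y => ?_, fun ε hε => ?_⟩
  · refine tendsto_nhds_unique (hT y) ?_
    exact (Complex.continuous_ofReal.tendsto _).comp ((Complex.continuous_re.tendsto _).comp (hT y))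
  · refine ge_of_tendsto' ((Complex.continuous_re.tendsto _).comp (hT y)) fun n => ?_
    simp only [Function.comp_apply, Complex.ofReal_re]
    exact mul_nonneg (h.pos n).le (integral_nonneg fun _ => fejer_nonneg _)
  · filter_upwards [key ε hε] with n hn y
    have := (Complex.abs_re_le_norm _).trans (hn y)
    simpa using this

lemma Attracted.continuous_dens (h : Attracted (ρ.map Prod.fst) ν c) : Continuous (dens ν) := by
  obtain ⟨hint, -⟩ := h.tendsto_integral (g := fun _ => 0) (G := 0) (T := 0) measurable_const
    (by simp) (by simp) continuousAt_const
  refine continuous_of_dominated (bound := fun s => ‖charFun ν s‖) (fun y => ?_) (fun y => ?_)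
    hint.norm ?_
  · exact (measurable_charFun.mul (by fun_prop)).aestronglyMeasurable
  · exact Eventually.of_forall fun s => by rw [norm_mul, norm_exp_neg_mul_mul_I, mul_one]
  · exact Eventually.of_forall fun s => by fun_prop

lemma integrable_fejer_sub (P : Measure ℝ) [IsFiniteMeasure P] (y : ℝ) :
    Integrable (fun x => fejer (x - y)) P :=
  Integrable.of_bound (C := 1) (continuous_fejer.comp (by fun_prop)).aestronglyMeasurable
    (.of_forall fun x => by
      rw [norm_of_nonneg (fejer_nonneg _)]; exact fejer_le_one _)

/-- Concentration bound in terms of the Fejér kernel. -/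
lemma real_Icc_le_integral_fejer (P : Measure ℝ) [IsFiniteMeasure P] (y : ℝ) :
    P.real (Icc y (y + 1)) ≤ 5 / 2 * ∫ x, fejer (x - y) ∂P := by
  have h1 : ∫ x, (Icc y (y + 1)).indicator (fun _ => (2 / 5 : ℝ)) x ∂P ≤ ∫ x, fejer (x - y) ∂P := by
    refine integral_mono ((integrable_const _).indicator measurableSet_Icc)
      (integrable_fejer_sub P y) fun x => ?_
    by_cases hx : x ∈ Icc y (y + 1)
    · rw [indicator_of_mem hx]
      refine fejer_ge ?_
      rw [abs_of_nonneg (by linarith [hx.1])]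
      linarith [hx.2, Real.pi_gt_three]
    · rw [indicator_of_notMem hx]; exact fejer_nonneg _
  rw [integral_indicator_const _ measurableSet_Icc, smul_eq_mul] at h1
  linarith

lemma Attracted.concentration (h : Attracted (ρ.map Prod.fst) ν c) :
    ∃ K > 0, ∀ n y, (walkLaw ρ n).real (Icc y (y + 1)) ≤ K / c n := by
  obtain ⟨hre, hnn, hlim⟩ := h.fejer_limit
  obtain ⟨hint, -⟩ := h.tendsto_integral (g := fun _ => 0) (G := 0) (T := 0) measurable_const
    (by simp) (by simp) continuousAt_const
  set D := ∫ s, ‖charFun ν s‖ with hD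
  have hD0 : 0 ≤ D := integral_nonneg fun _ => norm_nonneg _
  have hden : ∀ y, (dens ν y).re ≤ D := fun y => by
    refine (Complex.re_le_norm _).trans ((norm_integral_le_integral_norm _).trans (le_of_eq ?_))
    simp only [norm_mul, norm_exp_neg_mul_mul_I, mul_one, hD]
  obtain ⟨N, hN⟩ := eventually_atTop.1 (hlim 1 one_pos)
  obtain ⟨K, hK⟩ : ∃ K, ∀ n < N, c n ≤ K := by
    obtain ⟨K, hK⟩ := (range N).image c |>.bddAbove
    exact ⟨K, fun n hn => hK (by simpa using ⟨n, hn, rfl⟩)⟩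
  refine ⟨max K (5 / 2 * (D + 1)), lt_max_of_lt_right (by positivity), fun n y => ?_⟩
  have cn := h.pos n
  rw [le_div_iff₀ cn]
  rcases lt_or_ge n N with hn | hn
  · refine le_trans ?_ (le_max_left _ _)
    calc (walkLaw ρ n).real (Icc y (y + 1)) * c n ≤ 1 * c n := by
          gcongr; exact measureReal_le_one
      _ ≤ K := by rw [one_mul]; exact hK n hn
  · refine le_trans ?_ (le_max_right _ _)
    have h1 := hN n hn (y / c n)
    rw [mul_div_cancel₀ _ cn.ne'] at h1
    have h2 := real_Icc_le_integral_fejer (walkLaw ρ n) y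
    have h3 := (abs_le.1 h1).2
    have h4 := hden (y / c n)
    have h5 := mul_le_mul_of_nonneg_right h2 cn.le
    linarith

lemma Attracted.measure_Ioo_eq_zero (h : Attracted (ρ.map Prod.fst) ν c) {a b : ℝ} (ha : 0 < a) (hab : a < b)
    (hd : ∀ y, 0 < y → (dens ν y).re = 0) : ν (Ioo a b) = 0 := by
  obtain ⟨hre, hnn, hlim⟩ := h.fejer_limit
  have key : ∀ ε > 0, ν (Ioo a b) ≤ ofReal ε := by
    intro ε hε
    set ε' := ε / (5 / 2 * (b - a + 1)) with hε'
    have hba : 0 < b - a := by linarith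
    have hε'0 : 0 < ε' := by positivity
    refine (h.le_liminf_open isOpen_Ioo).trans ?_
    refine liminf_le_of_frequently_le (Eventually.frequently ?_)
    filter_upwards [hlim ε' hε'0, h.lim.eventually_ge_atTop 1] with n hn hc1
    have cn := h.pos n
    rw [← ofReal_measureReal]
    refine ofReal_le_ofReal ?_
    set k := ⌈c n * (b - a)⌉₊ with hk
    have hsub : {x | x / c n ∈ Ioo a b} ⊆
        ⋃ i ∈ range k, Icc (c n * a + i) (c n * a + i + 1) := by
      intro x hx
      have hx' : x / c n ∈ Ioo a b := hx
      rw [mem_Ioo, lt_div_iff₀ cn, div_lt_iff₀ cn] at hx'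
      have h0 : 0 ≤ x - c n * a := by linarith
      simp only [mem_iUnion, Finset.mem_range]
      refine ⟨⌊x - c n * a⌋₊, ?_, ?_, ?_⟩
      · rw [hk, Nat.floor_lt h0]
        exact lt_of_lt_of_le (by linarith) (Nat.le_ceil _)
      · linarith [Nat.floor_le h0]
      · linarith [Nat.lt_floor_add_one (x - c n * a)]
    calc (walkLaw ρ n).real {x | x / c n ∈ Ioo a b}
        ≤ ∑ i ∈ range k, (walkLaw ρ n).real (Icc (c n * a + i) (c n * a + i + 1)) :=
          (measureReal_mono hsub (measure_ne_top _ _)).trans (measureReal_biUnion_finset_le _ _)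
      _ ≤ ∑ i ∈ range k, 5 / 2 * (ε' / c n) := by
          refine sum_le_sum fun i _ => (real_Icc_le_integral_fejer _ _).trans ?_
          refine mul_le_mul_of_nonneg_left ?_ (by norm_num)
          have h1 := hn (a + i / c n)
          rw [hd _ (by positivity), sub_zero, mul_add, mul_div_cancel₀ _ cn.ne'] at h1
          rw [le_div_iff₀ cn, mul_comm]
          exact (le_abs_self _).trans h1
      _ = k * (5 / 2 * (ε' / c n)) := by simp
      _ ≤ (c n * (b - a) + c n) * (5 / 2 * (ε' / c n)) := by
          refine mul_le_mul_of_nonneg_right ?_ (by positivity)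
          linarith [(Nat.ceil_lt_add_one (mul_nonneg cn.le hba.le)).le]
      _ = ε := by rw [hε']; field_simp
  refine le_antisymm (ENNReal.le_of_forall_pos_le_add fun ε hε _ => ?_) bot_le
  simpa using key ε (by exact_mod_cast hε)

lemma Attracted.exists_dens_pos (h : Attracted (ρ.map Prod.fst) ν c) : ∃ y, 0 < y ∧ 0 < (dens ν y).re := by
  by_contra! hcon
  refine h.pos_mass.ne' (measure_null_of_locally_null _ fun x (hx : 0 < x) => ?_)
  refine ⟨Ioo (x / 2) (2 * x), mem_nhdsWithin_of_mem_nhds (Ioo_mem_nhds (by linarith) (by linarith)),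
    h.measure_Ioo_eq_zero (by positivity) (by linarith) fun y hy => ?_⟩
  exact le_antisymm (hcon y hy) (h.fejer_limit.2.1 y)

lemma Attracted.exists_scale {F : Measure ℝ} [IsProbabilityMeasure F] (h : Attracted F ν c) {κ δ : ℝ} (hκ : 0 < κ) (hδ : 0 < δ) (N : ℕ) :
    ∀ᶠ l in atTop, ∃ j, N ≤ j ∧ |c j / c l - κ| < δ := by
  have h1 := h.tendsto_ratio.eventually_lt_const (show 1 < 1 + δ / κ by
    linarith [div_pos hδ hκ])
  obtain ⟨N', hN'⟩ := eventually_atTop.1 h1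
  obtain ⟨B, hB⟩ : ∃ B, ∀ n ≤ max N N', c n ≤ B := by
    obtain ⟨B, hB⟩ := (range (max N N' + 1)).image c |>.bddAbove
    exact ⟨B, fun n hn => hB (by simpa using ⟨n, by omega, rfl⟩)⟩
  filter_upwards [h.lim.eventually_gt_atTop (B / κ)] with l hl
  have cl := h.pos l
  rw [div_lt_iff₀ hκ] at hl
  have hex : ∃ j, κ * c l ≤ c j := (h.lim.eventually_ge_atTop _).exists
  classical
  set j := Nat.find hex with hj
  have hjs : κ * c l ≤ c j := Nat.find_spec hex
  have hjN : max N N' < j := by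
    by_contra! hcon
    linarith [hB j hcon]
  obtain ⟨i, hi⟩ : ∃ i, j = i + 1 := ⟨j - 1, by omega⟩
  have him : c i < κ * c l := not_le.1 (Nat.find_min hex (by omega))
  have h2 := hN' i (by have := le_max_right N N'; omega)
  rw [div_lt_iff₀ (h.pos i), ← hi] at h2
  refine ⟨j, by have := le_max_left N N'; omega, ?_⟩
  have h3 : c j < (1 + δ / κ) * (κ * c l) := h2.trans (by gcongr)
  have h4 : (1 + δ / κ) * (κ * c l) = (κ + δ) * c l := by field_simp
  rw [abs_lt]
  constructor
  · have : κ ≤ c j / c l := by rwa [le_div_iff₀ cl]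
    linarith
  · have : c j / c l < κ + δ := by rw [div_lt_iff₀ cl]; linarith
    linarith

lemma Attracted.dens_zero_pos (h : Attracted (ρ.map Prod.fst) ν c) : 0 < (dens ν 0).re := by
  obtain ⟨hre, hnn, hlim⟩ := h.fejer_limit
  obtain ⟨K, hK, hc⟩ := h.comp
  have hK0 : 0 < K := by linarith
  obtain ⟨y₁, hy₁, hmass⟩ := exists_mem_forall_mem_nhdsWithin_pos_measure h.neg_mass.ne'
  have hy₁ : y₁ < 0 := hy₁
  obtain ⟨y₂, hy₂, hp⟩ := h.exists_dens_pos
  set p := (dens ν y₂).re with hpd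
  set κ := -y₁ / y₂ with hκ
  have hκ0 : 0 < κ := div_pos (by linarith) hy₂
  have hcont : ContinuousAt (fun q : ℝ × ℝ => (dens ν (-q.1 / q.2)).re) (y₁, κ) := by
    have h1 : Continuous fun y => (dens ν y).re :=
      Complex.continuous_re.comp h.continuous_dens
    exact h1.continuousAt.comp (continuousAt_fst.neg.div continuousAt_snd hκ0.ne')
  have hval : (dens ν (-y₁ / κ)).re = p := by grind
  obtain ⟨δ, hδ, hball⟩ := Metric.eventually_nhds_iff.1
    (hcont.eventually_const_lt (show p / 2 < _ by simp only; rw [hval]; linarith))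
  have hball' : ∀ a b, |a - y₁| < δ → |b - κ| < δ → p / 2 < (dens ν (-a / b)).re := by
    intro a b ha hb
    exact @hball (a, b) (by rw [Prod.dist_eq]; exact max_lt ha hb)
  set U := Ioo (y₁ - δ) (y₁ + δ) with hU
  have hU0 : 0 < ν U := (hmass _ (mem_nhdsWithin_of_mem_nhds
    (Ioo_mem_nhds (by linarith) (by linarith))))
  obtain ⟨q, hq0, hq⟩ : ∃ q : ℝ, 0 < q ∧ ofReal q < ν U := by
    refine ⟨(ν U).toReal / 2, by
      have := toReal_pos hU0.ne' (measure_ne_top _ _); positivity, ?_⟩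
    rw [ENNReal.ofReal_lt_iff_lt_toReal (by positivity) (measure_ne_top _ _)]
    have := toReal_pos hU0.ne' (measure_ne_top _ _)
    linarith
  obtain ⟨N, hN⟩ := eventually_atTop.1 (hlim (p / 4) (by positivity))
  obtain ⟨N₂, hN₂⟩ := eventually_atTop.1 (hlim (p * q / (8 * K)) (by positivity))
  have hUl := eventually_lt_of_lt_liminf (hq.trans_le (h.le_liminf_open (G := U) isOpen_Ioo))
  obtain ⟨l, ⟨⟨j, hj, hjl⟩, hlU⟩, hl2⟩ :=
    (((h.exists_scale hκ0 hδ N).and hUl).and (eventually_ge_atTop N₂)).exists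
  have cl := h.pos l
  have cj := h.pos j
  have h1 := hN₂ (j + l) (by omega) 0
  have h2 : q * (p / (4 * c j)) ≤ ∫ x, fejer (x - c (j + l) * 0) ∂walkLaw ρ (j + l) := by
    simp only [mul_zero, sub_zero]
    have hcj : c (j + l) = c (l + j) := by rw [add_comm]
    rw [add_comm j l, walkLaw_add, Measure.conv, integral_map (by fun_prop)
      continuous_fejer.aestronglyMeasurable, integral_prod]
    swap
    · exact Integrable.of_bound (C := 1)
        (continuous_fejer.comp (by fun_prop)).aestronglyMeasurable
        (.of_forall fun x => by
          rw [norm_of_nonneg (fejer_nonneg _)]; exact fejer_le_one _)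
    have h3 : q ≤ (walkLaw ρ l).real {x | x / c l ∈ U} := by
      have := toReal_mono (measure_ne_top _ _) hlU.le
      rwa [toReal_ofReal hq0.le] at this
    have hms : MeasurableSet {x : ℝ | x / c l ∈ U} :=
      measurableSet_Ioo.preimage (measurable_id.div_const _)
    calc q * (p / (4 * c j)) ≤ (walkLaw ρ l).real {x | x / c l ∈ U} * (p / (4 * c j)) := by gcongr
      _ = ∫ x, ({x : ℝ | x / c l ∈ U}).indicator (fun _ => p / (4 * c j)) x ∂walkLaw ρ l := by
          rw [integral_indicator_const _ hms, smul_eq_mul]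
      _ ≤ ∫ x, ∫ y, fejer (x + y) ∂walkLaw ρ j ∂walkLaw ρ l := by
          refine integral_mono ((integrable_const _).indicator hms) ?_ fun x => ?_
          · refine Integrable.integral_prod_left (f := fun z : ℝ × ℝ => fejer (z.1 + z.2))
              (Integrable.of_bound (C := 1)
              (continuous_fejer.comp (by fun_prop)).aestronglyMeasurable
              (.of_forall fun x => by
                rw [norm_of_nonneg (fejer_nonneg _)]; exact fejer_le_one _))
          · by_cases hx : x ∈ {x : ℝ | x / c l ∈ U}
            · rw [indicator_of_mem hx]
              have hx' : x / c l ∈ U := hx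
              have h4 := hN j hj (-(x / c l) / (c j / c l))
              have h5 := hball' (x / c l) (c j / c l)
                (by rw [abs_lt]; constructor <;> linarith [hx'.1, hx'.2]) hjl
              have h6 : c j * (-(x / c l) / (c j / c l)) = -x := by field_simp
              rw [h6] at h4
              simp only [sub_neg_eq_add] at h4
              have h7 := (abs_le.1 h4).1
              simp only [add_comm x]
              rw [div_le_iff₀ (by positivity)]
              linarith
            · rw [indicator_of_notMem hx]
              exact integral_nonneg fun _ => fejer_nonneg _
  have h3 := hc j (j + l) (by omega)
  have h4 := (abs_le.1 h1).2
  have h5 : p * q / (4 * K) ≤ c (j + l) * (q * (p / (4 * c j))) := by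
    rw [div_le_iff₀ (by positivity)]
    have : c (j + l) * (q * (p / (4 * c j))) * (4 * K) = (K * c (j + l)) * (p * q) / c j := by
      field_simp
    rw [this, le_div_iff₀ cj, mul_comm]
    exact mul_le_mul_of_nonneg_right h3 (by positivity)
  have h6 := mul_le_mul_of_nonneg_left h2 (h.pos (j + l)).le
  have h7 : p * q / (4 * K) = 2 * (p * q / (8 * K)) := by field_simp; norm_num
  have h8 : 0 < p * q / (8 * K) := by positivity
  linarith

/-- Lower bound for the limit of integrals of lower semicontinuous functions. -/
def VagueLE (ν : Measure ℝ) (μs : ℕ → Measure ℝ) : Prop :=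
  ∀ f : ℝ → ℝ≥0∞, LowerSemicontinuous f → ∫⁻ x, f x ∂ν ≤ liminf (fun n => ∫⁻ x, f x ∂μs n) atTop

lemma vagueLE_of_isOpen {ν : Measure ℝ} {μs : ℕ → Measure ℝ}
    (h : ∀ G, IsOpen G → ν G ≤ liminf (fun n => μs n G) atTop) : VagueLE ν μs := by
  intro f hf
  have hfm : Measurable f := hf.measurable
  have key : ∀ N : ℕ, ∫⁻ x, min (f x) N ∂ν ≤ liminf (fun n => ∫⁻ x, f x ∂μs n) atTop := by
    intro N
    set g : ℝ → ℝ := fun x => (min (f x) N).toReal with hg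
    have hgm : Measurable g := (hfm.min measurable_const).ennreal_toReal
    have hfin : ∀ x, min (f x) (N : ℝ≥0∞) ≠ ∞ := fun x =>
      ne_top_of_le_ne_top (ENNReal.natCast_ne_top N) (min_le_right _ _)
    have hgf : ∀ x, ofReal (g x) = min (f x) N := fun x => ofReal_toReal (hfin x)
    have hlc : ∀ P : Measure ℝ, ∫⁻ x, min (f x) N ∂P = ∫⁻ t in Ioi (0 : ℝ), P {x | t < g x} := by
      intro P
      rw [← lintegral_eq_lintegral_meas_lt P (.of_forall fun x => toReal_nonneg)
        hgm.aemeasurable]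
      grind
    have hopen : ∀ t : ℝ, 0 < t → IsOpen {x | t < g x} := by
      intro t ht
      have : {x | t < g x} = f ⁻¹' Ioi (ofReal t) ∩ {_x | ofReal t < N} := by
        ext x
        change t < g x ↔ ofReal t < f x ∧ ofReal t < N
        rw [← lt_min_iff, hg, ← ENNReal.ofReal_lt_iff_lt_toReal ht.le (hfin x)]
      rw [this]
      exact (hf.isOpen_preimage _).inter isOpen_const
    calc ∫⁻ x, min (f x) N ∂ν = ∫⁻ t in Ioi (0 : ℝ), ν {x | t < g x} := hlc ν
      _ ≤ ∫⁻ t in Ioi (0 : ℝ), liminf (fun n => μs n {x | t < g x}) atTop :=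
          setLIntegral_mono' measurableSet_Ioi fun t ht => h _ (hopen t ht)
      _ ≤ liminf (fun n => ∫⁻ t in Ioi (0 : ℝ), μs n {x | t < g x}) atTop := by
          refine lintegral_liminf_le fun n => ?_
          exact Antitone.measurable fun s t hst => measure_mono fun x hx => lt_of_le_of_lt hst hx
      _ ≤ _ := by
          refine liminf_le_liminf (.of_forall fun n => ?_)
          rw [← hlc]
          exact lintegral_mono fun x => min_le_left _ _
  calc ∫⁻ x, f x ∂ν = ∫⁻ x, ⨆ N : ℕ, min (f x) N ∂ν := by
        refine lintegral_congr fun x => ?_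
        rw [← inf_iSup_eq, ENNReal.iSup_natCast, inf_top_eq]
    _ = ⨆ N : ℕ, ∫⁻ x, min (f x) N ∂ν := by
        refine lintegral_iSup (fun N => hfm.min measurable_const) fun m n hmn x => ?_
        exact min_le_min_left _ (by exact_mod_cast hmn)
    _ ≤ _ := iSup_le key

lemma lowerSemicontinuous_indicator_of_isOpen {G : Set ℝ} (hG : IsOpen G) {w : ℝ → ℝ≥0∞}
    (hw : Continuous w) : LowerSemicontinuous (G.indicator w) := by
  rw [lowerSemicontinuous_iff_isOpen_preimage]
  intro y
  have : G.indicator w ⁻¹' Ioi y = G ∩ w ⁻¹' Ioi y := by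
    ext x
    by_cases hx : x ∈ G <;> simp [hx]
  rw [this]
  exact hG.inter (isOpen_Ioi.preimage hw)

/-- The local limit behaviour of the walk with step law `ρ`. -/
structure LLT (ρ : Measure (ℝ × ℝ)) (ℓ : ℕ → ℝ) (C : ℝ) : Prop where
  reg : RegSeq ℓ
  potter : ∃ K > 0, ∃ N : ℕ, ∀ m n, N ≤ m → m ≤ n → (n : ℝ) * ℓ n ^ 2 ≤ K * (m * ℓ m ^ 2)
  conc : ∃ K > 0, ∀ n y, (walkLaw ρ n).real (Icc y (y + 1)) ≤ K * ℓ n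
  C_pos : 0 < C
  vague : VagueLE (ofReal C • volume) fun n => ofReal (ℓ n)⁻¹ • walkLaw ρ n
  lim : Tendsto (fun n => (∫ x in Iio 0, exp x ∂walkLaw ρ n) / ℓ n) atTop (𝓝 C)
  tail : ∃ R > 0, ∃ K > 0, ∀ n : ℕ, (n : ℝ) * (ρ.map Prod.fst).real {x | R < |x| * ℓ n} ≤ K
  mass : ∃ q > 0, ∀ᶠ n in atTop, q ≤ (walkLaw ρ n).real (Ici 0) ∧ q ≤ (walkLaw ρ n).real (Iio 0)

lemma integrable_kern_mul (P : Measure ℝ) [IsFiniteMeasure P] : Integrable kern P :=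
  Integrable.of_bound (C := 2) continuous_kern.aestronglyMeasurable
    (.of_forall fun x => by
      rw [norm_of_nonneg (kern_pos x).le, kern]
      linarith [fejer_le_one x, fejer_le_one (x - π)])

lemma integral_kern : ∫ x, kern x = 4 * π := by
  have h := integral_kern_mul_exp 0
  simp only [Complex.ofReal_zero, zero_mul, Complex.exp_zero, mul_one, neg_zero, kerHat_zero,
    integral_complex_ofReal] at h
  have : ((∫ x, kern x : ℝ) : ℂ) = ((4 * π : ℝ) : ℂ) := by rw [h]; push_cast; ring
  exact_mod_cast this

lemma Attracted.tendsto_kern_mul_exp (h : Attracted (ρ.map Prod.fst) ν c) (θ : ℝ) :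
    Tendsto (fun n => (c n : ℂ) * ∫ x, (kern x : ℂ) * Complex.exp (θ * x * I) ∂walkLaw ρ n)
      atTop (𝓝 (kerHat (-θ) * dens ν 0)) := by
  rw [Metric.tendsto_nhds]
  intro ε hε
  have hcont : Continuous fun t => kerHat (t - θ) := continuous_kerHat.comp (by fun_prop)
  have h1 := h.local_limit (g := fun t => kerHat (t - θ)) (G := 2) (T := 1 + |θ|)
    hcont.measurable
    (fun t => (norm_kerHat_le _).trans (by linarith [tri_le_one (t - θ)]))
    (fun t ht => kerHat_of_one_lt (by linarith [abs_sub_abs_le_abs_sub t θ]))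
    hcont.continuousAt (half_pos hε)
  filter_upwards [h1] with n hn
  have h2 := hn 0
  rw [dist_eq_norm]
  have e : ∀ x : ℝ, ∫ t : ℝ, kerHat (t - θ) * Complex.exp (t * (x - c n * 0 : ℝ) * I) =
      (kern x : ℂ) * Complex.exp (θ * x * I) := by
    intro x
    rw [← integral_kerHat_mul_exp, ← integral_mul_const,
      ← integral_sub_right_eq_self (fun t : ℝ => kerHat t * Complex.exp (t * x * I) *
        Complex.exp (θ * x * I)) θ]
    refine integral_congr_ae (.of_forall fun t => ?_)
    simp only
    rw [mul_assoc (kerHat (t - θ)), ← Complex.exp_add]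
    congr 2
    push_cast
    ring
  simp only [e, zero_sub] at h2
  linarith

lemma Attracted.tendsto_kern (h : Attracted (ρ.map Prod.fst) ν c) :
    Tendsto (fun n => c n * ∫ x, kern x ∂walkLaw ρ n) atTop (𝓝 (2 * (dens ν 0).re)) := by
  have h1 := (Complex.continuous_re.tendsto _).comp (h.tendsto_kern_mul_exp 0)
  rw [neg_zero, kerHat_zero, h.fejer_limit.1 0] at h1
  simp only [Function.comp_def, Complex.ofReal_zero, zero_mul, Complex.exp_zero, mul_one,
    integral_complex_ofReal] at h1
  convert h1 using 2 with n
  · rw [← Complex.ofReal_mul, Complex.ofReal_re]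
  · rw [Complex.mul_re]; simp

/-- A probability measure obtained from `P` by tilting with `kern`. -/
def kernTilt (P : Measure ℝ) : Measure ℝ :=
  P.withDensity fun x => ofReal (kern x / ∫ y, kern y ∂P)

lemma measurable_kernTilt (a : ℝ) : Measurable fun x => ofReal (kern x / a) :=
  (continuous_kern.measurable.div_const _).ennreal_ofReal

lemma isProbabilityMeasure_kernTilt {P : Measure ℝ} (hP : Integrable kern P) [NeZero P] :
    IsProbabilityMeasure (kernTilt P) := by
  have hpos : 0 < ∫ y, kern y ∂P := by
    rw [integral_pos_iff_support_of_nonneg (fun x => (kern_pos x).le) hP]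
    have : Function.support kern = univ := by
      ext x; simp [(kern_pos x).ne']
    rw [this]
    simpa [pos_iff_ne_zero] using NeZero.ne P
  constructor
  rw [kernTilt, withDensity_apply _ MeasurableSet.univ, Measure.restrict_univ,
    ← ofReal_integral_eq_lintegral_ofReal (hP.div_const _)
      (.of_forall fun x => div_nonneg (kern_pos x).le hpos.le), integral_div,
    div_self hpos.ne', ofReal_one]

lemma charFun_kernTilt (P : Measure ℝ) (t : ℝ) :
    charFun (kernTilt P) t =
      (∫ x, (kern x : ℂ) * Complex.exp (t * x * I) ∂P) / ((∫ y, kern y ∂P : ℝ) : ℂ) := by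
  have h0 : 0 ≤ ∫ y, kern y ∂P := integral_nonneg fun x => (kern_pos x).le
  rw [charFun_apply_real, kernTilt, integral_withDensity_eq_integral_toReal_smul
    (measurable_kernTilt _) (.of_forall fun x => ofReal_lt_top), ← integral_div]
  refine integral_congr_ae (.of_forall fun x => ?_)
  simp only
  rw [toReal_ofReal (div_nonneg (kern_pos x).le h0), Complex.real_smul]
  push_cast
  ring

lemma lintegral_kernTilt (P : Measure ℝ) {G : Set ℝ} (hG : MeasurableSet G) :
    ∫⁻ x, G.indicator (fun x => ofReal (1 / kern x)) x ∂kernTilt P =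
      ofReal (∫ y, kern y ∂P)⁻¹ * P G := by
  have hm : Measurable fun x => ofReal (1 / kern x) :=
    (measurable_const.div continuous_kern.measurable).ennreal_ofReal
  have h0 : 0 ≤ ∫ y, kern y ∂P := integral_nonneg fun x => (kern_pos x).le
  rw [kernTilt, lintegral_withDensity_eq_lintegral_mul _ (measurable_kernTilt _) (hm.indicator hG),
    ← setLIntegral_one, ← lintegral_indicator hG,
    ← lintegral_const_mul _ (measurable_const.indicator hG)]
  refine lintegral_congr fun x => ?_
  by_cases hx : x ∈ G
  · simp only [Pi.mul_apply, indicator_of_mem hx, mul_one]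
    rw [← ofReal_mul (div_nonneg (kern_pos x).le h0)]
    congr 1
    have := (kern_pos x).ne'
    field_simp
  · simp [indicator_of_notMem hx]

lemma Attracted.vague (h : Attracted (ρ.map Prod.fst) ν c) :
    VagueLE (ofReal ((dens ν 0).re / (2 * π)) • volume)
      fun n => ofReal (c n) • walkLaw ρ n := by
  have hD := h.dens_zero_pos
  set D := (dens ν 0).re with hDd
  have hp := fun n => isProbabilityMeasure_kernTilt (integrable_kern_mul (walkLaw ρ n))
  have hp' : IsProbabilityMeasure (kernTilt volume) := isProbabilityMeasure_kernTilt integrable_kern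
  let P : ℕ → ProbabilityMeasure ℝ := fun n => ⟨kernTilt (walkLaw ρ n), hp n⟩
  have hP : Tendsto P atTop (𝓝 (⟨kernTilt volume, hp'⟩ : ProbabilityMeasure ℝ)) := by
    refine ProbabilityMeasure.tendsto_iff_tendsto_charFun.2 fun t => ?_
    change Tendsto (fun n => charFun (kernTilt (walkLaw ρ n)) t) atTop
      (𝓝 (charFun (kernTilt volume) t))
    have h1 := h.tendsto_kern_mul_exp t
    have h2 := (Complex.continuous_ofReal.tendsto _).comp h.tendsto_kern
    have h3 := h1.div h2 (by exact_mod_cast (by positivity : (2 * D) ≠ 0))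
    rw [charFun_kernTilt, integral_kern_mul_exp, integral_kern]
    have e : kerHat (-t) * dens ν 0 / ((2 * D : ℝ) : ℂ) =
        2 * π * kerHat (-t) / ((4 * π : ℝ) : ℂ) := by
      rw [h.fejer_limit.1 0, ← hDd]
      have hD' : (D : ℂ) ≠ 0 := by exact_mod_cast hD.ne'
      have hπ : (π : ℂ) ≠ 0 := by exact_mod_cast Real.pi_ne_zero
      push_cast
      field_simp
      norm_num
    rw [← e]
    refine h3.congr fun n => ?_
    rw [charFun_kernTilt]
    have cn : (c n : ℂ) ≠ 0 := by exact_mod_cast (h.pos n).ne'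
    simp only [Pi.div_apply, Function.comp_apply]
    push_cast
    rw [mul_div_mul_left _ _ cn]
  have hv : VagueLE (kernTilt volume) fun n => kernTilt (walkLaw ρ n) :=
    vagueLE_of_isOpen fun G hG => ProbabilityMeasure.le_liminf_measure_open_of_tendsto hP hG
  refine vagueLE_of_isOpen fun G hG => ?_
  have hcont : Continuous fun x => ofReal (1 / kern x) :=
    continuous_ofReal.comp (continuous_const.div continuous_kern fun x => (kern_pos x).ne')
  have h1 := hv _ (lowerSemicontinuous_indicator_of_isOpen hG hcont)
  simp only [lintegral_kernTilt _ hG.measurableSet] at h1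
  rw [integral_kern] at h1
  have hkn : ∀ᶠ n in atTop, D < c n * ∫ y, kern y ∂walkLaw ρ n :=
    h.tendsto_kern.eventually_const_lt (by linarith)
  have h2 : Tendsto (fun n => ofReal (c n * ∫ y, kern y ∂walkLaw ρ n)) atTop
      (𝓝 (ofReal (2 * D))) :=
    (continuous_ofReal.tendsto _).comp h.tendsto_kern
  have h3 : ∀ᶠ n in atTop, (ofReal (c n * ∫ y, kern y ∂walkLaw ρ n)) *
      (ofReal (∫ y, kern y ∂walkLaw ρ n)⁻¹ * walkLaw ρ n G) =
      ofReal (c n) * walkLaw ρ n G := by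
    filter_upwards [hkn] with n hn
    have h0 : 0 < ∫ y, kern y ∂walkLaw ρ n := by
      by_contra! hcon
      have := mul_nonpos_of_nonneg_of_nonpos (h.pos n).le hcon
      linarith
    rw [← mul_assoc, ← ofReal_mul (by linarith)]
    congr 2
    field_simp
  simp only [Measure.smul_apply, smul_eq_mul]
  rw [← liminf_congr h3]
  refine le_trans ?_ (ENNReal.le_liminf_mul)
  rw [h2.liminf_eq]
  refine le_trans (le_of_eq ?_) (mul_le_mul_right h1 _)
  rw [← mul_assoc, ← ofReal_mul (by positivity)]
  congr 2
  field_simp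
  norm_num

lemma integrableOn_exp_Iic_measure (P : Measure ℝ) [IsFiniteMeasure P] :
    IntegrableOn (fun x => exp x) (Iic 0) P :=
  Measure.integrableOn_of_bounded (M := 1) (measure_ne_top _ _)
    Real.continuous_exp.aestronglyMeasurable
    ((ae_restrict_iff' measurableSet_Iic).2 (.of_forall fun x hx => by
      rw [norm_of_nonneg (exp_pos x).le]; exact Real.exp_le_one_iff.2 hx))

lemma exp_le_mul_kern {x : ℝ} (hx : x ≤ 0) : exp x ≤ exp π / 2 * kern x := by
  have hπ := pi_pos
  refine le_trans ?_ (mul_le_mul_of_nonneg_left (kern_ge x) (by positivity))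
  rw [abs_of_nonpos hx]
  have h1 := Real.quadratic_le_exp_of_nonneg (x := -x + π) (by linarith)
  have h2 : exp x = exp π / exp (-x + π) := by
    rw [← Real.exp_sub]; congr 1; ring
  have hp : 0 < -x + π := by linarith
  rw [h2, div_mul_div_comm, div_le_div_iff₀ (by positivity) (by positivity)]
  have h3 := exp_pos π
  nlinarith

lemma VagueLE.const_lt {C : ℝ} {P : ℕ → Measure ℝ} {c : ℕ → ℝ} (hC : 0 ≤ C)
    (hc : ∀ n, 0 ≤ c n)
    (h : VagueLE (ofReal C • volume) fun n => ofReal (c n) • P n)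
    {f : ℝ → ℝ} (hf : LowerSemicontinuous fun x => ofReal (f x)) (hf0 : ∀ x, 0 ≤ f x)
    (hfi : Integrable f) (hfP : ∀ n, Integrable f (P n)) {x : ℝ} (hx : x < C * ∫ x, f x) :
    ∀ᶠ n in atTop, x < c n * ∫ y, f y ∂P n := by
  have h1 := h _ hf
  simp only [lintegral_smul_measure, smul_eq_mul] at h1
  rw [← ofReal_integral_eq_lintegral_ofReal hfi (.of_forall hf0),
    ← ofReal_mul hC] at h1
  have h2 : ∀ n, ofReal (c n) * ∫⁻ x, ofReal (f x) ∂P n =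
      ofReal (c n * ∫ y, f y ∂P n) := fun n => by
    rw [← ofReal_integral_eq_lintegral_ofReal (hfP n) (.of_forall hf0),
      ← ofReal_mul (hc n)]
  simp only [h2] at h1
  rcases lt_or_ge x 0 with hx0 | hx0
  · exact Eventually.of_forall fun n =>
      hx0.trans_le (mul_nonneg (hc n) (integral_nonneg hf0))
  · have h3 : ofReal x < ofReal (C * ∫ x, f x) :=
      (ENNReal.ofReal_lt_ofReal_iff (hx0.trans_lt hx)).2 hx
    filter_upwards [eventually_lt_of_lt_liminf (h3.trans_le h1)] with n hn
    exact (ENNReal.ofReal_lt_ofReal_iff_of_nonneg hx0).1 hn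

lemma Attracted.tendsto_exp (h : Attracted (ρ.map Prod.fst) ν c) :
    Tendsto (fun n => c n * ∫ x in Iio 0, exp x ∂walkLaw ρ n) atTop
      (𝓝 ((dens ν 0).re / (2 * π))) := by
  have hD := h.dens_zero_pos
  have hv := h.vague
  set D := (dens ν 0).re with hDd
  have hπ := pi_pos
  set C := D / (2 * π) with hC
  have hC0 : 0 < C := by positivity
  have hcn : ∀ n, 0 ≤ c n := fun n => (h.pos n).le
  set M := exp π / 2 with hM
  have hM0 : 0 < M := by positivity
  have hexp : Integrable ((Iio 0).indicator fun x => exp x) (volume : Measure ℝ) :=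
    (integrable_indicator_iff measurableSet_Iio).2 ((integrableOn_exp_Iic 0).mono_set Iio_subset_Iic_self)
  have hexp' : Integrable ((Iic 0).indicator fun x => exp x) (volume : Measure ℝ) :=
    (integrable_indicator_iff measurableSet_Iic).2 (integrableOn_exp_Iic 0)
  have hexpn : ∀ n, Integrable ((Iio 0).indicator fun x => exp x) (walkLaw ρ n) := fun n =>
    (integrable_indicator_iff measurableSet_Iio).2
      ((integrableOn_exp_Iic_measure _).mono_set Iio_subset_Iic_self)
  have hexpn' : ∀ n, Integrable ((Iic 0).indicator fun x => exp x) (walkLaw ρ n) := fun n =>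
    (integrable_indicator_iff measurableSet_Iic).2 (integrableOn_exp_Iic_measure _)
  set g : ℝ → ℝ := fun x => M * kern x - (Iic 0).indicator (fun x => exp x) x with hg
  have hg0 : ∀ x, 0 ≤ g x := fun x => by
    by_cases hx : x ≤ 0
    · simp only [hg, indicator_of_mem (mem_Iic.2 hx)]
      exact sub_nonneg.2 (exp_le_mul_kern hx)
    · simp only [hg, indicator_of_notMem (fun h => hx (mem_Iic.1 h))]
      rw [sub_zero]
      exact mul_nonneg hM0.le (kern_pos x).le
  have hglsc : LowerSemicontinuous fun x => ofReal (g x) := by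
    have e : (fun x => ofReal (g x)) = fun x =>
        max (ofReal (M * kern x - exp (min x 0)))
          ((Ioi 0).indicator (fun x => ofReal (M * kern x)) x) := by
      funext x
      by_cases hx : x ≤ 0
      · simp [hg, hx, not_lt.2 hx]
      · have hx' : 0 < x := not_le.1 hx
        simp only [hg, indicator_of_notMem (fun h => hx (mem_Iic.1 h)),
          indicator_of_mem (mem_Ioi.2 hx'), sub_zero]
        rw [max_eq_right]
        exact ofReal_le_ofReal (by linarith [exp_pos (min x 0)])
    rw [e]
    refine LowerSemicontinuous.sup (Continuous.lowerSemicontinuous ?_)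
      (lowerSemicontinuous_indicator_of_isOpen isOpen_Ioi ?_)
    · have := continuous_kern
      exact continuous_ofReal.comp (by fun_prop)
    · have := continuous_kern
      exact continuous_ofReal.comp (by fun_prop)
  have hgi : Integrable g := (integrable_kern.const_mul M).sub hexp'
  have hgn : ∀ n, Integrable g (walkLaw ρ n) := fun n =>
    ((integrable_kern_mul _).const_mul M).sub (hexpn' n)
  have hlow : LowerSemicontinuous fun x =>
      ofReal ((Iio 0).indicator (fun x => exp x) x) := by
    have e : (fun x => ofReal ((Iio 0).indicator (fun x => exp x) x)) =
        (Iio 0).indicator fun x => ofReal (exp x) := by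
      funext x
      by_cases hx : x < 0 <;> simp [hx]
    rw [e]
    exact lowerSemicontinuous_indicator_of_isOpen isOpen_Iio
      (continuous_ofReal.comp Real.continuous_exp)
  have i1 : ∫ x, (Iio 0).indicator (fun x => exp x) x = 1 := by
    rw [integral_indicator measurableSet_Iio, ← integral_Iic_eq_integral_Iio, integral_exp_Iic_zero]
  have i2 : ∫ x, g x = M * (4 * π) - 1 := by
    rw [hg, integral_sub (integrable_kern.const_mul M) hexp', integral_const_mul, integral_kern,
      integral_indicator measurableSet_Iic, integral_exp_Iic_zero]
  rw [tendsto_order]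
  constructor
  · intro x hx
    have := hv.const_lt hC0.le hcn hlow (fun x => indicator_nonneg (fun _ _ => (exp_pos _).le) x)
      hexp hexpn (x := x) (by rw [i1, mul_one]; exact hx)
    simpa only [integral_indicator measurableSet_Iio] using this
  · intro x hx
    set δ := (x - C) / 2 with hδ
    have hδ0 : 0 < δ := by rw [hδ]; linarith
    have h1 := hv.const_lt hC0.le hcn hglsc hg0 hgi hgn (x := C * (M * (4 * π) - 1) - δ)
      (by rw [i2]; linarith)
    have h2 := (h.tendsto_kern.const_mul M).eventually_lt_const
      (show _ < M * (2 * D) + δ by linarith)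
    filter_upwards [h1, h2] with n hn1 hn2
    have e1 : c n * ∫ y, g y ∂walkLaw ρ n = M * (c n * ∫ y, kern y ∂walkLaw ρ n) -
        c n * ∫ y in Iic 0, exp y ∂walkLaw ρ n := by
      rw [hg, integral_sub ((integrable_kern_mul _).const_mul M) (hexpn' n), integral_const_mul,
        integral_indicator measurableSet_Iic]
      ring
    have e2 : ∫ y in Iio 0, exp y ∂walkLaw ρ n ≤ ∫ y in Iic 0, exp y ∂walkLaw ρ n :=
      setIntegral_mono_set (integrableOn_exp_Iic_measure _)
        (.of_forall fun y => (exp_pos y).le) Iio_subset_Iic_self.eventuallyLE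
    have e3 : C * (M * (4 * π)) = M * (2 * D) := by
      rw [hC]; field_simp; norm_num
    have e4 := mul_le_mul_of_nonneg_left e2 (hcn n)
    grind

lemma Attracted.tail (h : Attracted (ρ.map Prod.fst) ν c) :
    ∃ R > 0, ∃ K > 0, ∀ n : ℕ, (n : ℝ) * (ρ.map Prod.fst).real {x | R < |x| * (c n)⁻¹} ≤ K := by
  obtain ⟨Λ, hΛ, δ, hδ, N, hN⟩ := h.eventually_near_zero
  obtain ⟨M, hM, htail⟩ := exists_tail_le (ρ.map Prod.fst)
  obtain ⟨N', hN'⟩ := eventually_atTop.1 (h.lim.eventually_ge_atTop M)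
  refine ⟨2 / δ + 1, by positivity, 4 * Λ + N + N', by positivity, fun n => ?_⟩
  have cn := h.pos n
  rcases lt_or_ge n (max N N' + 1) with hn | hn
  · have h1 : (n : ℝ) ≤ N + N' := by
      have h2 : n ≤ N + N' := by grind
      exact_mod_cast h2
    have h3 : (ρ.map Prod.fst).real {x | 2 / δ + 1 < |x| * (c n)⁻¹} ≤ 1 := measureReal_le_one
    nlinarith [mul_le_mul_of_nonneg_left h3 (Nat.cast_nonneg (α := ℝ) n)]
  · have h1 := le_max_left N N'
    have h2 := le_max_right N N'
    have hn0 : (0 : ℝ) < n := by exact_mod_cast (by omega : 0 < n)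
    have h3 := htail (2 * c n / δ) (Λ / n) (by positivity) fun t ht => by
      have h4 : 2 / (2 * c n / δ) = δ / c n := by field_simp
      rw [h4, le_div_iff₀ cn] at ht
      have := hN n (t * c n) (by omega) (by rwa [abs_mul, abs_of_pos cn])
      rwa [mul_div_cancel_right₀ _ cn.ne'] at this
    have h5 : (ρ.map Prod.fst).real {x | 2 / δ + 1 < |x| * (c n)⁻¹} ≤ 4 * (Λ / n) := by
      refine (measureReal_mono (fun x hx => ?_) (measure_ne_top _ _)).trans h3
      change 2 * c n / δ + M < |x|
      replace hx : 2 / δ + 1 < |x| * (c n)⁻¹ := hx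
      rw [← div_eq_mul_inv, lt_div_iff₀ cn] at hx
      grind
    calc (n : ℝ) * (ρ.map Prod.fst).real {x | 2 / δ + 1 < |x| * (c n)⁻¹} ≤ n * (4 * (Λ / n)) := by
          gcongr
      _ = 4 * Λ := by field_simp
      _ ≤ _ := by linarith [Nat.cast_nonneg (α := ℝ) N, Nat.cast_nonneg (α := ℝ) N']

lemma Attracted.mass (h : Attracted (ρ.map Prod.fst) ν c) :
    ∃ q > 0, ∀ᶠ n in atTop, q ≤ (walkLaw ρ n).real (Ici 0) ∧ q ≤ (walkLaw ρ n).real (Iio 0) := by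
  have key : ∀ G : Set ℝ, IsOpen G → 0 < ν G → ∃ q > 0, ∀ᶠ n in atTop,
      q ≤ (walkLaw ρ n).real {x | x / c n ∈ G} := by
    intro G hG hG0
    have hp := toReal_pos hG0.ne' (measure_ne_top _ _)
    refine ⟨(ν G).toReal / 2, by positivity, ?_⟩
    have hlt : ofReal ((ν G).toReal / 2) < ν G := by
      rw [ENNReal.ofReal_lt_iff_lt_toReal (by positivity) (measure_ne_top _ _)]
      linarith
    filter_upwards [eventually_lt_of_lt_liminf (hlt.trans_le (h.le_liminf_open hG))] with n hn
    have := toReal_mono (measure_ne_top _ _) hn.le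
    rwa [toReal_ofReal (by positivity)] at this
  obtain ⟨q₁, hq₁, h1⟩ := key _ isOpen_Ioi h.pos_mass
  obtain ⟨q₂, hq₂, h2⟩ := key _ isOpen_Iio h.neg_mass
  refine ⟨min q₁ q₂, lt_min hq₁ hq₂, ?_⟩
  filter_upwards [h1, h2] with n hn1 hn2
  have cn := h.pos n
  refine ⟨(min_le_left _ _).trans (hn1.trans (measureReal_mono fun x hx => ?_)),
    (min_le_right _ _).trans (hn2.trans (measureReal_mono fun x hx => ?_))⟩
  · exact ((div_pos_iff_of_pos_right cn).1 hx).le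
  · have : x / c n < 0 := hx
    rwa [div_lt_iff₀ cn, zero_mul] at this

lemma Attracted.llt (h : Attracted (ρ.map Prod.fst) ν c) :
    ∃ C, LLT ρ (fun n => (c n)⁻¹) C := by
  have hD := h.dens_zero_pos
  refine ⟨(dens ν 0).re / (2 * π), h.regSeq, ?_, ?_, by positivity, ?_, ?_, h.tail, h.mass⟩
  · obtain ⟨K, hK, N, hN⟩ := h.potter_lower
    refine ⟨K, hK, N, fun m n hm hmn => ?_⟩
    have cm := h.pos m
    have cn := h.pos n
    have := hN m n hm hmn
    rw [inv_pow, inv_pow, ← div_eq_mul_inv, ← div_eq_mul_inv, ← mul_div_assoc,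
      div_le_div_iff₀ (by positivity) (by positivity)]
    linarith
  · simpa only [div_eq_mul_inv] using h.concentration
  · simpa only [inv_inv] using h.vague
  · refine h.tendsto_exp.congr fun n => ?_
    rw [div_inv_eq_mul, mul_comm]

/-- `A` is a half line containing or not containing `0`, and `B` is a half line with the same
orientation which contains `0`. -/
structure HalfPair (A B : Set ℝ) : Prop extends IsHalf A where
  meas' : MeasurableSet B
  zero : (0 : ℝ) ∈ B
  add_mem : ∀ s ∈ B, ∀ a ∈ A, s + a ∈ B
  sub_mem : ∀ s ∈ B, ∀ a ∉ A, s - a ∈ B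

lemma halfPair_Iio {y : ℝ} (hy : 0 < y) : HalfPair (Iio 0) (Iio y) where
  __ := isHalf_Iio
  meas' := measurableSet_Iio
  zero := hy
  add_mem := by grind
  sub_mem := by grind

lemma halfPair_Ici {x : ℝ} (hx : 0 ≤ x) : HalfPair (Ici 0) (Ici (-x)) where
  __ := isHalf_Ici
  meas' := measurableSet_Ici
  zero := by simpa using hx
  add_mem := by grind
  sub_mem := by grind

lemma stayLaw_univ (ρ : Measure (ℝ × ℝ)) (A : Set ℝ) (n : ℕ) :
    stayLaw ρ A n univ = pathLaw ρ (stay A n) := by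
  rw [stayLaw, map_apply (measurable_pS n) MeasurableSet.univ]
  simp

lemma stayLaw_univ_antitone (ρ : Measure (ℝ × ℝ)) (A : Set ℝ) :
    Antitone fun n => stayLaw ρ A n univ := by
  intro m n hmn
  simp only [stayLaw_univ]
  exact measure_mono fun ω hω i h1 h2 => hω i h1 (h2.trans hmn)

variable (ρ) in
lemma stayLaw_univ_le_one (A : Set ℝ) (n : ℕ) :
    stayLaw ρ A n univ ≤ 1 := by
  rw [stayLaw_univ]; exact prob_le_one

/-- Decomposition of the path at its extremum. -/
lemma HalfPair.lintegral_eq (h : HalfPair A B) (n : ℕ) {f : ℝ → ℝ≥0∞} (hf : Measurable f) :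
    ∫⁻ x, f x ∂stayLaw ρ B n = ∑ k ∈ range (n + 1),
      ∫⁻ x in B, ∫⁻ y, f (x + y) ∂stayLaw ρ A (n - k) ∂stayLaw ρ Aᶜ k := by
  rw [lintegral_stayLaw ρ h.meas' n hf]
  have key : ∀ ω, (stay B n).indicator (fun ω => f (pS n ω)) ω = ∑ k ∈ range (n + 1),
      (splitSet A n k).indicator
        (fun ω => (B.indicator (fun _ => f (pS n ω)) (pS k ω))) ω := by
    intro ω
    rw [← sum_indicator_splitSet h.toIsHalf n
      (fun ω => (stay B n).indicator (fun ω => f (pS n ω)) ω) ω]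
    refine sum_congr rfl fun k hk => ?_
    have hk : k ≤ n := by simpa [Nat.lt_succ_iff] using hk
    by_cases hω : ω ∈ splitSet A n k
    · rw [indicator_of_mem hω, indicator_of_mem hω]
      have : ω ∈ stay B n ↔ pS k ω ∈ B := by
        constructor
        · intro hs
          rcases Nat.eq_zero_or_pos k with rfl | h0
          · simpa using h.zero
          · exact hs k h0 hk
        · intro hs i h1 h2
          rcases lt_trichotomy i k with hi | rfl | hi
          · have := h.sub_mem _ hs _ (hω.1 i hi)
            simpa using this
          · exact hs
          · have := h.add_mem _ hs _ (hω.2 i hi h2)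
            simpa using this
      by_cases hs : ω ∈ stay B n
      · rw [indicator_of_mem hs, indicator_of_mem (this.1 hs)]
      · rw [indicator_of_notMem hs, indicator_of_notMem (fun h' => hs (this.2 h'))]
    · rw [indicator_of_notMem hω, indicator_of_notMem hω]
  rw [lintegral_congr key, lintegral_finsetSum' _ ?_]
  · refine sum_congr rfl fun k hk => ?_
    have hk : k ≤ n := by simpa [Nat.lt_succ_iff] using hk
    have hm : Measurable (Function.uncurry fun x s : ℝ => B.indicator (fun _ => f s) x) := by
      have : (Function.uncurry fun x s : ℝ => B.indicator (fun _ => f s) x)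
          = (Prod.fst ⁻¹' B).indicator fun p : ℝ × ℝ => f p.2 := by
        ext p; simp only [Function.uncurry, indicator]; rfl
      rw [this]
      exact (hf.comp measurable_snd).indicator (measurable_fst h.meas')
    rw [lintegral_splitSet ρ h.meas hk hm, ← lintegral_indicator h.meas']
    refine lintegral_congr fun x => ?_
    by_cases hx : x ∈ B
    · simp [hx]
    · simp [hx]
  · intro k hk
    refine (Measurable.indicator ?_ (measurableSet_splitSet h.meas n k)).aemeasurable
    have : (fun ω : Traj => B.indicator (fun _ => f (pS n ω)) (pS k ω))
        = (pS k ⁻¹' B).indicator fun ω => f (pS n ω) := by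
      ext ω; simp only [indicator]; rfl
    rw [this]
    exact (hf.comp (measurable_pS n)).indicator (measurable_pS k h.meas')

lemma sum_range_mul_le (a b : ℕ → ℝ≥0∞) (N : ℕ) :
    ∑ n ∈ range (N + 1), ∑ k ∈ range (n + 1), a k * b (n - k)
      ≤ (∑ k ∈ range (N + 1), a k) * ∑ j ∈ range (N + 1), b j := by
  rw [Finset.sum_range_diag_flip (N + 1) fun k j => a k * b j, sum_mul]
  refine sum_le_sum fun k _ => ?_
  rw [mul_sum]
  exact sum_le_sum_of_subset (Finset.range_subset_range.2 (by omega))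

lemma le_sum_range_mul (a b : ℕ → ℝ≥0∞) (N : ℕ) :
    (∑ k ∈ range (N + 1), a k) * ∑ j ∈ range (N + 1), b j
      ≤ ∑ n ∈ range (2 * N + 1), ∑ k ∈ range (n + 1), a k * b (n - k) := by
  rw [Finset.sum_range_diag_flip (2 * N + 1) fun k j => a k * b j, sum_mul]
  refine (sum_le_sum fun k hk => ?_).trans
    (sum_le_sum_of_subset (Finset.range_subset_range.2 (by omega)))
  rw [mul_sum]
  have := mem_range.1 hk
  exact sum_le_sum_of_subset (Finset.range_subset_range.2 (by omega))

lemma HalfPair.mass_eq (h : HalfPair A B) (n : ℕ) :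
    stayLaw ρ B n univ = ∑ k ∈ range (n + 1),
      stayLaw ρ Aᶜ k B * stayLaw ρ A (n - k) univ := by
  have := h.lintegral_eq (ρ := ρ) n (f := fun _ => 1) measurable_const
  simp only [lintegral_const, Measure.restrict_apply MeasurableSet.univ, univ_inter, one_mul]
    at this
  grind

lemma HalfPair.mass_le (h : HalfPair A B) (N : ℕ) :
    ((N + 1 : ℕ) : ℝ≥0∞) * stayLaw ρ B N univ
      ≤ (∑' k, stayLaw ρ Aᶜ k B) * ∑ j ∈ range (N + 1), stayLaw ρ A j univ := by
  calc ((N + 1 : ℕ) : ℝ≥0∞) * stayLaw ρ B N univ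
      = ∑ n ∈ range (N + 1), stayLaw ρ B N univ := by simp
    _ ≤ ∑ n ∈ range (N + 1), stayLaw ρ B n univ :=
        sum_le_sum fun n hn => stayLaw_univ_antitone ρ B
          (Nat.lt_succ_iff.1 (mem_range.1 hn))
    _ = ∑ n ∈ range (N + 1), ∑ k ∈ range (n + 1),
          stayLaw ρ Aᶜ k B * stayLaw ρ A (n - k) univ :=
        sum_congr rfl fun n _ => h.mass_eq n
    _ ≤ _ := sum_range_mul_le (fun k => stayLaw ρ Aᶜ k B) (fun j => stayLaw ρ A j univ) N
    _ ≤ _ := mul_le_mul' (sum_le_tsum (range (N + 1))) le_rfl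

lemma HalfPair.sum_univ (h : HalfPair A B) (n : ℕ) :
    ∑ k ∈ range (n + 1), stayLaw ρ Aᶜ k univ * stayLaw ρ A (n - k) univ = 1 := by
  have := congrArg (fun m : Measure ℝ => m univ) (sum_stayLaw_conv ρ h.toIsHalf n)
  simp only [measure_univ, Measure.finsetSum_apply] at this
  rw [← this]
  refine sum_congr rfl fun k _ => ?_
  rw [← lintegral_one (μ := (stayLaw ρ Aᶜ k).conv _), Measure.lintegral_conv measurable_const]
  simp [mul_comm]

lemma HalfPair.mul_sum_le (h : HalfPair A B) (N : ℕ) :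
    (∑ k ∈ range (N + 1), stayLaw ρ Aᶜ k univ)
      * ∑ j ∈ range (N + 1), stayLaw ρ A j univ ≤ (2 * N + 1 : ℕ) := by
  refine (le_sum_range_mul (fun k => stayLaw ρ Aᶜ k univ) (fun j => stayLaw ρ A j univ) N).trans ?_
  rw [sum_congr rfl fun n _ => h.sum_univ n]
  simp

/-- Law of the walk at time `n` on the event that it stays negative. -/
abbrev descLaw (ρ : Measure (ℝ × ℝ)) (n : ℕ) : Measure ℝ := stayLaw ρ (Iio 0) n

/-- Law of the walk at time `n` on the event that it stays nonnegative. -/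
abbrev ascLaw (ρ : Measure (ℝ × ℝ)) (n : ℕ) : Measure ℝ := stayLaw ρ (Ici 0) n

lemma descLaw_zero : descLaw ρ 0 = Measure.dirac 0 := stayLaw_zero ρ _

lemma ascLaw_zero : ascLaw ρ 0 = Measure.dirac 0 := stayLaw_zero ρ _

/-- Renewal function of the walk staying negative. -/
def renU (ρ : Measure (ℝ × ℝ)) (x : ℝ) : ℝ≥0∞ := ∑' k, descLaw ρ k (Ici (-x))

/-- Renewal function of the walk staying nonnegative. -/
def renV (ρ : Measure (ℝ × ℝ)) (y : ℝ) : ℝ≥0∞ := 1 + ∑' k, ascLaw ρ (k + 1) (Iio y)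

lemma renV_eq {y : ℝ} (hy : 0 < y) : renV ρ y = ∑' k, ascLaw ρ k (Iio y) := by
  rw [tsum_eq_zero_add' summable, renV, ascLaw_zero]
  simp [hy]

lemma renU_mono : Monotone (renU ρ) := fun _ _ h =>
  tsum_le_tsum fun _ => measure_mono (Ici_subset_Ici.2 (by linarith))

lemma renV_mono : Monotone (renV ρ) := fun _ _ h =>
  add_le_add le_rfl (tsum_le_tsum fun _ => measure_mono (Iio_subset_Iio h))

lemma one_le_renU {x : ℝ} (hx : 0 ≤ x) : 1 ≤ renU ρ x := by
  refine le_trans ?_ (le_tsum 0)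
  rw [descLaw_zero]
  simp [hx]

lemma one_le_renV (y : ℝ) : 1 ≤ renV ρ y := le_self_add

lemma stayLaw_Iio_le {y : ℝ} (hy : 0 ≤ y) (N : ℕ) :
    ((N + 1 : ℕ) : ℝ≥0∞) * stayLaw ρ (Iio y) N univ
      ≤ renV ρ y * ∑ j ∈ range (N + 1), descLaw ρ j univ := by
  rcases hy.eq_or_lt with rfl | hy
  · calc ((N + 1 : ℕ) : ℝ≥0∞) * stayLaw ρ (Iio 0) N univ
        = ∑ n ∈ range (N + 1), descLaw ρ N univ := by simp
      _ ≤ ∑ n ∈ range (N + 1), descLaw ρ n univ :=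
          sum_le_sum fun n hn => stayLaw_univ_antitone ρ _
            (Nat.lt_succ_iff.1 (mem_range.1 hn))
      _ ≤ _ := le_mul_of_one_le_left bot_le (one_le_renV 0)
  · rw [renV_eq hy]
    simpa only [compl_Iio] using (halfPair_Iio hy).mass_le (ρ := ρ) N

lemma stayLaw_Ici_le {x : ℝ} (hx : 0 ≤ x) (N : ℕ) :
    ((N + 1 : ℕ) : ℝ≥0∞) * stayLaw ρ (Ici (-x)) N univ
      ≤ renU ρ x * ∑ j ∈ range (N + 1), ascLaw ρ j univ := by
  simpa only [compl_Ici, renU] using (halfPair_Ici hx).mass_le (ρ := ρ) N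

lemma sum_desc_mul_sum_asc_le (N : ℕ) :
    (∑ j ∈ range (N + 1), descLaw ρ j univ)
      * ∑ j ∈ range (N + 1), ascLaw ρ j univ ≤ (2 * N + 1 : ℕ) := by
  simpa only [compl_Ici] using (halfPair_Ici le_rfl).mul_sum_le (ρ := ρ) N

/-- Product bound for the probabilities of staying on one side of a barrier. -/
lemma stayLaw_mul_le {x y : ℝ} (hx : 0 ≤ x) (hy : 0 ≤ y) (N : ℕ) :
    ((N + 1 : ℕ) : ℝ≥0∞) * (stayLaw ρ (Iio y) N univ * stayLaw ρ (Ici (-x)) N univ)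
      ≤ 2 * (renV ρ y * renU ρ x) := by
  have h0 : ((N + 1 : ℕ) : ℝ≥0∞) ≠ 0 := by simp
  have h1 : ((N + 1 : ℕ) : ℝ≥0∞) ≠ ⊤ := ENNReal.natCast_ne_top _
  rw [← ENNReal.mul_le_mul_iff_right h0 h1]
  calc ((N + 1 : ℕ) : ℝ≥0∞) * (((N + 1 : ℕ) : ℝ≥0∞)
        * (stayLaw ρ (Iio y) N univ * stayLaw ρ (Ici (-x)) N univ))
      = (((N + 1 : ℕ) : ℝ≥0∞) * stayLaw ρ (Iio y) N univ)
        * (((N + 1 : ℕ) : ℝ≥0∞) * stayLaw ρ (Ici (-x)) N univ) := by ring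
    _ ≤ _ := mul_le_mul' (stayLaw_Iio_le hy N) (stayLaw_Ici_le hx N)
    _ = (renV ρ y * renU ρ x) * ((∑ j ∈ range (N + 1), descLaw ρ j univ)
        * ∑ j ∈ range (N + 1), ascLaw ρ j univ) := by ring
    _ ≤ (renV ρ y * renU ρ x) * (2 * N + 1 : ℕ) := mul_le_mul_right (sum_desc_mul_sum_asc_le N) _
    _ ≤ (renV ρ y * renU ρ x) * (2 * (N + 1 : ℕ)) := by
        refine mul_le_mul_right ?_ _
        exact_mod_cast (by omega : 2 * N + 1 ≤ 2 * (N + 1))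
    _ = _ := by ring

/-- A path of length `h + m + k` whose last `k` steps are run backwards. -/
def pcat3 (h m k : ℕ) (ω₁ ω₂ ω₃ : Traj) : Traj :=
  pcat h ω₁ (pcat m ω₂ (prev k ω₃))

lemma measurable_pcat3 (h m k : ℕ) :
    Measurable fun p : Traj × Traj × Traj =>
      pcat3 h m k p.1 p.2.1 p.2.2 := by
  unfold pcat3; fun_prop

variable (ρ) in
lemma lintegral_pcat3 (h m k : ℕ)
    {f : Traj → ℝ≥0∞} (hf : Measurable f) :
    ∫⁻ ω, f ω ∂pathLaw ρ
      = ∫⁻ ω₁, ∫⁻ ω₃, ∫⁻ ω₂, f (pcat3 h m k ω₁ ω₂ ω₃) ∂pathLaw ρ ∂pathLaw ρ ∂pathLaw ρ := by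
  rw [lintegral_pcat ρ h hf]
  refine lintegral_congr fun ω₁ => ?_
  have h1 : Measurable fun ω => f (pcat h ω₁ ω) := hf.comp (by fun_prop)
  rw [lintegral_pcat ρ m h1, lintegral_lintegral_swap]
  · rw [lintegral_prev ρ k]
    · rfl
    · exact Measurable.lintegral_prod_left' (f := fun p : Traj × Traj =>
        f (pcat h ω₁ (pcat m p.1 p.2))) (hf.comp (by fun_prop))
  · exact Measurable.aemeasurable (f := fun p : Traj × Traj =>
      f (pcat h ω₁ (pcat m p.1 p.2))) (hf.comp (by fun_prop))

lemma pS_pcat3_left {h m k i : ℕ} (hi : i ≤ h) (ω₁ ω₂ ω₃ : Traj) :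
    pS i (pcat3 h m k ω₁ ω₂ ω₃) = pS i ω₁ := pS_pcat_of_le hi _ _

lemma pS_pcat3_middle {h m k i : ℕ} (hi : i ≤ m) (ω₁ ω₂ ω₃ : Traj) :
    pS (h + i) (pcat3 h m k ω₁ ω₂ ω₃) = pS h ω₁ + pS i ω₂ := by
  rw [pcat3, pS_pcat_add, pS_pcat_of_le hi]

lemma pS_pcat3_right {h m k i : ℕ} (hi : i ≤ k) (ω₁ ω₂ ω₃ : Traj) :
    pS (h + m + i) (pcat3 h m k ω₁ ω₂ ω₃) = pS h ω₁ + pS m ω₂ + (pS k ω₃ - pS (k - i) ω₃) := by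
  rw [pcat3, add_assoc, pS_pcat_add, pS_pcat_add, pS_prev hi, add_assoc]

lemma pS_pcat3 (h m k : ℕ) (ω₁ ω₂ ω₃ : Traj) :
    pS (h + m + k) (pcat3 h m k ω₁ ω₂ ω₃) = pS h ω₁ + pS m ω₂ + pS k ω₃ := by
  rw [pS_pcat3_right le_rfl]; simp

/-- Local bound for the walk staying below a barrier. -/
lemma stayLaw_local_le {ℓ : ℕ → ℝ} {K : ℝ}
    (hc : ∀ n y, (walkLaw ρ n).real (Icc y (y + 1)) ≤ K * ℓ n) {h m : ℕ} (hm : 1 ≤ m) (y a : ℝ) :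
    stayLaw ρ (Iio y) (h + m + h) (Icc a (a + 1))
      ≤ stayLaw ρ (Iio y) h univ * stayLaw ρ (Ici (a - y)) h univ * ofReal (K * ℓ m) := by
  rw [← lintegral_indicator_one measurableSet_Icc,
    lintegral_stayLaw ρ measurableSet_Iio _ (measurable_one.indicator measurableSet_Icc),
    lintegral_pcat3 ρ h m h (f := fun ω => (stay (Iio y) (h + m + h)).indicator (fun ω =>
      (Icc a (a + 1)).indicator (1 : ℝ → ℝ≥0∞) (pS (h + m + h) ω)) ω) (((measurable_one.indicator measurableSet_Icc).comp
      (measurable_pS _)).indicator (measurableSet_stay measurableSet_Iio _)), stayLaw_univ,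
    stayLaw_univ, ← lintegral_indicator_one (measurableSet_stay measurableSet_Iio _),
    ← lintegral_indicator_one (measurableSet_stay measurableSet_Ici _), mul_assoc,
    ← lintegral_mul_const _ (measurable_one.indicator (measurableSet_stay measurableSet_Iio _))]
  refine lintegral_mono fun ω₁ => ?_
  simp only
  rw [← lintegral_mul_const _ (measurable_one.indicator (measurableSet_stay measurableSet_Ici _)),
    ← lintegral_const_mul _ (by
      exact (measurable_one.indicator (measurableSet_stay measurableSet_Ici _)).mul_const _)]
  refine lintegral_mono fun ω₃ => ?_
  simp only
  have key : ∀ ω₂, (stay (Iio y) (h + m + h)).indicator (fun ω =>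
      (Icc a (a + 1)).indicator (1 : ℝ → ℝ≥0∞) (pS (h + m + h) ω)) (pcat3 h m h ω₁ ω₂ ω₃)
      ≤ (stay (Iio y) h).indicator 1 ω₁ * ((stay (Ici (a - y)) h).indicator 1 ω₃ *
        (Icc (a - pS h ω₁ - pS h ω₃) (a - pS h ω₁ - pS h ω₃ + 1)).indicator
          (1 : ℝ → ℝ≥0∞) (pS m ω₂)) := by
    intro ω₂
    by_cases h1 : pcat3 h m h ω₁ ω₂ ω₃ ∈ stay (Iio y) (h + m + h)
    · rw [indicator_of_mem h1]
      by_cases h2 : pS (h + m + h) (pcat3 h m h ω₁ ω₂ ω₃) ∈ Icc a (a + 1)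
      · have e1 : ω₁ ∈ stay (Iio y) h := fun i hi hi' => by
          have := h1 i hi (by omega)
          rwa [pS_pcat3_left hi'] at this
        have e2 : ω₃ ∈ stay (Ici (a - y)) h := fun i hi hi' => by
          have h3 := h1 (h + m + (h - i)) (by omega) (by omega)
          rw [pS_pcat3_right (by omega), Nat.sub_sub_self hi'] at h3
          rw [pS_pcat3] at h2
          grind
        rw [pS_pcat3] at h2
        have e3 : pS m ω₂ ∈ Icc (a - pS h ω₁ - pS h ω₃) (a - pS h ω₁ - pS h ω₃ + 1) :=
          ⟨by linarith [h2.1], by linarith [h2.2]⟩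
        rw [indicator_of_mem e1, indicator_of_mem e2, indicator_of_mem e3]
        simp only [Pi.one_apply, mul_one]
        exact indicator_le (fun _ _ => le_rfl) _
      · rw [indicator_of_notMem h2]; exact bot_le
    · rw [indicator_of_notMem h1]; exact bot_le
  refine (lintegral_mono key).trans ?_
  have hm' : Measurable fun ω => (Icc (a - pS h ω₁ - pS h ω₃) (a - pS h ω₁ - pS h ω₃ + 1)).indicator
      (1 : ℝ → ℝ≥0∞) (pS m ω) := (measurable_one.indicator measurableSet_Icc).comp (measurable_pS _)
  rw [lintegral_const_mul _ (hm'.const_mul _), lintegral_const_mul _ hm']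
  refine mul_le_mul_right (mul_le_mul_right ?_ _) _
  have := hc m (a - pS h ω₁ - pS h ω₃)
  rw [← lintegral_walkLaw ρ m (measurable_one.indicator measurableSet_Icc),
    lintegral_indicator_one measurableSet_Icc]
  rw [Measure.real] at this
  rw [← ofReal_toReal (measure_ne_top (walkLaw ρ m) _)]
  exact ofReal_le_ofReal this

/-- The norming sequence of the local estimates for the conditioned walk. -/
def bseq (ℓ : ℕ → ℝ) (n : ℕ) : ℝ≥0∞ := ofReal (ℓ n / n)

lemma LLT.local_le (hL : LLT ρ ℓ C) : ∃ K : ℝ≥0∞, K ≠ ⊤ ∧ ∀ n, 1 ≤ n → ∀ x y : ℝ, 0 ≤ x → 0 ≤ y →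
    stayLaw ρ (Iio y) n (Icc (y - x) (y - x + 1)) ≤ K * bseq ℓ n * renV ρ y * renU ρ x := by
  obtain ⟨K, hK, hc⟩ := hL.conc
  obtain ⟨K', hK', hc'⟩ := hL.reg.comp_pow 2
  refine ⟨ofReal (6 * K * K'), ofReal_ne_top, fun n hn x y hx hy => ?_⟩
  set h := n / 3 with hh
  set m := n - 2 * h with hm
  have e : n = h + m + h := by omega
  have h1 := stayLaw_local_le hc (h := h) (m := m) (by omega) y (y - x)
  rw [← e, show y - x - y = -x by ring] at h1
  have h2 := stayLaw_mul_le (ρ := ρ) hx hy h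
  have hn0 : (0 : ℝ) < n := by exact_mod_cast hn
  have h3 : ofReal (K * ℓ m)
      ≤ ((h + 1 : ℕ) : ℝ≥0∞) * (ofReal (3 * K * K') * bseq ℓ n) := by
    rw [bseq, ← ENNReal.ofReal_natCast, ← ofReal_mul (by positivity),
      ← ofReal_mul (by positivity)]
    refine ofReal_le_ofReal ?_
    have h4 := hc' m n (by omega)
    have h5 : (n : ℝ) ≤ 3 * ((h + 1 : ℕ) : ℝ) := by
      exact_mod_cast (by omega : n ≤ 3 * (h + 1))
    calc K * ℓ m ≤ K * (K' * ℓ n) := by gcongr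
      _ = K * K' * ℓ n * (n / n) := by field_simp
      _ ≤ K * K' * ℓ n * (3 * ((h + 1 : ℕ) : ℝ) / n) := by
          have := (hL.reg.pos n).le
          gcongr
      _ = _ := by ring
  calc _ ≤ _ := h1
    _ ≤ stayLaw ρ (Iio y) h univ * stayLaw ρ (Ici (-x)) h univ *
        (((h + 1 : ℕ) : ℝ≥0∞) * (ofReal (3 * K * K') * bseq ℓ n)) := mul_le_mul_right h3 _
    _ = (((h + 1 : ℕ) : ℝ≥0∞) * (stayLaw ρ (Iio y) h univ * stayLaw ρ (Ici (-x)) h univ))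
        * (ofReal (3 * K * K') * bseq ℓ n) := by ring
    _ ≤ (2 * (renV ρ y * renU ρ x)) * (ofReal (3 * K * K') * bseq ℓ n) :=
        mul_le_mul_left h2 _
    _ = ofReal (6 * K * K') * bseq ℓ n * renV ρ y * renU ρ x := by
        rw [show 6 * K * K' = 2 * (3 * K * K') by ring, ofReal_mul zero_le_two]
        rw [show ofReal 2 = 2 by simp]
        ring

/-- The exponentially tilted mass of the walk staying in `A`. -/
def tilt (ρ : Measure (ℝ × ℝ)) (A : Set ℝ) (θ : ℝ) (n : ℕ) : ℝ≥0∞ :=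
  ∫⁻ x, ofReal (exp (θ * x)) ∂stayLaw ρ A n

lemma measurable_ofReal_exp_mul (θ : ℝ) :
    Measurable fun x : ℝ => ofReal (exp (θ * x)) := by fun_prop

lemma tilt_zero : tilt ρ A θ 0 = 1 := by
  rw [tilt, stayLaw_zero, lintegral_dirac' _ (measurable_ofReal_exp_mul θ)]
  simp

lemma tilt_le (hA : MeasurableSet A) (hθ : ∀ x ∈ A, θ * x ≤ 0) (n : ℕ) :
    tilt ρ A θ n ≤ 1 := by
  rcases Nat.eq_zero_or_pos n with rfl | hn
  · rw [tilt_zero]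
  · refine le_trans ?_ (stayLaw_univ_le_one ρ A n)
    rw [tilt, ← lintegral_one]
    refine lintegral_mono_ae ?_
    have : ∀ᵐ x ∂stayLaw ρ A n, x ∈ A := by
      rw [ae_iff]; exact stayLaw_compl_of_pos ρ hA hn
    filter_upwards [this] with x hx
    rw [← ofReal_one]
    exact ofReal_le_ofReal (Real.exp_le_one_iff.2 (hθ x hx))

lemma setLIntegral_exp_le (hA : MeasurableSet A) (hθ : ∀ x ∈ A, θ * x ≤ 0) (n : ℕ) :
    ∫⁻ x in A, ofReal (exp (θ * x)) ∂walkLaw ρ n ≤ walkLaw ρ n A := by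
  calc _ ≤ ∫⁻ x in A, 1 ∂walkLaw ρ n := by
        refine setLIntegral_mono' hA fun x hx => ?_
        rw [← ofReal_one]
        exact ofReal_le_ofReal (Real.exp_le_one_iff.2 (hθ x hx))
    _ = _ := by simp

lemma spitzerSeq_tilt (hA : IsHalf A) (hθ : ∀ x ∈ A, θ * x ≤ 0) :
    SpitzerSeq (fun n => (tilt ρ A θ n).toReal)
      (fun k => (∫⁻ x in A, ofReal (exp (θ * x)) ∂walkLaw ρ k).toReal) where
  zero := by rw [tilt_zero]; rfl
  nonneg := fun n => toReal_nonneg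
  nonneg' := fun n => toReal_nonneg
  recurrence := fun n => by
    have h := spitzer ρ hA n (measurable_ofReal_exp_mul θ)
    have h2 : ∀ k, ∫⁻ x in A, ∫⁻ y, ofReal (exp (θ * (x + y)))
          ∂stayLaw ρ A (n - k) ∂walkLaw ρ (k + 1)
        = (∫⁻ x in A, ofReal (exp (θ * x)) ∂walkLaw ρ (k + 1))
          * tilt ρ A θ (n - k) := by
      intro k
      rw [← lintegral_mul_const _ (measurable_ofReal_exp_mul θ)]
      refine lintegral_congr fun x => ?_
      rw [tilt, ← lintegral_const_mul _ (measurable_ofReal_exp_mul θ)]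
      refine lintegral_congr fun y => ?_
      rw [mul_add, exp_add, ofReal_mul (exp_pos _).le]
    simp only [h2] at h
    have h3 := congrArg ENNReal.toReal h
    rw [toReal_mul, ENNReal.toReal_natCast, ENNReal.toReal_sum] at h3
    · simpa only [tilt, toReal_mul, Nat.cast_add, Nat.cast_one] using h3
    · intro k _
      refine mul_ne_top ?_ ?_
      · exact ((setLIntegral_exp_le hA.meas hθ _).trans_lt (measure_lt_top _ _)).ne
      · exact ((tilt_le hA.meas hθ _).trans_lt one_lt_top).ne

lemma lintegral_exp_neg_abs_le {μ : Measure ℝ} {K l : ℝ} (hK : 0 ≤ K)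
    (hμ : ∀ y, μ (Icc y (y + 1)) ≤ ofReal K) (hl : 0 < l) :
    ∫⁻ x, ofReal (exp (-(l * |x|))) ∂μ ≤ ofReal (2 * K * (1 + 1 / l)) := by
  have hr : exp (-l) < 1 := by
    rw [← Real.exp_zero]; exact Real.exp_lt_exp.2 (by linarith)
  have hpt : ∀ x : ℝ, ofReal (exp (-(l * |x|))) ≤
      ∑' j : ℕ, (ofReal (exp (-l) ^ j) * (Icc (j : ℝ) (j + 1)).indicator 1 x
        + ofReal (exp (-l) ^ j) *
          (Icc (-(j + 1) : ℝ) (-(j + 1) + 1)).indicator 1 x) := by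
    intro x
    refine le_trans ?_ (le_tsum ⌊|x|⌋₊)
    have h1 := Nat.floor_le (abs_nonneg x)
    have h2 := Nat.lt_floor_add_one |x|
    set j := ⌊|x|⌋₊
    have h3 : ofReal (exp (-(l * |x|))) ≤ ofReal (exp (-l) ^ j) := by
      refine ofReal_le_ofReal ?_
      rw [← Real.exp_nat_mul]
      exact exp_le_exp.2 (by nlinarith)
    rcases le_total 0 x with hx | hx
    · rw [abs_of_nonneg hx] at h1 h2
      refine le_trans ?_ le_self_add
      rw [indicator_of_mem (by exact ⟨h1, h2.le⟩)]
      simpa using h3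
    · rw [abs_of_nonpos hx] at h1 h2
      refine le_trans ?_ le_add_self
      rw [indicator_of_mem (by constructor <;> linarith)]
      simpa using h3
  calc _ ≤ ∫⁻ x, ∑' j : ℕ, (ofReal (exp (-l) ^ j) *
            (Icc (j : ℝ) (j + 1)).indicator 1 x + ofReal (exp (-l) ^ j) *
          (Icc (-(j + 1) : ℝ) (-(j + 1) + 1)).indicator 1 x) ∂μ := lintegral_mono hpt
    _ = ∑' j : ℕ, (ofReal (exp (-l) ^ j) * μ (Icc (j : ℝ) (j + 1))
        + ofReal (exp (-l) ^ j) * μ (Icc (-(j + 1) : ℝ) (-(j + 1) + 1))) := by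
        rw [lintegral_tsum]
        · congr 1; funext j
          rw [lintegral_add_left, lintegral_const_mul, lintegral_const_mul,
            lintegral_indicator_one measurableSet_Icc, lintegral_indicator_one measurableSet_Icc]
          · exact measurable_one.indicator measurableSet_Icc
          · exact measurable_one.indicator measurableSet_Icc
          · exact (measurable_one.indicator measurableSet_Icc).const_mul _
        · intro j
          exact (((measurable_one.indicator measurableSet_Icc).const_mul _).add
            ((measurable_one.indicator measurableSet_Icc).const_mul _)).aemeasurable
    _ ≤ ∑' j : ℕ, ofReal (exp (-l) ^ j * (2 * K)) := by
        refine tsum_le_tsum fun j => ?_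
        rw [two_mul, mul_add, ofReal_add (by positivity) (by positivity),
          ofReal_mul (by positivity)]
        exact add_le_add (mul_le_mul_right (hμ _) _) (mul_le_mul_right (hμ _) _)
    _ = ofReal ((1 - exp (-l))⁻¹ * (2 * K)) := by
        rw [← ENNReal.ofReal_tsum_of_nonneg (fun j => by positivity)
          ((summable_geometric_of_lt_one (exp_pos _).le hr).mul_right _),
          tsum_mul_right, tsum_geometric_of_lt_one (exp_pos _).le hr]
    _ ≤ _ := by
        refine ofReal_le_ofReal ?_
        rw [mul_comm]
        refine mul_le_mul_of_nonneg_left ?_ (by positivity)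
        rw [inv_le_comm₀ (by linarith) (by positivity)]
        have h1 : exp (-l) ≤ (1 + l)⁻¹ := by
          rw [exp_neg]
          exact inv_anti₀ (by positivity) (by linarith [Real.add_one_le_exp l])
        have h2 : (1 + 1 / l)⁻¹ = 1 - (1 + l)⁻¹ := by field_simp; ring
        linarith

lemma inv_sqrt_step {k : ℕ} (hk : 1 ≤ k) :
    1 / (((k : ℝ) + 1) * √((k : ℝ) + 1)) ≤ 2 * (1 / √(k : ℝ) - 1 / √((k : ℝ) + 1)) := by
  have hk' : (0 : ℝ) < k := by exact_mod_cast hk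
  set a := √(k : ℝ) with ha
  set b := √((k : ℝ) + 1) with hb
  have ha0 : 0 < a := Real.sqrt_pos.2 hk'
  have hb0 : 0 < b := Real.sqrt_pos.2 (by linarith)
  have ha2 : a ^ 2 = k := Real.sq_sqrt hk'.le
  have hb2 : b ^ 2 = (k : ℝ) + 1 := Real.sq_sqrt (by linarith)
  have hab : a ≤ b := Real.sqrt_le_sqrt (by linarith)
  rw [← hb2, div_sub_div _ _ ha0.ne' hb0.ne', mul_div_assoc', div_le_div_iff₀ (by positivity)
    (by positivity)]
  have h1 : (b - a) * (b + a) = 1 := by nlinarith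
  have h3 : 1 ≤ (b - a) * (2 * b) := by
    rw [← h1]; exact mul_le_mul_of_nonneg_left (by linarith) (by linarith)
  calc 1 * (a * b) ≤ ((b - a) * (2 * b)) * (b * b) := by
        refine mul_le_mul h3 (mul_le_mul_of_nonneg_right hab hb0.le) (by positivity) (by linarith)
    _ = 2 * (1 * b - a * 1) * (b ^ 2 * b) := by ring

lemma LLT.tail_sum_le (hL : LLT ρ ℓ C) : ∃ K, 0 < K ∧ ∃ N : ℕ, 1 ≤ N ∧ ∀ n, N ≤ n → ∀ M, n ≤ M →
    ∑ k ∈ Finset.Ico n M, ℓ (k + 1) / ((k : ℝ) + 1) ≤ K * ℓ n := by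
  obtain ⟨K, hK, N, hp⟩ := hL.potter
  refine ⟨2 * √K, by positivity, N + 1, by omega, fun n hn M hM => ?_⟩
  have hn0 : (0 : ℝ) < n := by exact_mod_cast (by omega : 0 < n)
  have hl := hL.reg.pos n
  have key : ∀ M, n ≤ M → ∑ k ∈ Finset.Ico n M, ℓ (k + 1) / ((k : ℝ) + 1)
      ≤ 2 * √K * √n * ℓ n * (1 / √(n : ℝ) - 1 / √(M : ℝ)) := by
    intro M hM
    induction M, hM using Nat.le_induction with
    | base => simp
    | succ M hM ih =>
      rw [Finset.sum_Ico_succ_top hM]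
      have hM0 : (0 : ℝ) < M := by exact_mod_cast (by omega : 0 < M)
      have h1 := hp n (M + 1) (by omega) (by omega)
      have h2 : ℓ (M + 1) ≤ √K * √n * ℓ n / √((M : ℝ) + 1) := by
        rw [le_div_iff₀ (Real.sqrt_pos.2 (by linarith))]
        refine (sq_le_sq₀ (mul_nonneg (hL.reg.pos _).le (Real.sqrt_nonneg _)) (by positivity)).1 ?_
        rw [mul_pow, mul_pow, mul_pow, Real.sq_sqrt hK.le, Real.sq_sqrt hn0.le,
          Real.sq_sqrt (by linarith)]
        push_cast at h1
        linarith
      have h3 : ℓ (M + 1) / ((M : ℝ) + 1)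
          ≤ √K * √n * ℓ n * (1 / (((M : ℝ) + 1) * √((M : ℝ) + 1))) := by
        calc _ ≤ √K * √n * ℓ n / √((M : ℝ) + 1) / ((M : ℝ) + 1) := by gcongr
          _ = _ := by field_simp
      have h4 := mul_le_mul_of_nonneg_left (inv_sqrt_step (k := M) (by omega))
        (by positivity : 0 ≤ √K * √n * ℓ n)
      push_cast
      linarith
  refine (key M hM).trans ?_
  calc 2 * √K * √n * ℓ n * (1 / √(n : ℝ) - 1 / √(M : ℝ)) ≤ 2 * √K * √n * ℓ n * (1 / √(n : ℝ)) := by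
        refine mul_le_mul_of_nonneg_left ?_ (by positivity)
        have : 0 ≤ 1 / √(M : ℝ) := by positivity
        linarith
    _ = _ := by grind

/-- The exponential of the truncated Spitzer series. -/
def spitzerExp (ρ : Measure (ℝ × ℝ)) (A : Set ℝ) (n : ℕ) : ℝ :=
  exp (∑ k ∈ range n, (walkLaw ρ (k + 1)).real A / ((k : ℝ) + 1))

lemma spitzerExp_pos (n : ℕ) : 0 < spitzerExp ρ A n := exp_pos _

lemma spitzerExp_mono (ρ : Measure (ℝ × ℝ)) (A : Set ℝ) : Monotone (spitzerExp ρ A) :=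
  fun m n h => exp_le_exp.2 (sum_le_sum_of_subset_of_nonneg
    (Finset.range_subset_range.2 h) fun _ _ _ => by positivity)

lemma LLT.exists_le (hL : LLT ρ ℓ C) : ∃ K, 0 < K ∧ ∀ n, ℓ n ≤ K := by
  obtain ⟨K, hK, h⟩ := hL.reg.comp
  exact ⟨K * ℓ 0, mul_pos hK (hL.reg.pos 0), fun n => h n 0 (by omega)⟩

lemma LLT.tsum_tilt_le (hL : LLT ρ ℓ C) : ∃ K, 0 < K ∧ ∃ N : ℕ, 1 ≤ N ∧ ∀ n, N ≤ n →
    ∀ (A : Set ℝ) (θ : ℝ), IsHalf A → (∀ x ∈ A, θ * x ≤ 0) → |θ| = ℓ n →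
      ∑' k, tilt ρ A θ k ≤ ofReal (K * spitzerExp ρ A n) := by
  obtain ⟨K₁, hK₁, N, hN, ht⟩ := hL.tail_sum_le
  obtain ⟨K₂, hK₂, hc⟩ := hL.conc
  obtain ⟨K₃, hK₃, hb⟩ := hL.exists_le
  refine ⟨exp (2 * K₂ * (K₃ + 1) * K₁), exp_pos _, N, hN, fun n hn A θ hA hθ hθn => ?_⟩
  have hln := hL.reg.pos n
  have hS := spitzerSeq_tilt (ρ := ρ) hA hθ
  refine ENNReal.tsum_le_of_sum_range_le fun N' => ?_
  have hfin : ∀ k, tilt ρ A θ k ≠ ⊤ := fun k => ((tilt_le hA.meas hθ k).trans_lt one_lt_top).ne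
  rw [← ofReal_toReal (ENNReal.sum_ne_top.2 fun k _ => hfin k),
    ENNReal.toReal_sum fun k _ => hfin k]
  refine ofReal_le_ofReal ?_
  have h1 := hS.sum_le_exp N'
  refine (sum_le_sum_of_subset_of_nonneg (Finset.range_subset_range.2 (Nat.le_succ N'))
    fun _ _ _ => toReal_nonneg).trans (h1.trans ?_)
  rw [spitzerExp, ← exp_add]
  refine exp_le_exp.2 ?_
  have hfin2 : ∀ k, ∫⁻ x in A, ofReal (exp (θ * x)) ∂walkLaw ρ k ≠ ⊤ := fun k =>
    ((setLIntegral_exp_le hA.meas hθ k).trans_lt (measure_lt_top _ _)).ne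
  have hb1 : ∀ k, (∫⁻ x in A, ofReal (exp (θ * x)) ∂walkLaw ρ k).toReal
      ≤ (walkLaw ρ k).real A := fun k =>
    toReal_mono (measure_ne_top _ _) (setLIntegral_exp_le hA.meas hθ k)
  have hb2 : ∀ k, (∫⁻ x in A, ofReal (exp (θ * x)) ∂walkLaw ρ k).toReal
      ≤ 2 * K₂ * (K₃ + 1) / ℓ n * ℓ k := by
    intro k
    have hlk := hL.reg.pos k
    refine ENNReal.toReal_le_of_le_ofReal (by positivity) ?_
    calc ∫⁻ x in A, ofReal (exp (θ * x)) ∂walkLaw ρ k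
        ≤ ∫⁻ x in A, ofReal (exp (-(ℓ n * |x|))) ∂walkLaw ρ k := by
          refine setLIntegral_mono' hA.meas fun x hx => le_of_eq ?_
          rw [← hθn, ← abs_mul, abs_of_nonpos (hθ x hx), neg_neg]
      _ ≤ ∫⁻ x, ofReal (exp (-(ℓ n * |x|))) ∂walkLaw ρ k :=
          setLIntegral_le_lintegral _ _
      _ ≤ ofReal (2 * (K₂ * ℓ k) * (1 + 1 / ℓ n)) := by
          refine lintegral_exp_neg_abs_le (by positivity) (fun y => ?_) hln
          rw [← ofReal_toReal (measure_ne_top (walkLaw ρ k) _)]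
          exact ofReal_le_ofReal (hc k y)
      _ ≤ _ := by
          refine ofReal_le_ofReal ?_
          have : 1 + 1 / ℓ n ≤ (K₃ + 1) / ℓ n := by
            rw [← div_self hln.ne', ← add_div]
            exact div_le_div_of_nonneg_right (by linarith [hb n]) hln.le
          calc 2 * (K₂ * ℓ k) * (1 + 1 / ℓ n) ≤ 2 * (K₂ * ℓ k) * ((K₃ + 1) / ℓ n) :=
                mul_le_mul_of_nonneg_left this (by positivity)
            _ = _ := by ring
  set β := fun k => (∫⁻ x in A, ofReal (exp (θ * x)) ∂walkLaw ρ k).toReal with hβ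
  have hsub : range N' ⊆ range (max n N') :=
    Finset.range_subset_range.2 (le_max_right _ _)
  calc ∑ k ∈ range N', β (k + 1) / ((k : ℝ) + 1)
      ≤ ∑ k ∈ range (max n N'), β (k + 1) / ((k : ℝ) + 1) :=
        sum_le_sum_of_subset_of_nonneg hsub fun _ _ _ =>
          div_nonneg toReal_nonneg (by positivity)
    _ = ∑ k ∈ range n, β (k + 1) / ((k : ℝ) + 1)
        + ∑ k ∈ Finset.Ico n (max n N'), β (k + 1) / ((k : ℝ) + 1) :=
        (Finset.sum_range_add_sum_Ico _ (le_max_left _ _)).symm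
    _ ≤ ∑ k ∈ range n, (walkLaw ρ (k + 1)).real A / ((k : ℝ) + 1)
        + ∑ k ∈ Finset.Ico n (max n N'), 2 * K₂ * (K₃ + 1) / ℓ n * (ℓ (k + 1) / ((k : ℝ) + 1)) := by
        refine add_le_add (sum_le_sum fun k _ => ?_) (sum_le_sum fun k _ => ?_)
        · exact div_le_div_of_nonneg_right (hb1 _) (by positivity)
        · rw [← mul_div_assoc]
          exact div_le_div_of_nonneg_right (hb2 _) (by positivity)
    _ ≤ _ := by
        rw [← mul_sum, add_comm]
        refine add_le_add ?_ le_rfl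
        calc _ ≤ 2 * K₂ * (K₃ + 1) / ℓ n * (K₁ * ℓ n) :=
              mul_le_mul_of_nonneg_left (ht n hn _ (le_max_left _ _)) (by positivity)
          _ = _ := by field_simp

lemma renU_le_tsum_tilt {θ : ℝ} (hθ : 0 ≤ θ) (x : ℝ) :
    renU ρ x ≤ ofReal (exp (θ * x)) * ∑' k, tilt ρ (Iio 0) θ k := by
  rw [renU, ← ENNReal.tsum_mul_left]
  refine tsum_le_tsum fun k => ?_
  rw [tilt, ← lintegral_const_mul _ (measurable_ofReal_exp_mul θ)]
  rw [← lintegral_indicator_one measurableSet_Ici]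
  refine lintegral_mono fun s => ?_
  by_cases hs : s ∈ Ici (-x)
  swap
  · rw [indicator_of_notMem hs]; exact bot_le
  rw [indicator_of_mem hs]
  rw [← ofReal_mul (exp_pos _).le, ← exp_add, Pi.one_apply,
    ← ofReal_one]
  refine ofReal_le_ofReal (Real.one_le_exp ?_)
  have : -x ≤ s := hs
  nlinarith

lemma renV_le_tsum_tilt {θ : ℝ} (hθ : 0 ≤ θ) {x : ℝ} (hx : 0 < x) :
    renV ρ x ≤ ofReal (exp (θ * x)) * ∑' k, tilt ρ (Ici 0) (-θ) k := by
  rw [renV_eq hx, ← ENNReal.tsum_mul_left]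
  refine tsum_le_tsum fun k => ?_
  rw [tilt, ← lintegral_const_mul _ (measurable_ofReal_exp_mul _)]
  rw [← lintegral_indicator_one measurableSet_Iio]
  refine lintegral_mono fun s => ?_
  by_cases hs : s ∈ Iio x
  swap
  · rw [indicator_of_notMem hs]; exact bot_le
  rw [indicator_of_mem hs]
  rw [← ofReal_mul (exp_pos _).le, ← exp_add, Pi.one_apply,
    ← ofReal_one]
  refine ofReal_le_ofReal (Real.one_le_exp ?_)
  have : s < x := hs
  nlinarith

lemma LLT.ren_le (hL : LLT ρ ℓ C) : ∃ K, 0 < K ∧ ∃ N : ℕ, 1 ≤ N ∧ ∀ n, N ≤ n → ∀ T x,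
    ℓ n * x ≤ T → renU ρ x ≤ ofReal (K * exp T * spitzerExp ρ (Iio 0) n) ∧
      (0 < x → renV ρ x ≤ ofReal (K * exp T * spitzerExp ρ (Ici 0) n)) := by
  obtain ⟨K, hK, N, hN, h⟩ := hL.tsum_tilt_le
  refine ⟨K, hK, N, hN, fun n hn T x hx => ?_⟩
  have hl := hL.reg.pos n
  have hexp : ofReal (exp (ℓ n * x)) ≤ ofReal (exp T) :=
    ofReal_le_ofReal (exp_le_exp.2 hx)
  constructor
  · refine (renU_le_tsum_tilt hl.le x).trans ((mul_le_mul' hexp (h n hn (Iio 0) (ℓ n)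
      isHalf_Iio ?_ (abs_of_pos hl))).trans (le_of_eq ?_))
    · exact fun x hx => mul_nonpos_of_nonneg_of_nonpos hl.le (le_of_lt hx)
    · rw [← ofReal_mul (exp_pos _).le]; ring_nf
  · intro hx0
    refine (renV_le_tsum_tilt hl.le hx0).trans ((mul_le_mul' hexp (h n hn (Ici 0) (-ℓ n)
      isHalf_Ici ?_ (by rw [abs_neg, abs_of_pos hl]))).trans (le_of_eq ?_))
    · exact fun x hx => mul_nonpos_of_nonpos_of_nonneg (by linarith) hx
    · rw [← ofReal_mul (exp_pos _).le]; ring_nf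

/-- The renewal functions grow slower than any exponential function. -/
lemma LLT.ren_le_exp (hL : LLT ρ ℓ C) {θ : ℝ} (hθ : 0 < θ) : ∃ K, 0 < K ∧ ∀ x, 0 ≤ x →
    renU ρ x ≤ ofReal (K * exp (θ * x)) ∧
      renV ρ x ≤ ofReal (K * exp (θ * x)) := by
  obtain ⟨K, hK, N, hN, h⟩ := hL.ren_le
  obtain ⟨n, hn, hnN⟩ := ((hL.reg.lim.eventually_lt_const hθ).and (eventually_ge_atTop N)).exists
  set M := max (spitzerExp ρ (Iio 0) n) (spitzerExp ρ (Ici 0) n) with hM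
  have hM0 : 0 < M := (spitzerExp_pos n).trans_le (le_max_left _ _)
  refine ⟨K * M * exp θ, by positivity, fun x hx => ?_⟩
  have h1 : ℓ n * (x + 1) ≤ θ * x + θ := by nlinarith
  obtain ⟨hu, hv⟩ := h n hnN _ _ h1
  refine ⟨(renU_mono (by linarith)).trans (hu.trans (ofReal_le_ofReal ?_)),
    (renV_mono (by linarith)).trans ((hv (by linarith)).trans (ofReal_le_ofReal ?_))⟩
  · calc _ ≤ K * exp (θ * x + θ) * M :=
          mul_le_mul_of_nonneg_left (le_max_left _ _) (by positivity)
      _ = _ := by rw [exp_add]; ring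
  · calc _ ≤ K * exp (θ * x + θ) * M :=
          mul_le_mul_of_nonneg_left (le_max_right _ _) (by positivity)
      _ = _ := by rw [exp_add]; ring

lemma LLT.renU_lt_top (hL : LLT ρ ℓ C) (x : ℝ) : renU ρ x < ⊤ := by
  obtain ⟨K, -, h⟩ := hL.ren_le_exp one_pos
  exact (renU_mono (le_max_left x 0)).trans_lt
    ((h _ (le_max_right x 0)).1.trans_lt ofReal_lt_top)

lemma LLT.renV_lt_top (hL : LLT ρ ℓ C) (x : ℝ) : renV ρ x < ⊤ := by
  obtain ⟨K, -, h⟩ := hL.ren_le_exp one_pos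
  exact (renV_mono (le_max_left x 0)).trans_lt
    ((h _ (le_max_right x 0)).2.trans_lt ofReal_lt_top)

lemma spitzerExp_mul_self (n : ℕ) :
    spitzerExp ρ (Iio 0) n * spitzerExp ρ (Ici 0) n ≤ exp 1 * ((n : ℝ) + 1) := by
  rw [spitzerExp, spitzerExp, ← exp_add, ← Finset.sum_add_distrib]
  have : ∑ k ∈ range n, ((walkLaw ρ (k + 1)).real (Iio 0) / ((k : ℝ) + 1)
      + (walkLaw ρ (k + 1)).real (Ici 0) / ((k : ℝ) + 1)) = (harmonic n : ℝ) := by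
    rw [harmonic]
    push_cast
    refine sum_congr rfl fun k _ => ?_
    rw [← add_div, ← compl_Iio, probReal_add_probReal_compl measurableSet_Iio, one_div]
  rw [this]
  rcases Nat.eq_zero_or_pos n with rfl | hn
  · simp
  · have hn' : (0 : ℝ) < n := by exact_mod_cast hn
    calc exp (harmonic n) ≤ exp (1 + Real.log n) :=
          exp_le_exp.2 (harmonic_le_one_add_log n)
      _ = exp 1 * n := by rw [exp_add, Real.exp_log hn']
      _ ≤ _ := mul_le_mul_of_nonneg_left (by linarith) (exp_pos _).le

lemma LLT.spitzerExp_ratio (hL : LLT ρ ℓ C) : ∃ q : ℝ, 0 < q ∧ q ≤ 1 ∧ ∃ N : ℕ, ∀ m, N ≤ m →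
    ∀ n, m ≤ n → spitzerExp ρ (Ici 0) m * ((n : ℝ) + 1) ^ q
      ≤ spitzerExp ρ (Ici 0) n * ((m : ℝ) + 1) ^ q := by
  obtain ⟨q, hq, hev⟩ := hL.mass
  obtain ⟨N, hN⟩ := eventually_atTop.1 hev
  refine ⟨q, hq, (hN N le_rfl).1.trans measureReal_le_one, N, fun m hm n hn => ?_⟩
  induction n, hn using Nat.le_induction with
  | base => rfl
  | succ n hn ih =>
    have hn0 : (0 : ℝ) < (n : ℝ) + 1 := by positivity
    have h1 : spitzerExp ρ (Ici 0) (n + 1) = spitzerExp ρ (Ici 0) n *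
        exp ((walkLaw ρ (n + 1)).real (Ici 0) / ((n : ℝ) + 1)) := by
      rw [spitzerExp, spitzerExp, Finset.sum_range_succ, exp_add]
    have h2 : ((n : ℝ) + 1 + 1) ^ q ≤ ((n : ℝ) + 1) ^ q *
        exp ((walkLaw ρ (n + 1)).real (Ici 0) / ((n : ℝ) + 1)) := by
      calc ((n : ℝ) + 1 + 1) ^ q = (((n : ℝ) + 1) * (1 / ((n : ℝ) + 1) + 1)) ^ q := by
            congr 1; field_simp; ring
        _ = ((n : ℝ) + 1) ^ q * (1 / ((n : ℝ) + 1) + 1) ^ q :=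
            Real.mul_rpow hn0.le (by positivity)
        _ ≤ ((n : ℝ) + 1) ^ q * (exp (1 / ((n : ℝ) + 1))) ^ q := by
            refine mul_le_mul_of_nonneg_left (rpow_le_rpow (by positivity)
              (Real.add_one_le_exp _) hq.le) (by positivity)
        _ ≤ _ := by
            rw [← Real.exp_mul]
            refine mul_le_mul_of_nonneg_left (exp_le_exp.2 ?_) (by positivity)
            rw [div_mul_eq_mul_div, one_mul]
            exact div_le_div_of_nonneg_right (hN (n + 1) (by omega)).1 hn0.le
    push_cast
    calc spitzerExp ρ (Ici 0) m * ((n : ℝ) + 1 + 1) ^ q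
        ≤ spitzerExp ρ (Ici 0) m * (((n : ℝ) + 1) ^ q *
          exp ((walkLaw ρ (n + 1)).real (Ici 0) / ((n : ℝ) + 1))) :=
          mul_le_mul_of_nonneg_left h2 (spitzerExp_pos _).le
      _ = (spitzerExp ρ (Ici 0) m * ((n : ℝ) + 1) ^ q) *
          exp ((walkLaw ρ (n + 1)).real (Ici 0) / ((n : ℝ) + 1)) := by ring
      _ ≤ (spitzerExp ρ (Ici 0) n * ((m : ℝ) + 1) ^ q) *
          exp ((walkLaw ρ (n + 1)).real (Ici 0) / ((n : ℝ) + 1)) :=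
          mul_le_mul_of_nonneg_right ih (exp_pos _).le
      _ = _ := by rw [h1]; ring

lemma rpow_mul_rpow_le {s t q ε : ℝ} (hs : 1 ≤ s) (ht : 1 ≤ t) (hq : 0 < q) (hq1 : q ≤ 1)
    (hε : 0 < ε) : s ^ (1 - q) * t ^ q ≤ s ^ (1 - q * ε / (1 + ε)) + t ^ (1 + ε) := by
  have hs0 : 0 < s := by linarith
  have ht0 : 0 < t := by linarith
  rcases le_total (t ^ (1 + ε)) s with h | h
  · have h1 : t ^ q ≤ s ^ (q / (1 + ε)) := by
      calc t ^ q = (t ^ (1 + ε)) ^ (q / (1 + ε)) := by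
            rw [← Real.rpow_mul ht0.le]; congr 1; field_simp
        _ ≤ _ := rpow_le_rpow (by positivity) h (by positivity)
    calc s ^ (1 - q) * t ^ q ≤ s ^ (1 - q) * s ^ (q / (1 + ε)) :=
          mul_le_mul_of_nonneg_left h1 (by positivity)
      _ = s ^ (1 - q * ε / (1 + ε)) := by
          rw [← Real.rpow_add hs0]; congr 1; field_simp; ring
      _ ≤ _ := le_add_of_nonneg_right (by positivity)
  · calc s ^ (1 - q) * t ^ q ≤ (t ^ (1 + ε)) ^ (1 - q) * t ^ q :=
          mul_le_mul_of_nonneg_right (rpow_le_rpow hs0.le h (by linarith)) (by positivity)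
      _ = t ^ ((1 + ε) * (1 - q) + q) := by rw [← Real.rpow_mul ht0.le, Real.rpow_add ht0]
      _ ≤ t ^ (1 + ε) := Real.rpow_le_rpow_of_exponent_le ht (by nlinarith)
      _ ≤ _ := le_add_of_nonneg_left (by positivity)

/-- The first index `n ≥ N` at which the scale `1 / ℓ n` reaches `x`. -/
def scaleIdx (ℓ : ℕ → ℝ) (N : ℕ) (x : ℝ) : ℕ := sInf {n | N ≤ n ∧ ℓ n * x ≤ 1}

lemma RegSeq.scaleIdx_mem (h : RegSeq ℓ) (N : ℕ) (x : ℝ) :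
    N ≤ scaleIdx ℓ N x ∧ ℓ (scaleIdx ℓ N x) * x ≤ 1 := by
  have : {n | N ≤ n ∧ ℓ n * x ≤ 1}.Nonempty := by
    have h1 : Tendsto (fun n => ℓ n * x) atTop (𝓝 (0 * x)) := h.lim.mul_const x
    rw [zero_mul] at h1
    obtain ⟨n, hn, hnN⟩ := ((h1.eventually_lt_const one_pos).and (eventually_ge_atTop N)).exists
    exact ⟨n, hnN, hn.le⟩
  exact Nat.sInf_mem this

lemma RegSeq.scaleIdx_mono (h : RegSeq ℓ) (N : ℕ) : Monotone (scaleIdx ℓ N) := by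
  intro x y hxy
  refine Nat.sInf_le ⟨(h.scaleIdx_mem N y).1, le_trans ?_ (h.scaleIdx_mem N y).2⟩
  exact mul_le_mul_of_nonneg_left hxy (h.pos _).le

lemma one_lt_of_lt_scaleIdx {N m : ℕ} {x : ℝ} (hm : N ≤ m) (h : m < scaleIdx ℓ N x) :
    1 < ℓ m * x := by
  by_contra hc
  exact Nat.notMem_of_lt_sInf h ⟨hm, not_lt.1 hc⟩

lemma LLT.scaleIdx_le (hL : LLT ρ ℓ C) : ∃ N₀, ∀ N, N₀ ≤ N → ∃ K, 0 < K ∧ ∀ x, 0 ≤ x →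
    (scaleIdx ℓ N x : ℝ) + 1 ≤ K * (1 + x) ^ 2 := by
  obtain ⟨K, hK, N₀, hp⟩ := hL.potter
  refine ⟨N₀, fun N hN => ⟨K * (N * ℓ N ^ 2) + N + 2, by positivity, fun x hx => ?_⟩⟩
  have hsq : 1 ≤ (1 + x) ^ 2 := by nlinarith
  have hsq' : x ^ 2 ≤ (1 + x) ^ 2 := by nlinarith
  have hc : 0 ≤ K * (N * ℓ N ^ 2) := by positivity
  rcases Nat.lt_or_ge N (scaleIdx ℓ N x) with h | h
  · obtain ⟨m, hm⟩ : ∃ m, scaleIdx ℓ N x = m + 1 := ⟨scaleIdx ℓ N x - 1, by omega⟩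
    have h1 := one_lt_of_lt_scaleIdx (m := m) (by omega) (by omega : m < scaleIdx ℓ N x)
    have h2 := hp N m hN (by omega)
    have h3 : (m : ℝ) ≤ K * (N * ℓ N ^ 2) * x ^ 2 := by
      calc (m : ℝ) ≤ m * (ℓ m * x) ^ 2 := by
            have : 1 ≤ (ℓ m * x) ^ 2 := by nlinarith
            have hm0 : (0 : ℝ) ≤ m := by positivity
            nlinarith
        _ = m * ℓ m ^ 2 * x ^ 2 := by ring
        _ ≤ _ := mul_le_mul_of_nonneg_right h2 (sq_nonneg x)
    rw [hm]
    push_cast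
    have h4 := mul_le_mul_of_nonneg_left hsq' hc
    have h5 : (0 : ℝ) ≤ (N : ℝ) * (1 + x) ^ 2 := by positivity
    nlinarith
  · have h' : (scaleIdx ℓ N x : ℝ) ≤ N := by exact_mod_cast h
    have h5 : (N : ℝ) ≤ (N : ℝ) * (1 + x) ^ 2 := le_mul_of_one_le_right (by positivity) hsq
    have h4 : 0 ≤ K * (N * ℓ N ^ 2) * (1 + x) ^ 2 := by positivity
    nlinarith

lemma rpow_le_tsum_dyadic (n : ℕ) {p : ℝ} (hp : 0 ≤ p) :
    ofReal (((n : ℝ) + 1) ^ p) ≤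
      ∑' j : ℕ, if 2 ^ j ≤ n + 1 then ofReal ((2 : ℝ) ^ (((j : ℝ) + 1) * p)) else 0 := by
  set j := Nat.log 2 (n + 1) with hj
  have h1 : 2 ^ j ≤ n + 1 := Nat.pow_log_le_self 2 (by omega)
  have h2 : n + 1 < 2 ^ (j + 1) := Nat.lt_pow_succ_log_self (by norm_num) _
  refine le_trans ?_ (le_tsum j)
  rw [if_pos h1, Real.rpow_mul (by norm_num)]
  refine ofReal_le_ofReal (rpow_le_rpow (by positivity) ?_ hp)
  have h3 : ((n + 1 : ℕ) : ℝ) ≤ ((2 ^ (j + 1) : ℕ) : ℝ) := by exact_mod_cast h2.le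
  push_cast at h3
  rw [← Real.rpow_natCast] at h3
  push_cast at h3
  exact h3

lemma lintegral_rpow_lt_top {α : Type*} [MeasurableSpace α] {μ : Measure α}
    {s : α → ℕ} (hs : Measurable s) {K : ℝ}
    (hK : ∀ m : ℕ, 1 ≤ m → μ {x | m ≤ s x + 1} ≤ ofReal (K / m)) {p : ℝ} (hp : 0 ≤ p)
    (hp1 : p < 1) : ∫⁻ x, ofReal (((s x : ℝ) + 1) ^ p) ∂μ < ⊤ := by
  have hm : ∀ j : ℕ, MeasurableSet {x | 2 ^ j ≤ s x + 1} := fun j =>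
    measurableSet_le measurable_const (hs.add_const 1)
  have h0 : ∀ j : ℕ, (fun x => if 2 ^ j ≤ s x + 1 then ofReal ((2 : ℝ) ^ (((j : ℝ) + 1) * p))
      else 0) = {x | 2 ^ j ≤ s x + 1}.indicator
        fun _ => ofReal ((2 : ℝ) ^ (((j : ℝ) + 1) * p)) := by
    intro j; ext x; simp [indicator_apply]
  calc ∫⁻ x, ofReal (((s x : ℝ) + 1) ^ p) ∂μ
      ≤ ∫⁻ x, ∑' j : ℕ, (if 2 ^ j ≤ s x + 1 then ofReal ((2 : ℝ) ^ (((j : ℝ) + 1) * p))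
        else 0) ∂μ := lintegral_mono fun x => rpow_le_tsum_dyadic (s x) hp
    _ = ∑' j : ℕ, ofReal ((2 : ℝ) ^ (((j : ℝ) + 1) * p)) * μ {x | 2 ^ j ≤ s x + 1} := by
        rw [lintegral_tsum fun j => by
          rw [h0]; exact (measurable_const.indicator (hm j)).aemeasurable]
        refine tsum_congr fun j => ?_
        rw [h0, lintegral_indicator_const (hm j)]
    _ ≤ ∑' j : ℕ, ofReal (K * (2 : ℝ) ^ p) * ofReal ((2 : ℝ) ^ (p - 1)) ^ j := by
        refine tsum_le_tsum fun j => ?_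
        have h1 := hK (2 ^ j) Nat.one_le_two_pow
        refine (mul_le_mul_right h1 _).trans (le_of_eq ?_)
        rw [← ofReal_mul (by positivity), ← ENNReal.ofReal_pow (by positivity),
          ← ofReal_mul' (by positivity)]
        congr 1
        have e1 : (2 : ℝ) ^ (((j : ℝ) + 1) * p) = 2 ^ p * 2 ^ (p * j) := by
          rw [← Real.rpow_add two_pos]; congr 1; ring
        have e2 : ((2 : ℝ) ^ (p - 1)) ^ j = 2 ^ (p * j) / 2 ^ j := by
          rw [← Real.rpow_natCast, ← Real.rpow_mul two_pos.le, ← Real.rpow_natCast,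
            ← Real.rpow_sub two_pos]
          congr 1; ring
        rw [e1, e2]
        push_cast
        ring
    _ < ⊤ := by
        rw [ENNReal.tsum_mul_left, ENNReal.tsum_geometric]
        refine mul_lt_top ofReal_lt_top ?_
        rw [ENNReal.inv_lt_top, tsub_pos_iff_lt, ENNReal.ofReal_lt_one]
        exact Real.rpow_lt_one_of_one_lt_of_neg (by norm_num) (by linarith)

lemma LLT.lintegral_scaleIdx_lt_top (hL : LLT ρ ℓ C) : ∃ R, 0 < R ∧ ∀ N, 1 ≤ N → ∀ p : ℝ, 0 ≤ p →
    p < 1 → ∫⁻ x, ofReal (((scaleIdx ℓ N (|x.1| / R) : ℝ) + 1) ^ p) ∂ρ < ⊤ := by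
  obtain ⟨R, hR, K, hK, ht⟩ := hL.tail
  refine ⟨R, hR, fun N hN p hp hp1 => ?_⟩
  refine lintegral_rpow_lt_top (K := 2 * K + N + 2)
    ((hL.reg.scaleIdx_mono N).measurable.comp (by fun_prop)) (fun m hm => ?_) hp hp1
  have hm0 : (0 : ℝ) < m := by exact_mod_cast hm
  rcases Nat.lt_or_ge (N + 1) m with h | h
  · obtain ⟨k, rfl⟩ : ∃ k, m = k + 2 := ⟨m - 2, by omega⟩
    have hk0 : (0 : ℝ) < k := by exact_mod_cast (by omega : 0 < k)
    have hk1 : (1 : ℝ) ≤ k := by exact_mod_cast (by omega : 1 ≤ k)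
    have hsub : {x : ℝ × ℝ | k + 2 ≤ scaleIdx ℓ N (|x.1| / R) + 1}
        ⊆ Prod.fst ⁻¹' {x : ℝ | R < |x| * ℓ k} := by
      intro x hx
      have h1 := one_lt_of_lt_scaleIdx (by omega : N ≤ k)
        (show k < scaleIdx ℓ N (|x.1| / R) by
          have : k + 2 ≤ scaleIdx ℓ N (|x.1| / R) + 1 := hx
          omega)
      show R < |x.1| * ℓ k
      rw [← mul_div_assoc, lt_div_iff₀ hR] at h1
      linarith
    refine (measure_mono hsub).trans ?_
    rw [← map_apply measurable_fst (measurableSet_lt measurable_const (by fun_prop)),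
      ← ofReal_toReal (measure_ne_top _ _)]
    refine ofReal_le_ofReal ?_
    have h2 := ht k
    have h3 : (ρ.map Prod.fst).real {x | R < |x| * ℓ k} ≤ 1 := by
      have := isProbabilityMeasure_map_fst (ρ := ρ)
      exact measureReal_le_one
    rw [le_div_iff₀ hm0]
    push_cast
    change (ρ.map Prod.fst).real {x | R < |x| * ℓ k} * _ ≤ _
    have hN0 : (0 : ℝ) ≤ N := by positivity
    nlinarith
  · refine (prob_le_one).trans ?_
    rw [← ofReal_one]
    refine ofReal_le_ofReal ((one_le_div hm0).2 ?_)
    have : (m : ℝ) ≤ N + 1 := by exact_mod_cast h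
    linarith

lemma measurable_renU : Measurable (renU ρ) := renU_mono.measurable

lemma measurable_renV : Measurable (renV ρ) := renV_mono.measurable

lemma spitzerExp_mul_le {q : ℝ} {m n : ℕ}
    (h : m ≤ n → spitzerExp ρ (Ici 0) m * ((n : ℝ) + 1) ^ q
      ≤ spitzerExp ρ (Ici 0) n * ((m : ℝ) + 1) ^ q) :
    spitzerExp ρ (Iio 0) n * spitzerExp ρ (Ici 0) m ≤
      exp 1 * (((n : ℝ) + 1) ^ (1 - q) * ((m : ℝ) + 1) ^ q + ((m : ℝ) + 1)) := by
  have he := exp_pos 1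
  have hn : (0 : ℝ) < (n : ℝ) + 1 := by positivity
  rcases le_total n m with hnm | hnm
  · exact (mul_le_mul_of_nonneg_right (spitzerExp_mono ρ _ hnm) (spitzerExp_pos _).le).trans
      ((spitzerExp_mul_self m).trans
        (mul_le_mul_of_nonneg_left (le_add_of_nonneg_left (by positivity)) he.le))
  · refine le_trans ?_ (mul_le_mul_of_nonneg_left (le_add_of_nonneg_right (by positivity)) he.le)
    rw [Real.rpow_sub hn, Real.rpow_one, div_mul_eq_mul_div, mul_div_assoc',
      le_div_iff₀ (by positivity)]
    linarith [mul_le_mul_of_nonneg_left (h hnm) (spitzerExp_pos (ρ := ρ) (A := Iio 0) n).le,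
      mul_le_mul_of_nonneg_right (spitzerExp_mul_self (ρ := ρ) n)
        (by positivity : 0 ≤ ((m : ℝ) + 1) ^ q)]

/-- The key integrability property, under the moment condition on `Z`. -/
lemma LLT.lintegral_ren_lt_top (hL : LLT ρ ℓ C) {Z : ℝ × ℝ → ℝ} (hZm : Measurable Z)
    (hZ0 : ∀ x, 0 ≤ Z x) {ε : ℝ} (hε : 0 < ε) (hZ : ∫⁻ x, ofReal (Z x ^ (2 + ε)) ∂ρ < ⊤) :
    ∫⁻ x, renU ρ (2 * Z x + |x.1|) * renV ρ (2 * Z x + 1) ∂ρ < ⊤ := by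
  obtain ⟨K₁, hK₁, N₁, -, hren⟩ := hL.ren_le
  obtain ⟨q, hq, hq1, N₂, hrat⟩ := hL.spitzerExp_ratio
  obtain ⟨N₃, hidx⟩ := hL.scaleIdx_le
  obtain ⟨R, hR, hRint⟩ := hL.lintegral_scaleIdx_lt_top
  obtain ⟨K₃, hK₃, hℓ⟩ := hL.exists_le
  set N := N₁ + N₂ + N₃ + 1 with hN
  obtain ⟨K₂, hK₂, ht⟩ := hidx N (by omega)
  set T := 4 + 2 * R + K₃ with hT
  set e' := ε / 2 with he'
  have he0 : 0 < e' := by positivity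
  set p := 1 - q * e' / (1 + e') with hp
  have hp1 : p < 1 := by
    have : 0 < q * e' / (1 + e') := by positivity
    linarith
  have hp0 : 0 ≤ p := by
    have : q * e' / (1 + e') ≤ 1 := by
      rw [div_le_one (by linarith)]; nlinarith
    linarith
  set s : ℝ × ℝ → ℕ := fun x => scaleIdx ℓ N (|x.1| / R) with hs
  set t : ℝ × ℝ → ℕ := fun x => scaleIdx ℓ N (Z x) with ht'
  set K := K₁ * exp T * (K₁ * exp T) * exp 1 with hK
  have hK0 : 0 < K := by positivity
  set K' := K₂ ^ (1 + e') * 2 ^ (2 + ε) with hK'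
  have hK'0 : 0 < K' := by positivity
  have key : ∀ x : ℝ × ℝ, renU ρ (2 * Z x + |x.1|) * renV ρ (2 * Z x + 1) ≤
      ofReal K * (ofReal (((s x : ℝ) + 1) ^ p) + ofReal (3 * K') *
        (1 + ofReal (Z x ^ (2 + ε)))) := by
    intro x
    have hz := hZ0 x
    obtain ⟨hsN, hs1⟩ := hL.reg.scaleIdx_mem N (|x.1| / R)
    obtain ⟨htN, ht1⟩ := hL.reg.scaleIdx_mem N (Z x)
    change N ≤ s x at hsN
    change N ≤ t x at htN
    change ℓ (s x) * _ ≤ 1 at hs1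
    change ℓ (t x) * _ ≤ 1 at ht1
    have hlt := hL.reg.pos (t x)
    set Q := fun n => spitzerExp ρ (Iio 0) n with hQ
    set V := fun n => spitzerExp ρ (Ici 0) n with hV
    have hQ0 : ∀ n, 0 < Q n := fun n => spitzerExp_pos n
    have hV0 : ∀ n, 0 < V n := fun n => spitzerExp_pos n
    have hu1 : renU ρ (4 * Z x) ≤ ofReal (K₁ * exp T * Q (t x)) :=
      (hren (t x) (by omega) T _ (by nlinarith)).1
    have hu2 : renU ρ (2 * |x.1|) ≤ ofReal (K₁ * exp T * Q (s x)) := by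
      refine (hren (s x) (by omega) T _ ?_).1
      rw [mul_div_assoc', div_le_one hR] at hs1
      nlinarith
    have hv : renV ρ (2 * Z x + 1) ≤ ofReal (K₁ * exp T * V (t x)) := by
      refine (hren (t x) (by omega) T _ ?_).2 (by linarith)
      have := hℓ (t x)
      nlinarith
    have hu : renU ρ (2 * Z x + |x.1|) ≤ ofReal (K₁ * exp T * (Q (t x) + Q (s x))) := by
      rw [mul_add, ofReal_add (by have := hQ0 (t x); positivity)
        (by have := hQ0 (s x); positivity)]
      rcases le_total |x.1| (2 * Z x) with h | h
      · exact (renU_mono (by linarith)).trans (hu1.trans le_self_add)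
      · exact (renU_mono (by linarith)).trans (hu2.trans le_add_self)
    have hs1' : (1 : ℝ) ≤ (s x : ℝ) + 1 := by simp
    have ht1' : (1 : ℝ) ≤ (t x : ℝ) + 1 := by simp
    have hQV1 := spitzerExp_mul_self (ρ := ρ) (t x)
    have hQV2 := spitzerExp_mul_le (hrat (t x) (by omega) (s x))
    have hyoung := rpow_mul_rpow_le hs1' ht1' hq hq1 he0
    have htt : (t x : ℝ) + 1 ≤ ((t x : ℝ) + 1) ^ (1 + e') := by
      exact Real.self_le_rpow_of_one_le ht1' (by linarith)
    have htz : ((t x : ℝ) + 1) ^ (1 + e') ≤ K' * (1 + Z x ^ (2 + ε)) := by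
      calc ((t x : ℝ) + 1) ^ (1 + e') ≤ (K₂ * (1 + Z x) ^ 2) ^ (1 + e') :=
            rpow_le_rpow (by positivity) (ht _ hz) (by positivity)
        _ = K₂ ^ (1 + e') * (1 + Z x) ^ (2 + ε) := by
            rw [Real.mul_rpow hK₂.le (by positivity), ← Real.rpow_natCast,
              ← Real.rpow_mul (by positivity)]
            congr 2
            rw [he']; push_cast; ring
        _ ≤ K₂ ^ (1 + e') * (2 ^ (2 + ε) * (1 + Z x ^ (2 + ε))) := by
            refine mul_le_mul_of_nonneg_left ?_ (by positivity)
            rw [mul_add, mul_one, ← Real.mul_rpow two_pos.le hz]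
            rcases le_total (Z x) 1 with h | h
            · exact le_add_of_le_of_nonneg (rpow_le_rpow (by positivity) (by linarith)
                (by positivity)) (by positivity)
            · exact le_add_of_nonneg_of_le (by positivity)
                (rpow_le_rpow (by positivity) (by linarith) (by positivity))
        _ = _ := by rw [hK']; ring
    have hsum : (Q (t x) + Q (s x)) * V (t x) ≤
        exp 1 * (((s x : ℝ) + 1) ^ p + 3 * K' * (1 + Z x ^ (2 + ε))) := by
      nlinarith [exp_pos 1, add_le_add hQV1 hQV2,
        mul_le_mul_of_nonneg_left hyoung (exp_pos 1).le,
        mul_le_mul_of_nonneg_left (htt.trans htz) (exp_pos 1).le,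
        mul_le_mul_of_nonneg_left htz (exp_pos 1).le]
    refine (mul_le_mul' hu hv).trans ?_
    have hzz : 0 ≤ Z x ^ (2 + ε) := by positivity
    have hadd : (1 : ℝ≥0∞) + ofReal (Z x ^ (2 + ε)) = ofReal (1 + Z x ^ (2 + ε)) := by
      rw [ofReal_add zero_le_one hzz, ofReal_one]
    have hqs := hQ0 (s x)
    have hqt := hQ0 (t x)
    have e1 : 0 ≤ K₁ * exp T * (Q (t x) + Q (s x)) := by positivity
    have e2 : 0 ≤ ((s x : ℝ) + 1) ^ p := by positivity
    have e3 : 0 ≤ 3 * K' * (1 + Z x ^ (2 + ε)) := by positivity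
    rw [hadd, ← ofReal_mul (p := 3 * K') (by positivity), ← ofReal_add e2 e3,
      ← ofReal_mul hK0.le, ← ofReal_mul e1]
    refine ofReal_le_ofReal ?_
    linarith [mul_le_mul_of_nonneg_left hsum (by positivity : 0 ≤ K₁ * exp T * (K₁ * exp T))]
  refine (lintegral_mono key).trans_lt ?_
  have hsm : Measurable s := (hL.reg.scaleIdx_mono N).measurable.comp (by fun_prop)
  have hsm' : Measurable fun x => ofReal (((s x : ℝ) + 1) ^ p) := by fun_prop
  have hZm' : Measurable fun x => ofReal (Z x ^ (2 + ε)) := by fun_prop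
  rw [lintegral_const_mul _ (by fun_prop), lintegral_add_left hsm',
    lintegral_const_mul _ (by fun_prop), lintegral_add_left measurable_const, lintegral_one,
    measure_univ]
  refine mul_lt_top ofReal_lt_top (add_lt_top.2 ⟨?_, ?_⟩)
  · exact hRint N (by omega) p hp0 hp1
  · exact mul_lt_top ofReal_lt_top (add_lt_top.2 ⟨one_lt_top, hZ⟩)

lemma lowerSemicontinuous_indicator {G : Set ℝ} (hG : IsOpen G) {w : ℝ → ℝ≥0∞}
    (hw : LowerSemicontinuous w) : LowerSemicontinuous (G.indicator w) := by
  rw [lowerSemicontinuous_iff_isOpen_preimage]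
  intro y
  have : G.indicator w ⁻¹' Ioi y = G ∩ w ⁻¹' Ioi y := by
    ext x
    by_cases hx : x ∈ G <;> simp [hx]
  rw [this]
  exact hG.inter (hw.isOpen_preimage y)

lemma ennreal_le_liminf_add (u v : ℕ → ℝ≥0∞) :
    liminf u atTop + liminf v atTop ≤ liminf (fun n => u n + v n) atTop := by
  have h := lintegral_liminf_le (μ := (Measure.count : Measure Bool)) (u := (atTop : Filter ℕ))
    (f := fun n b => cond b (v n) (u n)) fun n => Measurable.of_discrete
  simpa [lintegral_count, tsum_bool, add_comm] using h

lemma tsum_le_liminf_sum {ι : ℕ → Finset ℕ} (hι : ∀ k, ∀ᶠ n in atTop, k ∈ ι n)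
    {g : ℕ → ℕ → ℝ≥0∞} {a : ℕ → ℝ≥0∞} (ha : ∀ k, a k ≤ liminf (fun n => g n k) atTop) :
    ∑' k, a k ≤ liminf (fun n => ∑ k ∈ ι n, g n k) atTop := by
  calc ∑' k, a k ≤ ∑' k, liminf (fun n => (ι n : Set ℕ).indicator (g n) k) atTop := by
        refine tsum_le_tsum fun k => (ha k).trans (le_of_eq (liminf_congr ?_))
        filter_upwards [hι k] with n hn
        rw [indicator_of_mem (Finset.mem_coe.2 hn)]
    _ = ∫⁻ k, liminf (fun n => (ι n : Set ℕ).indicator (g n) k) atTop ∂Measure.count :=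
        (lintegral_count _).symm
    _ ≤ liminf (fun n => ∫⁻ k, (ι n : Set ℕ).indicator (g n) k ∂Measure.count) atTop :=
        lintegral_liminf_le fun n => Measurable.of_discrete
    _ = _ := by
        congr 1; ext n
        rw [lintegral_count, ← tsum_subtype, Finset.tsum_subtype']

/-- Fatou's lemma at both ends of a sum over `{0, …, n}`. -/
lemma tsum_add_tsum_le_liminf_sum {g : ℕ → ℕ → ℝ≥0∞} {a b : ℕ → ℝ≥0∞}
    (ha : ∀ k, a k ≤ liminf (fun n => g n k) atTop)
    (hb : ∀ k, b k ≤ liminf (fun n => g n (n - k)) atTop) :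
    ∑' k, a k + ∑' k, b k ≤ liminf (fun n => ∑ k ∈ range (n + 1), g n k) atTop := by
  have hι : ∀ k, ∀ᶠ n in atTop, k ∈ range ((n + 1) / 2) := fun k => by
    filter_upwards [eventually_ge_atTop (2 * k + 2)] with n hn
    exact mem_range.2 (by omega)
  have h1 := tsum_le_liminf_sum hι ha
  have h2 := tsum_le_liminf_sum (g := fun n k => g n (n - k)) hι hb
  refine (add_le_add h1 h2).trans (le_trans (ennreal_le_liminf_add _ _) (liminf_le_liminf ?_))
  refine Eventually.of_forall fun n => ?_
  change ∑ k ∈ range ((n + 1) / 2), g n k + ∑ k ∈ range ((n + 1) / 2), g n (n - k) ≤ _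
  rw [← Finset.sum_image (f := g n) (s := range ((n + 1) / 2)) (g := fun k => n - k),
    ← Finset.sum_union]
  · refine sum_le_sum_of_subset fun k hk => ?_
    grind
  · rw [Finset.disjoint_left]
    grind
  · intro i hi j hj hij
    grind

lemma liminf_le_liminf_shift {w : ℕ → ℝ} (hw : ∀ᶠ n in atTop, 0 < w n) {j : ℕ}
    (h : Tendsto (fun n => w (n + j) / w n) atTop (𝓝 1)) (g : ℕ → ℝ≥0∞) :
    liminf (fun n => ofReal (w n) * g n) atTop ≤
      liminf (fun n => ofReal (w n) * g (n - j)) atTop := by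
  rw [← liminf_nat_add (fun n => ofReal (w n) * g (n - j)) j]
  have h1 : Tendsto (fun n => ofReal (w (n + j) / w n)) atTop (𝓝 1) := by
    rw [← ofReal_one]
    exact (continuous_ofReal.tendsto 1).comp h
  calc liminf (fun n => ofReal (w n) * g n) atTop
      = liminf (fun n => ofReal (w (n + j) / w n)) atTop
        * liminf (fun n => ofReal (w n) * g n) atTop := by rw [h1.liminf_eq, one_mul]
    _ ≤ liminf ((fun n => ofReal (w (n + j) / w n)) *
        (fun n => ofReal (w n) * g n)) atTop := ENNReal.le_liminf_mul
    _ = _ := by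
        refine liminf_congr ?_
        filter_upwards [hw] with n hn
        rw [Pi.mul_apply, ← mul_assoc, ← ofReal_mul' hn.le, div_mul_cancel₀ _ hn.ne',
          Nat.add_sub_cancel]

/-- The reciprocal of `ℓ n / n`. -/
def scaleW (ℓ : ℕ → ℝ) (n : ℕ) : ℝ := n / ℓ n

lemma RegSeq.scaleW_pos (h : RegSeq ℓ) : ∀ᶠ n in atTop, 0 < scaleW ℓ n := by
  filter_upwards [eventually_gt_atTop 0] with n hn
  have := h.pos n
  have : (0 : ℝ) < n := by exact_mod_cast hn
  unfold scaleW; positivity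

lemma RegSeq.tendsto_scaleW (h : RegSeq ℓ) (j : ℕ) :
    Tendsto (fun n => scaleW ℓ (n + j) / scaleW ℓ n) atTop (𝓝 1) := by
  refine ((tendsto_add_atTop_iff_nat j).2 (h.tendsto_div_ratio j)).congr fun n => ?_
  rw [Nat.add_sub_cancel, scaleW, scaleW, div_div_div_eq, div_div_div_eq]
  ring

lemma LLT.le_liminf_stay (hL : LLT ρ ℓ C) {A U : Set ℝ} (hA : IsHalf A)
    (hU : IsOpen U) (hUA : U ⊆ A) {f : ℝ → ℝ≥0∞} (hf : LowerSemicontinuous f) :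
    ofReal C * ∑' j, ∫⁻ y, (∫⁻ x in U, f (x + y)) ∂stayLaw ρ A j ≤
      liminf (fun n => ofReal (scaleW ℓ n) * ∫⁻ x, f x ∂stayLaw ρ A n) atTop := by
  have hfm := hf.measurable
  rw [← liminf_nat_add _ 1, ← ENNReal.tsum_mul_left]
  set g : ℕ → ℕ → ℝ≥0∞ := fun n k => ofReal (ℓ (n + 1))⁻¹ *
    ∫⁻ x in A, ∫⁻ y, f (x + y) ∂stayLaw ρ A (n - k) ∂walkLaw ρ (k + 1) with hg
  have h1 : ∀ n, ofReal (scaleW ℓ (n + 1)) * ∫⁻ x, f x ∂stayLaw ρ A (n + 1)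
      = ∑ k ∈ range (n + 1), g n k := fun n => by
    rw [← mul_sum, ← spitzer ρ hA n hfm, ← mul_assoc, scaleW, div_eq_inv_mul,
      ofReal_mul (inv_nonneg.2 (hL.reg.pos _).le), ENNReal.ofReal_natCast]
  rw [show (fun n => ofReal (scaleW ℓ (n + 1)) * ∫⁻ x, f x ∂stayLaw ρ A (n + 1)) =
    fun n => ∑ k ∈ range (n + 1), g n k from funext h1]
  have h2 := tsum_add_tsum_le_liminf_sum (g := g) (a := fun _ => 0)
    (b := fun j => ofReal C * ∫⁻ y, (∫⁻ x in U, f (x + y)) ∂stayLaw ρ A j)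
    (fun k => bot_le) fun j => ?_
  · simpa using h2
  have hm2 : Measurable fun p : ℝ × ℝ => f (p.2 + p.1) := by fun_prop
  have hmU : ∀ n : ℕ, Measurable fun y : ℝ => ∫⁻ x in U, f (x + y) ∂walkLaw ρ n := fun n =>
    hm2.lintegral_prod_right'
  have hmV : Measurable fun y : ℝ => ∫⁻ x in U, f (x + y) := hm2.lintegral_prod_right'
  calc ofReal C * ∫⁻ y, (∫⁻ x in U, f (x + y)) ∂stayLaw ρ A j
      = ∫⁻ y, (ofReal C * ∫⁻ x in U, f (x + y)) ∂stayLaw ρ A j :=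
        (lintegral_const_mul _ hmV).symm
    _ ≤ ∫⁻ y, liminf (fun n => ofReal (ℓ (n + 1))⁻¹ *
        ∫⁻ x in U, f (x + y) ∂walkLaw ρ (n + 1 - j)) atTop ∂stayLaw ρ A j := by
        refine lintegral_mono fun y => ?_
        have hl : LowerSemicontinuous (U.indicator fun x => f (x + y)) :=
          lowerSemicontinuous_indicator hU (hf.comp (by fun_prop : Continuous fun x => x + y))
        have h3 := hL.vague _ hl
        simp only [lintegral_indicator hU.measurableSet, Measure.restrict_smul,
          lintegral_smul_measure, smul_eq_mul] at h3
        have h4 : Tendsto (fun n => (ℓ (n + j))⁻¹ / (ℓ n)⁻¹) atTop (𝓝 1) := by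
          have := (hL.reg.tendsto_ratio j).inv₀ one_ne_zero
          grind
        have h5 := liminf_le_liminf_shift (w := fun n => (ℓ n)⁻¹)
          (.of_forall fun n => inv_pos.2 (hL.reg.pos n)) h4
          (fun n => ∫⁻ x in U, f (x + y) ∂walkLaw ρ n)
        refine h3.trans (h5.trans (le_of_eq ?_))
        rw [← liminf_nat_add _ 1]
    _ ≤ liminf (fun n => ∫⁻ y, ofReal (ℓ (n + 1))⁻¹ *
        ∫⁻ x in U, f (x + y) ∂walkLaw ρ (n + 1 - j) ∂stayLaw ρ A j) atTop :=
        lintegral_liminf_le fun n => (hmU _).const_mul _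
    _ ≤ liminf (fun n => g n (n - j)) atTop := by
        refine liminf_le_liminf ?_
        filter_upwards [eventually_ge_atTop j] with n hn
        rw [lintegral_const_mul _ (hmU _), hg]
        refine mul_le_mul_right ?_ _
        rw [Nat.sub_sub_self hn, show n - j + 1 = n + 1 - j by omega,
          lintegral_lintegral_swap (f := fun y x => f (x + y)) hm2.aemeasurable]
        exact lintegral_mono_set hUA

/-- The Green measure of the walk killed on leaving `A`. -/
def greenM (ρ : Measure (ℝ × ℝ)) [IsProbabilityMeasure ρ] (A : Set ℝ) : Measure ℝ :=
  Measure.sum (stayLaw ρ A)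

instance (A : Set ℝ) : SFinite (greenM ρ A) := by unfold greenM; infer_instance

lemma lintegral_greenM (A : Set ℝ) (f : ℝ → ℝ≥0∞) :
    ∫⁻ x, f x ∂greenM ρ A = ∑' k, ∫⁻ x, f x ∂stayLaw ρ A k := lintegral_sum_measure _ _

lemma renU_eq_greenM (x : ℝ) : renU ρ x = greenM ρ (Iio 0) (Ici (-x)) :=
  (Measure.sum_apply _ measurableSet_Ici).symm

lemma renV_eq_greenM {y : ℝ} (hy : 0 < y) : renV ρ y = greenM ρ (Ici 0) (Iio y) := by
  rw [renV_eq hy]; exact (Measure.sum_apply _ measurableSet_Iio).symm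

lemma ae_greenM {A B : Set ℝ} (hA : MeasurableSet A) (hB : MeasurableSet B) (h0 : (0 : ℝ) ∈ B) (hAB : A ⊆ B) :
    ∀ᵐ x ∂greenM ρ A, x ∈ B := by
  refine (Measure.ae_sum_iff' (p := fun x => x ∈ B) hB).2 fun k => ?_
  rcases Nat.eq_zero_or_pos k with rfl | hk
  · rw [stayLaw_zero]; exact (ae_dirac_iff (p := fun x => x ∈ B) hB).2 h0
  · exact measure_mono_null (compl_subset_compl.2 hAB) (stayLaw_compl_of_pos ρ hA hk)

lemma lintegral_indicator_le_greenM (hf : Measurable f) (A : Set ℝ) {R : ℝ → ℝ → Prop}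
    (hR : MeasurableSet {p : ℝ × ℝ | R p.1 p.2}) :
    ∫⁻ y, (∫⁻ s, {s | R s y}.indicator f s) ∂greenM ρ A
      = ∫⁻ s, f s * greenM ρ A {y | R s y} := by
  have hm : Measurable fun p : ℝ × ℝ => {s | R s p.1}.indicator f p.2 := by
    have : (fun p : ℝ × ℝ => {s | R s p.1}.indicator f p.2) =
        (Prod.swap ⁻¹' {p : ℝ × ℝ | R p.1 p.2}).indicator fun p => f p.2 := by
      ext p; by_cases h : R p.2 p.1 <;> simp [Set.indicator, h]
    rw [this]
    exact (hf.comp measurable_snd).indicator (hR.preimage measurable_swap)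
  rw [lintegral_lintegral_swap (f := fun y s => {s | R s y}.indicator f s) hm.aemeasurable]
  refine lintegral_congr fun s => ?_
  have : (fun y => {s | R s y}.indicator f s) = {y | R s y}.indicator fun _ => f s := by
    ext y; by_cases h : R s y <;> simp [Set.indicator, h]
  rw [this, lintegral_indicator_const
    (show MeasurableSet {y | R s y} from hR.preimage measurable_prodMk_left)]

lemma lintegral_shift_indicator (f : ℝ → ℝ≥0∞) {U : Set ℝ} (hU : MeasurableSet U) (y : ℝ) :
    ∫⁻ x in U, f (x + y) = ∫⁻ s, {s | s - y ∈ U}.indicator f s := by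
  rw [← lintegral_indicator hU,
    ← lintegral_add_right_eq_self (fun s => {s | s - y ∈ U}.indicator f s) y]
  refine lintegral_congr fun x => ?_
  by_cases h : x ∈ U
  · rw [indicator_of_mem h, indicator_of_mem (show x + y ∈ {s | s - y ∈ U} by change x + y - y ∈ U; rwa [add_sub_cancel_right])]
  · rw [indicator_of_notMem h,
      indicator_of_notMem (show x + y ∉ {s | s - y ∈ U} by change x + y - y ∉ U; rwa [add_sub_cancel_right])]

lemma lintegral_congr_indicator {U V : Set ℝ} {a : ℝ} (h : ∀ s, s ≠ a → (s ∈ U ↔ s ∈ V)) :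
    ∫⁻ s, U.indicator f s = ∫⁻ s, V.indicator f s := by
  refine lintegral_congr_ae ?_
  filter_upwards [Measure.ae_ne volume a] with s hs
  by_cases h' : s ∈ U
  · rw [indicator_of_mem h', indicator_of_mem ((h s hs).1 h')]
  · rw [indicator_of_notMem h', indicator_of_notMem (mt (h s hs).2 h')]

lemma LLT.le_liminf_desc (hL : LLT ρ ℓ C) (hf : LowerSemicontinuous f) :
    ofReal C * ∫⁻ s, f s * renU ρ (-s) ≤
      liminf (fun n => ofReal (scaleW ℓ n) * ∫⁻ x, f x ∂descLaw ρ n) atTop := by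
  refine le_trans (le_of_eq ?_) (hL.le_liminf_stay isHalf_Iio (U := Iio 0) isOpen_Iio subset_rfl hf)
  rw [← lintegral_greenM]
  congr 1
  have hR : MeasurableSet {p : ℝ × ℝ | p.1 ≤ p.2} := measurableSet_le measurable_fst measurable_snd
  have h1 := lintegral_indicator_le_greenM (ρ := ρ) hf.measurable (Iio 0) (R := fun s y => s ≤ y) hR
  refine Eq.trans ?_ (h1.symm.trans (lintegral_congr fun y => ?_))
  · refine lintegral_congr fun s => ?_
    rw [renU_eq_greenM, neg_neg]; rfl
  · rw [lintegral_shift_indicator f measurableSet_Iio]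
    refine lintegral_congr_indicator (a := y) fun s hs => ?_
    simp only [mem_Iio]
    change s ≤ y ↔ s - y < 0
    rw [sub_neg]
    exact ⟨fun h => lt_of_le_of_ne h hs, le_of_lt⟩

lemma LLT.le_liminf_asc (hL : LLT ρ ℓ C) (hf : LowerSemicontinuous f) :
    ofReal C * ∫⁻ s, f s * greenM ρ (Ici 0) (Iio s) ≤
      liminf (fun n => ofReal (scaleW ℓ n) * ∫⁻ x, f x ∂ascLaw ρ n) atTop := by
  refine le_trans (le_of_eq ?_) (hL.le_liminf_stay isHalf_Ici (U := Ioi 0)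
    isOpen_Ioi Ioi_subset_Ici_self hf)
  rw [← lintegral_greenM]
  congr 1
  have hR : MeasurableSet {p : ℝ × ℝ | p.2 < p.1} := measurableSet_lt measurable_snd measurable_fst
  have h1 := lintegral_indicator_le_greenM (ρ := ρ) hf.measurable (Ici 0) (R := fun s y => y < s) hR
  refine h1.symm.trans (lintegral_congr fun y => ?_)
  rw [lintegral_shift_indicator f measurableSet_Ioi]
  refine lintegral_congr_indicator (a := y) fun s hs => ?_
  change y < s ↔ 0 < s - y
  rw [sub_pos]

lemma lintegral_green_split (hf : Measurable f) {y : ℝ} (hy : 0 < y) :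
    renV ρ y * ∫⁻ s, (Iio y).indicator f s * renU ρ (y - s) ≤
      ∫⁻ x in Iio y, (∫⁻ s, f (x + s) * renU ρ (-s)) ∂greenM ρ (Ici 0)
      + ∫⁻ w, (∫⁻ r, (Iio y).indicator (fun r => f (r + w)) r * greenM ρ (Ici 0) (Iio r))
        ∂greenM ρ (Iio 0) := by
  have m3 : ∀ {P : ℝ → ℝ → ℝ → Prop}, MeasurableSet {p : (ℝ × ℝ) × ℝ | P p.1.1 p.1.2 p.2} →
      Measurable fun p : ℝ × ℝ => ∫⁻ s, {s | P p.1 p.2 s}.indicator f s := by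
    intro P hP
    refine Measurable.lintegral_prod_right' (f := fun p : (ℝ × ℝ) × ℝ =>
      {s | P p.1.1 p.1.2 s}.indicator f p.2) ?_
    have : (fun p : (ℝ × ℝ) × ℝ => {s | P p.1.1 p.1.2 s}.indicator f p.2) =
        {p : (ℝ × ℝ) × ℝ | P p.1.1 p.1.2 p.2}.indicator fun p => f p.2 := by
      ext p; by_cases h : P p.1.1 p.1.2 p.2 <;> simp [Set.indicator, h]
    rw [this]
    exact (hf.comp measurable_snd).indicator hP
  have hms : ∀ g h : (ℝ × ℝ) × ℝ → ℝ, Measurable g → Measurable h →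
      MeasurableSet {p | g p < h p} := fun g h => measurableSet_lt
  have hme : ∀ g h : (ℝ × ℝ) × ℝ → ℝ, Measurable g → Measurable h →
      MeasurableSet {p | g p ≤ h p} := fun g h => measurableSet_le
  have e0 : renV ρ y * ∫⁻ s, (Iio y).indicator f s * renU ρ (y - s) =
      ∫⁻ x in Iio y, (∫⁻ w, (∫⁻ s, {s | s < y ∧ s - y ≤ w}.indicator f s) ∂greenM ρ (Iio 0))
        ∂greenM ρ (Ici 0) := by
    rw [lintegral_const, Measure.restrict_apply_univ, renV_eq_greenM hy, mul_comm]
    congr 1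
    have h1 := lintegral_indicator_le_greenM (ρ := ρ) (hf.indicator measurableSet_Iio) (Iio 0)
      (f := (Iio y).indicator f) (R := fun s w => s - y ≤ w)
      (measurableSet_le (measurable_fst.sub_const y) measurable_snd)
    refine Eq.trans (lintegral_congr fun s => ?_) (h1.symm.trans (lintegral_congr fun w =>
      lintegral_congr fun s => ?_))
    · rw [renU_eq_greenM, neg_sub]; rfl
    · rw [indicator_indicator, inter_comm]; rfl
  have e1 : ∫⁻ x in Iio y, (∫⁻ s, f (x + s) * renU ρ (-s)) ∂greenM ρ (Ici 0) =
      ∫⁻ x in Iio y, (∫⁻ w, (∫⁻ s, {s | s - x ≤ w}.indicator f s) ∂greenM ρ (Iio 0))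
        ∂greenM ρ (Ici 0) := by
    refine lintegral_congr fun x => ?_
    rw [lintegral_indicator_le_greenM (ρ := ρ) hf (Iio 0) (R := fun s w => s - x ≤ w)
      (measurableSet_le (measurable_fst.sub_const x) measurable_snd),
      ← lintegral_add_right_eq_self (fun s => f s * greenM ρ (Iio 0) {w | s - x ≤ w}) x]
    refine lintegral_congr fun s => ?_
    rw [renU_eq_greenM, neg_neg, add_comm x s, add_sub_cancel_right]; rfl
  have e2 : ∫⁻ w, (∫⁻ r, (Iio y).indicator (fun r => f (r + w)) r * greenM ρ (Ici 0) (Iio r))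
        ∂greenM ρ (Iio 0) =
      ∫⁻ x, (∫⁻ w, (∫⁻ s, {s | s - w < y ∧ x < s - w}.indicator f s) ∂greenM ρ (Iio 0))
        ∂greenM ρ (Ici 0) := by
    rw [← lintegral_lintegral_swap (f := fun w x => ∫⁻ s, {s | s - w < y ∧ x < s - w}.indicator f s)
      (m3 (P := fun w x s => s - w < y ∧ x < s - w)
      ((hms _ _ (by fun_prop) (by fun_prop)).inter (hms _ _ (by fun_prop) (by fun_prop)))).aemeasurable]
    refine lintegral_congr fun w => ?_
    have hmw : MeasurableSet {s : ℝ | s - w < y} :=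
      measurableSet_lt (measurable_id.sub_const w) measurable_const
    have h1 := lintegral_indicator_le_greenM (ρ := ρ) (hf.indicator hmw) (Ici 0)
      (f := {s : ℝ | s - w < y}.indicator f) (R := fun s x => x < s - w)
      (measurableSet_lt measurable_snd (measurable_fst.sub_const w))
    refine Eq.trans ?_ (h1.symm.trans (lintegral_congr fun w =>
      lintegral_congr fun s => ?_))
    · rw [← lintegral_add_right_eq_self (fun s => {s : ℝ | s - w < y}.indicator f s *
        greenM ρ (Ici 0) {x | x < s - w}) w]
      refine lintegral_congr fun r => ?_
      by_cases h : r < y <;> simp [Set.indicator, h]; rfl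
    · rw [indicator_indicator, inter_comm]; rfl
  rw [e0, e1, e2]
  refine (add_le_add_right (setLIntegral_le_lintegral (Iio y) _) _).trans' ?_
  have m1 : Measurable fun x => ∫⁻ w, (∫⁻ s, {s | s - x ≤ w}.indicator f s) ∂greenM ρ (Iio 0) :=
    (m3 (P := fun x w s => s - x ≤ w) (hme _ _ (by fun_prop) (by fun_prop))).lintegral_prod_right'
  rw [← lintegral_add_left m1]
  refine lintegral_mono_ae ?_
  filter_upwards [ae_restrict_mem measurableSet_Iio, ae_restrict_of_ae (ae_greenM measurableSet_Ici
    measurableSet_Ici self_mem_Ici subset_rfl)] with x hxy hx0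
  have m2 : Measurable fun w => ∫⁻ s, {s | s - x ≤ w}.indicator f s :=
    (m3 (P := fun x w s => s - x ≤ w) (hme _ _ (by fun_prop) (by fun_prop))).comp
      measurable_prodMk_left
  rw [← lintegral_add_left m2]
  refine lintegral_mono fun w => ?_
  have m4 : MeasurableSet {s | s - x ≤ w} :=
    measurableSet_le (measurable_id.sub_const x) measurable_const
  rw [← lintegral_add_left (hf.indicator m4)]
  refine lintegral_mono_ae ?_
  filter_upwards [Measure.ae_ne volume (y + w)] with s hs
  by_cases h : s < y ∧ s - y ≤ w
  · rw [indicator_of_mem (show s ∈ {s | s < y ∧ s - y ≤ w} from h)]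
    by_cases h1 : s - x ≤ w
    · rw [indicator_of_mem (show s ∈ {s | s - x ≤ w} from h1)]
      exact le_self_add
    · have h2 : s - w < y ∧ x < s - w :=
        ⟨lt_of_le_of_ne (by linarith [h.2]) fun h3 => hs (by linarith), by linarith [not_le.1 h1]⟩
      rw [indicator_of_mem (show s ∈ {s | s - w < y ∧ x < s - w} from h2)]
      exact le_add_self
  · rw [indicator_of_notMem (show s ∉ {s | s < y ∧ s - y ≤ w} from h)]
    exact bot_le

lemma LLT.le_liminf_stay_Iio (hL : LLT ρ ℓ C) {y : ℝ} (hy : 0 < y)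
    (hf : LowerSemicontinuous f) :
    ofReal C * (renV ρ y * ∫⁻ s, (Iio y).indicator f s * renU ρ (y - s)) ≤
      liminf (fun n => ofReal (scaleW ℓ n) * ∫⁻ x, f x ∂stayLaw ρ (Iio y) n) atTop := by
  have hfm := hf.measurable
  have hlc : ∀ a : ℝ, LowerSemicontinuous fun x => f (a + x) := fun a =>
    hf.comp (by fun_prop : Continuous fun x => a + x)
  have hrc : ∀ a : ℝ, LowerSemicontinuous ((Iio y).indicator fun x => f (x + a)) := fun a =>
    lowerSemicontinuous_indicator isOpen_Iio (hf.comp (by fun_prop : Continuous fun x => x + a))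
  have hm2 : Measurable fun p : ℝ × ℝ => f (p.1 + p.2) := by fun_prop
  have hmU : Measurable fun s => renU ρ (-s) := measurable_renU.comp measurable_neg
  have hmG : Measurable fun r => greenM ρ (Ici 0) (Iio r) :=
    Monotone.measurable fun a b hab => measure_mono (Iio_subset_Iio hab)
  have hm1 : Measurable fun x => ∫⁻ s, f (x + s) * renU ρ (-s) :=
    Measurable.lintegral_prod_right' (f := fun p : ℝ × ℝ => f (p.1 + p.2) * renU ρ (-p.2))
      (hm2.mul (hmU.comp measurable_snd))
  have hind : Measurable fun p : ℝ × ℝ => (Iio y).indicator (fun x => f (x + p.1)) p.2 := by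
    have : (fun p : ℝ × ℝ => (Iio y).indicator (fun x => f (x + p.1)) p.2) =
        (Prod.snd ⁻¹' Iio y).indicator fun p : ℝ × ℝ => f (p.2 + p.1) := rfl
    rw [this]
    exact (by fun_prop : Measurable fun p : ℝ × ℝ => f (p.2 + p.1)).indicator
      (measurable_snd measurableSet_Iio)
  have hm3 : Measurable fun w =>
      ∫⁻ r, (Iio y).indicator (fun r => f (r + w)) r * greenM ρ (Ici 0) (Iio r) :=
    Measurable.lintegral_prod_right' (f := fun p : ℝ × ℝ =>
      (Iio y).indicator (fun x => f (x + p.1)) p.2 * greenM ρ (Ici 0) (Iio p.2))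
      (hind.mul (hmG.comp measurable_snd))
  set g : ℕ → ℕ → ℝ≥0∞ := fun n k => ofReal (scaleW ℓ n) *
    ∫⁻ x in Iio y, ∫⁻ w, f (x + w) ∂descLaw ρ (n - k) ∂ascLaw ρ k with hg
  have h1 : ∀ n, ofReal (scaleW ℓ n) * ∫⁻ x, f x ∂stayLaw ρ (Iio y) n =
      ∑ k ∈ range (n + 1), g n k := fun n => by
    rw [(halfPair_Iio hy).lintegral_eq n hfm, mul_sum, compl_Iio]
  have h2 := tsum_add_tsum_le_liminf_sum (g := g)
    (a := fun k => ofReal C *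
      ∫⁻ x in Iio y, (∫⁻ s, f (x + s) * renU ρ (-s)) ∂stayLaw ρ (Ici 0) k)
    (b := fun j => ofReal C *
      ∫⁻ w, (∫⁻ r, (Iio y).indicator (fun r => f (r + w)) r * greenM ρ (Ici 0) (Iio r))
        ∂stayLaw ρ (Iio 0) j) (fun k => ?_) fun j => ?_
  · simp only [h1]
    refine le_trans ?_ h2
    rw [ENNReal.tsum_mul_left, ENNReal.tsum_mul_left, ← mul_add]
    refine mul_le_mul_of_nonneg_left ((lintegral_green_split hfm hy).trans (le_of_eq ?_)) bot_le
    rw [lintegral_greenM, ← lintegral_indicator measurableSet_Iio, lintegral_greenM]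
    simp only [lintegral_indicator measurableSet_Iio]
  · have hmd : ∀ n, Measurable fun x => ∫⁻ w, f (x + w) ∂descLaw ρ n := fun n =>
      hm2.lintegral_prod_right'
    rw [← lintegral_const_mul _ hm1]
    refine (lintegral_mono fun x => (hL.le_liminf_desc (hlc x)).trans
      (liminf_le_liminf_shift hL.reg.scaleW_pos (hL.reg.tendsto_scaleW k) _)).trans ?_
    refine (lintegral_liminf_le fun n => (hmd (n - k)).const_mul _).trans (le_of_eq ?_)
    congr 1
    ext n
    exact lintegral_const_mul _ (hmd _)
  · have hma : ∀ n, Measurable fun w =>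
        ∫⁻ r, (Iio y).indicator (fun r => f (r + w)) r ∂ascLaw ρ n := fun n =>
      hind.lintegral_prod_right'
    rw [← lintegral_const_mul _ hm3]
    refine (lintegral_mono fun w => (hL.le_liminf_asc (hrc w)).trans
      (liminf_le_liminf_shift hL.reg.scaleW_pos (hL.reg.tendsto_scaleW j) _)).trans ?_
    refine (lintegral_liminf_le fun n => (hma (n - j)).const_mul _).trans ?_
    refine liminf_le_liminf ?_
    filter_upwards [eventually_ge_atTop j] with n hn
    rw [lintegral_const_mul _ (hma _), hg]
    refine mul_le_mul_of_nonneg_left (le_of_eq ?_) bot_le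
    rw [Nat.sub_sub_self hn, ← lintegral_indicator measurableSet_Iio,
      lintegral_lintegral_swap (f := fun w r => (Iio y).indicator (fun r => f (r + w)) r)
        hind.aemeasurable]
    refine lintegral_congr fun x => ?_
    by_cases h : x ∈ Iio y
    · simp only [indicator_of_mem h]
    · simp only [indicator_of_notMem h, lintegral_zero]

/-- The normalising constant `∫₀^∞ e^{-z} u(z) dz`. -/
def expU (ρ : Measure (ℝ × ℝ)) [IsProbabilityMeasure ρ] : ℝ≥0∞ :=
  ∫⁻ s in Iio 0, ofReal (exp s) * renU ρ (-s)

lemma lintegral_exp_Iic (y : ℝ) : ∫⁻ s in Iic y, ofReal (exp s) =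
    ofReal (exp y) := by
  rw [← ofReal_integral_eq_lintegral_ofReal (integrableOn_exp_Iic y)
    (.of_forall fun s => (exp_pos s).le), integral_exp_Iic]

lemma tsum_tilt_one : ∑' n, tilt ρ (Iio 0) 1 n = expU ρ := by
  have hexp : Measurable fun s => ofReal (exp s) := by fun_prop
  have h := lintegral_indicator_le_greenM (ρ := ρ) (hexp.indicator measurableSet_Iio) (Iio 0)
    (f := (Iio 0).indicator fun s => ofReal (exp s)) (R := fun s y => s ≤ y)
    (measurableSet_le measurable_fst measurable_snd)
  have h2 : expU ρ = ∫⁻ s, ((Iio 0).indicator fun s => ofReal (exp s)) s *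
      greenM ρ (Iio 0) {y | s ≤ y} := by
    rw [expU, ← lintegral_indicator measurableSet_Iio]
    refine lintegral_congr fun s => ?_
    by_cases h : s ∈ Iio 0
    · rw [indicator_of_mem h, indicator_of_mem h, renU_eq_greenM, neg_neg]; rfl
    · rw [indicator_of_notMem h, indicator_of_notMem h, zero_mul]
  rw [h2, ← h]
  simp only [tilt, one_mul]
  rw [← lintegral_greenM]
  refine lintegral_congr_ae ?_
  filter_upwards [ae_greenM measurableSet_Iio measurableSet_Iic self_mem_Iic
    (Iio_subset_Iic_self : Iio (0:ℝ) ⊆ Iic 0)] with y hy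
  rw [← lintegral_exp_Iic y, ← lintegral_indicator measurableSet_Iic]
  refine lintegral_congr_ae ?_
  filter_upwards [Measure.ae_ne volume (0 : ℝ)] with s hs
  by_cases h : s ≤ y
  · rw [indicator_of_mem (show s ∈ Iic y from h), indicator_of_mem (show s ∈ {s | s ≤ y} from h),
      indicator_of_mem (show s ∈ Iio 0 from lt_of_le_of_ne (h.trans hy) hs)]
  · rw [indicator_of_notMem (show s ∉ Iic y from h),
      indicator_of_notMem (show s ∉ {s | s ≤ y} from h)]

lemma one_le_expU : 1 ≤ expU ρ := by
  rw [← tsum_tilt_one, ← tilt_zero (ρ := ρ) (A := Iio 0) (θ := 1)]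
  exact le_tsum 0

lemma tilt_one_ne_top (n : ℕ) : tilt ρ (Iio 0) 1 n ≠ ⊤ := by
  refine ne_top_of_le_ne_top ?_ (tilt_le measurableSet_Iio (fun x hx => ?_) n)
  · exact one_ne_top
  · rw [one_mul]; exact le_of_lt hx

lemma setLIntegral_exp_toReal (n : ℕ) :
    (∫⁻ x in Iio 0, ofReal (exp (1 * x)) ∂walkLaw ρ n).toReal =
      ∫ x in Iio 0, exp x ∂walkLaw ρ n := by
  rw [integral_eq_lintegral_of_nonneg_ae (.of_forall fun x => (exp_pos x).le)
    (by fun_prop)]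
  simp only [one_mul]

lemma LLT.tilt_one (hL : LLT ρ ℓ C) : expU ρ ≠ ⊤ ∧
    Tendsto (fun n => ofReal (scaleW ℓ n) * tilt ρ (Iio 0) 1 n) atTop
      (𝓝 (ofReal C * expU ρ)) := by
  have hs := spitzerSeq_tilt (ρ := ρ) (A := Iio 0) (θ := 1) isHalf_Iio
    (fun x hx => by rw [one_mul]; exact le_of_lt hx)
  have hC := hL.lim
  simp only [← setLIntegral_exp_toReal] at hC
  have hb : ∃ K, ∀ k, (∫⁻ x in Iio 0, ofReal (exp (1 * x)) ∂walkLaw ρ k).toReal ≤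
      K * ℓ k := by
    obtain ⟨K, hK⟩ := hC.bddAbove_range
    exact ⟨K, fun k => (div_le_iff₀ (hL.reg.pos k)).1 (hK ⟨k, rfl⟩)⟩
  have hsum := hs.summable hL.reg hb
  have ht := hs.tendsto hL.reg hb hC
  have hU : expU ρ = ofReal (∑' n, (tilt ρ (Iio 0) 1 n).toReal) := by
    rw [ENNReal.ofReal_tsum_of_nonneg (fun n => toReal_nonneg) hsum, ← tsum_tilt_one]
    exact tsum_congr fun n => (ofReal_toReal (tilt_one_ne_top n)).symm
  refine ⟨hU ▸ ofReal_ne_top, ?_⟩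
  rw [hU, ← ofReal_mul hL.C_pos.le]
  refine (ENNReal.tendsto_ofReal ht).congr' ?_
  filter_upwards [hL.reg.scaleW_pos] with n hn
  rw [← ofReal_toReal (tilt_one_ne_top n), ← ofReal_mul hn.le,
    toReal_ofReal toReal_nonneg, scaleW]
  congr 1
  rw [div_div_eq_mul_div, mul_div_right_comm, mul_comm]
  ring

/-- The partial sums `∑_{j<k} η_{j+1} e^{S_{j+1}}`. -/
def pW (k : ℕ) (ω : Traj) : ℝ≥0∞ :=
  ∑ j ∈ range k, ofReal (ω j).2 * ofReal (exp (pS (j + 1) ω))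

/-- The partial sums `∑_{i<k} η_{i+1} e^{-S_i}`. -/
def pB (k : ℕ) (ω : Traj) : ℝ≥0∞ :=
  ∑ i ∈ range k, ofReal (ω i).2 * ofReal (exp (-pS i ω))

@[fun_prop]
lemma measurable_pW (k : ℕ) : Measurable (pW k) := by unfold pW; fun_prop

@[fun_prop]
lemma measurable_pB (k : ℕ) : Measurable (pB k) := by unfold pB; fun_prop

lemma pB_ne_top (k : ℕ) (ω : Traj) : pB k ω ≠ ⊤ :=
  (ENNReal.sum_lt_top.2 fun _ _ => mul_lt_top ofReal_lt_top
    ofReal_lt_top).ne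

lemma pS_congr {k : ℕ} {ω ω' : Traj} (h : ∀ i < k, ω i = ω' i) : pS k ω = pS k ω' :=
  sum_congr rfl fun i hi => by rw [h i (mem_range.1 hi)]

lemma pW_congr {k : ℕ} {ω ω' : Traj} (h : ∀ i < k, ω i = ω' i) : pW k ω = pW k ω' :=
  sum_congr rfl fun i hi => by
    have hi := mem_range.1 hi
    rw [h i hi, pS_congr fun j hj => h j (by omega)]

lemma pB_congr {k : ℕ} {ω ω' : Traj} (h : ∀ i < k, ω i = ω' i) : pB k ω = pB k ω' :=
  sum_congr rfl fun i hi => by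
    have hi := mem_range.1 hi
    rw [h i hi, pS_congr fun j hj => h j (by omega)]

lemma stay_congr {k : ℕ} {ω ω' : Traj} (A : Set ℝ) (h : ∀ i < k, ω i = ω' i) :
    ω ∈ stay A k ↔ ω' ∈ stay A k :=
  forall_congr' fun i => forall_congr' fun _ => forall_congr' fun hi => by
    rw [pS_congr fun j hj => h j (by omega)]

/-- Unnormalised density of the walk conditioned to stay negative. -/
def dnK (ρ : Measure (ℝ × ℝ)) [IsProbabilityMeasure ρ] (k : ℕ) (ω : Traj) : ℝ≥0∞ :=
  (stay (Iio 0) k).indicator (fun ω => renV ρ (-pS k ω)) ω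

/-- Unnormalised density of the walk conditioned to stay above the level `s`. -/
def upK (ρ : Measure (ℝ × ℝ)) [IsProbabilityMeasure ρ] (k : ℕ) (s : ℝ) (ω : Traj) : ℝ≥0∞ :=
  (stay (Ici s) k).indicator (fun ω => renU ρ (pS k ω - s)) ω

@[fun_prop]
lemma measurable_dnK (k : ℕ) : Measurable (dnK ρ k) :=
  (measurable_renV.comp (by fun_prop)).indicator (measurableSet_stay measurableSet_Iio k)

lemma measurable_upK_prod (k : ℕ) :
    Measurable fun p : ℝ × Traj => upK ρ k p.1 p.2 := by
  have hS : MeasurableSet {p : ℝ × Traj | p.2 ∈ stay (Ici p.1) k} := by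
    have : {p : ℝ × Traj | p.2 ∈ stay (Ici p.1) k} =
        ⋂ i, ⋂ (_ : 1 ≤ i), ⋂ (_ : i ≤ k), {p : ℝ × Traj | p.1 ≤ pS i p.2} := by
      ext p; simp only [mem_iInter]; rfl
    rw [this]
    exact MeasurableSet.iInter fun i => MeasurableSet.iInter fun _ => MeasurableSet.iInter fun _ =>
      measurableSet_le (by fun_prop) (by fun_prop)
  have : (fun p : ℝ × Traj => upK ρ k p.1 p.2) =
      {p : ℝ × Traj | p.2 ∈ stay (Ici p.1) k}.indicator
        fun p => renU ρ (pS k p.2 - p.1) := by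
    ext p
    by_cases h : p.2 ∈ stay (Ici p.1) k
    · rw [upK, indicator_of_mem h, indicator_of_mem (show p ∈ {p : ℝ × Traj |
        p.2 ∈ stay (Ici p.1) k} from h)]
    · rw [upK, indicator_of_notMem h, indicator_of_notMem (show p ∉ {p : ℝ × Traj |
        p.2 ∈ stay (Ici p.1) k} from h)]
  rw [this]
  exact (measurable_renU.comp (by fun_prop)).indicator hS

@[fun_prop]
lemma Measurable.upK {α : Type*} [MeasurableSpace α] {k : ℕ} {f : α → ℝ} {g : α → Traj}
    (hf : Measurable f) (hg : Measurable g) : Measurable fun a => BPREpaper.upK ρ k (f a) (g a) :=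
  (measurable_upK_prod k).comp (hf.prodMk hg)

/-- The limiting functional obtained from the first `k` and last `k` steps of the path. -/
def Phi (ρ : Measure (ℝ × ℝ)) [IsProbabilityMeasure ρ] (G : ℝ≥0∞ → ℝ≥0∞) (k : ℕ) (s : ℝ) :
    ℝ≥0∞ :=
  ∫⁻ ω₁, dnK ρ k ω₁ * ∫⁻ ω₃, upK ρ k s ω₃ *
    G (pW k ω₁ + ofReal (exp s) * pB k ω₃) ∂pathLaw ρ ∂pathLaw ρ

lemma pW_pcat3 (k m : ℕ) (ω₁ ω₂ ω₃ : Traj) : pW k (pcat3 k m k ω₁ ω₂ ω₃) = pW k ω₁ :=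
  pW_congr fun i hi => by simp [pcat3, pcat, hi]

lemma pB_prev_pcat3 (k m : ℕ) (ω₁ ω₂ ω₃ : Traj) :
    pB k (prev (k + m + k) (pcat3 k m k ω₁ ω₂ ω₃)) = pB k ω₃ :=
  pB_congr fun i hi => by
    have h1 : i < k + m + k := by omega
    have h2 : ¬ k + m + k - 1 - i < k := by omega
    have h3 : ¬ k + m + k - 1 - i - k < m := by omega
    have h4 : k + m + k - 1 - i - k - m < k := by omega
    have h5 : k - 1 - (k + m + k - 1 - i - k - m) = i := by omega
    simp only [prev, pcat3, pcat, h1, h2, h3, h4, h5, if_true, if_false]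

/-- The functional of a path of length `n` that only sees its first and last `k` steps. -/
def truncF (G : ℝ≥0∞ → ℝ≥0∞) (k n : ℕ) (ω : Traj) : ℝ≥0∞ :=
  (stay (Iio 0) n).indicator (fun ω => ofReal (exp (pS n ω)) *
    G (pW k ω + ofReal (exp (pS n ω)) * pB k (prev n ω))) ω

lemma measurable_truncF (hG : Measurable G) (k n : ℕ) : Measurable (truncF G k n) :=
  Measurable.indicator (by fun_prop) (measurableSet_stay measurableSet_Iio n)

/-- The endpoint functional for fixed initial and final pieces. -/
def midF (G : ℝ≥0∞ → ℝ≥0∞) (k : ℕ) (ω₁ ω₃ : Traj) (s : ℝ) : ℝ≥0∞ :=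
  {s : ℝ | ∀ i ∈ range (k + 1), s < pS i ω₃}.indicator (fun s => ofReal (exp s) *
    G (pW k ω₁ + ofReal (exp s) * pB k ω₃)) s

lemma lowerSemicontinuous_midF (hG : Continuous G) (k : ℕ) (ω₁ ω₃ : Traj) :
    LowerSemicontinuous (midF G k ω₁ ω₃) := by
  refine lowerSemicontinuous_indicator ?_ (Continuous.lowerSemicontinuous ?_)
  · have : {s : ℝ | ∀ i ∈ range (k + 1), s < pS i ω₃} =
        ⋂ i ∈ range (k + 1), Iio (pS i ω₃) := by ext; simp
    rw [this]
    exact isOpen_biInter_finset fun i _ => isOpen_Iio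
  · have h1 : Continuous fun s => ofReal (exp s) := continuous_ofReal.comp Real.continuous_exp
    have h2 : Continuous fun s => pW k ω₁ + ofReal (exp s) * pB k ω₃ :=
      continuous_const.add (ENNReal.continuous_mul_const (pB_ne_top k ω₃) |>.comp h1)
    refine continuous_iff_continuousAt.2 fun s => ?_
    exact ENNReal.Tendsto.mul h1.continuousAt (Or.inl (by
      rw [Ne, ENNReal.ofReal_eq_zero, not_le]; exact exp_pos s))
      (hG.comp h2).continuousAt (Or.inr ofReal_ne_top)

lemma midF_le_truncF (k m : ℕ) {ω₁ ω₂ ω₃ : Traj} (h₁ : ω₁ ∈ stay (Iio 0) k)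
    (h₂ : ω₂ ∈ stay (Iio (-pS k ω₁)) m) :
    midF G k ω₁ ω₃ (pS k ω₁ + pS m ω₂ + pS k ω₃) ≤
      truncF G k (k + m + k) (pcat3 k m k ω₁ ω₂ ω₃) := by
  by_cases h : pS k ω₁ + pS m ω₂ + pS k ω₃ ∈ {s : ℝ | ∀ i ∈ range (k + 1), s < pS i ω₃}
  · have h' : pcat3 k m k ω₁ ω₂ ω₃ ∈ stay (Iio 0) (k + m + k) := by
      intro i hi hi'
      rcases le_or_gt i k with h3 | h3
      · rw [pS_pcat3_left h3]; exact h₁ i hi h3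
      · obtain ⟨j, rfl⟩ := Nat.exists_eq_add_of_lt h3
        rcases le_or_gt (j + 1) m with h4 | h4
        · rw [add_assoc, pS_pcat3_middle h4]
          have : pS (j + 1) ω₂ < -pS k ω₁ := h₂ (j + 1) (by omega) h4
          rw [mem_Iio]
          linarith
        · obtain ⟨l, hl⟩ : ∃ l, k + j + 1 = k + m + l := ⟨j + 1 - m, by omega⟩
          have hlk : l ≤ k := by omega
          rw [hl, pS_pcat3_right hlk]
          have := h (k - l) (mem_range.2 (by omega))
          rw [mem_Iio]
          linarith
    rw [midF, indicator_of_mem h, truncF, indicator_of_mem h', pS_pcat3, pW_pcat3, pB_prev_pcat3]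
  · rw [midF, indicator_of_notMem h]; exact bot_le

lemma LLT.le_liminf_mid (hL : LLT ρ ℓ C) (hG : Continuous G) {k : ℕ} (hk : 1 ≤ k)
    (ω₁ ω₃ : Traj) :
    ofReal C * (dnK ρ k ω₁ * ∫⁻ s in Iio 0, ofReal (exp s) *
      (upK ρ k s ω₃ * G (pW k ω₁ + ofReal (exp s) * pB k ω₃))) ≤
    liminf (fun m => ofReal (scaleW ℓ m) *
      ∫⁻ ω₂, truncF G k (k + m + k) (pcat3 k m k ω₁ ω₂ ω₃) ∂pathLaw ρ) atTop := by
  by_cases h₁ : ω₁ ∈ stay (Iio 0) k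
  swap
  · rw [dnK, indicator_of_notMem h₁, zero_mul, mul_zero]; exact bot_le
  have hy : 0 < -pS k ω₁ := neg_pos.2 (h₁ k hk le_rfl)
  set y := -pS k ω₁ with hy'
  set b := pS k ω₁ + pS k ω₃ with hb
  have hlsc : LowerSemicontinuous fun x => midF G k ω₁ ω₃ (x + b) :=
    (lowerSemicontinuous_midF hG k ω₁ ω₃).comp (by fun_prop : Continuous fun x => x + b)
  have h := hL.le_liminf_stay_Iio hy hlsc
  refine le_trans (mul_le_mul_of_nonneg_left ?_ bot_le) (h.trans (liminf_le_liminf ?_))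
  · rw [dnK, indicator_of_mem h₁]
    refine mul_le_mul_of_nonneg_left ?_ bot_le
    rw [← lintegral_indicator measurableSet_Iio, ← lintegral_add_right_eq_self _ b]
    refine lintegral_mono_ae ?_
    have hae : ∀ᵐ x : ℝ, ∀ i ∈ range (k + 1), x ≠ pS i ω₃ - b :=
      (Finset.eventually_all _).2 fun i _ => Measure.ae_ne volume _
    filter_upwards [hae] with x hx
    by_cases h0 : x + b ∈ Iio 0 ∧ ω₃ ∈ stay (Ici (x + b)) k
    · have h3 : ∀ i ∈ range (k + 1), x + b < pS i ω₃ := fun i hi => by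
        refine lt_of_le_of_ne ?_ fun h => hx i hi (by linarith)
        rcases Nat.eq_zero_or_pos i with rfl | hi0
        · rw [pS_zero]; exact h0.1.le
        · exact h0.2 i hi0 (by have := mem_range.1 hi; omega)
      have h4 : x ∈ Iio y := by grind
      rw [indicator_of_mem h0.1, indicator_of_mem h4, midF,
        indicator_of_mem (show x + b ∈ {s : ℝ | ∀ i ∈ range (k + 1), s < pS i ω₃} from h3),
        upK, indicator_of_mem h0.2, show pS k ω₃ - (x + b) = y - x by rw [hb, hy']; ring]
      exact le_of_eq (by ring)
    · by_cases h1 : x + b ∈ Iio 0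
      · rw [indicator_of_mem h1, upK, indicator_of_notMem fun h2 => h0 ⟨h1, h2⟩, zero_mul, mul_zero]
        exact bot_le
      · rw [indicator_of_notMem h1]; exact bot_le
  · refine Eventually.of_forall fun m => mul_le_mul_of_nonneg_left ?_ bot_le
    rw [lintegral_stayLaw ρ measurableSet_Iio m hlsc.measurable]
    refine lintegral_mono fun ω₂ => ?_
    by_cases h₂ : ω₂ ∈ stay (Iio y) m
    · rw [indicator_of_mem h₂]
      refine le_trans (le_of_eq ?_) (midF_le_truncF k m (ω₃ := ω₃) h₁ h₂)
      congr 1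
      rw [hb]; ring
    · rw [indicator_of_notMem h₂]; exact bot_le

lemma setLIntegral_Phi (hG : Measurable G) (k : ℕ) :
    ∫⁻ s in Iio 0, ofReal (exp s) * Phi ρ G k s =
    ∫⁻ ω₁, ∫⁻ ω₃, dnK ρ k ω₁ * (∫⁻ s in Iio 0, ofReal (exp s) *
      (upK ρ k s ω₃ * G (pW k ω₁ + ofReal (exp s) * pB k ω₃)))
      ∂pathLaw ρ ∂pathLaw ρ := by
  have m1 : ∀ ω₁, Measurable fun p : ℝ × Traj => upK ρ k p.1 p.2 *
      G (pW k ω₁ + ofReal (exp p.1) * pB k p.2) := fun ω₁ => by fun_prop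
  have m2 : Measurable fun p : (Traj × ℝ) × Traj => upK ρ k p.1.2 p.2 *
      G (pW k p.1.1 + ofReal (exp p.1.2) * pB k p.2) := by fun_prop
  have m3 : Measurable fun p : Traj × ℝ => ∫⁻ ω₃, upK ρ k p.2 ω₃ *
      G (pW k p.1 + ofReal (exp p.2) * pB k ω₃) ∂pathLaw ρ := m2.lintegral_prod_right'
  have m4 : Measurable fun p : ℝ × Traj => dnK ρ k p.2 * ∫⁻ ω₃, upK ρ k p.1 ω₃ *
      G (pW k p.2 + ofReal (exp p.1) * pB k ω₃) ∂pathLaw ρ :=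
    (by fun_prop : Measurable fun p : ℝ × Traj => dnK ρ k p.2).mul (m3.comp measurable_swap)
  have m5 : ∀ ω₁, Measurable fun s : ℝ => ∫⁻ ω₃, upK ρ k s ω₃ *
      G (pW k ω₁ + ofReal (exp s) * pB k ω₃) ∂pathLaw ρ := fun ω₁ =>
    (m1 ω₁).lintegral_prod_right'
  calc _ = ∫⁻ s in Iio 0, ∫⁻ ω₁, ofReal (exp s) * (dnK ρ k ω₁ * ∫⁻ ω₃, upK ρ k s ω₃ *
        G (pW k ω₁ + ofReal (exp s) * pB k ω₃) ∂pathLaw ρ) ∂pathLaw ρ := by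
        refine lintegral_congr fun s => ?_
        rw [Phi, lintegral_const_mul]
        exact m4.comp measurable_prodMk_left
    _ = ∫⁻ ω₁, (∫⁻ s in Iio 0, ofReal (exp s) * (dnK ρ k ω₁ * ∫⁻ ω₃, upK ρ k s ω₃ *
        G (pW k ω₁ + ofReal (exp s) * pB k ω₃) ∂pathLaw ρ)) ∂pathLaw ρ :=
        lintegral_lintegral_swap (f := fun (s : ℝ) ω₁ => ofReal (exp s) * (dnK ρ k ω₁ *
          ∫⁻ ω₃, upK ρ k s ω₃ * G (pW k ω₁ + ofReal (exp s) * pB k ω₃) ∂pathLaw ρ))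
          ((by fun_prop : Measurable fun p : ℝ × Traj =>
            ofReal (exp p.1)).mul m4).aemeasurable
    _ = _ := by
        refine lintegral_congr fun ω₁ => ?_
        have m6 : Measurable fun p : ℝ × Traj => ofReal (exp p.1) *
            (upK ρ k p.1 p.2 * G (pW k ω₁ + ofReal (exp p.1) * pB k p.2)) := by
          fun_prop
        rw [lintegral_const_mul _ m6.lintegral_prod_left',
          ← lintegral_lintegral_swap (f := fun (s : ℝ) ω₃ => ofReal (exp s) *
            (upK ρ k s ω₃ * G (pW k ω₁ + ofReal (exp s) * pB k ω₃))) m6.aemeasurable,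
          ← lintegral_const_mul _ m6.lintegral_prod_right']
        refine lintegral_congr fun s => ?_
        have m7 : Measurable fun ω₃ => upK ρ k s ω₃ *
            G (pW k ω₁ + ofReal (exp s) * pB k ω₃) :=
          (m1 ω₁).comp measurable_prodMk_left
        simp only
        rw [lintegral_const_mul _ m7]
        ring

lemma mul_lintegral_lintegral_le_liminf {α β : Type*} [MeasurableSpace α] [MeasurableSpace β]
    {μ : Measure α} {ν : Measure β} [SFinite ν] {H : ℕ → α → β → ℝ≥0∞} {J : α → β → ℝ≥0∞}
    (hH : ∀ m, Measurable (Function.uncurry (H m))) (hJ : Measurable (Function.uncurry J))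
    {c : ℝ≥0∞} {w : ℕ → ℝ≥0∞} (h : ∀ a b, c * J a b ≤ liminf (fun m => w m * H m a b) atTop) :
    c * ∫⁻ a, ∫⁻ b, J a b ∂ν ∂μ ≤ liminf (fun m => w m * ∫⁻ a, ∫⁻ b, H m a b ∂ν ∂μ) atTop := by
  have hH' : ∀ m a, Measurable (H m a) := fun m a => (hH m).comp measurable_prodMk_left
  have hJ' : ∀ a, Measurable (J a) := fun a => hJ.comp measurable_prodMk_left
  have e : ∀ m, w m * ∫⁻ a, ∫⁻ b, H m a b ∂ν ∂μ = ∫⁻ a, ∫⁻ b, w m * H m a b ∂ν ∂μ := fun m => by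
    refine (lintegral_const_mul (w m) (hH m).lintegral_prod_right').symm.trans ?_
    refine lintegral_congr fun a => ?_
    exact (lintegral_const_mul _ (hH' m a)).symm
  simp only [e]
  refine le_trans ?_ (lintegral_liminf_le fun m =>
    ((hH m).const_mul (w m)).lintegral_prod_right')
  refine (lintegral_const_mul c hJ.lintegral_prod_right').symm.le.trans ?_
  refine lintegral_mono fun a => ?_
  refine le_trans ?_ (lintegral_liminf_le fun m => (hH' m a).const_mul (w m))
  refine (lintegral_const_mul c (hJ' a)).symm.le.trans ?_
  exact lintegral_mono fun b => h a b

lemma LLT.le_liminf_truncF (hL : LLT ρ ℓ C) (hG : Continuous G) {k : ℕ} (hk : 1 ≤ k) :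
    ofReal C * ∫⁻ s in Iio 0, ofReal (exp s) * Phi ρ G k s ≤
      liminf (fun n => ofReal (scaleW ℓ n) * ∫⁻ ω, truncF G k n ω ∂pathLaw ρ) atTop := by
  have hGm := hG.measurable
  have hH : ∀ m, Measurable fun p : Traj × Traj =>
      ∫⁻ ω₂, truncF G k (k + m + k) (pcat3 k m k p.1 ω₂ p.2) ∂pathLaw ρ := fun m =>
    Measurable.lintegral_prod_right' (f := fun q : (Traj × Traj) × Traj =>
      truncF G k (k + m + k) (pcat3 k m k q.1.1 q.2 q.1.2)) ((measurable_truncF hGm _ _).comp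
      ((measurable_pcat3 k m k).comp
      (measurable_fst.fst.prodMk (measurable_snd.prodMk measurable_fst.snd))))
  have key : ofReal C * ∫⁻ s in Iio 0, ofReal (exp s) * Phi ρ G k s ≤
      liminf (fun m => ofReal (scaleW ℓ m) *
        ∫⁻ ω, truncF G k (k + m + k) ω ∂pathLaw ρ) atTop := by
    have mJ : Measurable fun p : Traj × Traj => dnK ρ k p.1 *
        ∫⁻ s in Iio 0, ofReal (exp s) *
          (upK ρ k s p.2 * G (pW k p.1 + ofReal (exp s) * pB k p.2)) :=
      (by fun_prop : Measurable fun p : Traj × Traj => dnK ρ k p.1).mul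
        (Measurable.lintegral_prod_right' (f := fun q : (Traj × Traj) × ℝ =>
          ofReal (exp q.2) * (upK ρ k q.2 q.1.2 *
            G (pW k q.1.1 + ofReal (exp q.2) * pB k q.1.2))) (by fun_prop))
    simp only [fun m => lintegral_pcat3 ρ k m k (measurable_truncF hGm k (k + m + k))]
    rw [setLIntegral_Phi hGm]
    exact mul_lintegral_lintegral_le_liminf hH mJ fun ω₁ ω₃ => hL.le_liminf_mid hG hk ω₁ ω₃
  refine key.trans ((liminf_le_liminf_shift hL.reg.scaleW_pos
    (hL.reg.tendsto_scaleW (2 * k)) _).trans (le_of_eq (liminf_congr ?_)))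
  filter_upwards [eventually_ge_atTop (2 * k)] with n hn
  grind

/-- The increments of `pW`. -/
def dW (k h : ℕ) (ω : Traj) : ℝ≥0∞ :=
  ∑ j ∈ Finset.Ico k h, ofReal (ω j).2 * ofReal (exp (pS (j + 1) ω))

/-- The increments of `pB`. -/
def dB (k h : ℕ) (ω : Traj) : ℝ≥0∞ :=
  ∑ i ∈ Finset.Ico k h, ofReal (ω i).2 * ofReal (exp (-pS i ω))

@[fun_prop]
lemma measurable_dW (k h : ℕ) : Measurable (dW k h) := by unfold dW; fun_prop

@[fun_prop]
lemma measurable_dB (k h : ℕ) : Measurable (dB k h) := by unfold dB; fun_prop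

lemma dW_congr {k h : ℕ} {ω ω' : Traj} (hω : ∀ i < h, ω i = ω' i) : dW k h ω = dW k h ω' :=
  sum_congr rfl fun i hi => by
    have hi := (Finset.mem_Ico.1 hi).2
    rw [hω i hi, pS_congr fun j hj => hω j (by omega)]

lemma dB_congr {k h : ℕ} {ω ω' : Traj} (hω : ∀ i < h, ω i = ω' i) : dB k h ω = dB k h ω' :=
  sum_congr rfl fun i hi => by
    have hi := (Finset.mem_Ico.1 hi).2
    rw [hω i hi, pS_congr fun j hj => hω j (by omega)]

lemma pW_add_dW {k h : ℕ} (hk : k ≤ h) (ω : Traj) : pW k ω + dW k h ω = pW h ω :=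
  Finset.sum_range_add_sum_Ico _ hk

lemma pB_add_dB {k h : ℕ} (hk : k ≤ h) (ω : Traj) : pB k ω + dB k h ω = pB h ω :=
  Finset.sum_range_add_sum_Ico _ hk

lemma dW_eq_pB_prev (h h' : ℕ) (ω : Traj) :
    dW h (h + h') ω = ofReal (exp (pS (h + h') ω)) * pB h' (prev (h + h') ω) := by
  rw [dW, pB, mul_sum, Finset.sum_Ico_eq_sum_range, Nat.add_sub_cancel_left,
    ← Finset.sum_range_reflect]
  refine sum_congr rfl fun i hi => ?_
  have hi := mem_range.1 hi
  have h1 : h + h' - 1 - i = h + (h' - 1 - i) := by omega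
  have h2 : h + (h' - 1 - i) + 1 = h + h' - i := by omega
  have h3 : i < h + h' := by omega
  have h4 : pS i (prev (h + h') ω) = pS (h + h') ω - pS (h + h' - i) ω := pS_prev h3.le ω
  have h5 : prev (h + h') ω i = ω (h + (h' - 1 - i)) := by simp only [prev, h3, if_true, h1]
  rw [h4, h5, h2, mul_left_comm, ← ofReal_mul (exp_pos _).le, ← exp_add]
  congr 3
  ring

lemma pW_split {k h h' : ℕ} (hk : k ≤ h) (hk' : k ≤ h') (ω : Traj) :
    pW (h + h') ω = pW k ω + ofReal (exp (pS (h + h') ω)) * pB k (prev (h + h') ω)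
      + (dW k h ω + ofReal (exp (pS (h + h') ω)) * dB k h' (prev (h + h') ω)) := by
  rw [← pW_add_dW (Nat.le_add_right h h'), dW_eq_pB_prev, ← pB_add_dB hk', ← pW_add_dW hk]
  ring

lemma exp_le_tsum_bins {s y : ℝ} (hs : s ≤ y) : ofReal (exp (s - y)) ≤
    ∑' q : ℕ, ofReal (exp (-q)) * (Icc (y - ((q : ℝ) + 1)) (y - ((q : ℝ) + 1) + 1)).indicator 1 s := by
  refine le_trans ?_ (le_tsum ⌊y - s⌋₊)
  have h1 := Nat.floor_le (sub_nonneg.2 hs)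
  have h2 := Nat.lt_floor_add_one (y - s)
  rw [indicator_of_mem (by constructor <;> linarith), Pi.one_apply, mul_one]
  exact ofReal_le_ofReal (exp_le_exp.2 (by linarith))

lemma LLT.tsum_exp_renU_lt_top (hL : LLT ρ ℓ C) :
    ∑' q : ℕ, ofReal (exp (-q)) * renU ρ (q + 1) < ⊤ := by
  obtain ⟨K, hK, h⟩ := hL.ren_le_exp (θ := 1 / 2) (by norm_num)
  have h1 : ∀ q : ℕ, ofReal (exp (-q)) * renU ρ (q + 1) ≤
      ofReal (K * exp (1 / 2) * exp (-(1 / 2)) ^ q) := fun q => by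
    refine (mul_le_mul_of_nonneg_left (h (q + 1) (by positivity)).1 bot_le).trans (le_of_eq ?_)
    rw [← ofReal_mul (exp_pos _).le, mul_left_comm, ← exp_add, mul_assoc,
      ← Real.exp_nat_mul, ← exp_add]
    congr 3
    ring
  refine (tsum_le_tsum h1).trans_lt ?_
  rw [← ENNReal.ofReal_tsum_of_nonneg (fun q => by positivity)]
  · exact ofReal_lt_top
  · exact (summable_geometric_of_lt_one (exp_pos _).le
      (Real.exp_lt_one_iff.2 (by norm_num))).mul_left _

lemma LLT.exp_stay_le (hL : LLT ρ ℓ C) : ∃ K ≠ ⊤, ∀ n, 1 ≤ n → ∀ y, 0 ≤ y →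
    ∫⁻ x, ofReal (exp (x - y)) ∂stayLaw ρ (Iio y) n ≤ K * bseq ℓ n * renV ρ y := by
  obtain ⟨K, hK, h⟩ := hL.local_le
  refine ⟨K * ∑' q : ℕ, ofReal (exp (-q)) * renU ρ (q + 1),
    mul_ne_top hK hL.tsum_exp_renU_lt_top.ne, fun n hn y hy => ?_⟩
  have hae : ∀ᵐ x ∂stayLaw ρ (Iio y) n, x ∈ Iio y := stayLaw_compl_of_pos ρ measurableSet_Iio hn
  calc ∫⁻ x, ofReal (exp (x - y)) ∂stayLaw ρ (Iio y) n
      ≤ ∫⁻ x, ∑' q : ℕ, ofReal (exp (-q)) *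
          (Icc (y - ((q : ℝ) + 1)) (y - ((q : ℝ) + 1) + 1)).indicator 1 x
          ∂stayLaw ρ (Iio y) n := by
        refine lintegral_mono_ae ?_
        filter_upwards [hae] with x hx using exp_le_tsum_bins hx.le
    _ = ∑' q : ℕ, ofReal (exp (-q)) *
          stayLaw ρ (Iio y) n (Icc (y - ((q : ℝ) + 1)) (y - ((q : ℝ) + 1) + 1)) := by
        rw [lintegral_tsum fun q =>
          ((measurable_one.indicator measurableSet_Icc).const_mul _).aemeasurable]
        refine tsum_congr fun q => ?_
        rw [lintegral_const_mul _ (measurable_one.indicator measurableSet_Icc),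
          lintegral_indicator_one measurableSet_Icc]
    _ ≤ ∑' q : ℕ, (K * bseq ℓ n * renV ρ y) *
          (ofReal (exp (-q)) * renU ρ (q + 1)) := by
        refine tsum_le_tsum fun q => ?_
        refine (mul_le_mul_of_nonneg_left (h n hn _ y (by positivity) hy) bot_le).trans
          (le_of_eq ?_)
        ring
    _ = _ := by rw [ENNReal.tsum_mul_left]; ring

lemma LLT.err_W (hL : LLT ρ ℓ C) : ∃ K ≠ ⊤, ∀ k h h', 1 ≤ h' →
    ∫⁻ ω, (stay (Iio 0) (h + h')).indicator (fun ω => ofReal (exp (pS (h + h') ω)) *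
      min 1 (dW k h ω)) ω ∂pathLaw ρ ≤
    K * bseq ℓ h' * ∫⁻ ω, dnK ρ h ω * min 1 (dW k h ω) ∂pathLaw ρ := by
  obtain ⟨K, hK, hb⟩ := hL.exp_stay_le
  refine ⟨K, hK, fun k h h' hh => ?_⟩
  have hm : Measurable ((stay (Iio 0) (h + h')).indicator (fun ω =>
      ofReal (exp (pS (h + h') ω)) * min 1 (dW k h ω))) :=
    Measurable.indicator (by fun_prop) (measurableSet_stay measurableSet_Iio _)
  rw [lintegral_pcat ρ h hm, ← lintegral_const_mul _ (by fun_prop)]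
  refine lintegral_mono fun ω₁ => ?_
  have hd : ∀ ω₂, dW k h (pcat h ω₁ ω₂) = dW k h ω₁ := fun ω₂ =>
    dW_congr fun i hi => by simp [pcat, hi]
  by_cases h₁ : ω₁ ∈ stay (Iio 0) h
  · have hy : 0 ≤ -pS h ω₁ := by
      rcases Nat.eq_zero_or_pos h with rfl | hp
      · simp
      · exact (neg_pos.2 (h₁ h hp le_rfl)).le
    have hexp : Measurable fun x => ofReal (exp (x - -pS h ω₁)) := by fun_prop
    calc _ ≤ ∫⁻ ω₂, (stay (Iio (-pS h ω₁)) h').indicator (fun ω =>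
          ofReal (exp (pS h' ω - -pS h ω₁))) ω₂ * min 1 (dW k h ω₁) ∂pathLaw ρ := by
          refine lintegral_mono fun ω₂ => ?_
          by_cases h2 : pcat h ω₁ ω₂ ∈ stay (Iio 0) (h + h')
          · have h3 : ω₂ ∈ stay (Iio (-pS h ω₁)) h' := fun i hi hi' => by
              have := h2 (h + i) (by omega) (by omega)
              rw [pS_pcat_add, mem_Iio] at this
              rw [mem_Iio]; linarith
            rw [indicator_of_mem h2, indicator_of_mem h3, hd, pS_pcat_add, sub_neg_eq_add,
              add_comm (pS h ω₁)]
          · rw [indicator_of_notMem h2]; exact bot_le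
      _ = (∫⁻ x, ofReal (exp (x - -pS h ω₁)) ∂stayLaw ρ (Iio (-pS h ω₁)) h') *
            min 1 (dW k h ω₁) := by
          have hms : Measurable ((stay (Iio (-pS h ω₁)) h').indicator fun ω =>
              ofReal (exp (pS h' ω - -pS h ω₁))) :=
            (hexp.comp (measurable_pS h')).indicator (measurableSet_stay measurableSet_Iio _)
          rw [lintegral_stayLaw ρ measurableSet_Iio _ hexp, lintegral_mul_const _ hms]
      _ ≤ K * bseq ℓ h' * renV ρ (-pS h ω₁) * min 1 (dW k h ω₁) :=
          mul_le_mul_of_nonneg_right (hb h' hh _ hy) bot_le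
      _ = _ := by rw [dnK, indicator_of_mem h₁, mul_assoc]
  · refine le_trans (le_of_eq ?_) bot_le
    refine (lintegral_congr fun ω₂ => indicator_of_notMem (fun h2 => h₁ fun i hi hi' => ?_) _).trans
      lintegral_zero
    have := h2 i hi (by omega)
    rwa [pS_pcat_of_le hi'] at this

lemma LLT.err_B (hL : LLT ρ ℓ C) : ∃ K ≠ ⊤, ∀ k h h', 1 ≤ h →
    ∫⁻ ω, (stay (Iio 0) (h + h')).indicator (fun ω => ofReal (exp (pS (h + h') ω)) *
      min 1 (ofReal (exp (pS (h + h') ω)) * dB k h' (prev (h + h') ω))) ω ∂pathLaw ρ ≤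
    K * bseq ℓ h * ∑' q : ℕ, ofReal (exp (-q)) *
      ∫⁻ ω, upK ρ h' (-((q : ℝ) + 1)) ω * min 1 (dB k h' ω) ∂pathLaw ρ := by
  obtain ⟨K, hK, hb⟩ := hL.local_le
  refine ⟨K * renV ρ 0, mul_ne_top hK (hL.renV_lt_top 0).ne, fun k h h' hh => ?_⟩
  have hm : Measurable ((stay (Iio 0) (h + h')).indicator (fun ω =>
      ofReal (exp (pS (h + h') ω)) *
      min 1 (ofReal (exp (pS (h + h') ω)) * dB k h' (prev (h + h') ω)))) := by
    have := measurable_prev (h + h')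
    exact Measurable.indicator (by fun_prop) (measurableSet_stay measurableSet_Iio _)
  set F : Traj → ℝ≥0∞ := (stay (Iio 0) (h + h')).indicator (fun ω =>
      ofReal (exp (pS (h + h') ω)) *
      min 1 (ofReal (exp (pS (h + h') ω)) * dB k h' (prev (h + h') ω))) with hF
  have hm2 : Measurable fun p : Traj × Traj => F (pcat h p.2 (prev h' p.1)) := by
    have := measurable_prev h'
    exact hm.comp (by fun_prop)
  have hm3 : Measurable fun p : Traj × Traj => F (pcat h p.1 p.2) :=
    hm.comp (by fun_prop)
  have e1 : ∫⁻ ω, F ω ∂pathLaw ρ =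
      ∫⁻ ω₂, ∫⁻ ω₁, F (pcat h ω₁ (prev h' ω₂)) ∂pathLaw ρ ∂pathLaw ρ := by
    rw [lintegral_pcat ρ h hm, lintegral_lintegral_swap hm3.aemeasurable, lintegral_prev ρ h']
    exact hm3.lintegral_prod_left'
  have hI (a : ℝ) : Measurable ((Icc a (a + 1)).indicator (1 : ℝ → ℝ≥0∞)) :=
    measurable_one.indicator measurableSet_Icc
  have e2 : ∀ ω₂, ∫⁻ ω₁, F (pcat h ω₁ (prev h' ω₂)) ∂pathLaw ρ ≤
      ∑' q : ℕ, (K * renV ρ 0 * bseq ℓ h) * (ofReal (exp (-q)) *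
        (upK ρ h' (-((q : ℝ) + 1)) ω₂ * min 1 (dB k h' ω₂))) := by
    intro ω₂
    calc ∫⁻ ω₁, F (pcat h ω₁ (prev h' ω₂)) ∂pathLaw ρ
        ≤ ∫⁻ ω₁, (stay (Iio 0) h).indicator (fun ω => ∑' q : ℕ,
            ofReal (exp (-q)) * (stay (Ici (-((q : ℝ) + 1))) h').indicator
              (fun ω => min 1 (dB k h' ω)) ω₂ *
            (Icc (-pS h' ω₂ - ((q : ℝ) + 1)) (-pS h' ω₂ - ((q : ℝ) + 1) + 1)).indicator
              (1 : ℝ → ℝ≥0∞) (pS h ω)) ω₁ ∂pathLaw ρ := by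
          refine lintegral_mono fun ω₁ => ?_
          by_cases h2 : pcat h ω₁ (prev h' ω₂) ∈ stay (Iio 0) (h + h')
          swap
          · rw [hF, indicator_of_notMem h2]; exact bot_le
          have h₁ : ω₁ ∈ stay (Iio 0) h := fun i hi hi' => by
            have := h2 i hi (by omega)
            rwa [pS_pcat_of_le hi'] at this
          have hS : ∀ j ≤ h', pS h ω₁ + pS h' ω₂ < pS j ω₂ := fun j hj => by
            have := h2 (h + (h' - j)) (by omega) (by omega)
            rw [pS_pcat_add, pS_prev (by omega), Nat.sub_sub_self hj, mem_Iio] at this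
            linarith
          have hn : pS (h + h') (pcat h ω₁ (prev h' ω₂)) = pS h ω₁ + pS h' ω₂ := by
            rw [pS_pcat_add, pS_prev_self]
          have hs : pS h ω₁ + pS h' ω₂ ≤ 0 := by simpa using (hS 0 bot_le).le
          have hd : dB k h' (prev (h + h') (pcat h ω₁ (prev h' ω₂))) = dB k h' ω₂ :=
            dB_congr fun i hi => by
              have h1 : i < h + h' := by omega
              have h3 : ¬ h + h' - 1 - i < h := by omega
              have h4 : h + h' - 1 - i - h < h' := by omega
              have h5 : h' - 1 - (h + h' - 1 - i - h) = i := by omega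
              simp only [prev, pcat, h1, h3, h4, h5, if_true, if_false]
          rw [hF, indicator_of_mem h2, indicator_of_mem h₁, hn, hd]
          have hE := exp_le_tsum_bins (by linarith : pS h ω₁ ≤ -pS h' ω₂)
          rw [sub_neg_eq_add] at hE
          refine (mul_le_mul_of_nonneg_right hE bot_le).trans ?_
          rw [← ENNReal.tsum_mul_right]
          refine tsum_le_tsum fun q => ?_
          by_cases hin : pS h ω₁ ∈ Icc (-pS h' ω₂ - ((q : ℝ) + 1)) (-pS h' ω₂ - ((q : ℝ) + 1) + 1)
          · have h6 : ω₂ ∈ stay (Ici (-((q : ℝ) + 1))) h' := fun i _ hi' => by grind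
            rw [indicator_of_mem hin, indicator_of_mem h6, Pi.one_apply, mul_one, mul_one]
            refine mul_le_mul_of_nonneg_left (min_le_min_left _ ?_) bot_le
            refine (mul_le_mul_of_nonneg_right (b := ofReal (exp _)) (c := 1)
              (ENNReal.ofReal_le_one.2 (Real.exp_le_one_iff.2 hs)) bot_le).trans (one_mul _).le
          · rw [indicator_of_notMem hin, mul_zero, zero_mul]; exact bot_le
      _ = ∑' q : ℕ, ofReal (exp (-q)) * (stay (Ici (-((q : ℝ) + 1))) h').indicator
              (fun ω => min 1 (dB k h' ω)) ω₂ *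
            descLaw ρ h (Icc (-pS h' ω₂ - ((q : ℝ) + 1)) (-pS h' ω₂ - ((q : ℝ) + 1) + 1)) := by
          refine (lintegral_stayLaw ρ measurableSet_Iio h
            (.tsum fun q => (hI _).const_mul _)).symm.trans ?_
          rw [lintegral_tsum fun q => ((hI _).const_mul _).aemeasurable]
          exact tsum_congr fun q => by
            rw [lintegral_const_mul _ (hI _), lintegral_indicator_one measurableSet_Icc]
      _ ≤ _ := by
          refine tsum_le_tsum fun q => ?_
          by_cases h6 : ω₂ ∈ stay (Ici (-((q : ℝ) + 1))) h'
          · have hx : 0 ≤ pS h' ω₂ - -((q : ℝ) + 1) := by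
              rcases Nat.eq_zero_or_pos h' with rfl | hp
              · simp; positivity
              · exact sub_nonneg.2 (h6 h' hp le_rfl)
            have := hb h hh _ 0 hx le_rfl
            rw [sub_neg_eq_add, zero_sub, neg_add'] at this
            rw [indicator_of_mem h6, upK, indicator_of_mem h6, sub_neg_eq_add]
            refine (mul_le_mul_of_nonneg_left this bot_le).trans (le_of_eq ?_)
            ring
          · rw [indicator_of_notMem h6, mul_zero, zero_mul]; exact bot_le
  rw [e1]
  refine (lintegral_mono e2).trans (le_of_eq ?_)
  rw [lintegral_tsum fun q => by fun_prop, ← ENNReal.tsum_mul_left]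
  refine tsum_congr fun q => ?_
  rw [lintegral_const_mul _ (by fun_prop), lintegral_const_mul _ (by fun_prop)]

/-- `F` only depends on the first `n` steps of the path. -/
def DependsFirst {β : Type*} (n : ℕ) (F : Traj → β) : Prop :=
  ∀ ω ω' : Traj, (∀ i < n, ω i = ω' i) → F ω = F ω'

/-- `P` is the law of the walk conditioned to stay above the level `s`. -/
structure IsUp (ρ : Measure (ℝ × ℝ)) [IsProbabilityMeasure ρ] (s : ℝ)
    (P : Measure Traj) : Prop where
  prob : IsProbabilityMeasure P
  eq : ∀ (n : ℕ) (F : Traj → ℝ≥0∞), Measurable F → DependsFirst n F →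
    renU ρ (-s) * ∫⁻ ω, F ω ∂P = ∫⁻ ω, upK ρ n s ω * F ω ∂pathLaw ρ

/-- `P` is the law of the walk conditioned to stay negative. -/
structure IsDown (ρ : Measure (ℝ × ℝ)) [IsProbabilityMeasure ρ]
    (P : Measure Traj) : Prop where
  prob : IsProbabilityMeasure P
  eq : ∀ (n : ℕ) (F : Traj → ℝ≥0∞), Measurable F → DependsFirst n F →
    ∫⁻ ω, F ω ∂P = ∫⁻ ω, dnK ρ n ω * F ω ∂pathLaw ρ

lemma lintegral_stay_step {A : Set ℝ} (hA : MeasurableSet A) (n : ℕ) {φ : ℝ → ℝ × ℝ → ℝ≥0∞}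
    (hφ : Measurable (Function.uncurry φ)) :
    ∫⁻ ω, (stay A n).indicator (fun ω => φ (pS n ω) (ω n)) ω ∂pathLaw ρ
      = ∫⁻ x, (∫⁻ y, φ y x ∂stayLaw ρ A n) ∂ρ := by
  have hm : Measurable fun ω : Traj => φ (pS n ω) (ω n) :=
    hφ.comp ((measurable_pS n).prodMk (measurable_pi_apply n))
  have hr : ∀ f : ℝ × ℝ → ℝ≥0∞, Measurable f →
      ∫⁻ ω, f (ω 0) ∂pathLaw ρ = ∫⁻ x, f x ∂ρ := fun f hf => by
    rw [← lintegral_map hf (measurable_pi_apply 0), pathLaw, Measure.infinitePi_map_eval]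
  have h1 : ∀ ω ω' : Traj,
      (stay A n).indicator (fun ω => φ (pS n ω) (ω n)) (pcat n ω ω')
        = (stay A n).indicator (fun ω => φ (pS n ω) (ω' 0)) ω := fun ω ω' => by
    have hc : ∀ i < n, pcat n ω ω' i = ω i := fun i hi => if_pos hi
    have h0 : pcat n ω ω' n = ω' 0 := by simp [pcat]
    by_cases h : ω ∈ stay A n
    · rw [indicator_of_mem h, indicator_of_mem ((stay_congr A hc).2 h), pS_congr hc, h0]
    · rw [indicator_of_notMem h, indicator_of_notMem (mt (stay_congr A hc).1 h)]
  rw [lintegral_pcat ρ n (hm.indicator (measurableSet_stay hA n))]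
  have hm2 : Measurable (Function.uncurry fun (ω : Traj) (x : ℝ × ℝ) =>
      (stay A n).indicator (fun ω => φ (pS n ω) x) ω) := by
    have : (Function.uncurry fun (ω : Traj) (x : ℝ × ℝ) =>
      (stay A n).indicator (fun ω => φ (pS n ω) x) ω) =
        (Prod.fst ⁻¹' stay A n).indicator fun p => φ (pS n p.1) p.2 := rfl
    rw [this]
    exact (hφ.comp (((measurable_pS n).comp measurable_fst).prodMk measurable_snd)).indicator
      (measurable_fst (measurableSet_stay hA n))
  calc _ = ∫⁻ ω, (∫⁻ x, (stay A n).indicator (fun ω => φ (pS n ω) x) ω ∂ρ) ∂pathLaw ρ := by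
        refine lintegral_congr fun ω => ?_
        simp only [h1]
        exact hr _ (hm2.comp measurable_prodMk_left)
    _ = ∫⁻ x, (∫⁻ ω, (stay A n).indicator (fun ω => φ (pS n ω) x) ω ∂pathLaw ρ) ∂ρ :=
        lintegral_lintegral_swap hm2.aemeasurable
    _ = _ := lintegral_congr fun x =>
        (lintegral_stayLaw ρ hA n (hφ.comp measurable_prodMk_right)).symm

lemma tsum_stay_Ici_le {z : ℝ} (hz : 0 ≤ z) {f g : ℝ → ℝ≥0∞} (hf : Measurable f)
    (hg : ∀ x y, -z ≤ x → f (x + y) ≤ g y) :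
    ∑' n, ∫⁻ x, f x ∂stayLaw ρ (Ici (-z)) n ≤ renU ρ z * ∑' n, ∫⁻ y, g y ∂ascLaw ρ n := by
  have h1 : ∀ n, ∫⁻ x, f x ∂stayLaw ρ (Ici (-z)) n ≤ ∑ k ∈ range (n + 1),
      descLaw ρ k (Ici (-z)) * ∫⁻ y, g y ∂ascLaw ρ (n - k) := fun n => by
    rw [(halfPair_Ici hz).lintegral_eq n hf]
    refine sum_le_sum fun k _ => ?_
    rw [compl_Ici]
    refine (setLIntegral_mono' (g := fun _ => ∫⁻ y, g y ∂ascLaw ρ (n - k)) measurableSet_Ici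
      fun x hx => lintegral_mono fun y => hg x y hx).trans (le_of_eq ?_)
    rw [setLIntegral_const, mul_comm]
  refine ENNReal.tsum_le_of_sum_range_le fun N => ?_
  refine (sum_le_sum_of_subset (Finset.range_subset_range.2 (Nat.le_succ N))).trans
    ((sum_le_sum fun n _ => h1 n).trans ((sum_range_mul_le
      (fun k => descLaw ρ k (Ici (-z))) (fun k => ∫⁻ y, g y ∂ascLaw ρ k) N).trans ?_))
  rw [renU]
  exact mul_le_mul' (sum_le_tsum (range (N + 1)))
    (sum_le_tsum (range (N + 1)))

lemma LLT.tsum_tilt_ne_top (hL : LLT ρ ℓ C) {A : Set ℝ} {θ : ℝ} (hA : IsHalf A)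
    (hθ : ∀ x ∈ A, θ * x ≤ 0) (h0 : θ ≠ 0) : ∑' k, tilt ρ A θ k ≠ ⊤ := by
  obtain ⟨K, hK, N, hN, h⟩ := hL.tsum_tilt_le
  obtain ⟨n, hn, hnN⟩ := ((hL.reg.lim.eventually_lt_const (abs_pos.2 h0)).and
    (eventually_ge_atTop N)).exists
  have hl := hL.reg.pos n
  have ha := abs_pos.2 h0
  have hr1 : ℓ n / |θ| ≤ 1 := (div_le_one ha).2 hn.le
  have hr0 : 0 ≤ ℓ n / |θ| := by positivity
  have h1 := h n hnN A (ℓ n / |θ| * θ) hA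
    (fun x hx => by rw [mul_assoc]; exact mul_nonpos_of_nonneg_of_nonpos hr0 (hθ x hx))
    (by rw [abs_mul, abs_of_nonneg hr0, div_mul_cancel₀ _ ha.ne'])
  refine ((tsum_le_tsum fun k => ?_).trans h1).trans_lt ofReal_lt_top |>.ne
  rcases Nat.eq_zero_or_pos k with rfl | hk
  · rw [tilt_zero, tilt_zero]
  · refine lintegral_mono_ae ?_
    have : ∀ᵐ x ∂stayLaw ρ A k, x ∈ A := stayLaw_compl_of_pos ρ hA.meas hk
    filter_upwards [this] with x hx
    refine ofReal_le_ofReal (exp_le_exp.2 ?_)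
    have := hθ x hx
    rw [mul_assoc]
    nlinarith

lemma tsum_ne_top_of_eventually_le {t a : ℕ → ℝ≥0∞} {c : ℝ≥0∞} (ht : ∀ i, t i ≠ ⊤) (hc : c ≠ ⊤)
    (h : ∀ᶠ i in atTop, t i ≤ c * (a i + a (i + 1))) (ha : ∑' i, a i ≠ ⊤) : ∑' i, t i ≠ ⊤ := by
  obtain ⟨N, hN⟩ := eventually_atTop.1 h
  have h1 : ∀ i, t i ≤ (if i ∈ range N then t i else 0) + c * (a i + a (i + 1)) := by
    intro i
    by_cases hi : i < N
    · rw [if_pos (mem_range.2 hi)]; exact le_self_add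
    · exact (hN i (not_lt.1 hi)).trans le_add_self
  refine ((tsum_le_tsum h1).trans_lt ?_).ne
  rw [ENNReal.tsum_add, ENNReal.tsum_mul_left, ENNReal.tsum_add,
    tsum_eq_sum (s := range N) fun i hi => if_neg hi]
  refine add_lt_top.2 ⟨ENNReal.sum_lt_top.2 fun i hi => ?_,
    mul_lt_top hc.lt_top (add_lt_top.2 ⟨ha.lt_top, ?_⟩)⟩
  · rw [if_pos hi]; exact (ht i).lt_top
  · refine (le_trans ?_ le_rfl).trans_lt ha.lt_top
    exact ENNReal.tsum_comp_le_tsum_of_injective (add_left_injective 1) a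

lemma pS_mem_of_mem_stay {A : Set ℝ} (h0 : (0 : ℝ) ∈ A) {n : ℕ} {ω : Traj}
    (h : ω ∈ stay A n) : pS n ω ∈ A := by
  rcases Nat.eq_zero_or_pos n with rfl | hn
  · simpa using h0
  · exact h n hn le_rfl

lemma stay_anti {A : Set ℝ} {m n : ℕ} (h : m ≤ n) : stay A n ⊆ stay A m :=
  fun _ hω i h1 h2 => hω i h1 (h2.trans h)

lemma ae_summable_of_expectations {a t : ℕ → Traj → ℝ≥0∞} {bad : ℕ → Set Traj}
    {c : ℝ≥0∞} (hc : c ≠ ⊤) (ht : ∀ i ω, t i ω ≠ ⊤) (ha : ∀ i, Measurable (a i))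
    (h1 : ∑' i, ∫⁻ ω, a i ω ∂P ≠ ⊤) (h2 : ∑' i, P (bad i) ≠ ⊤)
    (h3 : ∀ᵐ ω ∂P, ∀ i, ω ∉ bad i → t i ω ≤ c * (a i ω + a (i + 1) ω)) :
    ∀ᵐ ω ∂P, ∑' i, t i ω ≠ ⊤ := by
  rw [← lintegral_tsum fun i => (ha i).aemeasurable] at h1
  filter_upwards [ae_lt_top (Measurable.tsum ha) h1, ae_eventually_notMem h2, h3] with ω h4 h5 h6
  exact tsum_ne_top_of_eventually_le (fun i => ht i ω) hc (h5.mono fun i hi => h6 i hi) h4.ne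

/-- `P` is dominated by the law of the walk staying in `A`, weighted with `H`. -/
def SubLaw (ρ : Measure (ℝ × ℝ)) [IsProbabilityMeasure ρ] (A : Set ℝ) (H : ℝ → ℝ≥0∞)
    (P : Measure Traj) : Prop :=
  ∀ (n : ℕ) (F : Traj → ℝ≥0∞), Measurable F → DependsFirst n F →
    ∫⁻ ω, F ω ∂P ≤ ∫⁻ ω, (stay A n).indicator (fun ω => H (pS n ω)) ω * F ω ∂pathLaw ρ

lemma IsUp.subLaw {s : ℝ} (hs : s ≤ 0) (hP : IsUp ρ s P) :
    SubLaw ρ (Ici s) (fun x => renU ρ (x - s)) P := fun n F hF h =>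
  (le_mul_of_one_le_left bot_le (one_le_renU (ρ := ρ) (by linarith : 0 ≤ -s))).trans
    (hP.eq n F hF h).le

lemma IsDown.subLaw (hP : IsDown ρ P) : SubLaw ρ (Iio 0) (fun x => renV ρ (-x)) P :=
  fun n F hF h => (hP.eq n F hF h).le

lemma SubLaw.lintegral_le {H f g : ℝ → ℝ≥0∞} (hP : SubLaw ρ A H P) (hA : MeasurableSet A)
    (hAB : A ⊆ B) (h0 : (0 : ℝ) ∈ B) (hf : Measurable f) (hg : Measurable g)
    (h : ∀ x ∈ B, H x * g x ≤ f x) (i : ℕ) :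
    ∫⁻ ω, g (pS i ω) ∂P ≤ ∫⁻ x, f x ∂stayLaw ρ A i := by
  rw [lintegral_stayLaw ρ hA _ hf]
  refine (hP i _ (by fun_prop) fun ω ω' h => by rw [pS_congr h]).trans (lintegral_mono fun ω => ?_)
  by_cases h1 : ω ∈ stay A i
  · simpa [h1] using h _ (pS_mem_of_mem_stay h0 fun j h2 h3 => hAB (h1 j h2 h3))
  · simp [h1]

lemma SubLaw.ae_mem {H : ℝ → ℝ≥0∞} (hP : SubLaw ρ A H P) (hA : MeasurableSet A)
    (hAB : A ⊆ B) (h0 : (0 : ℝ) ∈ B) (hB : MeasurableSet B) (i : ℕ) : ∀ᵐ ω ∂P, pS i ω ∈ B := by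
  have h := hP.lintegral_le hA hAB h0 (f := 0) measurable_zero
    (measurable_one.indicator hB.compl) (fun x hx => by simp [hx]) i
  rw [Pi.zero_def, lintegral_zero] at h
  exact le_antisymm
    ((lintegral_indicator_one (measurable_pS i hB.compl)).symm.le.trans h) bot_le

lemma IsUp.ae_ge {s : ℝ} (hs : s ≤ 0) (hP : IsUp ρ s P) : ∀ i, ∀ᵐ ω ∂P, s ≤ pS i ω :=
  (hP.subLaw hs).ae_mem measurableSet_Ici subset_rfl hs measurableSet_Ici

lemma IsDown.ae_le (hP : IsDown ρ P) : ∀ i, ∀ᵐ ω ∂P, pS i ω ≤ 0 :=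
  hP.subLaw.ae_mem measurableSet_Iio Iio_subset_Iic_self self_mem_Iic measurableSet_Iic

lemma IsUp.tsum_lintegral_exp (hL : LLT ρ ℓ C) {s : ℝ} (hs : s ≤ 0) (hP : IsUp ρ s P) :
    ∑' i, ∫⁻ ω, ofReal (exp (-(1 / 2) * pS i ω)) ∂P ≠ ⊤ := by
  obtain ⟨K, hK, hr⟩ := hL.ren_le_exp (θ := 1 / 4) (by norm_num)
  have hf : Measurable fun x : ℝ => ofReal (K * exp (-(x + s) / 4)) := by fun_prop
  have h1 := (hP.subLaw hs).lintegral_le measurableSet_Ici subset_rfl hs hf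
    (measurable_ofReal_exp_mul (-(1 / 2))) fun x (hx : s ≤ x) => by
      refine (mul_le_mul_of_nonneg_right (hr _ (by linarith)).1 bot_le).trans (le_of_eq ?_)
      rw [← ofReal_mul (by positivity), mul_assoc, ← exp_add]
      ring_nf
  have h2 := tsum_stay_Ici_le (ρ := ρ) (z := -s) (by linarith) hf
    (g := fun y => ofReal (K * exp (-s / 2)) *
      ofReal (exp (-(1 / 4) * y))) fun x y hx => by
    rw [← ofReal_mul (by positivity), mul_assoc, ← exp_add]
    refine ofReal_le_ofReal (mul_le_mul_of_nonneg_left (exp_le_exp.2 ?_) hK.le)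
    linarith
  rw [neg_neg] at h2
  refine ((tsum_le_tsum h1).trans h2).trans_lt (mul_lt_top (hL.renU_lt_top _) ?_) |>.ne
  have h3 : ∀ n, ∫⁻ y, ofReal (K * exp (-s / 2)) *
      ofReal (exp (-(1 / 4) * y)) ∂ascLaw ρ n =
      ofReal (K * exp (-s / 2)) * tilt ρ (Ici 0) (-(1 / 4)) n := fun n =>
    lintegral_const_mul _ (measurable_ofReal_exp_mul _)
  simp only [h3]
  rw [ENNReal.tsum_mul_left]
  refine mul_lt_top ofReal_lt_top (hL.tsum_tilt_ne_top isHalf_Ici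
    (fun x hx => ?_) (by norm_num)).lt_top
  have : 0 ≤ x := hx
  linarith

lemma IsDown.tsum_lintegral_exp (hL : LLT ρ ℓ C) (hP : IsDown ρ P) :
    ∑' i, ∫⁻ ω, ofReal (exp (1 / 2 * pS i ω)) ∂P ≠ ⊤ := by
  obtain ⟨K, hK, hr⟩ := hL.ren_le_exp (θ := 1 / 4) (by norm_num)
  have h1 : ∀ i, ∫⁻ ω, ofReal (exp (1 / 2 * pS i ω)) ∂P ≤
      ofReal K * tilt ρ (Iio 0) (1 / 4) i := fun i => by
    rw [tilt, ← lintegral_const_mul _ (measurable_ofReal_exp_mul _)]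
    refine hP.subLaw.lintegral_le measurableSet_Iio Iio_subset_Iic_self self_mem_Iic (by fun_prop)
      (measurable_ofReal_exp_mul (1 / 2)) (fun x (hx : x ≤ 0) => ?_) i
    refine (mul_le_mul_of_nonneg_right (hr _ (by linarith)).2 bot_le).trans (le_of_eq ?_)
    rw [← ofReal_mul (by positivity), ← ofReal_mul (by positivity), mul_assoc, ← exp_add]
    ring_nf
  refine ((tsum_le_tsum h1).trans_lt ?_).ne
  rw [ENNReal.tsum_mul_left]
  refine mul_lt_top ofReal_lt_top (hL.tsum_tilt_ne_top isHalf_Iio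
    (fun x hx => ?_) (by norm_num)).lt_top
  have : x < 0 := hx
  linarith

lemma SubLaw.tsum_bad_le {H : ℝ → ℝ≥0∞} {f : ℝ → ℝ × ℝ → ℝ} {W : ℝ × ℝ → ℝ≥0∞}
    (hP : SubLaw ρ A H P) (hA : MeasurableSet A) (hf : Measurable (Function.uncurry f))
    (hW : Measurable W) (h : ∀ y x, 0 < f y x → H (y + x.1) ≤ W x) :
    ∑' i, P {ω | 0 < f (pS i ω) (ω i)} ≤
      ∫⁻ x, W x * ∑' i, stayLaw ρ A i {y | 0 < f y x} ∂ρ := by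
  set D := {p | 0 < Function.uncurry f p}
  have hD : MeasurableSet D := measurableSet_lt measurable_const hf
  have hm (i : ℕ) : MeasurableSet {ω : Traj | 0 < f (pS i ω) (ω i)} :=
    hD.preimage ((measurable_pS i).prodMk (measurable_pi_apply i))
  have h1 (i : ℕ) : P {ω | 0 < f (pS i ω) (ω i)} ≤
      ∫⁻ x, W x * stayLaw ρ A i {y | 0 < f y x} ∂ρ := by
    have he := hP (i + 1) _ (measurable_one.indicator (hm i)) fun ω ω' h => by
      simp [indicator, h i, pS_congr fun j (hj : j < i) => h j (by omega)]
    rw [lintegral_indicator_one (hm i)] at he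
    refine he.trans ?_
    calc _ ≤ ∫⁻ ω, (stay A i).indicator
          (fun ω => D.indicator (fun p => W p.2) (pS i ω, ω i)) ω ∂pathLaw ρ := by
          refine lintegral_mono fun ω => ?_
          by_cases h2 : ω ∈ stay A (i + 1)
          · have h3 := stay_anti (Nat.le_succ i) h2
            by_cases h4 : 0 < f (pS i ω) (ω i)
            · rw [indicator_of_mem h3, indicator_of_mem (show (pS i ω, ω i) ∈ D from h4)]
              simpa [h2, h4, pS_succ] using h _ _ h4
            · simp [h4]
          · simp [h2]
      _ = ∫⁻ x, ∫⁻ y, D.indicator (fun p => W p.2) (y, x) ∂stayLaw ρ A i ∂ρ :=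
          lintegral_stay_step hA i (φ := fun y x => D.indicator (fun p => W p.2) (y, x))
            ((hW.comp measurable_snd).indicator hD)
      _ = _ := lintegral_congr fun x => lintegral_indicator_const
          (hD.preimage (by fun_prop : Measurable fun y : ℝ => (y, x))) (W x)
  refine (tsum_le_tsum h1).trans (le_of_eq ?_)
  rw [← lintegral_tsum (f := fun i x => W x * stayLaw ρ A i {y | 0 < f y x}) fun i =>
    Measurable.aemeasurable (hW.mul (measurable_measure_prodMk_right hD))]
  simp only [ENNReal.tsum_mul_left]

lemma IsUp.tsum_bad {s : ℝ} (hL : LLT ρ ℓ C) (hs : s ≤ 0) (hP : IsUp ρ s P) (hZm : Measurable Z)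
    (hZ0 : ∀ x, 0 ≤ Z x)
    (hZ : ∫⁻ x, renU ρ (2 * Z x + |x.1|) * renV ρ (2 * Z x + 1) ∂ρ < ⊤) :
    ∑' i, P {ω | 0 < 2 * Z (ω i) - (pS i ω - s)} ≠ ⊤ := by
  refine (((hP.subLaw hs).tsum_bad_le measurableSet_Ici (f := fun y x => 2 * Z x - (y - s))
    (W := fun x => renU ρ (2 * Z x + |x.1|)) (by fun_prop) (measurable_renU.comp (by fun_prop))
    fun y x h => renU_mono (by linarith [le_abs_self x.1])).trans_lt ?_).ne
  refine lt_of_le_of_lt (lintegral_mono fun x => ?_)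
    (lintegral_const_mul' _ _ (hL.renU_lt_top _).ne ▸ mul_lt_top (hL.renU_lt_top (-s)) hZ)
  have hm : MeasurableSet {y | 0 < 2 * Z x - (y - s)} :=
    measurableSet_lt measurable_const (by fun_prop)
  have h3 := tsum_stay_Ici_le (ρ := ρ) (z := -s) (by linarith)
    (g := (Iio (2 * Z x + 1)).indicator 1) (measurable_one.indicator hm) fun u y hu => by
      by_cases h : 0 < 2 * Z x - (u + y - s)
      · rw [indicator_of_mem (s := Iio _) (by rw [mem_Iio]; linarith)]
        exact indicator_le_self' (fun _ _ => zero_le_one) _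
      · rw [indicator_of_notMem (s := {y | 0 < 2 * Z x - (y - s)}) h]; exact bot_le
  simp only [lintegral_indicator_one measurableSet_Iio, lintegral_indicator_one hm, neg_neg] at h3
  rw [renV_eq (by linarith [hZ0 x]), mul_left_comm]
  exact mul_le_mul_of_nonneg_left h3 bot_le

lemma IsDown.tsum_bad (hP : IsDown ρ P) (hZm : Measurable Z)
    (hZ : ∫⁻ x, renU ρ (2 * Z x + |x.1|) * renV ρ (2 * Z x + 1) ∂ρ < ⊤) :
    ∑' i, P {ω | 0 < 2 * Z (ω i) + (pS i ω + (ω i).1)} ≠ ⊤ := by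
  refine ((hP.subLaw.tsum_bad_le measurableSet_Iio (f := fun y x => 2 * Z x + (y + x.1))
    (W := fun x => renV ρ (2 * Z x + 1)) (by fun_prop) (measurable_renV.comp (by fun_prop))
    fun y x h => renV_mono (by linarith)).trans_lt (lt_of_le_of_lt (lintegral_mono fun x => ?_)
      hZ)).ne
  rw [mul_comm]
  refine mul_le_mul_of_nonneg_right (tsum_le_tsum fun i => measure_mono fun y hy => ?_) bot_le
  have : 0 < 2 * Z x + (y + x.1) := hy
  show -(2 * Z x + |x.1|) ≤ y
  linarith [le_abs_self x.1]

lemma ofReal_mul_exp_le {x S p q : ℝ} {x' : ℝ × ℝ} (ha : 0 ≤ a)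
    (hη : x'.2 ≤ a * exp (-x'.1) + exp (Z x')) (hT : -x'.1 + S ≤ x + p)
    (he : Z x' + S ≤ x + q) :
    ofReal x'.2 * ofReal (exp S) ≤
      ofReal ((a + 1) * exp x) *
        (ofReal (exp p) + ofReal (exp q)) := by
  rw [← ofReal_mul' (exp_pos _).le, ← ofReal_add (exp_pos _).le
    (exp_pos _).le, ← ofReal_mul (by positivity)]
  refine ofReal_le_ofReal ?_
  have h1 : exp (-x'.1 + S) ≤ exp x * exp p := by
    rw [← exp_add]; exact exp_le_exp.2 hT
  have h2 : exp (Z x' + S) ≤ exp x * exp q := by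
    rw [← exp_add]; exact exp_le_exp.2 he
  calc x'.2 * exp S ≤ (a * exp (-x'.1) + exp (Z x')) * exp S :=
        mul_le_mul_of_nonneg_right hη (exp_pos _).le
    _ = a * exp (-x'.1 + S) + exp (Z x' + S) := by simp only [exp_add]; ring
    _ ≤ a * (exp x * exp p) + exp x * exp q := by gcongr
    _ ≤ _ := by
        have := mul_pos (exp_pos x) (exp_pos p)
        have h4 := mul_pos (exp_pos x) (exp_pos q)
        nlinarith [mul_nonneg ha h4.le]

lemma IsUp.ae_tsum_ne_top {s : ℝ} (hL : LLT ρ ℓ C) (hs : s ≤ 0) (hP : IsUp ρ s P)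
    (hZm : Measurable Z) (hZ0 : ∀ x, 0 ≤ Z x)
    (hZ : ∫⁻ x, renU ρ (2 * Z x + |x.1|) * renV ρ (2 * Z x + 1) ∂ρ < ⊤) (ha : 0 ≤ a)
    (hη : ∀ x : ℝ × ℝ, x.2 ≤ a * exp (-x.1) + exp (Z x)) :
    ∀ᵐ ω ∂P, ∑' i, ofReal (ω i).2 * ofReal (exp (-pS i ω)) ≠ ⊤ := by
  refine ae_summable_of_expectations (c := ofReal ((a + 1) * exp (-s / 2)))
    ofReal_ne_top
    (fun i ω => mul_ne_top ofReal_ne_top ofReal_ne_top)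
    (fun i => by fun_prop) (hP.tsum_lintegral_exp hL hs) (hP.tsum_bad hL hs hZm hZ0 hZ) ?_
  filter_upwards [ae_all_iff.2 (hP.ae_ge hs)] with ω h i hi
  have h1 : ¬ 0 < 2 * Z (ω i) - (pS i ω - s) := hi
  have h2 := h (i + 1)
  rw [add_comm (ofReal _)]
  refine ofReal_mul_exp_le ha (hη _) ?_ ?_
  · rw [pS_succ] at h2 ⊢; linarith
  · linarith

lemma IsDown.ae_tsum_ne_top (hL : LLT ρ ℓ C) (hP : IsDown ρ P) (hZm : Measurable Z)
    (hZ : ∫⁻ x, renU ρ (2 * Z x + |x.1|) * renV ρ (2 * Z x + 1) ∂ρ < ⊤) (ha : 0 ≤ a)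
    (hη : ∀ x : ℝ × ℝ, x.2 ≤ a * exp (-x.1) + exp (Z x)) :
    ∀ᵐ ω ∂P, ∑' i, ofReal (ω i).2 * ofReal (exp (pS (i + 1) ω)) ≠ ⊤ := by
  refine ae_summable_of_expectations (c := ofReal ((a + 1) * exp 0))
    ofReal_ne_top
    (fun i ω => mul_ne_top ofReal_ne_top ofReal_ne_top)
    (fun i => by fun_prop) (hP.tsum_lintegral_exp hL) (hP.tsum_bad hZm hZ) ?_
  filter_upwards [ae_all_iff.2 hP.ae_le] with ω h i hi
  have h1 : ¬ 0 < 2 * Z (ω i) + (pS i ω + (ω i).1) := hi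
  have h2 := h i
  refine ofReal_mul_exp_le ha (hη _) ?_ ?_ <;> rw [pS_succ] <;> linarith

lemma tendsto_of_add_of_le_liminf {x y : ℕ → ℝ≥0∞} {a b : ℝ≥0∞} (hb : b ≠ ⊤)
    (h : Tendsto (fun n => x n + y n) atTop (𝓝 (a + b))) (hx : a ≤ liminf x atTop)
    (hy : b ≤ liminf y atTop) : Tendsto x atTop (𝓝 a) := by
  refine tendsto_of_le_liminf_of_limsup_le hx (ENNReal.le_of_forall_pos_le_add fun ε hε _ => ?_)
  have h1 : ∀ᶠ n in atTop, b ≤ y n + ε := by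
    rcases eq_or_ne b 0 with rfl | hb0
    · exact Eventually.of_forall fun _ => bot_le
    have : b - ε < liminf y atTop :=
      (ENNReal.sub_lt_self hb hb0 (by exact_mod_cast hε.ne')).trans_le hy
    filter_upwards [eventually_lt_of_lt_liminf this] with n hn
    exact tsub_le_iff_right.1 hn.le
  have h2 : Tendsto (fun n => x n + y n + ε - b) atTop (𝓝 (a + b + ε - b)) :=
    ENNReal.Tendsto.sub (h.add tendsto_const_nhds) tendsto_const_nhds (Or.inr hb)
  have h3 : a + b + ε - b = a + ε := by
    rw [show a + b + (ε : ℝ≥0∞) = a + ε + b by ring, ENNReal.add_sub_cancel_right hb]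
  rw [← h3, ← h2.limsup_eq]
  refine limsup_le_limsup ?_
  filter_upwards [h1] with n hn
  refine ENNReal.le_sub_of_add_le_right hb ?_
  rw [add_assoc]
  exact add_le_add_right hn _

lemma tendsto_of_truncation {A : ℕ → ℝ≥0∞} {T : ℕ → ℕ → ℝ≥0∞} {a e : ℕ → ℝ≥0∞} {b : ℝ≥0∞}
    (hT : ∀ k, Tendsto (fun n => T k n) atTop (𝓝 (a k))) (ha : ∀ k, a k ≠ ⊤) (hb : b ≠ ⊤)
    (hab : Tendsto a atTop (𝓝 b)) (he : Tendsto e atTop (𝓝 0))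
    (hle : ∀ k, ∀ᶠ n in atTop, A n ≤ T k n) (hge : ∀ k, ∀ᶠ n in atTop, T k n ≤ A n + e k) :
    Tendsto A atTop (𝓝 b) := by
  refine tendsto_of_le_liminf_of_limsup_le ?_ ?_
  · have h1 : Tendsto (fun k => a k - e k) atTop (𝓝 (b - 0)) :=
      ENNReal.Tendsto.sub hab he (Or.inl hb)
    rw [tsub_zero] at h1
    refine le_of_tendsto h1 (.of_forall fun k => ?_)
    have h2 : Tendsto (fun n => T k n - e k) atTop (𝓝 (a k - e k)) :=
      ENNReal.Tendsto.sub (hT k) tendsto_const_nhds (Or.inl (ha k))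
    rw [← h2.liminf_eq]
    refine liminf_le_liminf ?_
    filter_upwards [hge k] with n hn
    exact tsub_le_iff_right.2 hn
  · refine ge_of_tendsto hab (.of_forall fun k => ?_)
    rw [← (hT k).limsup_eq]
    exact limsup_le_limsup (hle k)

/-- The series `∑ η_{j+1} e^{S_{j+1}}`. -/
def sW (ω : Traj) : ℝ≥0∞ :=
  ∑' j, ofReal (ω j).2 * ofReal (exp (pS (j + 1) ω))

/-- The series `∑ η_{i+1} e^{-S_i}`. -/
def sB (ω : Traj) : ℝ≥0∞ :=
  ∑' i, ofReal (ω i).2 * ofReal (exp (-pS i ω))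

lemma tendsto_pW (ω : Traj) : Tendsto (fun k => pW k ω) atTop (𝓝 (sW ω)) :=
  summable.hasSum.tendsto_sum_nat

lemma tendsto_pB (ω : Traj) : Tendsto (fun k => pB k ω) atTop (𝓝 (sB ω)) :=
  summable.hasSum.tendsto_sum_nat

lemma measurable_Phi (hG : Measurable G) (k : ℕ) : Measurable (Phi ρ G k) := by
  have m1 : Measurable fun p : (ℝ × Traj) × Traj => upK ρ k p.1.1 p.2 *
      G (pW k p.1.2 + ofReal (exp p.1.1) * pB k p.2) := by fun_prop
  have m2 : Measurable fun p : ℝ × Traj => dnK ρ k p.2 * ∫⁻ ω₃, upK ρ k p.1 ω₃ *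
      G (pW k p.2 + ofReal (exp p.1) * pB k ω₃) ∂pathLaw ρ :=
    ((measurable_dnK k).comp measurable_snd).mul (m1.lintegral_prod_right' (ν := pathLaw ρ))
  exact m2.lintegral_prod_right' (ν := pathLaw ρ)

lemma Phi_eq (hP : IsDown ρ P) {s : ℝ} {P' : Measure Traj} (hP' : IsUp ρ s P')
    (hG : Measurable G) (k : ℕ) : Phi ρ G k s = renU ρ (-s) *
      ∫⁻ ω₁, ∫⁻ ω₃, G (pW k ω₁ + ofReal (exp s) * pB k ω₃) ∂P' ∂P := by
  have := hP'.prob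
  have hm : Measurable fun p : Traj × Traj =>
      G (pW k p.1 + ofReal (exp s) * pB k p.2) := by fun_prop
  have h1 : ∀ ω₁, ∫⁻ ω₃, upK ρ k s ω₃ *
      G (pW k ω₁ + ofReal (exp s) * pB k ω₃) ∂pathLaw ρ = renU ρ (-s) *
      ∫⁻ ω₃, G (pW k ω₁ + ofReal (exp s) * pB k ω₃) ∂P' := fun ω₁ =>
    (hP'.eq k (fun ω₃ => G (pW k ω₁ + ofReal (exp s) * pB k ω₃)) (by fun_prop)
      fun ω ω' h => by simp only [pB_congr h]).symm
  have hJ : Measurable fun ω₁ =>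
      ∫⁻ ω₃, G (pW k ω₁ + ofReal (exp s) * pB k ω₃) ∂P' :=
    hm.lintegral_prod_right' (ν := P')
  have hm' : Measurable fun ω₁ => dnK ρ k ω₁ *
      ∫⁻ ω₃, G (pW k ω₁ + ofReal (exp s) * pB k ω₃) ∂P' := (measurable_dnK k).mul hJ
  simp only [Phi, h1, mul_left_comm _ (renU ρ (-s))]
  rw [lintegral_const_mul _ hm', hP.eq k _ hJ fun ω ω' h => by
    simp only [pW_congr h]]

/-- The limit of `Phi` as all steps are taken into account. -/
def limPhi (ρ : Measure (ℝ × ℝ)) [IsProbabilityMeasure ρ] (P : Measure Traj)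
    (Pu : ℝ → Measure Traj) (G : ℝ≥0∞ → ℝ≥0∞) (s : ℝ) : ℝ≥0∞ :=
  renU ρ (-s) * ∫⁻ ω₁, ∫⁻ ω₃, G (sW ω₁ + ofReal (exp s) * sB ω₃) ∂Pu s ∂P

lemma tendsto_Phi (hL : LLT ρ ℓ C) (hP : IsDown ρ P) {s : ℝ} (hPu : IsUp ρ s (Pu s))
    (hG : Continuous G) {c : ℝ≥0∞} (hc : c ≠ ⊤) (hGc : ∀ w, G w ≤ c) :
    Tendsto (fun k => Phi ρ G k s) atTop (𝓝 (limPhi ρ P Pu G s)) := by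
  have := hP.prob
  have := hPu.prob
  have hGm := hG.measurable
  simp only [Phi_eq hP hPu hGm]
  refine ENNReal.Tendsto.const_mul ?_ (Or.inr (hL.renU_lt_top _).ne)
  have hb : ∀ k ω₁, ∫⁻ ω₃, G (pW k ω₁ + ofReal (exp s) * pB k ω₃) ∂Pu s ≤ c :=
    fun k ω₁ => (lintegral_mono fun ω₃ => hGc _).trans (by simp)
  refine tendsto_lintegral_of_dominated_convergence (fun _ => c) (fun k => ?_)
    (fun k => ae_of_all _ (hb k)) (by simpa using hc) (ae_of_all _ fun ω₁ => ?_)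
  · have hm : Measurable fun p : Traj × Traj =>
      G (pW k p.1 + ofReal (exp s) * pB k p.2) := by fun_prop
    exact hm.lintegral_prod_right' (ν := Pu s)
  · refine tendsto_lintegral_of_dominated_convergence (fun _ => c) (fun k => by fun_prop)
      (fun k => ae_of_all _ fun _ => hGc _) (by simpa using hc) (ae_of_all _ fun ω₃ => ?_)
    exact (hG.tendsto _).comp ((tendsto_pW ω₁).add
      (ENNReal.Tendsto.const_mul (tendsto_pB ω₃) (Or.inr ofReal_ne_top)))

lemma Phi_le (hP : IsDown ρ P) {s : ℝ} (hPu : IsUp ρ s (Pu s))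
    (hG : Measurable G) {c : ℝ≥0∞} (hGc : ∀ w, G w ≤ c) (k : ℕ) :
    Phi ρ G k s ≤ c * renU ρ (-s) := by
  have := hP.prob
  have := hPu.prob
  rw [Phi_eq hP hPu hG, mul_comm]
  refine mul_le_mul_of_nonneg_right ?_ bot_le
  refine (lintegral_mono fun ω₁ => (lintegral_mono fun ω₃ => hGc _)).trans (by simp)

lemma lintegral_exp_Phi_le (hP : IsDown ρ P) (hPu : ∀ s ≤ 0, IsUp ρ s (Pu s))
    (hG : Measurable G) {c : ℝ≥0∞} (hGc : ∀ w, G w ≤ c) (k : ℕ) :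
    ∫⁻ s in Iio 0, ofReal (exp s) * Phi ρ G k s ≤ c * expU ρ := by
  have hm : Measurable fun s => ofReal (exp s) * renU ρ (-s) := by
    have := measurable_renU (ρ := ρ)
    fun_prop
  rw [expU, ← lintegral_const_mul _ hm]
  refine setLIntegral_mono (hm.const_mul _) fun s hs => ?_
  rw [mul_left_comm]
  exact mul_le_mul_of_nonneg_left (Phi_le hP (hPu s (le_of_lt hs)) hG hGc k) bot_le

lemma tendsto_lintegral_exp_Phi (hL : LLT ρ ℓ C) (hP : IsDown ρ P)
    (hPu : ∀ s ≤ 0, IsUp ρ s (Pu s)) (hG : Continuous G) {c : ℝ≥0∞} (hc : c ≠ ⊤)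
    (hGc : ∀ w, G w ≤ c) :
    Tendsto (fun k => ∫⁻ s in Iio 0, ofReal (exp s) * Phi ρ G k s) atTop
      (𝓝 (∫⁻ s in Iio 0, ofReal (exp s) * limPhi ρ P Pu G s)) := by
  refine tendsto_lintegral_of_dominated_convergence
    (fun s => c * (ofReal (exp s) * renU ρ (-s)))
    (fun k => (by fun_prop : Measurable fun s => ofReal (exp s)).mul
      (measurable_Phi hG.measurable k)) (fun k => ?_) ?_ ?_
  · filter_upwards [ae_restrict_mem measurableSet_Iio] with s hs
    rw [mul_left_comm]
    exact mul_le_mul_of_nonneg_left (Phi_le hP (hPu s (le_of_lt hs)) hG.measurable hGc k) bot_le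
  · have hm : Measurable fun s => ofReal (exp s) * renU ρ (-s) := by
      have := measurable_renU (ρ := ρ)
      fun_prop
    rw [lintegral_const_mul _ hm]
    exact mul_ne_top hc hL.tilt_one.1
  · filter_upwards [ae_restrict_mem measurableSet_Iio] with s hs
    exact ENNReal.Tendsto.const_mul (tendsto_Phi hL hP (hPu s (le_of_lt hs)) hG hc hGc)
      (Or.inr ofReal_ne_top)

lemma truncF_add {c : ℝ≥0∞} (hGc : ∀ w, G w ≤ c) (k n : ℕ) (ω : Traj) :
    truncF G k n ω + truncF (fun w => c - G w) k n ω = c *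
      (stay (Iio 0) n).indicator (fun ω => ofReal (exp (1 * pS n ω))) ω := by
  by_cases h : ω ∈ stay (Iio 0) n
  · rw [truncF, truncF, indicator_of_mem h, indicator_of_mem h, indicator_of_mem h, ← mul_add,
      add_tsub_cancel_of_le (hGc _), one_mul, mul_comm]
  · rw [truncF, truncF, indicator_of_notMem h, indicator_of_notMem h, indicator_of_notMem h,
      mul_zero, add_zero]

lemma LLT.tendsto_truncF (hL : LLT ρ ℓ C) (hP : IsDown ρ P) (hPu : ∀ s ≤ 0, IsUp ρ s (Pu s))
    (hG : Continuous G) {c : ℝ≥0∞} (hc : c ≠ ⊤) (hGc : ∀ w, G w ≤ c) {k : ℕ} (hk : 1 ≤ k) :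
    Tendsto (fun n => ofReal (scaleW ℓ n) * ∫⁻ ω, truncF G k n ω ∂pathLaw ρ) atTop
      (𝓝 (ofReal C * ∫⁻ s in Iio 0, ofReal (exp s) * Phi ρ G k s)) := by
  have hG' : Continuous fun w => c - G w := (ENNReal.continuous_sub_left hc).comp hG
  have hGc' : ∀ w, c - G w ≤ c := fun w => tsub_le_self
  have hfin : ∀ G' : ℝ≥0∞ → ℝ≥0∞, Continuous G' → (∀ w, G' w ≤ c) → ofReal C *
      ∫⁻ s in Iio 0, ofReal (exp s) * Phi ρ G' k s ≠ ⊤ := fun G' h1 h2 =>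
    mul_ne_top ofReal_ne_top
      ((lintegral_exp_Phi_le hP hPu h1.measurable h2 k).trans_lt
        (mul_lt_top hc.lt_top hL.tilt_one.1.lt_top)).ne
  refine tendsto_of_add_of_le_liminf (hfin _ hG' hGc') ?_
    (hL.le_liminf_truncF hG hk) (hL.le_liminf_truncF hG' hk)
  have h1 : ∀ n, ofReal (scaleW ℓ n) * ∫⁻ ω, truncF G k n ω ∂pathLaw ρ +
      ofReal (scaleW ℓ n) * ∫⁻ ω, truncF (fun w => c - G w) k n ω ∂pathLaw ρ =
      c * (ofReal (scaleW ℓ n) * tilt ρ (Iio 0) 1 n) := fun n => by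
    rw [← mul_add, ← lintegral_add_left (measurable_truncF hG.measurable k n)]
    simp only [truncF_add hGc]
    rw [lintegral_const_mul _ (Measurable.indicator (by fun_prop)
      (measurableSet_stay measurableSet_Iio n)), tilt,
      lintegral_stayLaw ρ measurableSet_Iio n (by fun_prop), mul_left_comm]
  have h2 : ∀ s ≤ 0, Phi ρ G k s + Phi ρ (fun w => c - G w) k s = c * renU ρ (-s) := fun s hs => by
    have := hP.prob
    have := (hPu s hs).prob
    have hGm := hG.measurable
    have hm : Measurable fun p : Traj × Traj =>
      G (pW k p.1 + ofReal (exp s) * pB k p.2) := by fun_prop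
    rw [Phi_eq hP (hPu s hs) hGm, Phi_eq hP (hPu s hs) hG'.measurable, ← mul_add,
      ← lintegral_add_left (hm.lintegral_prod_right' (ν := Pu s))]
    have h3 : ∀ ω₁, ∫⁻ ω₃, G (pW k ω₁ + ofReal (exp s) * pB k ω₃) ∂Pu s +
        ∫⁻ ω₃, (c - G (pW k ω₁ + ofReal (exp s) * pB k ω₃)) ∂Pu s = c := fun ω₁ => by
      rw [← lintegral_add_left (by fun_prop)]
      simp only [add_tsub_cancel_of_le (hGc _)]
      simp
    simp only [h3]
    simp [mul_comm]
  simp only [h1]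
  have h4 : ofReal C * (∫⁻ s in Iio 0, ofReal (exp s) * Phi ρ G k s) +
      ofReal C * (∫⁻ s in Iio 0, ofReal (exp s) *
        Phi ρ (fun w => c - G w) k s) = c * (ofReal C * expU ρ) := by
    have hm := measurable_renU (ρ := ρ)
    have hm' := measurable_Phi (ρ := ρ) hG.measurable k
    rw [← mul_add, ← lintegral_add_left (by fun_prop), mul_left_comm c, expU]
    congr 1
    rw [← lintegral_const_mul _ (by fun_prop)]
    refine setLIntegral_congr_fun measurableSet_Iio fun s hs => ?_
    rw [← mul_add, h2 s (le_of_lt hs), mul_left_comm]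
  rw [h4]
  exact ENNReal.Tendsto.const_mul hL.tilt_one.2 (Or.inr hc)

/-- The tails of the series `sW`. -/
def tW (k : ℕ) (ω : Traj) : ℝ≥0∞ :=
  ∑' j, ofReal (ω (j + k)).2 * ofReal (exp (pS (j + k + 1) ω))

/-- The tails of the series `sB`. -/
def tB (k : ℕ) (ω : Traj) : ℝ≥0∞ :=
  ∑' j, ofReal (ω (j + k)).2 * ofReal (exp (-pS (j + k) ω))

@[fun_prop]
lemma measurable_tW (k : ℕ) : Measurable (tW k) :=
  Measurable.tsum fun _ => by fun_prop

@[fun_prop]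
lemma measurable_tB (k : ℕ) : Measurable (tB k) :=
  Measurable.tsum fun _ => by fun_prop

lemma sum_Ico_le_tsum_add (f : ℕ → ℝ≥0∞) (k h : ℕ) :
    ∑ j ∈ Finset.Ico k h, f j ≤ ∑' j, f (j + k) := by
  rw [Finset.sum_Ico_eq_sum_range]
  simp only [add_comm k]
  exact sum_le_tsum _

lemma dW_le_tW (k h : ℕ) (ω : Traj) : dW k h ω ≤ tW k ω := sum_Ico_le_tsum_add _ k h

lemma dB_le_tB (k h : ℕ) (ω : Traj) : dB k h ω ≤ tB k ω := sum_Ico_le_tsum_add _ k h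

/-- A bound for the error made when only the first and last `k` steps are kept. -/
def errT (ρ : Measure (ℝ × ℝ)) [IsProbabilityMeasure ρ] (P : Measure Traj)
    (Pu : ℝ → Measure Traj) (k : ℕ) : ℝ≥0∞ :=
  ∫⁻ ω, min 1 (tW k ω) ∂P + ∑' q : ℕ, ofReal (exp (-q)) *
    (renU ρ (q + 1) * ∫⁻ ω, min 1 (tB k ω) ∂Pu (-((q : ℝ) + 1)))

lemma tendsto_lintegral_min_one {P : Measure Traj} [IsProbabilityMeasure P]
    {f : ℕ → Traj → ℝ≥0∞} (hf : ∀ k, Measurable (f k))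
    (h : ∀ᵐ ω ∂P, Tendsto (fun k => f k ω) atTop (𝓝 0)) :
    Tendsto (fun k => ∫⁻ ω, min 1 (f k ω) ∂P) atTop (𝓝 0) := by
  rw [← lintegral_zero (μ := P)]
  refine tendsto_lintegral_of_dominated_convergence (fun _ => 1)
    (fun k => measurable_const.min (hf k)) (fun k => ae_of_all _ fun _ => min_le_left _ _)
    (by simp) ?_
  filter_upwards [h] with ω hω
  have := (continuous_const.min continuous_id : Continuous fun x : ℝ≥0∞ => min 1 x).tendsto 0
  rw [min_eq_right zero_le] at this
  exact this.comp hω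

lemma tendsto_errT (hL : LLT ρ ℓ C) (hP : IsDown ρ P) (hPu : ∀ s ≤ 0, IsUp ρ s (Pu s))
    (hW : ∀ᵐ ω ∂P, sW ω ≠ ⊤) (hB : ∀ s ≤ 0, ∀ᵐ ω ∂Pu s, sB ω ≠ ⊤) :
    Tendsto (errT ρ P Pu) atTop (𝓝 0) := by
  have := hP.prob
  have hq : ∀ q : ℕ, -((q : ℝ) + 1) ≤ 0 := fun q => by grind
  rw [← add_zero (0 : ℝ≥0∞)]
  refine Tendsto.add (tendsto_lintegral_min_one measurable_tW ?_) ?_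
  · filter_upwards [hW] with ω hω
    exact ENNReal.tendsto_sum_nat_add _ hω
  · rw [← lintegral_zero (μ := (Measure.count : Measure ℕ))]
    simp only [← lintegral_count]
    refine tendsto_lintegral_of_dominated_convergence
      (fun q : ℕ => ofReal (exp (-q)) * renU ρ (q + 1))
      (fun k => Measurable.of_discrete) (fun k => ae_of_all _ fun q => ?_) ?_
      (ae_of_all _ fun q => ?_)
    · have := (hPu _ (hq q)).prob
      refine mul_le_mul_of_nonneg_left (mul_le_of_le_one_right' ?_) bot_le
      exact (lintegral_mono fun _ => min_le_left _ _).trans (by rw [lintegral_one]; exact prob_le_one)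
    · rw [lintegral_count]
      exact hL.tsum_exp_renU_lt_top.ne
    · have := (hPu _ (hq q)).prob
      have h0 : Tendsto (fun k => ∫⁻ ω, min 1 (tB k ω) ∂Pu (-((q : ℝ) + 1))) atTop (𝓝 0) := by
        refine tendsto_lintegral_min_one measurable_tB ?_
        filter_upwards [hB _ (hq q)] with ω hω
        exact ENNReal.tendsto_sum_nat_add _ hω
      have h1 := ENNReal.Tendsto.const_mul (a := ofReal (exp (-q)))
        (ENNReal.Tendsto.const_mul (a := renU ρ (q + 1)) h0 (Or.inr (hL.renU_lt_top _).ne))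
        (Or.inr ofReal_ne_top)
      simpa using h1

/-- The functional `e^{S_n} G(∑ η_j e^{S_j})` on the event that the walk stays negative. -/
def fullF (G : ℝ≥0∞ → ℝ≥0∞) (n : ℕ) (ω : Traj) : ℝ≥0∞ :=
  (stay (Iio 0) n).indicator (fun ω => ofReal (exp (pS n ω)) * G (pW n ω)) ω

lemma min_one_add_le (a b : ℝ≥0∞) : min 1 (a + b) ≤ min 1 a + min 1 b := by
  rcases le_total 1 a with h | h
  · exact (min_le_left _ _).trans (by rw [min_eq_left h]; exact le_self_add)
  rcases le_total 1 b with h' | h'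
  · exact (min_le_left _ _).trans (by rw [min_eq_left h']; exact le_add_self)
  grind

lemma fullF_le_truncF (hG : Antitone G) {k n : ℕ} (hn : 2 * k ≤ n) (ω : Traj) :
    fullF G n ω ≤ truncF G k n ω := by
  obtain ⟨m, rfl⟩ : ∃ m, n = k + m := ⟨n - k, by omega⟩
  by_cases h : ω ∈ stay (Iio 0) (k + m)
  · rw [fullF, truncF, indicator_of_mem h, indicator_of_mem h]
    refine mul_le_mul_of_nonneg_left (hG ?_) bot_le
    rw [pW_split le_rfl (by omega : k ≤ m)]
    exact le_self_add
  · rw [fullF, indicator_of_notMem h]; exact bot_le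

lemma truncF_le_fullF {c : ℝ≥0∞} (hGc : ∀ a b, G a ≤ G (a + b) + c * min 1 b) {k h h' : ℕ}
    (hk : k ≤ h) (hk' : k ≤ h') (ω : Traj) :
    truncF G k (h + h') ω ≤ fullF G (h + h') ω + c * ((stay (Iio 0) (h + h')).indicator (fun ω =>
        ofReal (exp (pS (h + h') ω)) * min 1 (dW k h ω)) ω +
      (stay (Iio 0) (h + h')).indicator (fun ω => ofReal (exp (pS (h + h') ω)) *
        min 1 (ofReal (exp (pS (h + h') ω)) * dB k h' (prev (h + h') ω))) ω) := by
  by_cases hm : ω ∈ stay (Iio 0) (h + h')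
  · rw [fullF, truncF, indicator_of_mem hm, indicator_of_mem hm, indicator_of_mem hm,
      indicator_of_mem hm, ← mul_add, mul_left_comm c, ← mul_add, pW_split hk hk']
    exact mul_le_mul_of_nonneg_left ((hGc _ _).trans
      (add_le_add_right (mul_le_mul_of_nonneg_left (min_one_add_le _ _) bot_le) _)) bot_le
  · rw [truncF, indicator_of_notMem hm]; exact bot_le

lemma LLT.exists_scaleW_mul_bseq_le (hL : LLT ρ ℓ C) : ∃ K : ℝ≥0∞, K ≠ ⊤ ∧ ∀ n m, 1 ≤ n →
    n ≤ 4 * m → ofReal (scaleW ℓ n) * bseq ℓ m ≤ K := by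
  obtain ⟨K, hK, h⟩ := hL.reg.div_comp 2
  refine ⟨ofReal K, ofReal_ne_top, fun n m hn hm => ?_⟩
  have h1 := hL.reg.pos n
  have h2 : (0 : ℝ) < n := by exact_mod_cast hn
  rw [scaleW, bseq, ← ofReal_mul (by positivity)]
  refine ofReal_le_ofReal ((mul_le_mul_of_nonneg_left (h m n hn (by omega))
    (by positivity)).trans (le_of_eq ?_))
  field_simp

lemma LLT.exists_truncF_le (hL : LLT ρ ℓ C) (hP : IsDown ρ P) (hPu : ∀ s ≤ 0, IsUp ρ s (Pu s))
    (hG : Measurable G) {c : ℝ≥0∞} (hc : c ≠ ⊤) (hGc : ∀ a b, G a ≤ G (a + b) + c * min 1 b) :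
    ∃ K : ℝ≥0∞, K ≠ ⊤ ∧ ∀ k, ∀ᶠ n in atTop,
      ofReal (scaleW ℓ n) * ∫⁻ ω, truncF G k n ω ∂pathLaw ρ ≤
      ofReal (scaleW ℓ n) * ∫⁻ ω, fullF G n ω ∂pathLaw ρ + K * errT ρ P Pu k := by
  obtain ⟨K₀, hK₀, h₀⟩ := hL.exists_scaleW_mul_bseq_le
  obtain ⟨K₁, hK₁, h₁⟩ := hL.err_W
  obtain ⟨K₂, hK₂, h₂⟩ := hL.err_B
  refine ⟨c * K₀ * (K₁ + K₂), by finiteness, fun k => ?_⟩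
  filter_upwards [eventually_ge_atTop (2 * k + 2)] with n hn
  obtain ⟨h, h', rfl, hk, hk', h3, h4⟩ : ∃ h h', n = h + h' ∧ k ≤ h ∧ k ≤ h' ∧
      h + h' ≤ 4 * h ∧ h + h' ≤ 4 * h' := ⟨n / 2, n - n / 2, by omega, by omega, by omega, by omega,
    by omega⟩
  have hm1 : Measurable ((stay (Iio 0) (h + h')).indicator (fun ω =>
      ofReal (exp (pS (h + h') ω)) * min 1 (dW k h ω))) :=
    Measurable.indicator (by fun_prop) (measurableSet_stay measurableSet_Iio _)
  have hm2 : Measurable ((stay (Iio 0) (h + h')).indicator (fun ω =>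
      ofReal (exp (pS (h + h') ω)) *
      min 1 (ofReal (exp (pS (h + h') ω)) * dB k h' (prev (h + h') ω)))) :=
    Measurable.indicator (by fun_prop) (measurableSet_stay measurableSet_Iio _)
  have hm3 : Measurable (fullF G (h + h')) :=
    Measurable.indicator (by fun_prop) (measurableSet_stay measurableSet_Iio _)
  have hW : ∫⁻ ω, dnK ρ h ω * min 1 (dW k h ω) ∂pathLaw ρ ≤ ∫⁻ ω, min 1 (tW k ω) ∂P := by
    rw [← hP.eq h (fun ω => min 1 (dW k h ω)) (by fun_prop) fun ω ω' hω => by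
      simp only [dW_congr hω]]
    exact lintegral_mono fun ω => min_le_min le_rfl (dW_le_tW k h ω)
  have hB : ∀ q : ℕ, ∫⁻ ω, upK ρ h' (-((q : ℝ) + 1)) ω * min 1 (dB k h' ω) ∂pathLaw ρ ≤
      renU ρ (q + 1) * ∫⁻ ω, min 1 (tB k ω) ∂Pu (-((q : ℝ) + 1)) := fun q => by
    have hq : -((q : ℝ) + 1) ≤ 0 := by grind
    rw [← (hPu _ hq).eq h' (fun ω => min 1 (dB k h' ω)) (by fun_prop) fun ω ω' hω => by
      simp only [dB_congr hω], neg_neg]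
    exact mul_le_mul_of_nonneg_left
      (lintegral_mono fun ω => min_le_min le_rfl (dB_le_tB k h' ω)) bot_le
  have h5 := h₁ k h h' (by omega)
  have h6 := h₂ k h h' (by omega)
  refine (mul_le_mul_of_nonneg_left (lintegral_mono fun ω => truncF_le_fullF hGc hk hk' ω)
    bot_le).trans ?_
  rw [lintegral_add_left hm3, lintegral_const_mul _ (by exact hm1.add hm2), lintegral_add_left hm1, mul_add]
  refine add_le_add_right ?_ _
  have h7 : ofReal (scaleW ℓ (h + h')) * (K₁ * bseq ℓ h' * ∫⁻ ω, min 1 (tW k ω) ∂P) ≤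
      K₀ * (K₁ * ∫⁻ ω, min 1 (tW k ω) ∂P) := by
    calc _ = ofReal (scaleW ℓ (h + h')) * bseq ℓ h' *
          (K₁ * ∫⁻ ω, min 1 (tW k ω) ∂P) := by ring
      _ ≤ _ := mul_le_mul_of_nonneg_right (h₀ _ _ (by omega) h4) bot_le
  set Sq := ∑' q : ℕ, ofReal (exp (-q)) *
    (renU ρ (q + 1) * ∫⁻ ω, min 1 (tB k ω) ∂Pu (-((q : ℝ) + 1))) with hSq
  have h8 : ofReal (scaleW ℓ (h + h')) * (K₂ * bseq ℓ h * Sq) ≤ K₀ * (K₂ * Sq) := by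
    calc _ = ofReal (scaleW ℓ (h + h')) * bseq ℓ h * (K₂ * Sq) := by ring
      _ ≤ _ := mul_le_mul_of_nonneg_right (h₀ _ _ (by omega) h3) bot_le
  have h9 : ofReal (scaleW ℓ (h + h')) * (c * (K₁ * bseq ℓ h' * (∫⁻ ω, min 1 (tW k ω) ∂P) +
      K₂ * bseq ℓ h * Sq)) ≤ c * K₀ * (K₁ + K₂) * errT ρ P Pu k := by
    rw [mul_left_comm, mul_add (ofReal _), mul_assoc c, mul_assoc c]
    refine mul_le_mul_of_nonneg_left ((add_le_add h7 h8).trans ?_) bot_le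
    rw [← mul_add, mul_assoc]
    refine mul_le_mul_of_nonneg_left ?_ bot_le
    rw [errT, ← hSq, mul_add]
    exact add_le_add (mul_le_mul_of_nonneg_right le_self_add bot_le)
      (mul_le_mul_of_nonneg_right le_add_self bot_le)
  refine le_trans (mul_le_mul_of_nonneg_left (mul_le_mul_of_nonneg_left (add_le_add
    (h5.trans (mul_le_mul_of_nonneg_left hW bot_le))
    (h6.trans (mul_le_mul_of_nonneg_left ?_ bot_le))) bot_le) bot_le) h9
  exact tsum_le_tsum fun q => mul_le_mul_of_nonneg_left (hB q) bot_le

lemma LLT.tendsto_fullF (hL : LLT ρ ℓ C) (hP : IsDown ρ P) (hPu : ∀ s ≤ 0, IsUp ρ s (Pu s))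
    (hW : ∀ᵐ ω ∂P, sW ω ≠ ⊤) (hB : ∀ s ≤ 0, ∀ᵐ ω ∂Pu s, sB ω ≠ ⊤)
    (hG : Continuous G) (hGa : Antitone G) (hG0 : G 0 ≠ ⊤) {c : ℝ≥0∞} (hc : c ≠ ⊤)
    (hGc : ∀ a b, G a ≤ G (a + b) + c * min 1 b) :
    Tendsto (fun n => ofReal (scaleW ℓ n) * ∫⁻ ω, fullF G n ω ∂pathLaw ρ) atTop
      (𝓝 (ofReal C * ∫⁻ s in Iio 0, ofReal (exp s) *
        limPhi ρ P Pu G s)) := by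
  have hGb : ∀ w, G w ≤ G 0 := fun w => hGa bot_le
  obtain ⟨K, hK, hle⟩ := hL.exists_truncF_le hP hPu hG.measurable hc hGc
  have h1 := tendsto_lintegral_exp_Phi hL hP hPu hG hG0 hGb
  have hfin : ∀ k, ofReal C *
      ∫⁻ s in Iio 0, ofReal (exp s) * Phi ρ G k s ≤
      ofReal C * (G 0 * expU ρ) := fun k =>
    mul_le_mul_of_nonneg_left (lintegral_exp_Phi_le hP hPu hG.measurable hGb k) bot_le
  have hfin' : ofReal C * (G 0 * expU ρ) ≠ ⊤ :=
    mul_ne_top ofReal_ne_top (mul_ne_top hG0 hL.tilt_one.1)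
  have h2 := ENNReal.Tendsto.const_mul (a := ofReal C) h1 (Or.inr ofReal_ne_top)
  have h3 := ENNReal.Tendsto.const_mul (a := K) (tendsto_errT hL hP hPu hW hB) (Or.inr hK)
  rw [mul_zero] at h3
  refine tendsto_of_truncation (fun k => hL.tendsto_truncF hP hPu hG hG0 hGb (Nat.le_add_left 1 k))
    (fun k => ((hfin _).trans_lt hfin'.lt_top).ne)
    (ne_top_of_le_ne_top hfin' (le_of_tendsto' h2 hfin))
    (h2.comp (tendsto_add_atTop_nat 1)) (h3.comp (tendsto_add_atTop_nat 1)) (fun k => ?_)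
    fun k => hle (k + 1)
  filter_upwards [eventually_ge_atTop (2 * (k + 1))] with n hn
  exact mul_le_mul_of_nonneg_left (lintegral_mono fun ω => fullF_le_truncF hGa hn ω) bot_le

/-- The product of the two factors in the limiting functional. -/
def psi (α₁ α₂ : ℝ) (w : ℝ≥0∞) : ℝ≥0∞ :=
  (ofReal α₁ + w)⁻¹ * (ofReal α₂ + w)⁻¹

lemma antitone_inv_add (a : ℝ≥0∞) : Antitone fun w => (a + w)⁻¹ := fun _ _ h =>
  inv_le_inv.2 (add_le_add_right h a)

lemma antitone_psi : Antitone (psi α₁ α₂) := fun _ _ h =>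
  mul_le_mul' (antitone_inv_add _ h) (antitone_inv_add _ h)

lemma inv_add_ne_top (hα : 0 < α₁) (w : ℝ≥0∞) : (ofReal α₁ + w)⁻¹ ≠ ⊤ :=
  ENNReal.inv_ne_top.2 (add_pos_of_pos_of_nonneg (ofReal_pos.2 hα) bot_le).ne'

lemma psi_ne_top (h₁ : 0 < α₁) (h₂ : 0 < α₂) (w : ℝ≥0∞) : psi α₁ α₂ w ≠ ⊤ :=
  mul_ne_top (inv_add_ne_top h₁ w) (inv_add_ne_top h₂ w)

lemma continuous_psi (h₁ : 0 < α₁) (h₂ : 0 < α₂) : Continuous (psi α₁ α₂) := by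
  have h : ∀ α : ℝ, Continuous fun w : ℝ≥0∞ => (ofReal α + w)⁻¹ := fun α =>
    continuous_inv.comp (continuous_const_add _)
  exact continuous_iff_continuousAt.2 fun w => ENNReal.Tendsto.mul (h α₁).continuousAt
    (Or.inr (inv_add_ne_top h₂ w)) (h α₂).continuousAt (Or.inr (inv_add_ne_top h₁ w))

lemma inv_add_le {α : ℝ≥0∞} (hα : α ≠ 0) (a b : ℝ≥0∞) :
    (α + a)⁻¹ ≤ (α + (a + b))⁻¹ + (α⁻¹ + α⁻¹ * α⁻¹) * min 1 b := by
  have h0 : ∀ w, (α + w)⁻¹ ≤ α⁻¹ := fun w => inv_le_inv.2 le_self_add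
  rcases le_total 1 b with hb | hb
  · rw [min_eq_left hb, mul_one]
    exact (h0 a).trans (le_self_add.trans le_add_self)
  rw [min_eq_right hb]
  rcases eq_or_ne (α + a) ⊤ with ht | ht
  · rw [ht, ENNReal.inv_top]; exact bot_le
  have hz : α + a ≠ 0 := fun h => hα (add_eq_zero.1 h).1
  have ht' : α + (a + b) ≠ ⊤ := by
    rw [← add_assoc]; exact ENNReal.add_ne_top.2 ⟨ht, ne_top_of_le_ne_top one_ne_top hb⟩
  have hz' : α + (a + b) ≠ 0 := fun h => hα (add_eq_zero.1 h).1
  calc (α + a)⁻¹ = (α + a)⁻¹ * ((α + a + b) * (α + (a + b))⁻¹) := by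
        rw [add_assoc, ENNReal.mul_inv_cancel hz' ht', mul_one]
    _ = (α + a)⁻¹ * (α + a) * (α + (a + b))⁻¹ + (α + a)⁻¹ * (α + (a + b))⁻¹ * b := by ring
    _ ≤ (α + (a + b))⁻¹ + (α⁻¹ + α⁻¹ * α⁻¹) * b := by
        rw [ENNReal.inv_mul_cancel hz ht, one_mul]
        exact add_le_add_right (mul_le_mul_of_nonneg_right
          ((mul_le_mul' (h0 _) (h0 _)).trans le_add_self) bot_le) _

lemma exists_psi_le (h₁ : 0 < α₁) (h₂ : 0 < α₂) : ∃ c : ℝ≥0∞, c ≠ ⊤ ∧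
    ∀ a b, psi α₁ α₂ a ≤ psi α₁ α₂ (a + b) + c * min 1 b := by
  have hz : ∀ {α : ℝ}, 0 < α → ofReal α ≠ 0 := fun h => (ofReal_pos.2 h).ne'
  have ht : ∀ {α : ℝ}, 0 < α → (ofReal α)⁻¹ ≠ ⊤ := fun h => ENNReal.inv_ne_top.2 (hz h)
  set a₁ := ofReal α₁
  set a₂ := ofReal α₂
  have t₁ : a₁⁻¹ ≠ ⊤ := ht h₁
  have t₂ : a₂⁻¹ ≠ ⊤ := ht h₂
  refine ⟨(a₁⁻¹ + a₁⁻¹ * a₁⁻¹) * a₂⁻¹ + a₁⁻¹ * (a₂⁻¹ + a₂⁻¹ * a₂⁻¹), by finiteness, fun a b => ?_⟩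
  have h0 : ∀ α w : ℝ≥0∞, (α + w)⁻¹ ≤ α⁻¹ := fun α w => inv_le_inv.2 le_self_add
  calc (a₁ + a)⁻¹ * (a₂ + a)⁻¹
      ≤ ((a₁ + (a + b))⁻¹ + (a₁⁻¹ + a₁⁻¹ * a₁⁻¹) * min 1 b) * (a₂ + a)⁻¹ :=
        mul_le_mul_of_nonneg_right (inv_add_le (hz h₁) a b) bot_le
    _ = (a₁ + (a + b))⁻¹ * (a₂ + a)⁻¹ + (a₁⁻¹ + a₁⁻¹ * a₁⁻¹) * min 1 b * (a₂ + a)⁻¹ := add_mul ..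
    _ ≤ (a₁ + (a + b))⁻¹ * ((a₂ + (a + b))⁻¹ + (a₂⁻¹ + a₂⁻¹ * a₂⁻¹) * min 1 b) +
        (a₁⁻¹ + a₁⁻¹ * a₁⁻¹) * min 1 b * a₂⁻¹ :=
      add_le_add (mul_le_mul_of_nonneg_left (inv_add_le (hz h₂) a b) bot_le)
        (mul_le_mul_of_nonneg_left (h0 _ _) bot_le)
    _ ≤ (a₁ + (a + b))⁻¹ * (a₂ + (a + b))⁻¹ + a₁⁻¹ * ((a₂⁻¹ + a₂⁻¹ * a₂⁻¹) * min 1 b) +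
        (a₁⁻¹ + a₁⁻¹ * a₁⁻¹) * min 1 b * a₂⁻¹ := by
      rw [mul_add]
      exact add_le_add_left (add_le_add_right (mul_le_mul_of_nonneg_right (h0 _ _) bot_le) _) _
    _ = _ := by rw [psi]; ring

lemma psi_ofReal (h₁ : 0 < α₁) (h₂ : 0 < α₂) {w : ℝ} (hw : 0 ≤ w) :
    psi α₁ α₂ (ofReal w) = ofReal ((α₁ + w)⁻¹ * (α₂ + w)⁻¹) := by
  rw [psi, ← ofReal_add h₁.le hw, ← ofReal_add h₂.le hw,
    ofReal_mul (by positivity), ENNReal.ofReal_inv_of_pos (by positivity),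
    ENNReal.ofReal_inv_of_pos (by positivity)]

/-- An identity for bounded functionals of the first `n` steps extends to nonnegative ones. -/
lemma lintegral_map_of_bounded {Ω : Type*} [MeasurableSpace Ω] {Y : Ω → Traj} {μ P : Measure Ω} [IsProbabilityMeasure μ] [IsProbabilityMeasure P]
    (hY : Measurable Y) (hμ : μ.map Y = pathLaw ρ) {n : ℕ} {𝓕 : ℕ → MeasurableSpace Ω}
    (hm : ∀ i < n, Measurable[𝓕 n] fun ω => Y ω i) {K : Traj → ℝ≥0∞} (hK : Measurable K)
    (hKt : ∀ ω, K ω ≠ ⊤) {r : ℝ≥0∞} (hr0 : r ≠ 0) (hr : r ≠ ⊤)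
    (h : ∀ g : Ω → ℝ, Measurable[𝓕 n] g → (∃ c, ∀ ω, |g ω| ≤ c) →
      ∫ ω, g ω ∂P = r.toReal⁻¹ * ∫ ω, g ω * (K (Y ω)).toReal ∂μ)
    {F : Traj → ℝ≥0∞} (hF : Measurable F) (hFn : DependsFirst n F) :
    r * ∫⁻ ω, F ω ∂(P.map Y) = ∫⁻ ω, K ω * F ω ∂pathLaw ρ := by
  set R : Traj → Traj := fun ω i => if i < n then ω i else 0 with hR
  have hRm : Measurable R := measurable_pi_lambda _ fun i => by
    simp only [hR]; split_ifs <;> fun_prop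
  have hFR : ∀ ω, F (R ω) = F ω := fun ω => hFn _ _ fun i hi => by simp [hR, hi]
  have hRY : Measurable[𝓕 n] fun ω => R (Y ω) := @measurable_pi_lambda _ _ _ (𝓕 n) _ _ fun i => by
    by_cases hi : i < n
    · simpa [hR, hi] using hm i hi
    · simp [hR, hi]
  have hpos : 0 < r.toReal := toReal_pos hr0 hr
  have hKY : Measurable fun ω => (K (Y ω)).toReal := (hK.comp hY).ennreal_toReal
  have hint : Integrable (fun ω => (K (Y ω)).toReal) μ := by
    by_contra hc
    have h1 := h (fun _ => 1) measurable_const ⟨1, fun _ => by simp⟩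
    simp only [one_mul, integral_undef hc] at h1
    simp at h1
  have hle : r • (P.map Y).map R = ((pathLaw ρ).withDensity K).map R := by
    refine Measure.ext fun S hS => ?_
    have hT : MeasurableSet (R ⁻¹' S) := hRm hS
    have hYT : MeasurableSet (Y ⁻¹' (R ⁻¹' S)) := hY hT
    have h1 := h ((Y ⁻¹' (R ⁻¹' S)).indicator fun _ => 1)
      (Measurable.indicator measurable_const (hRY hS)) ⟨1, fun ω => by
        by_cases hω : ω ∈ Y ⁻¹' (R ⁻¹' S)
        · rw [indicator_of_mem hω]; simp
        · rw [indicator_of_notMem hω]; simp⟩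
    have h2 : (fun ω => (Y ⁻¹' (R ⁻¹' S)).indicator (fun _ => (1 : ℝ)) ω * (K (Y ω)).toReal) =
        (Y ⁻¹' (R ⁻¹' S)).indicator fun ω => (K (Y ω)).toReal := by
      ext ω
      by_cases hω : ω ∈ Y ⁻¹' (R ⁻¹' S)
      · rw [indicator_of_mem hω, indicator_of_mem hω, one_mul]
      · rw [indicator_of_notMem hω, indicator_of_notMem hω, zero_mul]
    rw [h2, integral_indicator hYT, integral_indicator hYT, integral_const, smul_eq_mul, mul_one,
      measureReal_restrict_apply_univ, eq_inv_mul_iff_mul_eq₀ hpos.ne'] at h1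
    have h3 : ∫⁻ ω in Y ⁻¹' (R ⁻¹' S), K (Y ω) ∂μ =
        ofReal (∫ ω in Y ⁻¹' (R ⁻¹' S), (K (Y ω)).toReal ∂μ) := by
      rw [ofReal_integral_eq_lintegral_ofReal hint.integrableOn
        (ae_of_all _ fun _ => toReal_nonneg)]
      simp only [ofReal_toReal (hKt _)]
    rw [Measure.smul_apply, smul_eq_mul, map_apply hRm hS, map_apply hY hT,
      map_apply hRm hS, withDensity_apply _ hT, ← hμ,
      setLIntegral_map hT hK hY, h3, ← h1, ofReal_mul hpos.le, ofReal_toReal hr,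
      ofReal_measureReal]
  have h4 := congrArg (fun ν => ∫⁻ ω, F ω ∂ν) hle
  simp only [lintegral_smul_measure, smul_eq_mul, lintegral_map hF hRm, hFR] at h4
  rw [h4, lintegral_withDensity_eq_lintegral_mul _ hK hF]
  rfl

/-- The pair `(X, η)` associated with an offspring law. -/
def envStep (q : Measure ℕ) : ℝ × ℝ :=
  (Real.log (∑' i : ℕ, (i : ℝ) * (q {i}).toReal),
    (∑' i : ℕ, ((i : ℝ) * ((i : ℝ) - 1)) * (q {i}).toReal) /
      (2 * (∑' i : ℕ, (i : ℝ) * (q {i}).toReal) ^ 2))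

lemma measurable_envStep : Measurable envStep := by
  have h : ∀ i : ℕ, Measurable fun q : Measure ℕ => (q {i}).toReal := fun i =>
    (Measure.measurable_coe (measurableSet_singleton i)).ennreal_toReal
  have h1 : Measurable fun q : Measure ℕ => ∑' i : ℕ, (i : ℝ) * (q {i}).toReal :=
    Measurable.tsum fun i => (h i).const_mul _
  have h2 : Measurable fun q : Measure ℕ => ∑' i : ℕ, ((i : ℝ) * ((i : ℝ) - 1)) * (q {i}).toReal :=
    Measurable.tsum fun i => (h i).const_mul _
  exact (Real.measurable_log.comp h1).prodMk (h2.div ((h1.pow_const 2).const_mul 2))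

lemma envStep_snd_nonneg (q : Measure ℕ) : 0 ≤ (envStep q).2 := by
  refine div_nonneg (tsum_nonneg fun i => mul_nonneg ?_ toReal_nonneg) (by positivity)
  rcases i.eq_zero_or_pos with rfl | hi
  · simp
  · exact mul_nonneg (by positivity) (sub_nonneg.2 (by exact_mod_cast hi))

/-- The sequence of pairs `(X_{i+1}, η_{i+1})`. -/
def envPath (Q : ℕ → Ω → Measure ℕ) (ω : Ω) (i : ℕ) : ℝ × ℝ := envStep (Q (i + 1) ω)

lemma measurable_envPath (hQ : ∀ i, Measurable (Q i)) : Measurable (envPath Q) :=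
  measurable_pi_lambda _ fun i => measurable_envStep.comp (hQ (i + 1))

lemma map_envPath (hQ : IIDseq μ Q) :
    μ.map (envPath Q) = Measure.infinitePi fun _ => μ.map fun ω => envStep (Q 1 ω) := by
  have hm : ∀ i, Measurable fun ω => envPath Q ω i := fun i => measurable_envStep.comp (hQ.1 (i + 1))
  have h1 : iIndepFun (fun (i : ℕ) ω => envPath Q ω i) μ :=
    (hQ.2.1.precomp (g := fun i : ℕ => i + 1) (add_left_injective 1)).comp (fun _ => envStep)
      fun _ => measurable_envStep
  have h2 := h1.map_fun_eq_infinitePi_map hm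
  refine h2.trans ?_
  congr 1
  ext1 i
  exact ((hQ.2.2 (i + 1)).comp measurable_envStep).map_eq

lemma pS_envPath (n : ℕ) (ω : Ω) : pS n (envPath Q ω) = walk (Xenv Q) n ω := by
  rw [walk, ← Finset.Ico_add_one_right_eq_Icc, Finset.sum_Ico_eq_sum_range]
  refine sum_congr (by simp) fun i _ => ?_
  rw [add_comm 1 i]; rfl

lemma mem_stay_envPath (A : Set ℝ) (n : ℕ) (ω : Ω) :
    envPath Q ω ∈ stay A n ↔ ∀ i, 1 ≤ i → i ≤ n → walk (Xenv Q) i ω ∈ A :=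
  forall_congr' fun i => by rw [pS_envPath]

lemma Mwalk_neg_iff (X : ℕ → Ω → ℝ) (n : ℕ) (ω : Ω) :
    Mwalk X (n + 1) ω < 0 ↔ ∀ i, 1 ≤ i → i ≤ n + 1 → walk X i ω < 0 := by
  simp [Mwalk, Finset.sup'_lt_iff]

lemma Lwalk_nonneg_iff (X : ℕ → Ω → ℝ) (n : ℕ) (ω : Ω) :
    0 ≤ Lwalk X (n + 1) ω ↔ ∀ i, 1 ≤ i → i ≤ n + 1 → 0 ≤ walk X i ω := by
  simp [Lwalk, Finset.le_inf'_iff]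

lemma stayLaw_envPath (hY : MeasurePreserving (envPath Q) μ (pathLaw ρ)) {A B : Set ℝ}
    (hA : MeasurableSet A) (hB : MeasurableSet B) (n : ℕ) :
    stayLaw ρ A n B = μ {ω | walk (Xenv Q) n ω ∈ B ∧ ∀ i, 1 ≤ i → i ≤ n → walk (Xenv Q) i ω ∈ A} := by
  rw [stayLaw, map_apply (measurable_pS n) hB,
    Measure.restrict_apply (measurable_pS n hB), ← hY.map_eq,
    map_apply hY.measurable ((measurable_pS n hB).inter (measurableSet_stay hA n))]
  congr 1
  ext ω
  simp only [mem_preimage, mem_inter_iff, mem_stay_envPath, pS_envPath]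
  rfl

lemma uFun_eq (hY : MeasurePreserving (envPath Q) μ (pathLaw ρ)) {x : ℝ} (hx : 0 ≤ x)
    (hf : renU ρ x < ⊤) : uFun μ (Xenv Q) x = (renU ρ x).toReal := by
  have hk : ∀ k, descLaw ρ k (Ici (-x)) ≠ ⊤ := fun k =>
    (lt_of_le_of_lt (le_tsum k) hf).ne
  rw [uFun, if_pos hx, renU, tsum_toReal_eq hk,
    (ENNReal.summable_toReal hf.ne).tsum_eq_zero_add]
  congr 1
  · rw [descLaw_zero, Measure.dirac_apply' _ measurableSet_Ici, indicator_of_mem (by simpa using hx)]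
    simp
  · refine tsum_congr fun k => ?_
    rw [descLaw, stayLaw_envPath hY measurableSet_Iio measurableSet_Ici]
    simp only [Mwalk_neg_iff, mem_Ici, mem_Iio, neg_le]

lemma vFun_eq (hY : MeasurePreserving (envPath Q) μ (pathLaw ρ)) {x : ℝ} (hx : x ≤ 0)
    (hf : renV ρ (-x) < ⊤) : vFun μ (Xenv Q) x = (renV ρ (-x)).toReal := by
  have hf' : ∑' k, ascLaw ρ (k + 1) (Iio (-x)) ≠ ⊤ := (lt_of_le_of_lt le_add_self hf).ne
  have hk : ∀ k, ascLaw ρ (k + 1) (Iio (-x)) ≠ ⊤ := fun k =>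
    ne_top_of_le_ne_top hf' (le_tsum k)
  rw [vFun, if_pos hx, renV, ENNReal.toReal_add (by simp) hf', tsum_toReal_eq hk,
    ENNReal.toReal_one]
  congr 1
  refine tsum_congr fun k => ?_
  rw [ascLaw, stayLaw_envPath hY measurableSet_Ici measurableSet_Iio]
  simp only [Lwalk_nonneg_iff, mem_Ici, mem_Iio, lt_neg]

lemma vFun_zero (X : ℕ → Ω → ℝ) : vFun μ X 0 = 1 := by
  have h : ∀ k, {ω | 0 < -walk X (k + 1) ω ∧ 0 ≤ Lwalk X (k + 1) ω} = (∅ : Set Ω) := fun k => by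
    refine eq_empty_of_forall_notMem fun ω hω => ?_
    have := (Lwalk_nonneg_iff X k ω).1 hω.2 (k + 1) (by omega) le_rfl
    linarith [hω.1]
  simp only [vFun, le_refl, if_true, h]
  simp

lemma measurable_envPath_apply {n i : ℕ} (hi : i < n) :
    Measurable[envFiltration Q n] fun ω => envPath Q ω i := by
  refine measurable_envStep.comp (Measurable.mono (comap_measurable (Q (i + 1))) ?_ le_rfl)
  exact le_iSup₂_of_le (i + 1) (Finset.mem_Icc.2 ⟨by omega, hi⟩) le_rfl

lemma isUp_map_envPath (hY : MeasurePreserving (envPath Q) μ (pathLaw ρ))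
    (hU : ∀ x, renU ρ x < ⊤) {z : ℝ} (hz : 0 ≤ z) {P : Measure Ω}
    (hP : IsPplus μ (Xenv Q) (envFiltration Q) z P) : IsUp ρ (-z) (P.map (envPath Q)) := by
  have := hP.1
  refine ⟨isProbabilityMeasure_map hY.measurable.aemeasurable,
    fun n F hF hFn => ?_⟩
  have hst : MeasurableSet (posSet (Xenv Q) z n) := by
    have : posSet (Xenv Q) z n = envPath Q ⁻¹' stay (Ici (-z)) n := by
      ext ω
      simp [posSet, mem_stay_envPath, neg_le_iff_add_nonneg, add_comm]
    rw [this]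
    exact hY.measurable (measurableSet_stay measurableSet_Ici n)
  have h1 := one_le_renU (ρ := ρ) hz
  rw [neg_neg]
  refine lintegral_map_of_bounded hY.measurable hY.map_eq (𝓕 := envFiltration Q)
    (fun i hi => measurable_envPath_apply hi) (by fun_prop) (fun ω => ?_)
    (fun h => by rw [h] at h1; simp at h1) (hU z).ne (fun g hg hgb => ?_) hF hFn
  · rw [upK]
    by_cases h : ω ∈ stay (Ici (-z)) n
    · rw [indicator_of_mem h]; exact (hU _).ne
    · rw [indicator_of_notMem h]; simp
  · rw [hP.2 n g hg hgb, uFun_eq hY hz (hU z), ← integral_indicator hst]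
    congr 2
    ext ω
    by_cases h : ω ∈ posSet (Xenv Q) z n
    · have h' : envPath Q ω ∈ stay (Ici (-z)) n := by
        rw [mem_stay_envPath]
        intro i h1 h2
        have := h i (Finset.mem_Icc.2 ⟨h1, h2⟩)
        rw [mem_Ici]; linarith
      have h0 : 0 ≤ z + walk (Xenv Q) n ω := by
        rcases n.eq_zero_or_pos with rfl | hn
        · simpa [walk] using hz
        · exact h n (Finset.mem_Icc.2 ⟨hn, le_rfl⟩)
      rw [indicator_of_mem h, upK, indicator_of_mem h', uFun_eq hY h0 (hU _), pS_envPath,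
        sub_neg_eq_add, add_comm]
    · have h' : envPath Q ω ∉ stay (Ici (-z)) n := fun hc => h fun i hi => by
        have := (mem_stay_envPath _ n ω).1 hc i (Finset.mem_Icc.1 hi).1 (Finset.mem_Icc.1 hi).2
        rw [mem_Ici] at this; linarith
      rw [indicator_of_notMem h, upK, indicator_of_notMem h']; simp

lemma isDown_map_envPath (hY : MeasurePreserving (envPath Q) μ (pathLaw ρ))
    (hV : ∀ x, renV ρ x < ⊤) {P : Measure Ω}
    (hP : IsPminus μ (Xenv Q) (envFiltration Q) 0 P) : IsDown ρ (P.map (envPath Q)) := by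
  have := hP.1
  refine ⟨isProbabilityMeasure_map hY.measurable.aemeasurable,
    fun n F hF hFn => ?_⟩
  have hst' : negSet (Xenv Q) 0 n = envPath Q ⁻¹' stay (Iio 0) n := by
    ext ω
    simp [negSet, mem_stay_envPath]
  have hst : MeasurableSet (negSet (Xenv Q) 0 n) := by
    rw [hst']
    exact hY.measurable (measurableSet_stay measurableSet_Iio n)
  rw [← one_mul (∫⁻ ω, F ω ∂P.map (envPath Q))]
  refine lintegral_map_of_bounded hY.measurable hY.map_eq (𝓕 := envFiltration Q)
    (fun i hi => measurable_envPath_apply hi) (measurable_dnK n) (fun ω => ?_)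
    one_ne_zero one_ne_top (fun g hg hgb => ?_) hF hFn
  · rw [dnK]
    by_cases h : ω ∈ stay (Iio 0) n
    · rw [indicator_of_mem h]; exact (hV _).ne
    · rw [indicator_of_notMem h]; simp
  · rw [hP.2 n g hg hgb, vFun_zero, ← integral_indicator hst, ENNReal.toReal_one]
    congr 2
    ext ω
    by_cases h : ω ∈ negSet (Xenv Q) 0 n
    · have h' : envPath Q ω ∈ stay (Iio 0) n := by rw [hst'] at h; exact h
      have h0 : 0 + walk (Xenv Q) n ω ≤ 0 := by
        rcases n.eq_zero_or_pos with rfl | hn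
        · simp [walk]
        · exact (h n (Finset.mem_Icc.2 ⟨hn, le_rfl⟩)).le
      rw [indicator_of_mem h, dnK, indicator_of_mem h', vFun_eq hY h0 (hV _), pS_envPath,
        zero_add]
    · have h' : envPath Q ω ∉ stay (Iio 0) n := by rw [hst'] at h; exact h
      rw [indicator_of_notMem h, dnK, indicator_of_notMem h']; simp

lemma prev_prev (n : ℕ) (ω : Traj) : prev n (prev n ω) = ω := by
  funext i
  simp only [prev]
  grind

lemma pW_prev (n : ℕ) (ω : Traj) :
    pW n (prev n ω) = ofReal (exp (pS n ω)) * pB n ω := by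
  have h := pW_add_dW (Nat.zero_le n) (prev n ω)
  have h' := dW_eq_pB_prev 0 n (prev n ω)
  rw [zero_add, prev_prev, pS_prev_self] at h'
  rw [← h, h']
  simp [pW]

lemma etaEnv_nonneg (n : ℕ) (ω : Ω) : 0 ≤ etaEnv Q n ω := envStep_snd_nonneg (Q n ω)

lemma bEnv_nonneg (n : ℕ) (ω : Ω) : 0 ≤ bEnv Q n ω :=
  sum_nonneg fun _ _ => mul_nonneg (etaEnv_nonneg _ _) (exp_nonneg _)

lemma pW_prev_envPath (n : ℕ) (ω : Ω) :
    pW n (prev n (envPath Q ω)) = ofReal (exp (Senv Q n ω) * bEnv Q n ω) := by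
  rw [pW_prev, ofReal_mul (exp_nonneg _), pS_envPath, pB, bEnv,
    ENNReal.ofReal_sum_of_nonneg fun _ _ =>
      mul_nonneg (etaEnv_nonneg _ _) (exp_nonneg _)]
  congr 1
  refine sum_congr rfl fun i _ => ?_
  rw [pS_envPath, ofReal_mul (etaEnv_nonneg _ _)]
  rfl

lemma tauWalk_eq_self_iff (X : ℕ → Ω → ℝ) (n : ℕ) (ω : Ω) :
    tauWalk X n ω = n ↔ ∀ i < n, walk X n ω < walk X i ω := by
  have hle : ∀ i ≤ n, minWalk X n ω ≤ walk X i ω := fun i hi =>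
    Finset.inf'_le _ (mem_range.2 (by omega))
  obtain ⟨m, hm, hm'⟩ := Finset.exists_mem_eq_inf' (s := range (n + 1)) (by simp)
    fun i => walk X i ω
  have hmn : m ≤ n := by have := mem_range.1 hm; omega
  have hmem : m ∈ {i : ℕ | walk X i ω = minWalk X n ω} := hm'.symm
  constructor
  · intro h i hi
    have h1 : tauWalk X n ω ∈ {i : ℕ | walk X i ω = minWalk X n ω} := Nat.sInf_mem ⟨m, hmem⟩
    rw [h] at h1
    have h2 : i ∉ {i : ℕ | walk X i ω = minWalk X n ω} := Nat.notMem_of_lt_sInf (lt_of_lt_of_eq hi h.symm)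
    grind
  · intro h
    have h0 : m = n := by grind
    subst h0
    refine le_antisymm (Nat.sInf_le hmem) (not_lt.1 fun hc => ?_)
    have h1 : walk X (tauWalk X m ω) ω = minWalk X m ω := Nat.sInf_mem (s := {i : ℕ | walk X i ω = minWalk X m ω}) ⟨m, hmem⟩
    grind

lemma prev_mem_stay_iff (n : ℕ) (ω : Ω) :
    prev n (envPath Q ω) ∈ stay (Iio 0) n ↔ tauWalk (Xenv Q) n ω = n := by
  rw [tauWalk_eq_self_iff]
  constructor
  · intro h i hi
    have h1 := h (n - i) (by omega) (by omega)
    rw [mem_Iio, pS_prev (by omega), Nat.sub_sub_self hi.le, pS_envPath, pS_envPath] at h1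
    linarith
  · intro h i h1 h2
    have h3 := h (n - i) (by omega)
    rw [mem_Iio, pS_prev h2, pS_envPath, pS_envPath]
    linarith

lemma measurable_fullF {G : ℝ≥0∞ → ℝ≥0∞} (hG : Measurable G) (n : ℕ) : Measurable (fullF G n) :=
  Measurable.indicator (by fun_prop) (measurableSet_stay measurableSet_Iio _)

lemma measurableSet_tauWalk (hY : Measurable (envPath Q)) (n : ℕ) :
    MeasurableSet {ω | tauWalk (Xenv Q) n ω = n} := by
  have h : {ω | tauWalk (Xenv Q) n ω = n} =
      (fun ω => prev n (envPath Q ω)) ⁻¹' stay (Iio 0) n := by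
    ext ω; exact (prev_mem_stay_iff n ω).symm
  rw [h]
  exact ((measurable_prev n).comp hY) (measurableSet_stay measurableSet_Iio n)

lemma measurable_Senv (hY : Measurable (envPath Q)) (n : ℕ) : Measurable (Senv Q n) := by
  have h : Senv Q n = fun ω => pS n (envPath Q ω) := funext fun ω => (pS_envPath n ω).symm
  rw [h]
  exact (measurable_pS n).comp hY

lemma setLIntegral_tauWalk (hY : MeasurePreserving (envPath Q) μ (pathLaw ρ)) {G : ℝ≥0∞ → ℝ≥0∞} (hG : Measurable G) (n : ℕ) :
    ∫⁻ ω in {ω | tauWalk (Xenv Q) n ω = n}, ofReal (exp (Senv Q n ω)) *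
      G (ofReal (exp (Senv Q n ω) * bEnv Q n ω)) ∂μ = ∫⁻ ω, fullF G n ω ∂pathLaw ρ := by
  have hm := measurable_fullF hG n
  rw [lintegral_prev ρ n hm, ← hY.map_eq,
    lintegral_map (f := fun ω => fullF G n (prev n ω)) (hm.comp (measurable_prev n)) hY.measurable,
    ← lintegral_indicator (measurableSet_tauWalk hY.measurable n)]
  refine lintegral_congr fun ω => ?_
  by_cases h : tauWalk (Xenv Q) n ω = n
  · rw [indicator_of_mem (by exact h), fullF, indicator_of_mem ((prev_mem_stay_iff n ω).2 h),
      pW_prev_envPath, pS_prev_self, pS_envPath]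
    rfl
  · rw [indicator_of_notMem (by exact h), fullF,
      indicator_of_notMem (mt (prev_mem_stay_iff n ω).1 h)]

lemma setIntegral_tauWalk (hY : MeasurePreserving (envPath Q) μ (pathLaw ρ)) {G : ℝ≥0∞ → ℝ≥0∞} (hG : Measurable G) (n : ℕ) {φ : ℝ → ℝ} (hφ : ∀ w, 0 ≤ w → 0 ≤ φ w)
    (h : ∀ w, 0 ≤ w → G (ofReal w) = ofReal (φ w)) :
    ∫ ω in {ω | tauWalk (Xenv Q) n ω = n}, exp (Senv Q n ω) *
      φ (exp (Senv Q n ω) * bEnv Q n ω) ∂μ = (∫⁻ ω, fullF G n ω ∂pathLaw ρ).toReal := by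
  have h0 : ∀ ω, 0 ≤ exp (Senv Q n ω) * bEnv Q n ω := fun ω =>
    mul_nonneg (exp_nonneg _) (bEnv_nonneg n ω)
  have hr : ∀ ω, exp (Senv Q n ω) * φ (exp (Senv Q n ω) * bEnv Q n ω) =
      (ofReal (exp (Senv Q n ω)) *
        G (ofReal (exp (Senv Q n ω) * bEnv Q n ω))).toReal := fun ω => by
    rw [h _ (h0 ω), ← ofReal_mul (exp_nonneg _),
      toReal_ofReal (mul_nonneg (exp_nonneg _) (hφ _ (h0 ω)))]
  have hSm := measurable_Senv hY.measurable n
  have hbm : Measurable fun ω => ofReal (exp (Senv Q n ω) * bEnv Q n ω) := by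
    have : (fun ω => ofReal (exp (Senv Q n ω) * bEnv Q n ω)) =
        fun ω => pW n (prev n (envPath Q ω)) := funext fun ω => (pW_prev_envPath n ω).symm
    rw [this]
    exact (measurable_pW n).comp ((measurable_prev n).comp hY.measurable)
  simp only [hr]
  rw [integral_toReal, setLIntegral_tauWalk hY hG]
  · exact ((hSm.exp.ennreal_ofReal).mul (hG.comp hbm)).aemeasurable
  · refine ae_of_all _ fun ω => ?_
    rw [h _ (h0 ω)]
    exact mul_lt_top ofReal_lt_top ofReal_lt_top

lemma lintegral_fullF_one (n : ℕ) :
    ∫⁻ ω, fullF (fun _ => 1) n ω ∂pathLaw ρ = tilt ρ (Iio 0) 1 n := by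
  rw [tilt, lintegral_stayLaw ρ measurableSet_Iio n (by fun_prop)]
  simp only [one_mul, fullF, mul_one]

lemma etaEnv_le (hQ : ∀ n ω, IsProbabilityMeasure (Q n ω)) (a : ℕ) (ω : Ω) :
    etaEnv Q 1 ω ≤ a * exp (-Xenv Q 1 ω) + zetaEnv Q a ω := by
  set p : ℕ → ℝ := fun i => (Q 1 ω {i}).toReal with hp
  have hp0 : ∀ i, 0 ≤ p i := fun i => toReal_nonneg
  have hpi : ∀ i : ℕ, 0 ≤ (i : ℝ) * ((i : ℝ) - 1) := fun i => by
    rcases i.eq_zero_or_pos with rfl | hi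
    · simp
    · exact mul_nonneg (by positivity) (sub_nonneg.2 (by exact_mod_cast hi))
  have hz0 : ∀ y : ℕ, 0 ≤ if a ≤ y then (y : ℝ) ^ 2 * p y else 0 := fun y => by
    split_ifs
    · exact mul_nonneg (by positivity) (hp0 y)
    · exact le_rfl
  have hζ : 0 ≤ zetaEnv Q a ω := div_nonneg (tsum_nonneg hz0) (by positivity)
  have hr : 0 ≤ a * exp (-Xenv Q 1 ω) + zetaEnv Q a ω := by positivity
  have hps : Summable p := by
    refine ENNReal.summable_toReal (f := fun i => Q 1 ω {i}) ?_
    rw [← measure_iUnion (fun i j hij => by simpa using hij) fun i => measurableSet_singleton i]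
    have := hQ 1 ω
    exact measure_ne_top _ _
  by_cases hs : Summable fun i : ℕ => ((i : ℝ) * ((i : ℝ) - 1)) * p i
  swap
  · rw [etaEnv, tsum_eq_zero_of_not_summable hs, zero_div]; exact hr
  have hs1 : Summable fun i : ℕ => (i : ℝ) * p i := by
    refine (hs.add hps).of_nonneg_of_le (fun i => mul_nonneg (by positivity) (hp0 i)) fun i => ?_
    nlinarith [mul_nonneg (sq_nonneg ((i : ℝ) - 1)) (hp0 i)]
  have hs2 : Summable fun y : ℕ => if a ≤ y then (y : ℝ) ^ 2 * p y else 0 := by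
    refine (hs.add hs1).of_nonneg_of_le hz0 fun i => ?_
    split_ifs
    · exact le_of_eq (by ring)
    · exact add_nonneg (mul_nonneg (hpi i) (hp0 i)) (mul_nonneg (by positivity) (hp0 i))
  have hle : ∑' i : ℕ, ((i : ℝ) * ((i : ℝ) - 1)) * p i ≤
      a * meanQ Q 1 ω + ∑' y : ℕ, if a ≤ y then (y : ℝ) ^ 2 * p y else 0 := by
    rw [meanQ, ← tsum_mul_left, ← (hs1.mul_left _).tsum_add hs2]
    refine hs.tsum_le_tsum (fun i => ?_) ((hs1.mul_left _).add hs2)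
    have h1 := hp0 i
    have h2 : (0 : ℝ) ≤ i := by positivity
    have h3 : (0 : ℝ) ≤ a := by positivity
    split_ifs with h
    · nlinarith [mul_nonneg h2 h1, mul_nonneg h3 (mul_nonneg h2 h1)]
    · have h4 : (i : ℝ) - 1 ≤ a := by
        have : (i : ℝ) ≤ a := by exact_mod_cast (not_le.1 h).le
        linarith
      nlinarith [mul_nonneg (sub_nonneg.2 h4) (mul_nonneg h2 h1)]
  have hm0 : 0 ≤ meanQ Q 1 ω := tsum_nonneg fun i => mul_nonneg (by positivity) (hp0 i)
  rcases hm0.eq_or_lt with hm | hm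
  · rw [etaEnv, ← hm]; simpa using hr
  · rw [Xenv, exp_neg, Real.exp_log hm, etaEnv, zetaEnv,
      show (a : ℝ) * (meanQ Q 1 ω)⁻¹ = a * meanQ Q 1 ω / meanQ Q 1 ω ^ 2 by field_simp, ← add_div]
    refine (div_le_div_of_nonneg_right hle (by positivity)).trans ?_
    refine div_le_div_of_nonneg_left ?_ (by positivity) (by nlinarith [sq_nonneg (meanQ Q 1 ω)])
    exact add_nonneg (by positivity) (tsum_nonneg hz0)

/-- The excess of `η` over a multiple of `e^{-X}`, on a logarithmic scale. -/
def logExcess (a : ℝ) (x : ℝ × ℝ) : ℝ := Real.log (max (x.2 - a * exp (-x.1)) 1)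

lemma measurable_logExcess (a : ℝ) : Measurable (logExcess a) :=
  Real.measurable_log.comp (Measurable.max (by fun_prop) measurable_const)

lemma logExcess_nonneg (a : ℝ) (x : ℝ × ℝ) : 0 ≤ logExcess a x :=
  Real.log_nonneg (le_max_right _ _)

lemma le_exp_logExcess (a : ℝ) (x : ℝ × ℝ) :
    x.2 ≤ a * exp (-x.1) + exp (logExcess a x) := by
  rw [logExcess, Real.exp_log (lt_of_lt_of_le one_pos (le_max_right _ _))]
  grind

lemma exists_lintegral_logExcess_lt_top (hQm : Measurable (Q 1))
    (hQ : ∀ n ω, IsProbabilityMeasure (Q n ω)) (hA3 : AssumptionA3 μ Q) :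
    ∃ ε : ℝ, 0 < ε ∧ ∃ a : ℕ, ∫⁻ x, ofReal (logExcess a x ^ (2 + ε))
      ∂(μ.map fun ω => envStep (Q 1 ω)) < ⊤ := by
  obtain ⟨ε, hε, a, -, hint⟩ := hA3
  refine ⟨ε, hε, a, ?_⟩
  have hm : Measurable fun x => ofReal (logExcess a x ^ (2 + ε)) :=
    ((measurable_logExcess a).pow_const _).ennreal_ofReal
  rw [lintegral_map (g := fun ω => envStep (Q 1 ω)) hm (measurable_envStep.comp hQm)]
  refine lt_of_le_of_lt (lintegral_mono fun ω => ofReal_le_ofReal ?_) hint.lintegral_lt_top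
  refine rpow_le_rpow (logExcess_nonneg _ _) ?_ (by positivity)
  refine Real.log_le_log (lt_of_lt_of_le one_pos (le_max_right _ _)) (max_le_max ?_ le_rfl)
  have := etaEnv_le hQ a ω
  change etaEnv Q 1 ω - a * exp (-Xenv Q 1 ω) ≤ _
  linarith

lemma exists_LLT {c : ℕ → ℝ} (hY : MeasurePreserving (envPath Q) μ (pathLaw ρ))
    (hA4 : AssumptionA4 μ (Xenv Q) c) : ∃ (ℓ : ℕ → ℝ) (C : ℝ), LLT ρ ℓ C := by
  obtain ⟨hc, hnl, -, ν, hν, -, h0, h1, hw⟩ := hA4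
  have hlaw : ∀ n, walkLaw ρ n = μ.map (walk (Xenv Q) n) := fun n => by
    rw [walkLaw, ← hY.map_eq, Measure.map_map (measurable_pS n) hY.measurable]
    congr 1
    exact funext fun ω => pS_envPath n ω
  have hwm : ∀ n, Measurable (walk (Xenv Q) n) := measurable_Senv hY.measurable
  have hw' : WeakTendsto (fun n => (walkLaw ρ n).map fun x => x / c n) ν := by
    convert hw using 2 with n
    rw [hlaw, Measure.map_map (by fun_prop) (hwm n)]
    rfl
  have hfst : ρ.map Prod.fst = μ.map (Xenv Q 1) := by
    have h2 : (pathLaw ρ).map (fun ω => ω 0) = ρ := by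
      rw [pathLaw]; exact Measure.infinitePi_map_eval _ 0
    conv_lhs => rw [← h2, ← hY.map_eq]
    rw [Measure.map_map (measurable_pi_apply 0) hY.measurable,
      Measure.map_map measurable_fst ((measurable_pi_apply 0).comp hY.measurable)]
    rfl
  obtain ⟨c', hat⟩ := exists_attracted ρ (by rwa [hfst]) hc hw' h0 h1
  obtain ⟨C, hC⟩ := hat.llt
  exact ⟨_, C, hC⟩

@[fun_prop]
lemma measurable_sW : Measurable sW :=
  Measurable.tsum fun _ => by fun_prop

@[fun_prop]
lemma measurable_sB : Measurable sB :=
  Measurable.tsum fun _ => by fun_prop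

lemma Bplus_eq (ω : Ω) : Bplus Q ω = (sB (envPath Q ω)).toReal := by
  rw [sB, tsum_toReal_eq fun i => mul_ne_top ofReal_ne_top
    ofReal_ne_top, Bplus]
  refine tsum_congr fun i => ?_
  rw [pS_envPath, toReal_mul, toReal_ofReal (exp_nonneg _),
    envPath, toReal_ofReal (envStep_snd_nonneg _)]
  rfl

lemma Bminus_eq (ω : Ω) : Bminus Q ω = (sW (envPath Q ω)).toReal := by
  rw [sW, tsum_toReal_eq fun i => mul_ne_top ofReal_ne_top
    ofReal_ne_top, Bminus]
  refine tsum_congr fun i => ?_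
  rw [pS_envPath, toReal_mul, toReal_ofReal (exp_nonneg _),
    envPath, toReal_ofReal (envStep_snd_nonneg _)]
  rfl

lemma kappa_of_nonneg {y : ℝ} (hy : 0 ≤ y) : kappa y = y := by
  rw [kappa]
  grind

lemma psi_le (w : ℝ≥0∞) : psi α₁ α₂ w ≤ psi α₁ α₂ 0 := antitone_psi bot_le

lemma psi_toReal (h₁ : 0 < α₁) (h₂ : 0 < α₂) {r : ℝ} (hr : 0 ≤ r) {b w : ℝ≥0∞} (hb : b ≠ ⊤)
    (hw : w ≠ ⊤) : (psi α₁ α₂ (w + ofReal r * b)).toReal =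
      (α₁ + r * kappa b.toReal + kappa w.toReal)⁻¹ * (α₂ + r * kappa b.toReal + kappa w.toReal)⁻¹ := by
  have hb0 : 0 ≤ b.toReal := toReal_nonneg
  have hw0 : 0 ≤ w.toReal := toReal_nonneg
  rw [kappa_of_nonneg hb0, kappa_of_nonneg hw0]
  have h : w + ofReal r * b = ofReal (r * b.toReal + w.toReal) := by
    rw [ofReal_add (by positivity) hw0, ofReal_mul hr, ofReal_toReal hb,
      ofReal_toReal hw, add_comm]
  rw [h, psi_ofReal h₁ h₂ (by positivity), toReal_ofReal (by positivity), add_assoc,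
    add_assoc]

lemma integral_integral_psi (hY : Measurable (envPath Q)) (h₁ : 0 < α₁) (h₂ : 0 < α₂)
    {P₁ P₂ : Measure Ω} [IsProbabilityMeasure P₁] [IsProbabilityMeasure P₂]
    (hB : ∀ᵐ ω ∂P₁.map (envPath Q), sB ω ≠ ⊤) (hW : ∀ᵐ ω ∂P₂.map (envPath Q), sW ω ≠ ⊤) {r : ℝ} (hr : 0 ≤ r) :
    ∫ ω₁, (∫ ω₂, (α₁ + r * kappa (Bplus Q ω₁) + kappa (Bminus Q ω₂))⁻¹ *
        (α₂ + r * kappa (Bplus Q ω₁) + kappa (Bminus Q ω₂))⁻¹ ∂P₂) ∂P₁ =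
      (∫⁻ ω₁, (∫⁻ ω₃, psi α₁ α₂ (sW ω₁ + ofReal r * sB ω₃)
        ∂P₁.map (envPath Q)) ∂P₂.map (envPath Q)).toReal := by
  have hψ := (continuous_psi h₁ h₂).measurable
  have hi1 := isProbabilityMeasure_map (μ := P₁) hY.aemeasurable
  have hi2 := isProbabilityMeasure_map (μ := P₂) hY.aemeasurable
  have hm : Measurable (Function.uncurry fun (ω₁ ω₂ : Traj) =>
      psi α₁ α₂ (sW ω₁ + ofReal r * sB ω₂)) := by
    refine hψ.comp (Measurable.add (measurable_sW.comp measurable_fst)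
      ((measurable_sB.comp measurable_snd).const_mul _))
  have hm' : Measurable fun ω₃ => ∫⁻ ω₁, psi α₁ α₂ (sW ω₁ + ofReal r * sB ω₃)
      ∂P₂.map (envPath Q) := (hm.comp measurable_swap).lintegral_prod_right'
  have hinner : ∀ b : ℝ≥0∞, b ≠ ⊤ → ∫ ω₂, (α₁ + r * kappa b.toReal + kappa (Bminus Q ω₂))⁻¹ *
        (α₂ + r * kappa b.toReal + kappa (Bminus Q ω₂))⁻¹ ∂P₂ =
      (∫⁻ ω₁, psi α₁ α₂ (sW ω₁ + ofReal r * b) ∂P₂.map (envPath Q)).toReal := fun b hb => by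
    have hmb : Measurable fun ω => psi α₁ α₂ (sW ω + ofReal r * b) :=
      hψ.comp (measurable_sW.add_const _)
    rw [lintegral_map hmb hY, ← integral_toReal (f := fun ω => psi α₁ α₂ (sW (envPath Q ω) + ofReal r * b))
      (hmb.comp hY).aemeasurable
      (ae_of_all _ fun ω => (psi_ne_top h₁ h₂ _).lt_top)]
    refine integral_congr_ae ?_
    filter_upwards [ae_of_ae_map hY.aemeasurable hW] with ω hω
    rw [psi_toReal h₁ h₂ hr hb hω, Bminus_eq]
  have hlt : ∀ ω₃, ∫⁻ ω₁, psi α₁ α₂ (sW ω₁ + ofReal r * sB ω₃)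
      ∂P₂.map (envPath Q) < ⊤ := fun ω₃ =>
    lt_of_le_of_lt (lintegral_mono fun _ => psi_le _) (by simpa using (psi_ne_top h₁ h₂ 0).lt_top)
  rw [lintegral_lintegral_swap hm.aemeasurable, lintegral_map hm' hY,
    ← integral_toReal (f := fun ω => ∫⁻ ω₁, psi α₁ α₂ (sW ω₁ + ofReal r * sB (envPath Q ω))
      ∂P₂.map (envPath Q)) (hm'.comp hY).aemeasurable (ae_of_all _ fun ω => hlt _)]
  refine integral_congr_ae ?_
  filter_upwards [ae_of_ae_map hY.aemeasurable hB] with ω hω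
  rw [Bplus_eq]
  exact hinner _ hω

lemma aemeasurable_limPhi (hL : LLT ρ ℓ C) (hP : IsDown ρ P) (hPu : ∀ s ≤ 0, IsUp ρ s (Pu s))
    (hG : Continuous G) {c : ℝ≥0∞} (hc : c ≠ ⊤) (hGc : ∀ w, G w ≤ c) :
    AEMeasurable (limPhi ρ P Pu G) (volume.restrict (Iio 0)) := by
  refine aemeasurable_of_tendsto_metrizable_ae atTop (f := fun k s => Phi ρ G k s)
    (fun k => (measurable_Phi hG.measurable k).aemeasurable) ?_
  filter_upwards [ae_restrict_mem measurableSet_Iio] with s hs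
  exact tendsto_Phi hL hP (hPu s (le_of_lt hs)) hG hc hGc

lemma limPhi_le (hP : IsDown ρ P) {s : ℝ} (hPu : IsUp ρ s (Pu s)) {c : ℝ≥0∞} (hGc : ∀ w, G w ≤ c) :
    limPhi ρ P Pu G s ≤ c * renU ρ (-s) := by
  have := hP.prob
  have := hPu.prob
  rw [limPhi, mul_comm]
  refine mul_le_mul_of_nonneg_right ?_ bot_le
  exact (lintegral_mono fun ω₁ => lintegral_mono fun ω₃ => hGc _).trans (by simp)

lemma setLIntegral_Ioi_neg (f : ℝ → ℝ≥0∞) : ∫⁻ z in Ioi 0, f (-z) = ∫⁻ s in Iio 0, f s := by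
  have h := (Measure.measurePreserving_neg (volume : Measure ℝ)).setLIntegral_comp_preimage_emb
    (MeasurableEquiv.neg ℝ).measurableEmbedding f (Iio 0)
  rw [← h]
  congr 2
  ext z; simp

lemma setIntegral_Ioi_neg {f : ℝ → ℝ≥0∞} (hf : AEMeasurable f (volume.restrict (Iio 0)))
    (hf' : ∀ s < 0, f s < ⊤) : ∫ z in Ioi 0, (f (-z)).toReal = (∫⁻ s in Iio 0, f s).toReal := by
  have h : MeasurePreserving (fun z : ℝ => -z) (volume.restrict (Ioi 0)) (volume.restrict (Iio 0)) := by
    have := (Measure.measurePreserving_neg (volume : Measure ℝ)).restrict_preimage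
      (measurableSet_Iio (a := (0 : ℝ)))
    simpa using this
  rw [← setLIntegral_Ioi_neg, integral_toReal]
  · exact hf.comp_quasiMeasurePreserving h.quasiMeasurePreserving
  · filter_upwards [ae_restrict_mem measurableSet_Ioi] with z hz
    exact hf' _ (by simpa using hz)

end

/-- **Lemma `Ldiscright`.** Under A3 and A4, for positive `α₁, α₂`,
`E[e^{S_n} / ∏_{i=1}^2 (α_i + e^{S_n} b_n); τ(n) = n] / E[e^{S_n}; τ(n) = n]`
converges to `∭ Ψ(u,v,-z) P_z⁺(B⁺ ∈ du) P⁻(B⁻ ∈ dv) μ₁(dz)`, where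
`Ψ(u,v,x) = ∏_{i=1}^2 (α_i + e^x κ(u) + κ(v))⁻¹`. -/
theorem statement11
    {Ω : Type*} [MeasurableSpace Ω] (μ : Measure Ω) [IsProbabilityMeasure μ]
    (Q : ℕ → Ω → Measure ℕ) (hQprob : ∀ n ω, IsProbabilityMeasure (Q n ω))
    (hiid : IIDseq μ Q) (c : ℕ → ℝ)
    (hA3 : AssumptionA3 μ Q) (hA4 : AssumptionA4 μ (Xenv Q) c)
    (Pp : ℝ → Measure Ω)
    (hPp : ∀ x : ℝ, 0 ≤ x → IsPplus μ (Xenv Q) (envFiltration Q) x (Pp x))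
    (Pm0 : Measure Ω) (hPm0 : IsPminus μ (Xenv Q) (envFiltration Q) 0 Pm0)
    (α₁ α₂ : ℝ) (hα₁ : 0 < α₁) (hα₂ : 0 < α₂) :
    Tendsto (fun n : ℕ =>
        (∫ ω in {ω | tauWalk (Xenv Q) n ω = n},
            Real.exp (Senv Q n ω) /
              ((α₁ + Real.exp (Senv Q n ω) * bEnv Q n ω) *
                (α₂ + Real.exp (Senv Q n ω) * bEnv Q n ω)) ∂μ) /
          ∫ ω in {ω | tauWalk (Xenv Q) n ω = n}, Real.exp (Senv Q n ω) ∂μ)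
      atTop (𝓝 (∫ z in Set.Ici (0 : ℝ),
        ((∫ z' in Set.Ioi (0 : ℝ), Real.exp (-z') * uFun μ (Xenv Q) z')⁻¹ *
            Real.exp (-z) * uFun μ (Xenv Q) z) *
          ∫ ω₁, (∫ ω₂,
              (α₁ + Real.exp (-z) * kappa (Bplus Q ω₁) + kappa (Bminus Q ω₂))⁻¹ *
                (α₂ + Real.exp (-z) * kappa (Bplus Q ω₁) + kappa (Bminus Q ω₂))⁻¹
            ∂Pm0) ∂(Pp z))) := by
  have hQ := hiid.1
  have hρ : IsProbabilityMeasure (μ.map fun ω => envStep (Q 1 ω)) :=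
    isProbabilityMeasure_map (measurable_envStep.comp (hQ 1)).aemeasurable
  obtain ⟨ε, hε, a, hZ⟩ := exists_lintegral_logExcess_lt_top (hQ 1) hQprob hA3
  have hM : MeasurePreserving (envPath Q) μ (pathLaw (μ.map fun ω => envStep (Q 1 ω))) :=
    ⟨measurable_envPath hQ, map_envPath hiid⟩
  have hY := hM.measurable
  set ρ : Measure (ℝ × ℝ) := μ.map fun ω => envStep (Q 1 ω)
  obtain ⟨ℓ, C, hL⟩ := exists_LLT hM hA4
  have hZ' := hL.lintegral_ren_lt_top (measurable_logExcess a) (logExcess_nonneg a) hε hZ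
  set P : Measure Traj := Pm0.map (envPath Q)
  set Pu : ℝ → Measure Traj := fun s => (Pp (-s)).map (envPath Q)
  have hP : IsDown ρ P := isDown_map_envPath hM hL.renV_lt_top hPm0
  have hPu : ∀ s ≤ 0, IsUp ρ s (Pu s) := fun s hs => by
    have h := isUp_map_envPath hM hL.renU_lt_top (neg_nonneg.2 hs) (hPp (-s) (neg_nonneg.2 hs))
    rwa [neg_neg] at h
  have hW : ∀ᵐ ω ∂P, sW ω ≠ ⊤ := IsDown.ae_tsum_ne_top hL hP (measurable_logExcess a) hZ'
    (Nat.cast_nonneg a) (le_exp_logExcess a)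
  have hB : ∀ s ≤ 0, ∀ᵐ ω ∂Pu s, sB ω ≠ ⊤ := fun s hs =>
    IsUp.ae_tsum_ne_top hL hs (hPu s hs) (measurable_logExcess a) (logExcess_nonneg a) hZ'
      (Nat.cast_nonneg a) (le_exp_logExcess a)
  have hψ := continuous_psi hα₁ hα₂
  have hψ0 := psi_ne_top hα₁ hα₂ 0
  obtain ⟨c₀, hc₀, hψc⟩ := exists_psi_le hα₁ hα₂
  have hnum := hL.tendsto_fullF hP hPu hW hB hψ antitone_psi hψ0 hc₀ hψc
  obtain ⟨hE, hden⟩ := hL.tilt_one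
  set Λ : ℝ≥0∞ := ∫⁻ s in Iio 0, ofReal (exp s) * limPhi ρ P Pu (psi α₁ α₂) s with hΛ
  have hE0 : expU ρ ≠ 0 := (lt_of_lt_of_le one_pos one_le_expU).ne'
  have hC : 0 < C := hL.C_pos
  have hlim_le : ∀ s ≤ 0, limPhi ρ P Pu (psi α₁ α₂) s ≤ psi α₁ α₂ 0 * renU ρ (-s) := fun s hs =>
    limPhi_le hP (hPu s hs) psi_le
  have hΛt : Λ ≠ ⊤ := by
    refine ne_top_of_le_ne_top (mul_ne_top hψ0 hE) ?_
    rw [expU, ← lintegral_const_mul' _ _ hψ0]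
    refine setLIntegral_mono' measurableSet_Iio fun s hs => ?_
    rw [mul_left_comm]
    exact mul_le_mul_of_nonneg_left (hlim_le s (le_of_lt hs)) bot_le
  have hD : ∫ z' in Ioi (0 : ℝ), exp (-z') * uFun μ (Xenv Q) z' = (expU ρ).toReal := by
    rw [expU, ← setIntegral_Ioi_neg]
    · refine setIntegral_congr_fun measurableSet_Ioi fun z hz => ?_
      rw [neg_neg, uFun_eq hM (le_of_lt hz) (hL.renU_lt_top z), toReal_mul,
        toReal_ofReal (exp_nonneg _)]
    · exact (Measurable.mul (by fun_prop) (measurable_renU.comp measurable_neg)).aemeasurable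
    · exact fun s _ => mul_lt_top ofReal_lt_top (hL.renU_lt_top _)
  have hrhs : ∫ z in Ici (0 : ℝ),
      ((∫ z' in Ioi (0 : ℝ), exp (-z') * uFun μ (Xenv Q) z')⁻¹ *
          exp (-z) * uFun μ (Xenv Q) z) *
        ∫ ω₁, (∫ ω₂,
            (α₁ + exp (-z) * kappa (Bplus Q ω₁) + kappa (Bminus Q ω₂))⁻¹ *
              (α₂ + exp (-z) * kappa (Bplus Q ω₁) + kappa (Bminus Q ω₂))⁻¹
          ∂Pm0) ∂(Pp z) = (expU ρ).toReal⁻¹ * Λ.toReal := by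
    rw [hD, integral_Ici_eq_integral_Ioi, hΛ, ← setIntegral_Ioi_neg, ← integral_const_mul]
    · refine setIntegral_congr_fun measurableSet_Ioi fun z hz => ?_
      have hz0 : 0 ≤ z := le_of_lt hz
      have := (hPp z hz0).1
      have := hPm0.1
      have hBz := hB (-z) (neg_nonpos.2 hz0)
      simp only [Pu, neg_neg] at hBz
      simp only [limPhi, Pu, neg_neg]
      rw [integral_integral_psi hY hα₁ hα₂ hBz hW (exp_nonneg _),
        uFun_eq hM hz0 (hL.renU_lt_top z), toReal_mul, toReal_mul,
        toReal_ofReal (exp_nonneg _)]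
      ring
    · exact AEMeasurable.mul (by fun_prop) (aemeasurable_limPhi hL hP hPu hψ hψ0 psi_le)
    · exact fun s hs => mul_lt_top ofReal_lt_top
        (lt_of_le_of_lt (hlim_le s (le_of_lt hs))
          (mul_lt_top hψ0.lt_top (hL.renU_lt_top _)))
  rw [hrhs]
  have hCE : ofReal C * expU ρ ≠ 0 := mul_ne_zero (ofReal_pos.2 hC).ne' hE0
  have hCE' : ofReal C * expU ρ ≠ ⊤ := mul_ne_top ofReal_ne_top hE
  have hlim := ((tendsto_toReal (mul_ne_top ofReal_ne_top hΛt)).comp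
    hnum).div ((tendsto_toReal hCE').comp hden) (toReal_pos hCE hCE').ne'
  have hval : (ofReal C * Λ).toReal / (ofReal C * expU ρ).toReal =
      (expU ρ).toReal⁻¹ * Λ.toReal := by
    rw [toReal_mul, toReal_mul, toReal_ofReal hC.le,
      mul_div_mul_left _ _ hC.ne', div_eq_inv_mul]
  rw [hval] at hlim
  refine hlim.congr' ?_
  filter_upwards [hL.reg.scaleW_pos] with n hn
  have h1 := setIntegral_tauWalk hM hψ.measurable n
    (φ := fun w => (α₁ + w)⁻¹ * (α₂ + w)⁻¹) (fun w hw => by positivity)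
    fun w hw => psi_ofReal hα₁ hα₂ hw
  have h2 := setIntegral_tauWalk hM (G := fun _ => 1) measurable_const n (φ := fun _ => 1)
    (fun _ _ => zero_le_one) fun _ _ => by simp
  simp only [mul_one, lintegral_fullF_one] at h2
  simp_rw [← mul_inv, ← div_eq_mul_inv] at h1
  simp only [Pi.div_apply, Function.comp_apply]
  rw [h1, h2, toReal_mul, toReal_mul, toReal_ofReal hn.le,
    mul_div_mul_left _ _ hn.ne']

end BPREpaper
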